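/- Fix an integer d ≥ 2 and constants c > 0, C ≥ 1. There exist ε_d > 0 and δ_0 > 0 such that for all δ ∈ (0,δ_0) the following holds. Let B_1,…,B_{d+1} be balls of radius 1 in ℝ^d such that c ≤ |det(x_2−x_1, x_3−x_1, …, x_{d+1}−x_1)| ≤ C for every choice of points x_j ∈ B_j (1 ≤ j ≤ d+1). Let E_j ⊆ B_j (1 ≤ j ≤ d+1) be (δ, d/2)_d sets with constant C, and let D ⊆ [0,C] be a (δ, 1/2)_1 set with constant C. Then the set X = { (x_1,…,x_{d+1}) ∈ E_1 × ⋯ × E_{d+1} : |x_k − x_j| ∈ D for all 1 ≤ j < k ≤ d+1 } has Lebesgue measure in ℝ^{d(d+1)} at most δ^{d(d+1)/2 + ε_d}. -/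

import Mathlib

open MeasureTheory Metric Set
open scoped ENNReal

noncomputable section

abbrev Euc (d : ℕ) : Type := EuclideanSpace ℝ (Fin d)

/-- `A ⊆ ℝ^n` is a `(δ,ρ)_n` set with constant `C`: every ball of radius `r ≥ δ`
meets `A` in measure at most `C·δ^(n-ρ)·r^ρ`. -/
def IsDeltaRhoSet (n : ℕ) (δ ρ C : ℝ) (A : Set (Euc n)) : Prop :=
  ∀ (x : Euc n) (r : ℝ), δ ≤ r →
    volume (A ∩ closedBall x r) ≤ ENNReal.ofReal (C * δ ^ ((n : ℝ) - ρ) * r ^ ρ)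

/-- `A ⊆ ℝ` is a `(δ,ρ)_1` set with constant `C`. -/
def IsDeltaRhoSet1 (δ ρ C : ℝ) (A : Set ℝ) : Prop :=
  ∀ (x r : ℝ), δ ≤ r →
    volume (A ∩ closedBall x r) ≤ ENNReal.ofReal (C * δ ^ (1 - ρ) * r ^ ρ)

/-- A finite set of reals whose distinct points are at distance at least `x`. -/
def IsSep (x : ℝ) (B : Finset ℝ) : Prop := ∀ a ∈ B, ∀ b ∈ B, a ≠ b → x ≤ |a - b|

lemma exists_maximal_sep (S : Finset ℝ) {x : ℝ} (hx : 0 < x) :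
    ∃ B ⊆ S, IsSep x B ∧ ∀ s ∈ S, ∃ b ∈ B, |s - b| < x := by
  classical
  obtain ⟨B, hB, hmax⟩ := Finset.exists_max_image (S.powerset.filter (IsSep x)) Finset.card
    ⟨∅, by simp [IsSep]⟩
  simp only [Finset.mem_filter, Finset.mem_powerset] at hB hmax
  refine ⟨B, hB.1, hB.2, fun s hs => ?_⟩
  by_contra! hc
  have hsB : s ∉ B := fun h => by
    have := hc s h
    simp at this; linarith
  have h1 := hmax (insert s B) ⟨Finset.insert_subset hs hB.1, by
    intro a ha b hb hab
    rcases Finset.mem_insert.1 ha with h1 | h1 <;> rcases Finset.mem_insert.1 hb with h2 | h2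
    · exact absurd (h1.trans h2.symm) hab
    · rw [h1]; exact hc b h2
    · rw [h2, abs_sub_comm]; exact hc a h1
    · exact hB.2 a h1 b h2 hab⟩
  rw [Finset.card_insert_of_notMem hsB] at h1
  omega

lemma sep_card_le {B : Finset ℝ} {x c h : ℝ} (hx : 0 < x) (hh : 0 ≤ h) (hB : IsSep x B)
    (hc : ∀ b ∈ B, |b - c| ≤ h) : (B.card : ℝ) ≤ 2 * h / x + 1 := by
  have key : B.card ≤ (Finset.Icc (0 : ℤ) ⌊2 * h / x⌋).card := by
    refine Finset.card_le_card_of_injOn (fun b => ⌊(b - c + h) / x⌋) ?_ ?_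
    · intro b hb
      have h1 := abs_le.1 (hc b hb)
      simp only [Finset.coe_Icc, Set.mem_Icc]
      exact ⟨Int.floor_nonneg.2 (div_nonneg (by linarith) hx.le),
        Int.floor_le_floor (by gcongr; linarith)⟩
    · intro a ha b hb hab
      by_contra hne
      have h1 := hB a ha b hb hne
      have h2 := Int.abs_sub_lt_one_of_floor_eq_floor hab
      rw [← sub_div, abs_div, abs_of_pos hx, div_lt_one hx] at h2
      have : a - c + h - (b - c + h) = a - b := by ring
      rw [this] at h2; linarith
  have h0 : (0 : ℝ) ≤ 2 * h / x := by positivity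
  have h3 : (0 : ℤ) ≤ ⌊2 * h / x⌋ := Int.floor_nonneg.2 h0
  rw [Int.card_Icc] at key
  have h4 : (B.card : ℤ) ≤ ⌊2 * h / x⌋ + 1 := by omega
  have h5 : ((B.card : ℤ) : ℝ) ≤ ((⌊2 * h / x⌋ + 1 : ℤ) : ℝ) := by exact_mod_cast h4
  push_cast at h5
  linarith [Int.floor_le (2 * h / x)]

/-- A separated subset of the values of `φ`, large in terms of the multiplicity of `φ`. -/
lemma exists_sep_card {ι : Type*} (I : Finset ι) (φ : ι → ℝ) {x m : ℝ} (hx : 0 < x)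
    (hm : ∀ c, ((I.filter fun i => |φ i - c| < x).card : ℝ) ≤ m) :
    ∃ B ⊆ I.image φ, IsSep x B ∧ (I.card : ℝ) ≤ B.card * m := by
  classical
  obtain ⟨B, hB, hs, hcov⟩ := exists_maximal_sep (I.image φ) hx
  refine ⟨B, hB, hs, ?_⟩
  have h1 : I ⊆ B.biUnion fun b => I.filter fun i => |φ i - b| < x := by
    intro i hi
    obtain ⟨b, hb, hlt⟩ := hcov (φ i) (Finset.mem_image_of_mem _ hi)
    simp only [Finset.mem_biUnion, Finset.mem_filter]
    exact ⟨b, hb, hi, hlt⟩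
  calc (I.card : ℝ) ≤ ((B.biUnion fun b => I.filter fun i => |φ i - b| < x).card : ℝ) := by
        exact_mod_cast Finset.card_le_card h1
    _ ≤ ∑ b ∈ B, ((I.filter fun i => |φ i - b| < x).card : ℝ) := by
        exact_mod_cast Finset.card_biUnion_le
    _ ≤ ∑ b ∈ B, m := Finset.sum_le_sum fun b _ => hm b
    _ = B.card * m := by simp

lemma exists_sep_energy {ι : Type*} (I : Finset ι) (φ : ι → ℝ) {x : ℝ} (hx : 0 < x) :
    ∃ B ⊆ I.image φ, IsSep x B ∧ (I.card : ℝ) ^ 2 ≤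
      B.card * ((I ×ˢ I).filter fun p => |φ p.1 - φ p.2| < 2 * x).card := by
  classical
  obtain ⟨B, hB, hs, hcov⟩ := exists_maximal_sep (I.image φ) hx
  refine ⟨B, hB, hs, ?_⟩
  choose! β hβ hlt using fun (i : ι) (hi : i ∈ I) => hcov (φ i) (Finset.mem_image_of_mem _ hi)
  have h1 : I.card = ∑ b ∈ B, (I.filter fun i => β i = b).card :=
    Finset.card_eq_sum_card_fiberwise hβ
  have h2 : ∑ b ∈ B, (I.filter fun i => β i = b).card ^ 2 ≤
      ((I ×ˢ I).filter fun p => |φ p.1 - φ p.2| < 2 * x).card := by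
    have : ∑ b ∈ B, (I.filter fun i => β i = b).card ^ 2 =
      (B.biUnion fun b => (I.filter fun i => β i = b) ×ˢ (I.filter fun i => β i = b)).card := by
      rw [Finset.card_biUnion]
      · simp [Finset.card_product, sq]
      · intro b _ b' _ hbb
        rw [Function.onFun, Finset.disjoint_left]
        rintro ⟨i, j⟩ h h'
        simp only [Finset.mem_product, Finset.mem_filter] at h h'
        exact hbb (h.1.2.symm.trans h'.1.2)
    rw [this]
    apply Finset.card_le_card
    rintro ⟨i, j⟩ h
    simp only [Finset.mem_biUnion, Finset.mem_product, Finset.mem_filter] at h ⊢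
    obtain ⟨b, hb, ⟨hi, hib⟩, hj, hjb⟩ := h
    refine ⟨⟨hi, hj⟩, ?_⟩
    have e1 := abs_lt.1 (hlt i hi)
    have e2 := abs_lt.1 (hlt j hj)
    rw [hib] at e1; rw [hjb] at e2
    rw [abs_lt]; constructor <;> linarith [e1.1, e1.2, e2.1, e2.2]
  have h3 : ((∑ b ∈ B, (I.filter fun i => β i = b).card : ℕ) : ℝ) ^ 2 ≤
      B.card * ((∑ b ∈ B, (I.filter fun i => β i = b).card ^ 2 : ℕ) : ℝ) := by
    push_cast
    exact sq_sum_le_card_mul_sum_sq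
  rw [h1]
  refine h3.trans ?_
  gcongr

/-- Some dilate `r ∈ R` makes `S + r S` large, by averaging additive energies. -/
lemma exists_large_sum_dilate (S R : Finset ℝ) {τ Y m₁ m₂ : ℝ} (hτ : 0 < τ) (hY : 0 < Y)
    (hY1 : Y ≤ 1) (hR : R.Nonempty) (hRs : IsSep τ R) (hm₁ : 0 ≤ m₁)
    (h1 : ∀ c, ((S.filter fun s => |s - c| < 2 * τ).card : ℝ) ≤ m₁)
    (h2 : ∀ c, ((S.filter fun s => |s - c| ≤ Y).card : ℝ) ≤ m₂) :
    ∃ r ∈ R, ∃ B ⊆ (S ×ˢ S).image (fun p => p.1 + r * p.2), IsSep τ B ∧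
      (S.card : ℝ) ^ 4 ≤
        B.card * ((S.card : ℝ) ^ 2 * m₁ * m₂ + (S.card : ℝ) ^ 4 * (5 / (Y * R.card))) := by
  classical
  set E : ℝ → Finset ((ℝ × ℝ) × (ℝ × ℝ)) := fun r =>
    ((S ×ˢ S) ×ˢ (S ×ˢ S)).filter
      fun p => |(p.1.1 + r * p.1.2) - (p.2.1 + r * p.2.2)| < 2 * τ with hE
  set near : Finset ((ℝ × ℝ) × (ℝ × ℝ)) :=
    ((S ×ˢ S) ×ˢ (S ×ˢ S)).filter fun p => |p.1.2 - p.2.2| ≤ Y with hnear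
  have hRc : (0 : ℝ) < R.card := by exact_mod_cast hR.card_pos
  have hm₂ : 0 ≤ m₂ := le_trans (by positivity) (h2 0)
  have hn : ∀ r, ((E r ∩ near).card : ℝ) ≤ (S.card : ℝ) ^ 2 * m₁ * m₂ := by
    intro r
    have hsub : E r ∩ near ⊆ (S ×ˢ S).biUnion fun p =>
        (S.filter fun s => |s - p.2| ≤ Y).biUnion fun s4 =>
          (S.filter fun s => |s - (p.1 + r * p.2 - r * s4)| < 2 * τ).image
            fun s3 => (p, (s3, s4)) := by
      rintro ⟨⟨s1, s2⟩, ⟨s3, s4⟩⟩ h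
      simp only [hE, hnear, Finset.mem_inter, Finset.mem_filter, Finset.mem_product] at h
      simp only [Finset.mem_biUnion, Finset.mem_image, Finset.mem_filter, Finset.mem_product]
      refine ⟨(s1, s2), h.1.1.1, s4, ⟨h.1.1.2.2, ?_⟩, s3, ⟨h.1.1.2.1, ?_⟩, rfl⟩
      · rw [abs_sub_comm]; exact h.2.2
      · rw [abs_sub_comm]; convert h.1.2 using 2; ring
    calc ((E r ∩ near).card : ℝ) ≤ (Finset.card _ : ℝ) := by
          exact_mod_cast Finset.card_le_card hsub
      _ ≤ ∑ p ∈ S ×ˢ S, ((((S.filter fun s => |s - p.2| ≤ Y).biUnion fun s4 =>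
          (S.filter fun s => |s - (p.1 + r * p.2 - r * s4)| < 2 * τ).image
            fun s3 => (p, (s3, s4))).card : ℕ) : ℝ) := by exact_mod_cast Finset.card_biUnion_le
      _ ≤ ∑ p ∈ S ×ˢ S, m₂ * m₁ := by
          refine Finset.sum_le_sum fun p _ => ?_
          calc _ ≤ ∑ s4 ∈ S.filter fun s => |s - p.2| ≤ Y,
                  ((((S.filter fun s => |s - (p.1 + r * p.2 - r * s4)| < 2 * τ).image
                  fun s3 => (p, (s3, s4))).card : ℕ) : ℝ) := by
                exact_mod_cast Finset.card_biUnion_le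
            _ ≤ ∑ s4 ∈ S.filter fun s => |s - p.2| ≤ Y, m₁ := by
                refine Finset.sum_le_sum fun s4 _ => le_trans ?_ (h1 (p.1 + r * p.2 - r * s4))
                exact_mod_cast Finset.card_image_le
            _ = ((S.filter fun s => |s - p.2| ≤ Y).card : ℝ) * m₁ := by simp
            _ ≤ m₂ * m₁ := by gcongr; exact h2 _
      _ = _ := by simp [Finset.card_product]; ring
  have hfar : ∑ r ∈ R, ((E r \ near).card : ℝ) ≤ (S.card : ℝ) ^ 4 * (5 / Y) := by
    have e1 : ∑ r ∈ R, (E r \ near).card =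
        ∑ p ∈ (((S ×ˢ S) ×ˢ (S ×ˢ S)) \ near), (R.filter fun r => p ∈ E r).card := by
      have := Finset.sum_card_bipartiteAbove_eq_sum_card_bipartiteBelow (s := R)
        (t := ((S ×ˢ S) ×ˢ (S ×ˢ S)) \ near) (fun r p => p ∈ E r)
      simp only [Finset.bipartiteAbove, Finset.bipartiteBelow] at this
      rw [← this]
      refine Finset.sum_congr rfl fun r _ => ?_
      congr 1
      ext p
      simp only [Finset.mem_sdiff, Finset.mem_filter, hE]
      tauto
    have e2 : ∀ p ∈ (((S ×ˢ S) ×ˢ (S ×ˢ S)) \ near),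
        ((R.filter fun r => p ∈ E r).card : ℝ) ≤ 5 / Y := by
      rintro ⟨⟨s1, s2⟩, ⟨s3, s4⟩⟩ hp
      simp only [hnear, Finset.mem_sdiff, Finset.mem_filter, not_and, not_le] at hp
      have hd := hp.2 hp.1
      have hd0 : 0 < |s2 - s4| := hY.trans hd
      have hne : s2 - s4 ≠ 0 := abs_pos.1 hd0
      have := sep_card_le (B := R.filter fun r => ((s1, s2), (s3, s4)) ∈ E r)
        (x := τ) (c := -((s1 - s3) / (s2 - s4))) (h := 2 * τ / Y) hτ (by positivity)
        (fun a ha b hb => hRs a (Finset.mem_filter.1 ha).1 b (Finset.mem_filter.1 hb).1) ?_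
      · refine this.trans ?_
        have : 2 * (2 * τ / Y) / τ = 4 / Y := by field_simp; norm_num
        rw [this, show (5 : ℝ) / Y = 4 / Y + 1 / Y by ring]
        gcongr
        exact (one_le_div hY).2 hY1
      · intro r hr
        simp only [hE, Finset.mem_filter] at hr
        have h3 := hr.2.2
        have : r - -((s1 - s3) / (s2 - s4)) =
            (s1 + r * s2 - (s3 + r * s4)) / (s2 - s4) := by field_simp; ring
        rw [this, abs_div]
        exact div_le_div₀ (by positivity) h3.le hY hd.le
    calc ∑ r ∈ R, ((E r \ near).card : ℝ) =
        ∑ p ∈ (((S ×ˢ S) ×ˢ (S ×ˢ S)) \ near), ((R.filter fun r => p ∈ E r).card : ℝ) := by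
          exact_mod_cast e1
      _ ≤ ∑ p ∈ (((S ×ˢ S) ×ˢ (S ×ˢ S)) \ near), 5 / Y := Finset.sum_le_sum e2
      _ = ((((S ×ˢ S) ×ˢ (S ×ˢ S)) \ near).card : ℝ) * (5 / Y) := by simp
      _ ≤ (((S ×ˢ S) ×ˢ (S ×ˢ S)).card : ℝ) * (5 / Y) := by
          gcongr; exact Finset.sdiff_subset
      _ = _ := by rw [Finset.card_product, Finset.card_product]; push_cast; ring
  obtain ⟨r, hr, hrE⟩ : ∃ r ∈ R, ((E r \ near).card : ℝ) ≤
      (S.card : ℝ) ^ 4 * (5 / (Y * R.card)) := by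
    refine Finset.exists_le_of_sum_le hR ?_
    refine hfar.trans (le_of_eq ?_)
    simp only [Finset.sum_const, nsmul_eq_mul]
    field_simp
  obtain ⟨B, hB, hBs, hBc⟩ := exists_sep_energy (S ×ˢ S) (fun p => p.1 + r * p.2) hτ
  refine ⟨r, hr, B, hB, hBs, ?_⟩
  have hEc : ((E r).card : ℝ) ≤ (S.card : ℝ) ^ 2 * m₁ * m₂ +
      (S.card : ℝ) ^ 4 * (5 / (Y * R.card)) := by
    have : (E r).card = (E r \ near).card + (E r ∩ near).card :=
      (Finset.card_sdiff_add_card_inter _ _).symm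
    rw [this]; push_cast
    linarith [hn r]
  calc (S.card : ℝ) ^ 4 = ((S ×ˢ S).card : ℝ) ^ 2 := by
        rw [Finset.card_product]; push_cast; ring
    _ ≤ _ := hBc
    _ ≤ _ := by gcongr

lemma exists_approx_or_gap (Q : Set ℝ) (h0 : (0 : ℝ) ∈ Q) (h1 : (1 : ℝ) ∈ Q) {t : ℝ}
    (ht : 0 < t) :
    (∀ r ∈ Icc (0 : ℝ) 1, ∃ q ∈ Q, q ∈ Icc (0 : ℝ) 1 ∧ |r - q| ≤ 3 * t) ∨
    ∃ q ∈ Q, q ∈ Icc (0 : ℝ) 1 ∧ ∃ r : ℝ, (r = q / 2 ∨ r = (q + 1) / 2) ∧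
      ∀ q' ∈ Q, t ≤ |r - q'| := by
  by_cases H : ∃ q ∈ Q, q ∈ Icc (0 : ℝ) 1 ∧ ∃ r : ℝ, (r = q / 2 ∨ r = (q + 1) / 2) ∧
      ∀ q' ∈ Q, t ≤ |r - q'|
  · exact Or.inr H
  left
  push Not at H
  have H' : ∀ q ∈ Q, q ∈ Icc (0 : ℝ) 1 → ∀ r : ℝ, (r = q / 2 ∨ r = (q + 1) / 2) →
      ∃ q' ∈ Q, q' ∈ Icc (0 : ℝ) 1 ∧ |r - q'| < t := by
    intro q hq hq01 r hr
    obtain ⟨q', hq', hlt⟩ := H q hq hq01 r hr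
    have hr01 : r ∈ Icc (0 : ℝ) 1 := by
      rcases hr with rfl | rfl <;> constructor <;> linarith [hq01.1, hq01.2]
    have hl := abs_lt.1 hlt
    rcases lt_or_ge q' 0 with h | h
    · exact ⟨0, h0, by simp, by rw [abs_lt]; constructor <;> linarith [hr01.1]⟩
    rcases lt_or_ge 1 q' with h' | h'
    · exact ⟨1, h1, by simp, by rw [abs_lt]; constructor <;> linarith [hr01.2]⟩
    exact ⟨q', hq', ⟨h, h'⟩, hlt⟩
  have key : ∀ n : ℕ, ∀ r ∈ Icc (0 : ℝ) 1, ∃ q ∈ Q, q ∈ Icc (0 : ℝ) 1 ∧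
      |r - q| ≤ 2 * t + (1 / 2) ^ n := by
    intro n
    induction n with
    | zero =>
      intro r hr
      refine ⟨0, h0, by simp, ?_⟩
      rw [sub_zero, abs_of_nonneg hr.1]; norm_num; linarith [hr.2]
    | succ n ih =>
      intro r hr
      rcases le_or_gt r (1 / 2) with h | h
      · obtain ⟨q, hq, hq01, hd⟩ := ih (2 * r) ⟨by linarith [hr.1], by linarith⟩
        obtain ⟨q', hq', hq'01, hd'⟩ := H' q hq hq01 (q / 2) (Or.inl rfl)
        refine ⟨q', hq', hq'01, ?_⟩
        rw [pow_succ]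
        rw [abs_le] at hd ⊢; rw [abs_lt] at hd'
        constructor <;> linarith [hd.1, hd.2, hd'.1, hd'.2]
      · obtain ⟨q, hq, hq01, hd⟩ := ih (2 * r - 1) ⟨by linarith, by linarith [hr.2]⟩
        obtain ⟨q', hq', hq'01, hd'⟩ := H' q hq hq01 ((q + 1) / 2) (Or.inr rfl)
        refine ⟨q', hq', hq'01, ?_⟩
        rw [pow_succ]
        rw [abs_le] at hd ⊢; rw [abs_lt] at hd'
        constructor <;> linarith [hd.1, hd.2, hd'.1, hd'.2]
  intro r hr
  obtain ⟨n, hn⟩ := exists_pow_lt_of_lt_one ht (by norm_num : (1 / 2 : ℝ) < 1)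
  obtain ⟨q, hq, hq01, hd⟩ := key n r hr
  exact ⟨q, hq, hq01, by linarith⟩

/-- The multiples of `τ` in `[0, 1]`. -/
lemma exists_grid {τ : ℝ} (hτ : 0 < τ) :
    ∃ R : Finset ℝ, R.Nonempty ∧ IsSep τ R ∧ (∀ r ∈ R, r ∈ Icc (0 : ℝ) 1) ∧ 1 / τ ≤ R.card := by
  classical
  have h0 : (0 : ℝ) ≤ 1 / τ := by positivity
  have hinj : Function.Injective fun i : ℕ => (i : ℝ) * τ := by
    intro i j h
    have := mul_right_cancel₀ hτ.ne' h
    exact_mod_cast this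
  refine ⟨(Finset.range (⌊1 / τ⌋₊ + 1)).image fun i : ℕ => (i : ℝ) * τ, ⟨0, ?_⟩, ?_, ?_, ?_⟩
  · rw [Finset.mem_image]; exact ⟨0, by simp⟩
  · intro a ha b hb hab
    simp only [Finset.mem_image] at ha hb
    obtain ⟨i, -, rfl⟩ := ha
    obtain ⟨j, -, rfl⟩ := hb
    have hij : (i : ℤ) - j ≠ 0 := by
      intro h; apply hab; have : i = j := by omega
      rw [this]
    have : (1 : ℝ) ≤ |(i : ℝ) - j| := by exact_mod_cast Int.one_le_abs hij
    rw [← sub_mul, abs_mul, abs_of_pos hτ]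
    nlinarith
  · intro r hr
    simp only [Finset.mem_image, Finset.mem_range] at hr
    obtain ⟨i, hi, rfl⟩ := hr
    refine ⟨by positivity, ?_⟩
    have : (i : ℝ) ≤ 1 / τ := le_trans (by exact_mod_cast Nat.lt_succ_iff.1 hi) (Nat.floor_le h0)
    rwa [le_div_iff₀ hτ] at this
  · rw [Finset.card_image_of_injective _ hinj, Finset.card_range]
    push_cast
    exact (Nat.lt_floor_add_one _).le

open scoped Pointwise in
/-- The iterated difference set `kA - kA`. -/
def diffSet (A : Finset ℝ) : ℕ → Finset ℝ
  | 0 => {0}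
  | k + 1 => diffSet A k + (A - A)

lemma mem_diffSet_succ {A : Finset ℝ} {k : ℕ} {x : ℝ} :
    x ∈ diffSet A (k + 1) ↔ ∃ y ∈ diffSet A k, ∃ a ∈ A, ∃ a' ∈ A, x = y + (a - a') := by
  simp only [diffSet, Finset.mem_add, Finset.mem_sub]
  constructor
  · rintro ⟨y, hy, z, ⟨a, ha, a', ha', rfl⟩, rfl⟩
    exact ⟨y, hy, a, ha, a', ha', rfl⟩
  · rintro ⟨y, hy, a, ha, a', ha', rfl⟩
    exact ⟨y, hy, _, ⟨a, ha, a', ha', rfl⟩, rfl⟩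

lemma neg_mem_diffSet {A : Finset ℝ} {k : ℕ} {x : ℝ} (hx : x ∈ diffSet A k) :
    -x ∈ diffSet A k := by
  induction k generalizing x with
  | zero => simp_all [diffSet]
  | succ k ih =>
    obtain ⟨y, hy, a, ha, a', ha', rfl⟩ := mem_diffSet_succ.1 hx
    exact mem_diffSet_succ.2 ⟨-y, ih hy, a', ha', a, ha, by ring⟩

lemma add_mem_diffSet {A : Finset ℝ} {i j : ℕ} {x y : ℝ} (hx : x ∈ diffSet A i)
    (hy : y ∈ diffSet A j) : x + y ∈ diffSet A (i + j) := by
  induction j generalizing y with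
  | zero => simp_all [diffSet]
  | succ k ih =>
    obtain ⟨y, hy₀, a, ha, a', ha', rfl⟩ := mem_diffSet_succ.1 hy
    exact mem_diffSet_succ.2 ⟨x + y, ih hy₀, a, ha, a', ha', by ring⟩

lemma diffSet_mono {A : Finset ℝ} (hA : A.Nonempty) {i j : ℕ} (hij : i ≤ j) :
    diffSet A i ⊆ diffSet A j := by
  obtain ⟨a, ha⟩ := hA
  induction j, hij using Nat.le_induction with
  | base => exact subset_rfl
  | succ j _ ih =>
    intro x hx
    exact mem_diffSet_succ.2 ⟨x, ih hx, a, ha, a, ha, by ring⟩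

/-- `l` is a scalar such that `l • A` is covered by few translates of `jA - jA`, up to errors of
size comparable with `η`. -/
def Mult (A : Finset ℝ) (η L : ℝ) (j : ℕ) (l : ℝ) : Prop :=
  |l| ≤ L ^ j ∧ ∃ X : Finset ℝ, (X.card : ℝ) ≤ L ^ j ∧
    ∀ a ∈ A, ∃ x ∈ X, ∃ t ∈ diffSet A j, |l * a - x - t| ≤ L ^ j * η

section Mult

variable {A : Finset ℝ} {η L l m : ℝ} {i j : ℕ}

lemma Mult.mono (hA : A.Nonempty) (hη : 0 < η) (hL : 2 ≤ L) (hij : i ≤ j) (h : Mult A η L i l) :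
    Mult A η L j l := by
  have hp : L ^ i ≤ L ^ j := pow_le_pow_right₀ (by linarith) hij
  obtain ⟨h1, X, hX, h⟩ := h
  refine ⟨h1.trans hp, X, hX.trans hp, fun a ha => ?_⟩
  obtain ⟨x, hx, t, ht, hd⟩ := h a ha
  exact ⟨x, hx, t, diffSet_mono hA hij ht, hd.trans (by gcongr)⟩

lemma Mult.neg (h : Mult A η L j l) : Mult A η L j (-l) := by
  classical
  obtain ⟨h1, X, hX, h⟩ := h
  refine ⟨by rwa [abs_neg], X.image fun x => -x, ?_, fun a ha => ?_⟩
  · exact le_trans (by exact_mod_cast Finset.card_image_le) hX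
  obtain ⟨x, hx, t, ht, hd⟩ := h a ha
  refine ⟨-x, Finset.mem_image_of_mem _ hx, -t, neg_mem_diffSet ht, ?_⟩
  rw [← abs_neg]; convert hd using 2; ring

lemma Mult.add (hη : 0 < η) (hL : 2 ≤ L) (hA : A.Nonempty) (h : Mult A η L i l)
    (h' : Mult A η L j m) : Mult A η L (i + j + 1) (l + m) := by
  classical
  obtain ⟨h1, X, hX, h⟩ := h
  obtain ⟨h1', X', hX', h'⟩ := h'
  have hi : 1 ≤ L ^ i := one_le_pow₀ (by linarith)
  have hj : 1 ≤ L ^ j := one_le_pow₀ (by linarith)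
  have hp : L ^ i + L ^ j ≤ L ^ (i + j + 1) := by
    rw [pow_succ, pow_add]; nlinarith [mul_nonneg (sub_nonneg.2 hi) (sub_nonneg.2 hj)]
  have hp' : L ^ i * L ^ j ≤ L ^ (i + j + 1) := by
    rw [← pow_add]; exact pow_le_pow_right₀ (by linarith) (by omega)
  refine ⟨(abs_add_le _ _).trans (by linarith),
    (X ×ˢ X').image fun p => p.1 + p.2, ?_, fun a ha => ?_⟩
  · calc (((X ×ˢ X').image fun p => p.1 + p.2).card : ℝ) ≤ ((X ×ˢ X').card : ℝ) := by
          exact_mod_cast Finset.card_image_le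
      _ = X.card * X'.card := by rw [Finset.card_product]; push_cast; ring
      _ ≤ L ^ i * L ^ j := by gcongr
      _ ≤ _ := hp'
  obtain ⟨x, hx, t, ht, hd⟩ := h a ha
  obtain ⟨x', hx', t', ht', hd'⟩ := h' a ha
  refine ⟨x + x', Finset.mem_image.2 ⟨(x, x'), Finset.mk_mem_product hx hx', rfl⟩, t + t',
    diffSet_mono hA (by omega) (add_mem_diffSet ht ht'), ?_⟩
  calc |(l + m) * a - (x + x') - (t + t')| = |(l * a - x - t) + (m * a - x' - t')| := by
        congr 1; ring
    _ ≤ L ^ i * η + L ^ j * η := (abs_add_le _ _).trans (by linarith)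
    _ ≤ _ := by rw [← add_mul]; gcongr

lemma Mult.diffSet_cover (h : Mult A η L j l) (k : ℕ) :
    ∃ X : Finset ℝ, (X.card : ℝ) ≤ (L ^ j) ^ (2 * k) ∧
      ∀ s ∈ diffSet A k, ∃ x ∈ X, ∃ t ∈ diffSet A (2 * k * j),
        |l * s - x - t| ≤ 2 * k * (L ^ j * η) := by
  classical
  obtain ⟨h1, X, hX, h⟩ := h
  have hLj : 0 ≤ L ^ j := (abs_nonneg _).trans h1
  induction k with
  | zero =>
    refine ⟨{0}, by simp, fun s hs => ⟨0, by simp, 0, by simp [diffSet], ?_⟩⟩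
    simp only [diffSet, Finset.mem_singleton] at hs
    simp [hs]
  | succ k ih =>
    obtain ⟨Y, hY, ih⟩ := ih
    refine ⟨(Y ×ˢ (X ×ˢ X)).image fun p => p.1 + (p.2.1 - p.2.2), ?_, fun s hs => ?_⟩
    · calc (((Y ×ˢ (X ×ˢ X)).image fun p => p.1 + (p.2.1 - p.2.2)).card : ℝ)
          ≤ ((Y ×ˢ (X ×ˢ X)).card : ℝ) := by exact_mod_cast Finset.card_image_le
        _ = Y.card * (X.card * X.card) := by simp [Finset.card_product]
        _ ≤ (L ^ j) ^ (2 * k) * (L ^ j * L ^ j) := by gcongr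
        _ = _ := by ring
    obtain ⟨s, hs₀, a, ha, a', ha', rfl⟩ := mem_diffSet_succ.1 hs
    obtain ⟨y, hy, t, ht, hd⟩ := ih s hs₀
    obtain ⟨x, hx, u, hu, hd1⟩ := h a ha
    obtain ⟨x', hx', u', hu', hd2⟩ := h a' ha'
    refine ⟨y + (x - x'), Finset.mem_image.2 ⟨(y, (x, x')), by simp [*], rfl⟩,
      t + (u + -u'), ?_, ?_⟩
    · have := add_mem_diffSet ht (add_mem_diffSet hu (neg_mem_diffSet hu'))
      convert this using 2; ring
    · rw [abs_le] at *
      push_cast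
      constructor <;> linarith [hd.1, hd.2, hd1.1, hd1.2, hd2.1, hd2.2]

lemma Mult.mul (hη : 0 < η) (hL : 2 ≤ L) (hA : A.Nonempty) (h : Mult A η L i l)
    (h' : Mult A η L j m) : Mult A η L (2 * i * j + i + 2 * j + 1) (l * m) := by
  classical
  obtain ⟨Y, hY, hc⟩ := h.diffSet_cover j
  obtain ⟨h1, -⟩ := h
  obtain ⟨h1', X, hX, h'⟩ := h'
  have hL1 : 1 ≤ L := by linarith
  have hj2 : (2 * j : ℝ) ≤ L ^ (2 * j) := by
    have : ((2 * j : ℕ) : ℝ) ≤ 2 ^ (2 * j) := by exact_mod_cast Nat.lt_two_pow_self.le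
    calc (2 * j : ℝ) = ((2 * j : ℕ) : ℝ) := by push_cast; ring
      _ ≤ 2 ^ (2 * j) := this
      _ ≤ _ := by gcongr
  have hL0 : 0 < L := by linarith
  refine ⟨?_, (X ×ˢ Y).image fun p => l * p.1 + p.2, ?_, fun a ha => ?_⟩
  · rw [abs_mul]
    calc |l| * |m| ≤ L ^ i * L ^ j := by gcongr
      _ = L ^ (i + j) := by ring
      _ ≤ _ := pow_le_pow_right₀ hL1 (by omega)
  · calc (((X ×ˢ Y).image fun p => l * p.1 + p.2).card : ℝ) ≤ ((X ×ˢ Y).card : ℝ) := by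
          exact_mod_cast Finset.card_image_le
      _ = X.card * Y.card := by rw [Finset.card_product]; push_cast; ring
      _ ≤ L ^ j * (L ^ i) ^ (2 * j) := by gcongr
      _ = L ^ (j + i * (2 * j)) := by rw [pow_add, pow_mul L i]
      _ ≤ _ := pow_le_pow_right₀ hL1 (by nlinarith)
  obtain ⟨x, hx, t, ht, hd⟩ := h' a ha
  obtain ⟨y, hy, u, hu, hd'⟩ := hc t ht
  refine ⟨l * x + y, Finset.mem_image.2 ⟨(x, y), Finset.mk_mem_product hx hy, rfl⟩, u,
    diffSet_mono hA (by nlinarith) hu, ?_⟩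
  calc |l * m * a - (l * x + y) - u| = |l * (m * a - x - t) + (l * t - y - u)| := by
        congr 1; ring
    _ ≤ L ^ i * (L ^ j * η) + 2 * j * (L ^ i * η) := by
        refine (abs_add_le _ _).trans (add_le_add ?_ hd')
        rw [abs_mul]; gcongr
    _ ≤ L ^ i * (L ^ (2 * j) * η) + L ^ (2 * j) * (L ^ i * η) := by
        have : L ^ j ≤ L ^ (2 * j) := pow_le_pow_right₀ hL1 (by omega)
        gcongr
    _ = 2 * (L ^ i * L ^ (2 * j)) * η := by ring
    _ ≤ L * (L ^ i * L ^ (2 * j)) * η := by gcongr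
    _ = L ^ (i + 2 * j + 1) * η := by ring
    _ ≤ _ := by
        have : L ^ (i + 2 * j + 1) ≤ L ^ (2 * i * j + i + 2 * j + 1) :=
          pow_le_pow_right₀ hL1 (by nlinarith [Nat.zero_le (i * j)])
        gcongr

lemma Mult.one (hη : 0 < η) (hL : 2 ≤ L) (hA : A.Nonempty) (hj : 1 ≤ j) : Mult A η L j 1 := by
  have h1 : (1 : ℝ) ≤ L ^ j := one_le_pow₀ (by linarith)
  obtain ⟨a₀, ha₀⟩ := hA
  refine ⟨by simpa using h1, {a₀}, by simpa using h1, fun a ha => ⟨a₀, by simp, a - a₀, ?_, ?_⟩⟩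
  · exact diffSet_mono ⟨a₀, ha₀⟩ hj
      (mem_diffSet_succ.2 ⟨0, by simp [diffSet], a, ha, a₀, ha₀, by ring⟩)
  · simp; positivity

end Mult

/-- Indices for the closure of `Mult` under iterated ring operations. -/
def multIdx : ℕ → ℕ
  | 0 => 8
  | n + 1 => 2 * multIdx n * multIdx n + multIdx n + 2 * multIdx n + 1

lemma multIdx_le_succ (n : ℕ) : multIdx n ≤ multIdx (n + 1) := by
  simp only [multIdx]; omega

lemma multIdx_mono : Monotone multIdx := monotone_nat_of_le_succ multIdx_le_succ

/-- Scalars obtained from level `0` scalars by `n` rounds of ring operations. -/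
def MultLvl (A : Finset ℝ) (η L : ℝ) (n : ℕ) (l : ℝ) : Prop := Mult A η L (multIdx n) l

section MultLvl

variable {A : Finset ℝ} {η L l m : ℝ} {n n' : ℕ}

lemma MultLvl.mono (hη : 0 < η) (hL : 2 ≤ L) (hA : A.Nonempty) (hn : n ≤ n')
    (h : MultLvl A η L n l) : MultLvl A η L n' l :=
  Mult.mono hA hη hL (multIdx_mono hn) h

lemma MultLvl.add (hη : 0 < η) (hL : 2 ≤ L) (hA : A.Nonempty) (h : MultLvl A η L n l)
    (h' : MultLvl A η L n m) : MultLvl A η L (n + 1) (l + m) :=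
  Mult.mono hA hη hL (by simp only [multIdx]; omega) (Mult.add hη hL hA h h')

lemma MultLvl.sub (hη : 0 < η) (hL : 2 ≤ L) (hA : A.Nonempty) (h : MultLvl A η L n l)
    (h' : MultLvl A η L n m) : MultLvl A η L (n + 1) (l - m) := by
  rw [sub_eq_add_neg]
  exact MultLvl.add hη hL hA h (Mult.neg h')

lemma MultLvl.mul (hη : 0 < η) (hL : 2 ≤ L) (hA : A.Nonempty) (h : MultLvl A η L n l)
    (h' : MultLvl A η L n m) : MultLvl A η L (n + 1) (l * m) :=
  Mult.mul hη hL hA h h'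

end MultLvl

/-- If `r` is close to a ratio of two scalars preserving `A`, then `A + r A` has few separated
points. -/
lemma Mult.card_sum_dilate_le {A B : Finset ℝ} {η L r w μ ν R : ℝ} {j : ℕ} (hη : 0 < η)
    (hw : 0 ≤ w) (hμ0 : μ ≠ 0)
    (hA : ∀ a ∈ A, |a| ≤ R) (hμ : Mult A η L j μ) (hν : Mult A η L j ν) (hr : |r - ν / μ| ≤ w)
    (hR : 0 ≤ R)
    (hB : B ⊆ (A ×ˢ A).image (fun p => p.1 + r * p.2)) (hs : IsSep η B) :
    (B.card : ℝ) ≤ L ^ j * L ^ j * (diffSet A (j + j)).card *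
      (2 * ((2 * L ^ j * η + |μ| * w * R) / |μ|) / η + 1) := by
  classical
  obtain ⟨h1, X, hX, hc⟩ := hμ
  obtain ⟨h1', X', hX', hc'⟩ := hν
  have hLj : 0 ≤ L ^ j := (abs_nonneg _).trans h1
  have hμp : 0 < |μ| := abs_pos.2 hμ0
  set W := 2 * L ^ j * η + |μ| * w * R with hW
  have hW0 : 0 ≤ W := by positivity
  have hsub : B ⊆ ((X ×ˢ X') ×ˢ diffSet A (j + j)).biUnion fun p =>
      B.filter fun b => |b - (p.1.1 + p.1.2 + p.2) / μ| ≤ W / |μ| := by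
    intro b hb
    obtain ⟨⟨a, a'⟩, haa, rfl⟩ := Finset.mem_image.1 (hB hb)
    rw [Finset.mem_product] at haa
    obtain ⟨x, hx, t, ht, hd⟩ := hc a haa.1
    obtain ⟨x', hx', t', ht', hd'⟩ := hc' a' haa.2
    refine Finset.mem_biUnion.2 ⟨((x, x'), t + t'), ?_, Finset.mem_filter.2 ⟨hb, ?_⟩⟩
    · simp only [Finset.mem_product]
      exact ⟨⟨hx, hx'⟩, add_mem_diffSet ht ht'⟩
    · rw [le_div_iff₀ hμp, ← abs_mul]
      have e : (a + r * a' - (x + x' + (t + t')) / μ) * μ =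
          (μ * a - x - t) + (ν * a' - x' - t') + (r - ν / μ) * μ * a' := by
        field_simp; ring
      have h3 : |(r - ν / μ) * μ * a'| ≤ w * |μ| * R := by
        rw [abs_mul, abs_mul]
        gcongr
        exact hA a' haa.2
      simp only
      rw [e]
      refine (abs_add_le _ _).trans ?_
      have := abs_add_le (μ * a - x - t) (ν * a' - x' - t')
      rw [hW]; linarith
  calc (B.card : ℝ) ≤ (Finset.card _ : ℝ) := by exact_mod_cast Finset.card_le_card hsub
    _ ≤ ∑ p ∈ (X ×ˢ X') ×ˢ diffSet A (j + j),
        ((B.filter fun b => |b - (p.1.1 + p.1.2 + p.2) / μ| ≤ W / |μ|).card : ℝ) := by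
        exact_mod_cast Finset.card_biUnion_le
    _ ≤ ∑ p ∈ (X ×ˢ X') ×ˢ diffSet A (j + j), (2 * (W / |μ|) / η + 1) := by
        refine Finset.sum_le_sum fun p _ => ?_
        refine sep_card_le hη (by positivity) (c := (p.1.1 + p.1.2 + p.2) / μ)
          (fun a ha b hb => hs a (Finset.mem_filter.1 ha).1 b (Finset.mem_filter.1 hb).1)
          fun b hb => (Finset.mem_filter.1 hb).2
    _ = X.card * X'.card * (diffSet A (j + j)).card * (2 * (W / |μ|) / η + 1) := by
        rw [Finset.sum_const, nsmul_eq_mul, Finset.card_product, Finset.card_product]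
        push_cast; ring
    _ ≤ _ := by gcongr

/-- A finite set of reals which at scale `η` looks like a `1/2`-dimensional Frostman set at scales
above `θ ^ 1000`, up to factors `L`. -/
structure NonConc (θ η L : ℝ) (S : Finset ℝ) : Prop where
  lower : θ ^ 1000 / η ≤ L * S.card
  bdd : ∀ s ∈ S, |s| ≤ L
  count : ∀ y, θ ^ 1000 ≤ y → y ≤ 1 → ∀ c,
    ((S.filter fun s => |s - c| ≤ y).card : ℝ) ≤ L * √y * (θ ^ 1000 / η)
  fine : ∀ c, ((S.filter fun s => |s - c| ≤ η).card : ℝ) ≤ L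

section

variable {θ η L : ℝ} {S : Finset ℝ}

lemma NonConc.nonempty (hS : NonConc θ η L S) (hθ : 0 < θ) (hη : 0 < η) : S.Nonempty := by
  by_contra h
  rw [Finset.not_nonempty_iff_eq_empty] at h
  have := hS.lower
  rw [h] at this
  have h1 : 0 < θ ^ 1000 / η := by positivity
  simp at this; linarith

lemma NonConc.exists_sep (hS : NonConc θ η L S) (hθ : 0 < θ) (hη : 0 < η) (hL : 2 ≤ L) {y : ℝ}
    (hy : θ ^ 1000 ≤ y) : ∃ B ⊆ S, IsSep y B ∧ 1 ≤ L ^ 2 * √y * B.card := by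
  classical
  have hy0 : 0 < y := lt_of_lt_of_le (by positivity) hy
  have hN : 0 < θ ^ 1000 / η := by positivity
  rcases le_or_gt y 1 with h1 | h1
  · obtain ⟨B, hB, hs, hc⟩ := exists_sep_card S id hy0 (m := L * √y * (θ ^ 1000 / η)) (fun c => by
      refine le_trans ?_ (hS.count y hy h1 c)
      exact_mod_cast Finset.card_le_card fun s hs => by
        simp only [Finset.mem_filter, id] at hs ⊢
        exact ⟨hs.1, hs.2.le⟩)
    refine ⟨B, by simpa using hB, hs, ?_⟩
    have : 1 * (θ ^ 1000 / η) ≤ L ^ 2 * √y * B.card * (θ ^ 1000 / η) := by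
      calc 1 * (θ ^ 1000 / η) ≤ L * S.card := by rw [one_mul]; exact hS.lower
        _ ≤ L * (B.card * (L * √y * (θ ^ 1000 / η))) := by gcongr
        _ = _ := by ring
    exact le_of_mul_le_mul_right this hN
  · obtain ⟨s, hs⟩ := hS.nonempty hθ hη
    refine ⟨{s}, by simpa using hs, by intro a ha b hb hab; simp_all, ?_⟩
    have h2 : 1 ≤ √y := by rw [Real.one_le_sqrt]; exact h1.le
    have h3 : (1 : ℝ) ≤ L ^ 2 := one_le_pow₀ (by linarith)
    simp only [Finset.card_singleton, Nat.cast_one, mul_one]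
    nlinarith

lemma isSep_image {ι : Type*} (I : Finset ι) (φ : ι → ℝ) {x : ℝ} (hx : 0 < x)
    (h : ∀ i ∈ I, ∀ j ∈ I, i ≠ j → x ≤ |φ i - φ j|) :
    IsSep x (I.image φ) ∧ (I.image φ).card = I.card := by
  classical
  refine ⟨?_, Finset.card_image_of_injOn ?_⟩
  · intro a ha b hb hab
    obtain ⟨i, hi, rfl⟩ := Finset.mem_image.1 ha
    obtain ⟨j, hj, rfl⟩ := Finset.mem_image.1 hb
    exact h i hi j hj fun hij => hab (by rw [hij])
  · intro i hi j hj hij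
    by_contra hne
    have := h i hi j hj hne
    simp [hij] at this; linarith

lemma IsSep.le_abs_sub {x : ℝ} {B : Finset ℝ} (h : IsSep x B) {a b : ℝ} (ha : a ∈ B)
    (hb : b ∈ B) (hab : a ≠ b) : x ≤ |a - b| := h a ha b hb hab

lemma sqrt_five_mul_le (hL : 2 ≤ L) {m : ℝ} (hm : 0 ≤ m) : √(5 * L * m) ≤ L ^ 2 * √m := by
  rw [show L ^ 2 * √m = √(L ^ 4 * m) by
    rw [Real.sqrt_mul (by positivity), show L ^ 4 = (L ^ 2) ^ 2 by ring,
      Real.sqrt_sq (by positivity)]]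
  apply Real.sqrt_le_sqrt
  have : 5 * L ≤ L ^ 4 := by nlinarith [pow_le_pow_left₀ (by norm_num) hL 3]
  gcongr

lemma abs_sub_le_of_abs_le {a b R : ℝ} (ha : |a| ≤ R) (hb : |b| ≤ R) : |a - b| ≤ 2 * R := by
  rw [abs_le] at *; constructor <;> linarith [ha.1, ha.2, hb.1, hb.2]

lemma NonConc.coarse_gap {A Λ : Finset ℝ} (hΛ : NonConc θ η L Λ) (hθ : 0 < θ) (hθ1 : θ ≤ 1)
    (hη : 0 < η) (hL : 2 ≤ L) (hLθ : L ^ 10 * θ ≤ 1) (hAne : A.Nonempty)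
    (hAΛ : ∀ l ∈ Λ, MultLvl A η L 0 l)
    {B : Finset ℝ} (hBΛ : B ⊆ Λ) (hBs : IsSep (θ ^ 48) B) (hBc : 1 ≤ L ^ 2 * θ ^ 24 * B.card)
    {b₁ b₂ b₃ b₄ ν : ℝ} (hb₁ : b₁ ∈ B) (hb₂ : b₂ ∈ B) (hb₃ : b₃ ∈ B) (hb₄ : b₄ ∈ B)
    (hne : b₃ ≠ b₄) (hν : ν = b₁ - b₂ ∨ ν = b₁ - b₂ + (b₃ - b₄))
    (hν1 : |ν| ≤ |2 * (b₃ - b₄)|)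
    (hgap : ∀ a ∈ B, ∀ a' ∈ B, ∀ b ∈ B, ∀ b' ∈ B, b ≠ b' →
      θ ^ 24 ≤ |ν / (2 * (b₃ - b₄)) - (a - a') / (b - b')|) :
    ∃ B₁ : Finset ℝ, ∃ ρ : ℝ, (∀ b ∈ B₁, MultLvl A η L 5 b ∧ |b| ≤ L ^ 6) ∧ IsSep ρ B₁ ∧
      1 ≤ L ^ 12 * θ ^ 4 * √ρ * B₁.card ∧ θ ^ 120 ≤ ρ ∧ ρ ≤ θ ^ 10 := by
  classical
  set μ := 2 * (b₃ - b₄) with hμ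
  have hbd : ∀ {l}, l ∈ B → |l| ≤ L := fun hl => hΛ.bdd _ (hBΛ hl)
  have hdist := hBs.le_abs_sub hb₃ hb₄ hne
  have hμlow : θ ^ 48 ≤ |μ| := by rw [hμ, abs_mul, abs_two]; linarith [abs_nonneg (b₃ - b₄)]
  have hμp : 0 < |μ| := lt_of_lt_of_le (by positivity) hμlow
  have hμ0 : μ ≠ 0 := abs_pos.1 hμp
  have hμup : |μ| ≤ 4 * L := by
    rw [hμ, abs_mul, abs_two]; linarith [abs_sub_le_of_abs_le (hbd hb₃) (hbd hb₄)]
  obtain ⟨M, hMΛ, hMs, hMc⟩ := hΛ.exists_sep hθ hη hL (y := 5 * L * |μ|) (by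
    calc θ ^ 1000 ≤ θ ^ 48 := pow_le_pow_of_le_one hθ.le hθ1 (by norm_num)
      _ ≤ |μ| := hμlow
      _ ≤ 5 * L * |μ| := by nlinarith)
  have ht1 : θ ^ 72 ≤ 1 := pow_le_one₀ hθ.le hθ1
  have hsep := isSep_image (M ×ˢ (B ×ˢ B)) (fun p => p.1 + (μ * p.2.1 + ν * p.2.2))
    (x := |μ| * θ ^ 72) (by positivity) ?_
  · refine ⟨_, |μ| * θ ^ 72, ?_, hsep.1, ?_, ?_, ?_⟩
    · intro b hb
      obtain ⟨⟨l, a, a'⟩, hp, rfl⟩ := Finset.mem_image.1 hb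
      simp only [Finset.mem_product] at hp
      have m0 : ∀ {l}, l ∈ B → MultLvl A η L 0 l := fun h => hAΛ _ (hBΛ h)
      have mμ : MultLvl A η L 2 μ := by
        rw [hμ, two_mul]
        exact MultLvl.add hη hL hAne (MultLvl.sub hη hL hAne (m0 hb₃) (m0 hb₄))
          (MultLvl.sub hη hL hAne (m0 hb₃) (m0 hb₄))
      have mν : MultLvl A η L 2 ν := by
        rcases hν with h | h <;> rw [h]
        · exact MultLvl.mono hη hL hAne (by norm_num) (MultLvl.sub hη hL hAne (m0 hb₁) (m0 hb₂))
        · exact MultLvl.add hη hL hAne (MultLvl.sub hη hL hAne (m0 hb₁) (m0 hb₂))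
            (MultLvl.sub hη hL hAne (m0 hb₃) (m0 hb₄))
      refine ⟨?_, ?_⟩
      · refine MultLvl.add hη hL hAne
          (MultLvl.mono hη hL hAne (by norm_num) (hAΛ _ (hMΛ hp.1)))
          (MultLvl.add hη hL hAne ?_ ?_)
        · exact MultLvl.mul hη hL hAne mμ (MultLvl.mono hη hL hAne (by norm_num) (m0 hp.2.1))
        · exact MultLvl.mul hη hL hAne mν (MultLvl.mono hη hL hAne (by norm_num) (m0 hp.2.2))
      · have h1 : |l + (μ * a + ν * a')| ≤ L + (4 * L * L + 4 * L * L) := by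
          refine (abs_add_le _ _).trans (add_le_add (hΛ.bdd _ (hMΛ hp.1)) ?_)
          refine (abs_add_le _ _).trans (add_le_add ?_ ?_) <;> rw [abs_mul]
          · gcongr; exact hbd hp.2.1
          · gcongr
            · exact hν1.trans hμup
            · exact hbd hp.2.2
        refine h1.trans ?_
        have h4 : (16 : ℝ) ≤ L ^ 4 := by
          have := pow_le_pow_left₀ (by norm_num) hL 4; linarith
        nlinarith [sq_nonneg L]
    · rw [hsep.2, Finset.card_product, Finset.card_product,
        show |μ| * θ ^ 72 = |μ| * (θ ^ 36) ^ 2 by ring, Real.sqrt_mul hμp.le,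
        Real.sqrt_sq (by positivity)]
      push_cast
      calc (1 : ℝ) = 1 * (1 * 1) := by norm_num
        _ ≤ (L ^ 2 * √(5 * L * |μ|) * M.card) *
            ((L ^ 2 * θ ^ 24 * B.card) * (L ^ 2 * θ ^ 24 * B.card)) := by gcongr
        _ ≤ (L ^ 2 * (L ^ 2 * √|μ|) * M.card) *
            ((L ^ 2 * θ ^ 24 * B.card) * (L ^ 2 * θ ^ 24 * B.card)) := by
            gcongr; exact sqrt_five_mul_le hL hμp.le
        _ = L ^ 8 * θ ^ 48 * (√|μ| * (M.card * (B.card * B.card))) := by ring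
        _ ≤ L ^ 12 * θ ^ 40 * (√|μ| * (M.card * (B.card * B.card))) := by
            have h1 : L ^ 8 ≤ L ^ 12 := pow_le_pow_right₀ (by linarith) (by norm_num)
            have h2 : θ ^ 48 ≤ θ ^ 40 := pow_le_pow_of_le_one hθ.le hθ1 (by norm_num)
            gcongr
        _ = _ := by ring
    · calc θ ^ 120 = θ ^ 48 * θ ^ 72 := by ring
        _ ≤ _ := by gcongr
    · calc |μ| * θ ^ 72 ≤ 4 * L * θ ^ 72 := by gcongr
        _ ≤ L ^ 10 * θ ^ 72 := by
            gcongr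
            nlinarith [pow_le_pow_left₀ (by norm_num) hL 9]
        _ = L ^ 10 * θ * θ ^ 71 := by ring
        _ ≤ 1 * θ ^ 10 := by
            gcongr 1
            exact pow_le_pow_of_le_one hθ.le hθ1 (by norm_num)
        _ = θ ^ 10 := one_mul _
  · rintro ⟨l, a, a'⟩ hp ⟨l', b, b'⟩ hp' hne'
    simp only [Finset.mem_product] at hp hp'
    by_contra! hlt
    have e1 : |μ * (a - b) + ν * (a' - b')| ≤ |μ| * (4 * L) := by
      refine (abs_add_le _ _).trans ?_
      rw [abs_mul μ, abs_mul ν]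
      have h1 := abs_sub_le_of_abs_le (hbd hp.2.1) (hbd hp'.2.1)
      have h2 := abs_sub_le_of_abs_le (hbd hp.2.2) (hbd hp'.2.2)
      have h3 : |ν| * |a' - b'| ≤ |μ| * (2 * L) := by gcongr
      have h4 : |μ| * |a - b| ≤ |μ| * (2 * L) := by gcongr
      linarith
    have hll : l = l' := by
      by_contra hll
      have h1 := hMs.le_abs_sub hp.1 hp'.1 hll
      have h2 : |l - l'| ≤ |l + (μ * a + ν * a') - (l' + (μ * b + ν * b'))| +
          |μ * (a - b) + ν * (a' - b')| := by
        rw [show l - l' = l + (μ * a + ν * a') - (l' + (μ * b + ν * b')) -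
          (μ * (a - b) + ν * (a' - b')) by ring]
        exact abs_sub _ _
      simp only at hlt
      have h3 : |μ| * θ ^ 72 ≤ |μ| * L := by gcongr; linarith
      nlinarith
    subst hll
    have e2 : |(a - b) + ν / μ * (a' - b')| < θ ^ 72 := by
      have : l + (μ * a + ν * a') - (l + (μ * b + ν * b')) =
          μ * ((a - b) + ν / μ * (a' - b')) := by field_simp; ring
      simp only at hlt
      rw [this, abs_mul] at hlt
      exact lt_of_mul_lt_mul_left hlt hμp.le
    by_cases hab : a' = b'
    · subst hab
      have hab2 : a ≠ b := fun h => hne' (by rw [h])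
      have h1 := hBs.le_abs_sub hp.2.1 hp'.2.1 hab2
      simp only [sub_self, mul_zero, add_zero] at e2
      have : θ ^ 72 ≤ θ ^ 48 := pow_le_pow_of_le_one hθ.le hθ1 (by norm_num)
      linarith
    · have h1 := hBs.le_abs_sub hp.2.2 hp'.2.2 hab
      have h2 := hgap b hp'.2.1 a hp.2.1 a' hp.2.2 b' hp'.2.2 hab
      have h3 : a' - b' ≠ 0 := sub_ne_zero.2 hab
      have h4 : (a - b) + ν / μ * (a' - b') = (ν / μ - (b - a) / (a' - b')) * (a' - b') := by
        field_simp; ring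
      rw [h4, abs_mul] at e2
      have : θ ^ 24 * θ ^ 48 ≤ |ν / μ - (b - a) / (a' - b')| * |a' - b'| := by gcongr
      have h5 : θ ^ 24 * θ ^ 48 = θ ^ 72 := by ring
      linarith

end

section

variable {θ η L : ℝ} {S : Finset ℝ}

/-- A consequence of `exists_large_sum_dilate` for a nonconcentrated set. -/
lemma NonConc.exists_large_sum_dilate (hS : NonConc θ η L S) (hθ : 0 < θ) (hη : 0 < η)
    (hL : 2 ≤ L) {R : Finset ℝ} {τ Y u₁ u₂ u₃ : ℝ} (hτ : 0 < τ) (hY : 0 < Y)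
    (hY1 : Y ≤ 1) (hR : R.Nonempty) (hRs : IsSep τ R) (hu₁ : 0 ≤ u₁)
    (h1 : ∀ c, ((S.filter fun s => |s - c| < 2 * τ).card : ℝ) ≤ u₁)
    (h2 : ∀ c, ((S.filter fun s => |s - c| ≤ Y).card : ℝ) ≤ u₂ * (θ ^ 1000 / η))
    (h3 : (S.card : ℝ) ^ 2 * 5 ≤ u₃ * (θ ^ 1000 / η) * (Y * R.card)) :
    ∃ r ∈ R, ∃ B ⊆ (S ×ˢ S).image (fun p => p.1 + r * p.2), IsSep τ B ∧
      θ ^ 1000 / η ≤ L ^ 2 * (u₁ * u₂ + u₃) * B.card := by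
  obtain ⟨r, hr, B, hB, hBs, hc⟩ :=
    _root_.exists_large_sum_dilate S R hτ hY hY1 hR hRs hu₁ h1 h2
  refine ⟨r, hr, B, hB, hBs, ?_⟩
  set N := θ ^ 1000 / η with hN
  have hN0 : 0 < N := by positivity
  have hS0 : (0 : ℝ) < S.card := by exact_mod_cast (hS.nonempty hθ hη).card_pos
  have hR0 : (0 : ℝ) < R.card := by exact_mod_cast hR.card_pos
  have h4 : (S.card : ℝ) ^ 4 * (5 / (Y * R.card)) ≤ (S.card : ℝ) ^ 2 * (u₃ * N) := by
    have : (S.card : ℝ) ^ 2 * (5 / (Y * R.card)) ≤ u₃ * N := by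
      rw [mul_div_assoc', div_le_iff₀ (by positivity)]; exact h3
    calc (S.card : ℝ) ^ 4 * (5 / (Y * R.card))
        = (S.card : ℝ) ^ 2 * ((S.card : ℝ) ^ 2 * (5 / (Y * R.card))) := by ring
      _ ≤ _ := by gcongr
  have h5 : (S.card : ℝ) ^ 2 * (S.card : ℝ) ^ 2 ≤
      (B.card * (u₁ * u₂ + u₃) * N) * (S.card : ℝ) ^ 2 := by
    calc (S.card : ℝ) ^ 2 * (S.card : ℝ) ^ 2 = (S.card : ℝ) ^ 4 := by ring
      _ ≤ _ := hc
      _ ≤ B.card * ((S.card : ℝ) ^ 2 * u₁ * (u₂ * N) + (S.card : ℝ) ^ 2 * (u₃ * N)) := by gcongr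
      _ = _ := by ring
  have h6 := le_of_mul_le_mul_right h5 (by positivity)
  have h7 : N * N ≤ (L ^ 2 * (u₁ * u₂ + u₃) * B.card) * N := by
    have hl : N ≤ L * S.card := hS.lower
    calc N * N ≤ (L * S.card) * (L * S.card) := by gcongr
      _ = L ^ 2 * (S.card : ℝ) ^ 2 := by ring
      _ ≤ L ^ 2 * (B.card * (u₁ * u₂ + u₃) * N) := by gcongr
      _ = _ := by ring
  exact le_of_mul_le_mul_right h7 hN0

lemma NonConc.coarse_dense {A Λ : Finset ℝ} (hΛ : NonConc θ η L Λ) (hθ : 0 < θ) (hθ1 : θ ≤ 1)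
    (hη : 0 < η) (hL : 2 ≤ L) (hLθ : L ^ 10 * θ ≤ 1) (hΛc : Λ.card ≤ L ^ 3 * (θ ^ 1000 / η))
    (hAne : A.Nonempty) (hAΛ : ∀ l ∈ Λ, MultLvl A η L 0 l)
    {B : Finset ℝ} (hBΛ : B ⊆ Λ) (hBs : IsSep (θ ^ 48) B)
    (hdense : ∀ r ∈ Icc (0 : ℝ) 1, ∃ a ∈ B, ∃ a' ∈ B, ∃ b ∈ B, ∃ b' ∈ B, b ≠ b' ∧
      (a - a') / (b - b') ∈ Icc (0 : ℝ) 1 ∧ |r - (a - a') / (b - b')| ≤ 3 * θ ^ 24) :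
    ∃ B₁ : Finset ℝ, ∃ ρ : ℝ, (∀ b ∈ B₁, MultLvl A η L 5 b ∧ |b| ≤ L ^ 6) ∧ IsSep ρ B₁ ∧
      1 ≤ L ^ 20 * θ ^ 4 * √ρ * B₁.card ∧ θ ^ 120 ≤ ρ ∧ ρ ≤ θ ^ 10 := by
  classical
  have hL1 : 1 ≤ L := by linarith
  set N := θ ^ 1000 / η with hN
  have hN0 : 0 < N := by positivity
  obtain ⟨R, hRne, hRs, hR01, hRc⟩ := exists_grid (τ := 8 * L * θ ^ 24) (by positivity)
  have h16 : 16 * L * θ ^ 24 ≤ (L ^ 3 * θ ^ 12) ^ 2 := by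
    rw [mul_pow, ← pow_mul, ← pow_mul]
    have : 16 ≤ L ^ 4 := by have := pow_le_pow_left₀ (by norm_num) hL 4; linarith
    gcongr ?_ * _
    calc 16 * L ≤ L ^ 4 * L := by gcongr
      _ = L ^ 5 := by ring
      _ ≤ _ := pow_le_pow_right₀ hL1 (by norm_num)
  have hsm : L ^ 3 * θ ^ 12 ≤ 1 := by
    calc L ^ 3 * θ ^ 12 ≤ L ^ 10 * θ := by
          gcongr ?_ * ?_
          · exact pow_le_pow_right₀ hL1 (by norm_num)
          · exact pow_le_of_le_one hθ.le hθ1 (by norm_num)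
      _ ≤ 1 := hLθ
  obtain ⟨r, hr, D, hD, hDs, hDc⟩ := hΛ.exists_large_sum_dilate hθ hη hL (R := R)
    (τ := 8 * L * θ ^ 24) (Y := θ ^ 8) (u₁ := L * (L ^ 3 * θ ^ 12) * N) (u₂ := L * θ ^ 4)
    (u₃ := L ^ 13 * θ ^ 16 * N)
    (by positivity) (by positivity) (pow_le_one₀ hθ.le hθ1) hRne hRs (by positivity)
    (fun c => by
      calc ((Λ.filter fun s => |s - c| < 2 * (8 * L * θ ^ 24)).card : ℝ)
          ≤ ((Λ.filter fun s => |s - c| ≤ 16 * L * θ ^ 24).card : ℝ) := by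
            exact_mod_cast Finset.card_le_card fun s hs => by
              simp only [Finset.mem_filter] at hs ⊢
              exact ⟨hs.1, by linarith [hs.2]⟩
        _ ≤ L * √(16 * L * θ ^ 24) * N := hΛ.count _ (by
            have : θ ^ 1000 ≤ θ ^ 24 := pow_le_pow_of_le_one hθ.le hθ1 (by norm_num)
            have : 0 < θ ^ 24 := by positivity
            nlinarith) (h16.trans (pow_le_one₀ (by positivity) hsm)) c
        _ ≤ _ := by
            gcongr
            exact Real.sqrt_le_iff.2 ⟨by positivity, h16⟩)
    (fun c => by
      have := hΛ.count (θ ^ 8) (pow_le_pow_of_le_one hθ.le hθ1 (by norm_num))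
        (pow_le_one₀ hθ.le hθ1) c
      have h8 : √(θ ^ 8) = θ ^ 4 := by
        rw [show θ ^ 8 = (θ ^ 4) ^ 2 by ring, Real.sqrt_sq (by positivity)]
      rwa [h8] at this)
    (by
      rw [div_le_iff₀ (by positivity)] at hRc
      have h40 : 40 ≤ L ^ 6 := by have := pow_le_pow_left₀ (by norm_num) hL 6; linarith
      calc (Λ.card : ℝ) ^ 2 * 5 ≤ (L ^ 3 * N) ^ 2 * (5 * 1) := by gcongr; norm_num
        _ ≤ (L ^ 3 * N) ^ 2 * (5 * (R.card * (8 * L * θ ^ 24))) := by gcongr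
        _ = L ^ 7 * N ^ 2 * 40 * (θ ^ 24 * R.card) := by ring
        _ ≤ L ^ 7 * N ^ 2 * L ^ 6 * (θ ^ 24 * R.card) := by gcongr
        _ = _ := by ring)
  have hDc' : 1 ≤ L ^ 16 * θ ^ 16 * D.card := by
    have h2 : 2 * L ^ 15 ≤ L ^ 16 := by
      rw [pow_succ L 15, mul_comm]; gcongr
    have : N * 1 ≤ N * (L ^ 16 * θ ^ 16 * D.card) := by
      rw [mul_one]
      calc N ≤ _ := hDc
        _ = L ^ 7 * (θ ^ 16 * N * D.card) + L ^ 15 * (θ ^ 16 * N * D.card) := by ring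
        _ ≤ L ^ 15 * (θ ^ 16 * N * D.card) + L ^ 15 * (θ ^ 16 * N * D.card) := by
            gcongr ?_ * _ + _
            exact pow_le_pow_right₀ hL1 (by norm_num)
        _ = 2 * L ^ 15 * (θ ^ 16 * N * D.card) := by ring
        _ ≤ L ^ 16 * (θ ^ 16 * N * D.card) := by gcongr
        _ = _ := by ring
    exact le_of_mul_le_mul_left this hN0
  obtain ⟨a₁, ha₁, a₂, ha₂, b₁, hb₁, b₂, hb₂, hne, hq, hrq⟩ := hdense r (hR01 r hr)
  set μ := b₁ - b₂ with hμ
  set ν := a₁ - a₂ with hν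
  have hbd : ∀ {l}, l ∈ B → |l| ≤ L := fun hl => hΛ.bdd _ (hBΛ hl)
  have hμlow : θ ^ 48 ≤ |μ| := hBs.le_abs_sub hb₁ hb₂ hne
  have hμp : 0 < |μ| := lt_of_lt_of_le (by positivity) hμlow
  have hμ0 : μ ≠ 0 := abs_pos.1 hμp
  have hμup : |μ| ≤ 2 * L := abs_sub_le_of_abs_le (hbd hb₁) (hbd hb₂)
  have hνμ : |ν| ≤ |μ| := by
    have : |ν / μ| ≤ 1 := abs_le.2 ⟨by linarith [hq.1], hq.2⟩
    rwa [abs_div, div_le_one hμp] at this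
  obtain ⟨M, hMΛ, hMs, hMc⟩ := hΛ.exists_sep hθ hη hL (y := 5 * L * |μ|) (by
    calc θ ^ 1000 ≤ θ ^ 48 := pow_le_pow_of_le_one hθ.le hθ1 (by norm_num)
      _ ≤ |μ| := hμlow
      _ ≤ 5 * L * |μ| := by nlinarith)
  choose! f hf hfd using fun (d : ℝ) (hd : d ∈ D) => Finset.mem_image.1 (hD hd)
  have hf1 : ∀ d ∈ D, (f d).1 ∈ Λ := fun d hd => (Finset.mem_product.1 (hf d hd)).1
  have hf2 : ∀ d ∈ D, (f d).2 ∈ Λ := fun d hd => (Finset.mem_product.1 (hf d hd)).2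
  have ht1 : θ ^ 24 ≤ 1 := pow_le_one₀ hθ.le hθ1
  have hsep := isSep_image (M ×ˢ D) (fun p => p.1 + (μ * (f p.2).1 + ν * (f p.2).2))
    (x := |μ| * θ ^ 24) (by positivity) ?_
  · refine ⟨_, |μ| * θ ^ 24, ?_, hsep.1, ?_, ?_, ?_⟩
    · intro b hb
      obtain ⟨⟨l, d⟩, hp, rfl⟩ := Finset.mem_image.1 hb
      simp only [Finset.mem_product] at hp
      have m0 : ∀ {l}, l ∈ B → MultLvl A η L 0 l := fun h => hAΛ _ (hBΛ h)
      refine ⟨?_, ?_⟩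
      · refine MultLvl.add hη hL hAne
          (MultLvl.mono hη hL hAne (by norm_num) (hAΛ _ (hMΛ hp.1)))
          (MultLvl.add hη hL hAne (MultLvl.mono hη hL hAne (by norm_num : 2 ≤ 3) ?_)
          (MultLvl.mono hη hL hAne (by norm_num : 2 ≤ 3) ?_))
        · exact MultLvl.mul hη hL hAne (MultLvl.sub hη hL hAne (m0 hb₁) (m0 hb₂))
            (MultLvl.mono hη hL hAne (by norm_num) (hAΛ _ (hf1 d hp.2)))
        · exact MultLvl.mul hη hL hAne (MultLvl.sub hη hL hAne (m0 ha₁) (m0 ha₂))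
            (MultLvl.mono hη hL hAne (by norm_num) (hAΛ _ (hf2 d hp.2)))
      · have h1 : |l + (μ * (f d).1 + ν * (f d).2)| ≤ L + (2 * L * L + 2 * L * L) := by
          refine (abs_add_le _ _).trans (add_le_add (hΛ.bdd _ (hMΛ hp.1)) ?_)
          refine (abs_add_le _ _).trans (add_le_add ?_ ?_) <;> rw [abs_mul]
          · gcongr; exact hΛ.bdd _ (hf1 d hp.2)
          · gcongr
            · exact hνμ.trans hμup
            · exact hΛ.bdd _ (hf2 d hp.2)
        refine h1.trans ?_
        have h4 : (16 : ℝ) ≤ L ^ 4 := by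
          have := pow_le_pow_left₀ (by norm_num) hL 4; linarith
        nlinarith [sq_nonneg L]
    · rw [hsep.2, Finset.card_product,
        show |μ| * θ ^ 24 = |μ| * (θ ^ 12) ^ 2 by ring, Real.sqrt_mul hμp.le,
        Real.sqrt_sq (by positivity)]
      push_cast
      calc (1 : ℝ) = 1 * 1 := by norm_num
        _ ≤ (L ^ 2 * √(5 * L * |μ|) * M.card) * (L ^ 16 * θ ^ 16 * D.card) := by gcongr
        _ ≤ (L ^ 2 * (L ^ 2 * √|μ|) * M.card) * (L ^ 16 * θ ^ 16 * D.card) := by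
            gcongr; exact sqrt_five_mul_le hL hμp.le
        _ = _ := by ring
    · calc θ ^ 120 ≤ θ ^ 72 := pow_le_pow_of_le_one hθ.le hθ1 (by norm_num)
        _ = θ ^ 48 * θ ^ 24 := by ring
        _ ≤ _ := by gcongr
    · calc |μ| * θ ^ 24 ≤ 2 * L * θ ^ 24 := by gcongr
        _ ≤ L ^ 10 * θ ^ 24 := by
            gcongr
            nlinarith [pow_le_pow_left₀ (by norm_num) hL 9]
        _ = L ^ 10 * θ * θ ^ 23 := by ring
        _ ≤ 1 * θ ^ 10 := by
            gcongr 1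
            exact pow_le_pow_of_le_one hθ.le hθ1 (by norm_num)
        _ = θ ^ 10 := one_mul _
  · rintro ⟨l, d⟩ hp ⟨l', d'⟩ hp' hne'
    simp only [Finset.mem_product] at hp hp'
    simp only
    have h1 := abs_sub_le_of_abs_le (hΛ.bdd _ (hf1 d hp.2)) (hΛ.bdd _ (hf1 d' hp'.2))
    have h2 := abs_sub_le_of_abs_le (hΛ.bdd _ (hf2 d hp.2)) (hΛ.bdd _ (hf2 d' hp'.2))
    by_cases hll : l = l'
    · subst hll
      have hdd : d ≠ d' := fun h => hne' (by rw [h])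
      have h3 := hDs.le_abs_sub hp.2 hp'.2 hdd
      have h4 : l + (μ * (f d).1 + ν * (f d).2) - (l + (μ * (f d').1 + ν * (f d').2)) =
          μ * ((d - d') - (r - ν / μ) * ((f d).2 - (f d').2)) := by
        have e1 := hfd d hp.2
        have e2 := hfd d' hp'.2
        rw [← sub_eq_zero]
        have : d - d' = (f d).1 + r * (f d).2 - ((f d').1 + r * (f d').2) := by rw [e1, e2]
        rw [this]; field_simp; ring
      rw [h4, abs_mul]
      gcongr
      have h5 : |(r - ν / μ) * ((f d).2 - (f d').2)| ≤ 3 * θ ^ 24 * (2 * L) := by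
        rw [abs_mul]; gcongr
      have h6 := abs_sub_abs_le_abs_sub (d - d') ((r - ν / μ) * ((f d).2 - (f d').2))
      have : 0 < θ ^ 24 := by positivity
      nlinarith
    · have h3 := hMs.le_abs_sub hp.1 hp'.1 hll
      have e1 : |μ * ((f d).1 - (f d').1) + ν * ((f d).2 - (f d').2)| ≤ |μ| * (4 * L) := by
        refine (abs_add_le _ _).trans ?_
        rw [abs_mul μ, abs_mul ν]
        have h3 : |ν| * |(f d).2 - (f d').2| ≤ |μ| * (2 * L) := by gcongr
        have h4 : |μ| * |(f d).1 - (f d').1| ≤ |μ| * (2 * L) := by gcongr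
        linarith
      have h4 : l + (μ * (f d).1 + ν * (f d).2) - (l' + (μ * (f d').1 + ν * (f d').2)) =
          (l - l') - -(μ * ((f d).1 - (f d').1) + ν * ((f d).2 - (f d').2)) := by ring
      rw [h4]
      have h5 := abs_sub_abs_le_abs_sub (l - l')
        (-(μ * ((f d).1 - (f d').1) + ν * ((f d).2 - (f d').2)))
      rw [abs_neg] at h5
      have h6 : |μ| * θ ^ 24 ≤ |μ| * L := by gcongr; linarith
      linarith

lemma NonConc.coarse {A Λ : Finset ℝ} (hΛ : NonConc θ η L Λ) (hθ : 0 < θ) (hθ1 : θ ≤ 1)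
    (hη : 0 < η) (hL : 2 ≤ L) (hLθ : L ^ 10 * θ ≤ 1) (hΛc : Λ.card ≤ L ^ 3 * (θ ^ 1000 / η))
    (hAne : A.Nonempty) (hAΛ : ∀ l ∈ Λ, MultLvl A η L 0 l) :
    ∃ B₁ : Finset ℝ, ∃ ρ : ℝ, (∀ b ∈ B₁, MultLvl A η L 5 b ∧ |b| ≤ L ^ 6) ∧ IsSep ρ B₁ ∧
      1 ≤ L ^ 20 * θ ^ 4 * √ρ * B₁.card ∧ θ ^ 120 ≤ ρ ∧ ρ ≤ θ ^ 10 := by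
  have hL1 : 1 ≤ L := by linarith
  obtain ⟨B, hBΛ, hBs, hBc⟩ := hΛ.exists_sep hθ hη hL (y := θ ^ 48)
    (pow_le_pow_of_le_one hθ.le hθ1 (by norm_num))
  rw [show √(θ ^ 48) = θ ^ 24 by
    rw [show θ ^ 48 = (θ ^ 24) ^ 2 by ring, Real.sqrt_sq (by positivity)]] at hBc
  have hB2 : 1 < B.card := by
    have h1 : L ^ 2 * θ ^ 24 < 1 := by
      have h2 : L ^ 2 * L ≤ L ^ 10 := by
        rw [← pow_succ]; exact pow_le_pow_right₀ hL1 (by norm_num)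
      have h3 : L ^ 2 * θ ^ 24 * 2 ≤ 1 := by
        calc L ^ 2 * θ ^ 24 * 2 ≤ L ^ 2 * θ * L := by
              gcongr; exact pow_le_of_le_one hθ.le hθ1 (by norm_num)
          _ = L ^ 2 * L * θ := by ring
          _ ≤ L ^ 10 * θ := by gcongr
          _ ≤ 1 := hLθ
      linarith
    by_contra h
    have : (B.card : ℝ) ≤ 1 := by exact_mod_cast not_lt.1 h
    have : L ^ 2 * θ ^ 24 * B.card ≤ L ^ 2 * θ ^ 24 * 1 := by gcongr
    linarith
  obtain ⟨b₀, hb₀, b₀', hb₀', hne₀⟩ := Finset.one_lt_card.1 hB2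
  set Q : Set ℝ := {q | ∃ a ∈ B, ∃ a' ∈ B, ∃ b ∈ B, ∃ b' ∈ B, b ≠ b' ∧
    q = (a - a') / (b - b')} with hQ
  rcases exists_approx_or_gap Q ⟨b₀, hb₀, b₀, hb₀, b₀, hb₀, b₀', hb₀', hne₀, by simp⟩
    ⟨b₀, hb₀, b₀', hb₀', b₀, hb₀, b₀', hb₀', hne₀, by rw [div_self (sub_ne_zero.2 hne₀)]⟩
    (t := θ ^ 24) (by positivity) with h | h
  · obtain ⟨B₁, ρ, h1, h2, h3, h4⟩ := hΛ.coarse_dense hθ hθ1 hη hL hLθ hΛc hAne hAΛ hBΛ hBs (by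
      intro r hr
      obtain ⟨q, ⟨a, ha, a', ha', b, hb, b', hb', hne, rfl⟩, hq, hrq⟩ := h r hr
      exact ⟨a, ha, a', ha', b, hb, b', hb', hne, hq, hrq⟩)
    exact ⟨B₁, ρ, h1, h2, h3, h4⟩
  · obtain ⟨q, ⟨b₁, hb₁, b₂, hb₂, b₃, hb₃, b₄, hb₄, hne, rfl⟩, hq, r, hr, hgap⟩ := h
    have h0 : b₃ - b₄ ≠ 0 := sub_ne_zero.2 hne
    have hex : ∃ ν : ℝ, (ν = b₁ - b₂ ∨ ν = b₁ - b₂ + (b₃ - b₄)) ∧ r = ν / (2 * (b₃ - b₄)) := by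
      rcases hr with h | h
      · exact ⟨_, Or.inl rfl, by rw [h]; field_simp⟩
      · exact ⟨_, Or.inr rfl, by rw [h]; field_simp⟩
    obtain ⟨ν, hν, hrν⟩ := hex
    obtain ⟨B₁, ρ, h1, h2, h3, h4⟩ := hΛ.coarse_gap hθ hθ1 hη hL hLθ hAne hAΛ hBΛ hBs hBc
      hb₁ hb₂ hb₃ hb₄ hne hν (by
        have h1 : |ν / (2 * (b₃ - b₄))| ≤ 1 := by
          rw [← hrν, abs_le]
          rcases hr with h | h <;> rw [h] <;> constructor <;> linarith [hq.1, hq.2]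
        have h2 : 0 < |2 * (b₃ - b₄)| := abs_pos.2 (by simpa using h0)
        rwa [abs_div, div_le_one h2] at h1) (by
        intro a ha a' ha' b hb b' hb' hbb
        rw [← hrν]
        exact hgap _ ⟨a, ha, a', ha', b, hb, b', hb', hbb, rfl⟩)
    refine ⟨B₁, ρ, h1, h2, h3.trans ?_, h4⟩
    gcongr
    norm_num

end

section

variable {θ η L : ℝ} {S : Finset ℝ}

lemma NonConc.fine_two (hS : NonConc θ η L S) (c : ℝ) :
    ((S.filter fun s => |s - c| < 2 * η).card : ℝ) ≤ 2 * L := by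
  classical
  have hsub : (S.filter fun s => |s - c| < 2 * η) ⊆
      (S.filter fun s => |s - (c + η)| ≤ η) ∪ (S.filter fun s => |s - (c - η)| ≤ η) := by
    intro s hs
    simp only [Finset.mem_filter, Finset.mem_union, abs_le, abs_lt] at hs ⊢
    rcases le_total c s with h | h
    · left; exact ⟨hs.1, by constructor <;> linarith [hs.2.1, hs.2.2]⟩
    · right; exact ⟨hs.1, by constructor <;> linarith [hs.2.1, hs.2.2]⟩
  have h1 := hS.fine (c + η)
  have h2 := hS.fine (c - η)
  have h3 : ((S.filter fun s => |s - c| < 2 * η).card : ℝ) ≤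
      (S.filter fun s => |s - (c + η)| ≤ η).card + (S.filter fun s => |s - (c - η)| ≤ η).card := by
    exact_mod_cast (Finset.card_le_card hsub).trans (Finset.card_union_le _ _)
  linarith

lemma card_le_card_diffSet_one {A : Finset ℝ} : A.card ≤ (diffSet A 1).card := by
  classical
  rcases A.eq_empty_or_nonempty with rfl | ⟨a₀, h0⟩
  · simp
  refine Finset.card_le_card_of_injOn (fun a => a - a₀) (fun a ha => ?_) (fun a _ b _ h => by
    simpa using h)
  exact mem_diffSet_succ.2 ⟨0, by simp [diffSet], a, ha, a₀, h0, by ring⟩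

/-- The two alternatives of the fine scale argument both contradict slow growth of `A`. -/
lemma NonConc.fine_contra {A R : Finset ℝ} (hA : NonConc θ η L A) (hθ : 0 < θ) (hθ1 : θ ≤ 1)
    (hη : 0 < η) (hL : 2 ≤ L)
    (hgrow : ∀ k, ((diffSet A k).card : ℝ) ≤ L ^ (k + 1) * (θ ^ 1000 / η))
    (hR : R.Nonempty) (hRs : IsSep η R) {e : ℕ} {u κ W : ℝ} (he : 2 * e ≤ 1000)
    (hRc : L ^ 4 * 5 * (θ ^ 1000 / η) ≤ u * (θ ^ (2 * e) * R.card)) {j : ℕ}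
    (hupper : ∀ r ∈ R, ∃ μ ν w : ℝ, 0 ≤ w ∧ μ ≠ 0 ∧ Mult A η L j μ ∧ Mult A η L j ν ∧
      |r - ν / μ| ≤ w ∧ 1 / |μ| ≤ κ ∧ w ≤ W * η) :
    1 ≤ L ^ 2 * (2 * L * (L * θ ^ e) + u) *
      (L ^ (4 * j + 1) * (4 * L ^ j * κ + 2 * W * L + 1)) := by
  set N := θ ^ 1000 / η with hN
  have hN0 : 0 < N := by positivity
  have hL1 : 1 ≤ L := by linarith
  have hAc : (A.card : ℝ) ≤ L ^ 2 * N :=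
    le_trans (by exact_mod_cast card_le_card_diffSet_one) (hgrow 1)
  obtain ⟨r, hr, B, hB, hBs, hc⟩ := hA.exists_large_sum_dilate hθ hη hL (R := R) (τ := η)
    (Y := θ ^ (2 * e)) (u₁ := 2 * L) (u₂ := L * θ ^ e) (u₃ := u) hη (by positivity)
    (pow_le_one₀ hθ.le hθ1) hR hRs (by positivity) hA.fine_two (fun c => by
      have := hA.count (θ ^ (2 * e)) (pow_le_pow_of_le_one hθ.le hθ1 he)
        (pow_le_one₀ hθ.le hθ1) c
      have h8 : √(θ ^ (2 * e)) = θ ^ e := by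
        rw [mul_comm, pow_mul, Real.sqrt_sq (by positivity)]
      rwa [h8] at this) (by
      calc (A.card : ℝ) ^ 2 * 5 ≤ (L ^ 2 * N) ^ 2 * 5 := by gcongr
        _ = N * (L ^ 4 * 5 * N) := by ring
        _ ≤ N * (u * (θ ^ (2 * e) * R.card)) := by gcongr
        _ = _ := by ring)
  obtain ⟨μ, ν, w, hw, hμ0, hμ, hν, hrw, hμκ, hwW⟩ := hupper r hr
  have hμp : 0 < |μ| := abs_pos.2 hμ0
  have hup := Mult.card_sum_dilate_le hη hw hμ0 hA.bdd hμ hν hrw (by linarith) hB hBs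
  have h5 : 2 * ((2 * L ^ j * η + |μ| * w * L) / |μ|) / η + 1 ≤
      4 * L ^ j * κ + 2 * W * L + 1 := by
    have e1 : 2 * ((2 * L ^ j * η + |μ| * w * L) / |μ|) / η =
        4 * L ^ j * (1 / |μ|) + 2 * (w / η) * L := by field_simp; ring
    rw [e1]
    gcongr
    rwa [div_le_iff₀ hη]
  have hu : 0 ≤ u := by
    have h1 : 0 < L ^ 4 * 5 * N := by positivity
    by_contra! h
    have hR0 : (0 : ℝ) ≤ θ ^ (2 * e) * R.card := by positivity
    nlinarith
  have hX : 0 ≤ 2 * ((2 * L ^ j * η + |μ| * w * L) / |μ|) / η + 1 := by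
    have : 0 < L ^ j := by positivity
    positivity
  have : N * 1 ≤ N * (L ^ 2 * (2 * L * (L * θ ^ e) + u) *
      (L ^ (4 * j + 1) * (4 * L ^ j * κ + 2 * W * L + 1))) := by
    calc N * 1 = N := mul_one _
      _ ≤ L ^ 2 * (2 * L * (L * θ ^ e) + u) * B.card := hc
      _ ≤ L ^ 2 * (2 * L * (L * θ ^ e) + u) * (L ^ j * L ^ j * (L ^ (j + j + 1) * N) *
          (4 * L ^ j * κ + 2 * W * L + 1)) := by
          gcongr
          refine hup.trans ?_
          gcongr
          exact hgrow (j + j)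
      _ = _ := by ring
  exact le_of_mul_le_mul_left this hN0

/-- The dense case: every point of the unit interval is close to a quotient. -/
lemma NonConc.dense_contra {A S B : Finset ℝ} {ρ : ℝ} (hA : NonConc θ η L A) (hθ : 0 < θ)
    (hθ1 : θ ≤ 1) (hη : 0 < η) (hL : 2 ≤ L)
    (hgrow : ∀ k, ((diffSet A k).card : ℝ) ≤ L ^ (k + 1) * (θ ^ 1000 / η))
    (hsmall : ∀ a : ℕ, a + 1 ≤ 5 * multIdx 10 + 100 → L ^ a * θ < 1)
    (hS5 : ∀ u ∈ S, MultLvl A η L 5 u) (hBS : ∀ {b}, b ∈ B → b ∈ S) (hBs : IsSep ρ B)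
    (hρ1 : θ ^ 120 ≤ ρ) (hρle : ρ ≤ 1)
    (h : ∀ r ∈ Icc (0 : ℝ) 1, ∃ q ∈ {q : ℝ | ∃ a ∈ S, ∃ a' ∈ S, ∃ b ∈ B, ∃ b' ∈ B, b ≠ b' ∧
        q = (a - a') / (b - b')}, q ∈ Icc (0 : ℝ) 1 ∧ |r - q| ≤ 3 * (η / ρ)) : False := by
  classical
  set j := multIdx 10 with hj
  have hj8 : 8 ≤ j := multIdx_mono (by norm_num : 0 ≤ 10)
  have hL1 : 1 ≤ L := by linarith
  have hL0 : 0 < L := by linarith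
  have hAne := hA.nonempty hθ hη
  have hρ0 : 0 < ρ := lt_of_lt_of_le (by positivity) hρ1
  have hpow : ∀ {a b : ℕ}, a ≤ b → L ^ a ≤ L ^ b := fun h => pow_le_pow_right₀ hL1 h
  have hθpow : ∀ {a b : ℕ}, a ≤ b → θ ^ b ≤ θ ^ a := fun h => pow_le_pow_of_le_one hθ.le hθ1 h
  obtain ⟨R, hRne, hRs, hR01, hRc⟩ := exists_grid hη
  have := hA.fine_contra hθ hθ1 hη hL hgrow hRne hRs (e := 242) (u := L ^ 4 * 5 * θ ^ 500)
    (κ := 1 / ρ) (W := 3 / ρ) (by norm_num) (by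
      rw [div_le_iff₀ hη] at hRc
      rw [mul_div_assoc', div_le_iff₀ hη]
      calc L ^ 4 * 5 * θ ^ 1000 = L ^ 4 * 5 * θ ^ 984 * θ ^ 16 * 1 := by ring
        _ ≤ L ^ 4 * 5 * θ ^ 984 * 1 * (R.card * η) := by
            gcongr; exact pow_le_one₀ hθ.le hθ1
        _ = _ := by ring) (j := j) (by
      intro r hr
      obtain ⟨q, ⟨a, ha, a', ha', b, hb, b', hb', hne, rfl⟩, -, hrq⟩ := h r (hR01 r hr)
      have hm : ∀ {u v}, u ∈ S → v ∈ S → Mult A η L j (u - v) := fun hu hv =>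
        MultLvl.mono hη hL hAne (by norm_num : 6 ≤ 10)
          (MultLvl.sub hη hL hAne (hS5 _ hu) (hS5 _ hv))
      refine ⟨b - b', a - a', 3 * (η / ρ), by positivity, sub_ne_zero.2 hne,
        hm (hBS hb) (hBS hb'), hm ha ha', hrq, ?_, le_of_eq (by ring)⟩
      exact one_div_le_one_div_of_le hρ0 (hBs.le_abs_sub hb hb' hne))
  have h1 : L ^ 2 * (2 * L * (L * θ ^ 242) + L ^ 4 * 5 * θ ^ 500) ≤ L ^ 11 * θ ^ 242 := by
    have e1 : θ ^ 500 ≤ θ ^ 242 := hθpow (by norm_num)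
    have e2 : (2 : ℝ) ^ 3 ≤ L ^ 3 := pow_le_pow_left₀ (by norm_num) hL 3
    calc L ^ 2 * (2 * L * (L * θ ^ 242) + L ^ 4 * 5 * θ ^ 500)
        = (2 * L ^ 4) * θ ^ 242 + (5 * L ^ 6) * θ ^ 500 := by ring
      _ ≤ (2 * L ^ 6) * θ ^ 242 + (5 * L ^ 6) * θ ^ 242 := by
          gcongr ?_ * _ + _ * ?_
          gcongr 2 * ?_; exact hpow (by norm_num)
      _ = 7 * L ^ 6 * θ ^ 242 := by ring
      _ ≤ L ^ 3 * L ^ 6 * θ ^ 242 := by gcongr; linarith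
      _ = L ^ 9 * θ ^ 242 := by ring
      _ ≤ _ := by gcongr ?_ * _; exact hpow (by norm_num)
  have h2 : 4 * L ^ j * (1 / ρ) + 2 * (3 / ρ) * L + 1 ≤ L ^ (j + 4) / ρ := by
    rw [le_div_iff₀ hρ0]
    have e2 : (2 : ℝ) ^ 4 ≤ L ^ 4 := pow_le_pow_left₀ (by norm_num) hL 4
    have e3 : L ≤ L ^ j := by simpa using hpow (by omega : 1 ≤ j)
    calc (4 * L ^ j * (1 / ρ) + 2 * (3 / ρ) * L + 1) * ρ = 4 * L ^ j + 6 * L + ρ := by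
          field_simp; ring
      _ ≤ 4 * L ^ j + 6 * L ^ j + L ^ j := by linarith
      _ ≤ L ^ j * 2 ^ 4 := by linarith
      _ ≤ L ^ j * L ^ 4 := by gcongr
      _ = _ := by ring
  have h3 : 1 * ρ ≤ L ^ (5 * j + 16) * θ ^ 242 := by
    calc 1 * ρ ≤ (L ^ 11 * θ ^ 242) * (L ^ (4 * j + 1) * (L ^ (j + 4) / ρ)) * ρ := by
          gcongr
          refine this.trans ?_
          gcongr
      _ = _ := by field_simp; ring
  have h4 : θ ^ 120 ≤ (L ^ (5 * j + 16) * θ) * θ ^ 241 := by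
    calc θ ^ 120 ≤ 1 * ρ := by linarith
      _ ≤ _ := h3
      _ = _ := by ring
  have h5 := hsmall (5 * j + 16) (by omega)
  have h6 : (L ^ (5 * j + 16) * θ) * θ ^ 241 < 1 * θ ^ 120 := by
    refine mul_lt_mul h5 (hθpow (by norm_num)) (by positivity) (by norm_num)
  linarith

set_option maxHeartbeats 1000000 in
/-- If the quotients `(a - a') / (b - b')` leave a gap, then `Λ + μ Λ + ν B` contains a large
separated set, for suitable multipliers `μ`, `ν`. -/
lemma NonConc.exists_gap_set {A Λ B : Finset ℝ} {ρ : ℝ} (hΛ : NonConc θ η L Λ) (hθ : 0 < θ)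
    (hθ1 : θ ≤ 1) (hη : 0 < η) (hη1 : η ≤ 1) (hL : 2 ≤ L) (hAne : A.Nonempty)
    (hAΛ : ∀ l ∈ Λ, MultLvl A η L 0 l)
    (hB : ∀ u ∈ B, MultLvl A η L 5 u ∧ |u| ≤ L ^ 6) (hBs : IsSep ρ B)
    (hBc : 1 ≤ L ^ 20 * θ ^ 4 * √ρ * B.card) (hρ1 : θ ^ 120 ≤ ρ)
    (h : ∃ q ∈ {q : ℝ | ∃ a ∈ Λ ∪ B, ∃ a' ∈ Λ ∪ B, ∃ b ∈ B, ∃ b' ∈ B, b ≠ b' ∧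
        q = (a - a') / (b - b')}, q ∈ Icc (0 : ℝ) 1 ∧ ∃ r, (r = q / 2 ∨ r = (q + 1) / 2) ∧
        ∀ q' ∈ {q : ℝ | ∃ a ∈ Λ ∪ B, ∃ a' ∈ Λ ∪ B, ∃ b ∈ B, ∃ b' ∈ B, b ≠ b' ∧
        q = (a - a') / (b - b')}, η / ρ ≤ |r - q'|) :
    ∃ R : Finset ℝ, IsSep η R ∧ (∀ r ∈ R, MultLvl A η L 10 r) ∧
      θ ^ 1000 / η ≤ L ^ 40 * θ ^ 4 * R.card := by
  classical
  set N := θ ^ 1000 / η with hN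
  have hN0 : 0 < N := by positivity
  have hL1 : 1 ≤ L := by linarith
  have hL0 : 0 < L := by linarith
  have hρ0 : 0 < ρ := lt_of_lt_of_le (by positivity) hρ1
  have hpow : ∀ {a b : ℕ}, a ≤ b → L ^ a ≤ L ^ b := fun h => pow_le_pow_right₀ hL1 h
  have hΛ6 : ∀ l ∈ Λ, |l| ≤ L ^ 6 := fun l hl =>
    (hΛ.bdd l hl).trans (by simpa using hpow (by norm_num : 1 ≤ 6))
  have hS5 : ∀ u ∈ Λ ∪ B, MultLvl A η L 5 u := by
    intro u hu
    rcases Finset.mem_union.1 hu with h | h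
    · exact MultLvl.mono hη hL hAne (by norm_num) (hAΛ u h)
    · exact (hB u h).1
  have hBS : ∀ {b}, b ∈ B → b ∈ Λ ∪ B := fun h => Finset.mem_union_right _ h
  obtain ⟨q, ⟨a₁, ha₁, a₂, ha₂, b₃, hb₃, b₄, hb₄, hne, rfl⟩, hq, r, hr, hgap⟩ := h
  have h0 : b₃ - b₄ ≠ 0 := sub_ne_zero.2 hne
  set μ := 2 * (b₃ - b₄) with hμ
  have hμ0 : μ ≠ 0 := by simpa [hμ] using h0
  have hμp : 0 < |μ| := abs_pos.2 hμ0
  have hμρ : ρ ≤ |μ| := by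
    rw [hμ, abs_mul, abs_two]; linarith [hBs.le_abs_sub hb₃ hb₄ hne, abs_nonneg (b₃ - b₄)]
  have hBb : ∀ {b}, b ∈ B → |b| ≤ L ^ 6 := fun h => (hB _ h).2
  have h34 := abs_sub_le_of_abs_le (hBb hb₃) (hBb hb₄)
  have hμup : |μ| ≤ 4 * L ^ 6 := by rw [hμ, abs_mul, abs_two]; linarith
  have h1m := MultLvl.sub hη hL hAne (hS5 _ (hBS hb₃)) (hS5 _ (hBS hb₄))
  have h2m := MultLvl.sub hη hL hAne (hS5 _ ha₁) (hS5 _ ha₂)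
  have hμm : MultLvl A η L 7 μ := by rw [hμ, two_mul]; exact MultLvl.add hη hL hAne h1m h1m
  have hex : ∃ ν : ℝ, MultLvl A η L 7 ν ∧ r = ν / μ := by
    rcases hr with h | h
    · exact ⟨a₁ - a₂, MultLvl.mono hη hL hAne (by norm_num) h2m, by rw [h, hμ]; field_simp⟩
    · exact ⟨(a₁ - a₂) + (b₃ - b₄), MultLvl.add hη hL hAne h2m h1m, by rw [h, hμ]; field_simp⟩
  obtain ⟨ν, hνm, hrν⟩ := hex
  have hr1 : |r| ≤ 1 := by
    rw [abs_le]
    rcases hr with h | h <;> rw [h] <;> constructor <;> linarith [hq.1, hq.2]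
  obtain ⟨M, hMΛ, hMs, hMc⟩ := hΛ.exists_sep hθ hη hL (y := L ^ 9 * |μ|) (by
    have : θ ^ 1000 ≤ θ ^ 120 := pow_le_pow_of_le_one hθ.le hθ1 (by norm_num)
    have : (1 : ℝ) ≤ L ^ 9 := one_le_pow₀ hL1
    nlinarith)
  set I := M ×ˢ (Λ ×ˢ B) with hI
  set φ : ℝ × (ℝ × ℝ) → ℝ := fun p => p.1 + (μ * p.2.1 + ν * p.2.2) with hφ
  have hνr : ν = μ * r := by rw [hrν]; field_simp
  have hdiff : ∀ p ∈ I, ∀ p' ∈ I, |φ p - φ p'| < |μ| * η → |μ| * η ≤ |μ| →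
      p.1 = p'.1 ∧ p.2.2 = p'.2.2 ∧ |p.2.1 - p'.2.1| ≤ η := by
    rintro ⟨l, a, b⟩ hp ⟨l', a', b'⟩ hp' hlt hη1
    simp only [hI, Finset.mem_product] at hp hp'
    simp only [hφ] at hlt ⊢
    have e0 : l + (μ * a + ν * b) - (l' + (μ * a' + ν * b')) =
        (l - l') - -(μ * ((a - a') + r * (b - b'))) := by rw [hνr]; ring
    have e1 : |(a - a') + r * (b - b')| ≤ 4 * L ^ 6 := by
      refine (abs_add_le _ _).trans ?_
      have h1 := abs_sub_le_of_abs_le (hΛ6 _ hp.2.1) (hΛ6 _ hp'.2.1)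
      have h2 := abs_sub_le_of_abs_le (hBb hp.2.2) (hBb hp'.2.2)
      have h3 : |r * (b - b')| ≤ 1 * |b - b'| := by rw [abs_mul]; gcongr
      linarith
    have hll : l = l' := by
      by_contra hll
      have h1 := hMs.le_abs_sub hp.1 hp'.1 hll
      rw [e0] at hlt
      have h2 := abs_sub_abs_le_abs_sub (l - l') (-(μ * ((a - a') + r * (b - b'))))
      rw [abs_neg, abs_mul] at h2
      have h3 : |μ| * |(a - a') + r * (b - b')| ≤ |μ| * (4 * L ^ 6) := by gcongr
      have h4 : 8 * L ^ 6 ≤ L ^ 9 := by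
        have := pow_le_pow_left₀ (by norm_num) hL 3
        have h6 : (0 : ℝ) ≤ L ^ 6 := by positivity
        nlinarith
      have h5 : (1 : ℝ) ≤ L ^ 6 := one_le_pow₀ hL1
      have h7 : |μ| * (4 * L ^ 6) + |μ| * 1 ≤ L ^ 9 * |μ| := by nlinarith
      linarith
    subst hll
    rw [e0, sub_self, zero_sub, neg_neg, abs_mul] at hlt
    have e2 := lt_of_mul_lt_mul_left hlt hμp.le
    by_cases hbb : b = b'
    · subst hbb
      refine ⟨rfl, rfl, ?_⟩
      simp only [sub_self, mul_zero, add_zero] at e2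
      exact e2.le
    · exfalso
      have h1 := hBs.le_abs_sub hp.2.2 hp'.2.2 hbb
      have h2 := hgap _ ⟨a', Finset.mem_union_left _ hp'.2.1, a, Finset.mem_union_left _ hp.2.1,
        b, hp.2.2, b', hp'.2.2, hbb, rfl⟩
      have h3 : b - b' ≠ 0 := sub_ne_zero.2 hbb
      have h4 : (a - a') + r * (b - b') = (r - (a' - a) / (b - b')) * (b - b') := by
        field_simp; ring
      rw [h4, abs_mul] at e2
      have : η / ρ * ρ ≤ |r - (a' - a) / (b - b')| * |b - b'| := by gcongr
      rw [div_mul_cancel₀ _ hρ0.ne'] at this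
      linarith
  obtain ⟨B', hB', hB's, hB'c⟩ := exists_sep_card I φ (x := |μ| * η / 2) (m := L)
    (by positivity) (by
      intro c
      rcases (I.filter fun i => |φ i - c| < |μ| * η / 2).eq_empty_or_nonempty with h | ⟨p₀, hp₀⟩
      · rw [h]; simp; linarith
      · rw [Finset.mem_filter] at hp₀
        refine le_trans ?_ (hΛ.fine p₀.2.1)
        have : (I.filter fun i => |φ i - c| < |μ| * η / 2).card ≤
            (Λ.filter fun s => |s - p₀.2.1| ≤ η).card := by
          have key : ∀ p ∈ I.filter (fun i => |φ i - c| < |μ| * η / 2),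
              p.1 = p₀.1 ∧ p.2.2 = p₀.2.2 ∧ |p.2.1 - p₀.2.1| ≤ η := by
            intro p hp
            rw [Finset.mem_filter] at hp
            refine hdiff p hp.1 p₀ hp₀.1 ?_ (by nlinarith)
            have e1 := abs_lt.1 hp.2
            have e2 := abs_lt.1 hp₀.2
            rw [abs_lt]; constructor <;> linarith [e1.1, e1.2, e2.1, e2.2]
          refine Finset.card_le_card_of_injOn (fun p => p.2.1) ?_ ?_
          · intro p hp
            have hp1 := (Finset.mem_filter.1 hp).1
            simp only [hI, Finset.mem_product] at hp1
            exact Finset.mem_filter.2 ⟨hp1.2.1, (key p hp).2.2⟩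
          · intro p hp p' hp' hpp
            have k1 := key p hp
            have k2 := key p' hp'
            exact Prod.ext (k1.1.trans k2.1.symm) (Prod.ext hpp (k1.2.1.trans k2.2.1.symm))
        exact_mod_cast this)
  obtain ⟨R, hR, hRs, hRc⟩ := exists_sep_card B' id (x := η) (m := L ^ 10 / |μ|) hη (by
    intro c
    refine (sep_card_le (x := |μ| * η / 2) (c := c) (h := η) (by positivity) hη.le
      (fun a ha b hb => hB's a (Finset.mem_filter.1 ha).1 b (Finset.mem_filter.1 hb).1)
      (fun b hb => ((Finset.mem_filter.1 hb).2).le)).trans ?_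
    rw [le_div_iff₀ hμp]
    have e2 : (2 : ℝ) ^ 4 ≤ L ^ 4 := pow_le_pow_left₀ (by norm_num) hL 4
    have h5 : (1 : ℝ) ≤ L ^ 6 := one_le_pow₀ hL1
    calc (2 * η / (|μ| * η / 2) + 1) * |μ| = 4 + |μ| := by field_simp; ring
      _ ≤ L ^ 6 * 2 ^ 4 := by linarith
      _ ≤ L ^ 6 * L ^ 4 := by gcongr
      _ = _ := by ring)
  rw [Finset.image_id] at hR
  have hlow : N ≤ L * Λ.card := hΛ.lower
  have hIc : N ≤ L ^ 40 * θ ^ 4 * R.card := by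
    clear_value N
    clear hN hdiff hrν hνr
    have e1 : √(L ^ 9 * |μ|) ≤ L ^ 5 * √|μ| := by
      rw [Real.sqrt_mul (by positivity)]
      gcongr
      refine Real.sqrt_le_iff.2 ⟨by positivity, ?_⟩
      rw [← pow_mul]; exact hpow (by norm_num)
    have e2 : √|μ| * √ρ ≤ |μ| := by
      calc √|μ| * √ρ ≤ √|μ| * √|μ| := by gcongr
        _ = |μ| := Real.mul_self_sqrt hμp.le
    calc N = 1 * (N * 1) := by ring
      _ ≤ (L ^ 2 * √(L ^ 9 * |μ|) * M.card) *
          ((L * Λ.card) * (L ^ 20 * θ ^ 4 * √ρ * B.card)) := by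
          gcongr
      _ ≤ (L ^ 2 * (L ^ 5 * √|μ|) * M.card) *
          ((L * Λ.card) * (L ^ 20 * θ ^ 4 * √ρ * B.card)) := by gcongr
      _ = L ^ 28 * θ ^ 4 * (√|μ| * √ρ) * (I.card : ℝ) := by
          rw [hI, Finset.card_product, Finset.card_product]; push_cast; ring
      _ ≤ L ^ 28 * θ ^ 4 * |μ| * (R.card * (L ^ 10 / |μ|) * L) := by
          gcongr
          exact hB'c.trans (by gcongr)
      _ = L ^ 39 * θ ^ 4 * R.card * (|μ| / |μ|) := by ring
      _ = L ^ 39 * θ ^ 4 * R.card := by rw [div_self hμp.ne', mul_one]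
      _ ≤ _ := by
          refine mul_le_mul_of_nonneg_right (mul_le_mul_of_nonneg_right ?_ (by positivity))
              (by positivity)
          exact pow_le_pow_right₀ hL1 (by norm_num)
  refine ⟨R, hRs, fun x hx => ?_, hIc⟩
  obtain ⟨⟨l, a, b⟩, hp, rfl⟩ := Finset.mem_image.1 (hB' (hR hx))
  simp only [hI, Finset.mem_product] at hp
  refine MultLvl.add hη hL hAne
    (MultLvl.mono hη hL hAne (by norm_num) (hAΛ _ (hMΛ hp.1)))
    (MultLvl.add hη hL hAne ?_ ?_)
  · exact MultLvl.mul hη hL hAne hμm (MultLvl.mono hη hL hAne (by norm_num) (hAΛ _ hp.2.1))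
  · exact MultLvl.mul hη hL hAne hνm
      (MultLvl.mono hη hL hAne (by norm_num) (hB _ hp.2.2).1)

/-- The gap case. -/
lemma NonConc.gap_contra {A R : Finset ℝ} (hA : NonConc θ η L A) (hθ : 0 < θ)
    (hθ1 : θ ≤ 1) (hη : 0 < η) (hL : 2 ≤ L)
    (hgrow : ∀ k, ((diffSet A k).card : ℝ) ≤ L ^ (k + 1) * (θ ^ 1000 / η))
    (hsmall : ∀ a : ℕ, a + 1 ≤ 5 * multIdx 10 + 100 → L ^ a * θ < 1)
    (hRs : IsSep η R) (hRm : ∀ r ∈ R, MultLvl A η L 10 r)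
    (hIc : θ ^ 1000 / η ≤ L ^ 40 * θ ^ 4 * R.card) : False := by
  classical
  set j := multIdx 10 with hj
  have hj8 : 8 ≤ j := multIdx_mono (by norm_num : 0 ≤ 10)
  have hL1 : 1 ≤ L := by linarith
  have hL0 : 0 < L := by linarith
  have hAne := hA.nonempty hθ hη
  have hpow : ∀ {a b : ℕ}, a ≤ b → L ^ a ≤ L ^ b := fun h => pow_le_pow_right₀ hL1 h
  set N := θ ^ 1000 / η with hN
  have hN0 : 0 < N := by positivity
  have hRne : R.Nonempty := by
    by_contra hcon
    rw [Finset.not_nonempty_iff_eq_empty] at hcon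
    rw [hcon] at hIc; simp at hIc; linarith
  have := hA.fine_contra hθ hθ1 hη hL hgrow hRne hRs (e := 1) (u := L ^ 44 * 5 * θ ^ 2)
    (κ := 1) (W := 0) (by norm_num) (by
      calc L ^ 4 * 5 * N ≤ L ^ 4 * 5 * (L ^ 40 * θ ^ 4 * R.card) := by gcongr
        _ = _ := by ring) (j := j) (by
      intro x hx
      exact ⟨1, x, 0, le_rfl, one_ne_zero, Mult.one hη hL hAne (by omega), hRm x hx,
        by rw [div_one, sub_self, abs_zero], by simp, by simp⟩)
  have e3 : (2 : ℝ) ^ 3 ≤ L ^ 3 := pow_le_pow_left₀ (by norm_num) hL 3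
  have h1 : L ^ 2 * (2 * L * (L * θ ^ 1) + L ^ 44 * 5 * θ ^ 2) ≤ L ^ 49 * θ := by
    have e1 : θ ^ 2 ≤ θ := pow_le_of_le_one hθ.le hθ1 (by norm_num)
    calc L ^ 2 * (2 * L * (L * θ ^ 1) + L ^ 44 * 5 * θ ^ 2)
        = (2 * L ^ 4) * θ + (5 * L ^ 46) * θ ^ 2 := by ring
      _ ≤ (2 * L ^ 46) * θ + (5 * L ^ 46) * θ := by
          gcongr ?_ * _ + _ * ?_
          gcongr 2 * ?_; exact hpow (by norm_num)
      _ = 7 * L ^ 46 * θ := by ring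
      _ ≤ L ^ 3 * L ^ 46 * θ := by gcongr; linarith
      _ = _ := by ring
  have h2 : 4 * L ^ j * 1 + 2 * 0 * L + 1 ≤ L ^ (j + 3) := by
    have : (1 : ℝ) ≤ L ^ j := one_le_pow₀ hL1
    calc 4 * L ^ j * 1 + 2 * 0 * L + 1 ≤ L ^ j * 2 ^ 3 := by linarith
      _ ≤ L ^ j * L ^ 3 := by gcongr
      _ = _ := by ring
  have h3 := hsmall (5 * j + 53) (by omega)
  have h4 : 1 ≤ L ^ (5 * j + 53) * θ := by
    calc 1 ≤ _ := this
      _ ≤ (L ^ 49 * θ) * (L ^ (4 * j + 1) * L ^ (j + 3)) := by gcongr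
      _ = _ := by ring
  linarith

/-- A discretized sum-product statement: a `1/2`-dimensional set `A` with small iterated sumsets
cannot be approximately preserved by a `1/2`-dimensional set of scalars. -/
theorem ring_contra : ∃ n₀ : ℕ, ∀ (θ η L : ℝ) (A Λ : Finset ℝ), 0 < θ → θ ≤ 1 →
    0 < η → η ≤ 1 → 2 ≤ L →
    L ^ n₀ * θ ≤ 1 → NonConc θ η L A → NonConc θ η L Λ →
    (∀ k, ((diffSet A k).card : ℝ) ≤ L ^ (k + 1) * (θ ^ 1000 / η)) →
    (Λ.card : ℝ) ≤ L ^ 3 * (θ ^ 1000 / η) →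
    (∀ l ∈ Λ, MultLvl A η L 0 l) → False := by
  classical
  refine ⟨5 * multIdx 10 + 100, ?_⟩
  intro θ η L A Λ hθ hθ1 hη hη1 hL hLθ hA hΛ hgrow hΛc hAΛ
  set j := multIdx 10 with hj
  have hj8 : 8 ≤ j := multIdx_mono (by norm_num : 0 ≤ 10)
  have hL1 : 1 ≤ L := by linarith
  have hL0 : 0 < L := by linarith
  have hAne := hA.nonempty hθ hη
  set N := θ ^ 1000 / η with hN
  have hN0 : 0 < N := by positivity
  have hpow : ∀ {a b : ℕ}, a ≤ b → L ^ a ≤ L ^ b := fun h => pow_le_pow_right₀ hL1 h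
  have hθpow : ∀ {a b : ℕ}, a ≤ b → θ ^ b ≤ θ ^ a := fun h => pow_le_pow_of_le_one hθ.le hθ1 h
  have hsmall : ∀ a : ℕ, a + 1 ≤ 5 * j + 100 → L ^ a * θ < 1 := by
    intro a ha
    have h1 : L ^ a * θ * 2 ≤ 1 := by
      calc L ^ a * θ * 2 ≤ L ^ a * θ * L := by gcongr
        _ = L ^ (a + 1) * θ := by ring
        _ ≤ L ^ (5 * j + 100) * θ := by gcongr
        _ ≤ 1 := hLθ
    have : 0 < L ^ a * θ := by positivity
    linarith
  obtain ⟨B, ρ, hB, hBs, hBc, hρ1, hρ2⟩ := hΛ.coarse hθ hθ1 hη hL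
    (hsmall 10 (by omega)).le hΛc hAne hAΛ
  have hρ0 : 0 < ρ := lt_of_lt_of_le (by positivity) hρ1
  have hρle : ρ ≤ 1 := hρ2.trans (pow_le_one₀ hθ.le hθ1)
  have hB2 : 1 < B.card := by
    by_contra h
    have h1 : (B.card : ℝ) ≤ 1 := by exact_mod_cast not_lt.1 h
    have h2 : √ρ ≤ 1 := Real.sqrt_le_one.2 hρle
    have h3 : L ^ 20 * θ ^ 4 * √ρ * B.card ≤ L ^ 20 * θ * 1 * 1 := by
      gcongr
      exact pow_le_of_le_one hθ.le hθ1 (by norm_num)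
    have := hsmall 20 (by omega)
    linarith
  obtain ⟨b₀, hb₀, b₀', hb₀', hne₀⟩ := Finset.one_lt_card.1 hB2
  have hΛ6 : ∀ l ∈ Λ, |l| ≤ L ^ 6 := fun l hl =>
    (hΛ.bdd l hl).trans (by simpa using hpow (by norm_num : 1 ≤ 6))
  have hS5 : ∀ u ∈ Λ ∪ B, MultLvl A η L 5 u := by
    intro u hu
    rcases Finset.mem_union.1 hu with h | h
    · exact MultLvl.mono hη hL hAne (by norm_num) (hAΛ u h)
    · exact (hB u h).1
  set Q : Set ℝ := {q | ∃ a ∈ Λ ∪ B, ∃ a' ∈ Λ ∪ B, ∃ b ∈ B, ∃ b' ∈ B, b ≠ b' ∧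
    q = (a - a') / (b - b')} with hQ
  have hBS : ∀ {b}, b ∈ B → b ∈ Λ ∪ B := fun h => Finset.mem_union_right _ h
  rcases exists_approx_or_gap Q
    ⟨b₀, hBS hb₀, b₀, hBS hb₀, b₀, hb₀, b₀', hb₀', hne₀, by simp⟩
    ⟨b₀, hBS hb₀, b₀', hBS hb₀', b₀, hb₀, b₀', hb₀', hne₀, by rw [div_self (sub_ne_zero.2 hne₀)]⟩
    (t := η / ρ) (by positivity) with h | h
  · exact hA.dense_contra hθ hθ1 hη hL hgrow hsmall hS5 hBS hBs hρ1 hρle h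
  · obtain ⟨R, hRs, hRm, hRc⟩ := hΛ.exists_gap_set hθ hθ1 hη hη1 hL hAne hAΛ hB hBs hBc hρ1 h
    exact hA.gap_contra hθ hθ1 hη hL hgrow hsmall hRs hRm hRc

end

lemma sum_le_popular {ι : Type*} (S : Finset ι) (f : ι → ℝ) {M τ : ℝ} (hM : ∀ i ∈ S, f i ≤ M)
    (hτ : 0 ≤ τ) :
    ∑ i ∈ S, f i ≤ M * (S.filter fun i => τ ≤ f i).card + τ * S.card := by
  rw [← Finset.sum_filter_add_sum_filter_not S fun i => τ ≤ f i]
  gcongr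
  · rw [mul_comm, ← nsmul_eq_mul]
    exact Finset.sum_le_card_nsmul _ _ _ fun i hi => hM i (Finset.mem_filter.1 hi).1
  · calc ∑ i ∈ S.filter fun i => ¬ τ ≤ f i, f i ≤ ∑ i ∈ S.filter fun i => ¬ τ ≤ f i, τ :=
          Finset.sum_le_sum fun i hi => (not_le.1 (Finset.mem_filter.1 hi).2).le
      _ = τ * (S.filter fun i => ¬ τ ≤ f i).card := by simp [mul_comm]
      _ ≤ _ := by gcongr; exact Finset.filter_subset _ _

set_option maxHeartbeats 1000000 in
/-- The Balog–Szemerédi–Gowers path counting lemma. -/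
lemma exists_many_paths {α β : Type*} [DecidableEq α] [DecidableEq β] {U : Finset α}
    {V : Finset β} {Γ : Finset (α × β)} (hΓ : Γ ⊆ U ×ˢ V) {K : ℝ} (hK : 2 ≤ K) (hne : Γ.Nonempty)
    (h : (U.card : ℝ) * V.card ≤ K * Γ.card) :
    ∃ U' ⊆ U, ∃ V' ⊆ V, (U.card : ℝ) ≤ K ^ 4 * U'.card ∧ (V.card : ℝ) ≤ K ^ 4 * V'.card ∧
      ∀ u ∈ U', ∀ v ∈ V', (U.card : ℝ) * V.card ≤ K ^ 17 *
        ((U ×ˢ V).filter fun q => (u, q.2) ∈ Γ ∧ (q.1, q.2) ∈ Γ ∧ (q.1, v) ∈ Γ).card := by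
  classical
  obtain ⟨⟨x₀, y₀⟩, hxy⟩ := hne
  have hxy' := Finset.mem_product.1 (hΓ hxy)
  have hn : (0 : ℝ) < U.card := by exact_mod_cast Finset.card_pos.2 ⟨_, hxy'.1⟩
  have hm : (0 : ℝ) < V.card := by exact_mod_cast Finset.card_pos.2 ⟨_, hxy'.2⟩
  set n : ℝ := (U.card : ℝ) with hn'
  set m : ℝ := (V.card : ℝ) with hm'
  have hK0 : 0 < K := by linarith
  set g : α → β → ℝ := fun u v => if (u, v) ∈ Γ then 1 else 0 with hg
  have hg0 : ∀ u v, 0 ≤ g u v := fun u v => by simp only [hg]; split_ifs <;> norm_num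
  have hg1 : ∀ u v, g u v ≤ 1 := fun u v => by simp only [hg]; split_ifs <;> norm_num
  set deg : α → ℝ := fun u => ∑ v ∈ V, g u v with hdeg
  have hdegm : ∀ u, deg u ≤ m := fun u => by
    calc deg u ≤ ∑ v ∈ V, (1 : ℝ) := Finset.sum_le_sum fun v _ => hg1 u v
      _ = m := by simp [hm']
  have hΓc : ∑ u ∈ U, deg u = Γ.card := by
    simp only [hdeg, hg]
    rw [← Finset.sum_product' U V (fun u v => if (u, v) ∈ Γ then (1 : ℝ) else 0), Finset.sum_boole,
      Finset.filter_mem_eq_inter, Finset.inter_eq_right.2 hΓ]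
  set U₀ := U.filter fun u => m / (2 * K) ≤ deg u with hU₀
  have hU₀U : U₀ ⊆ U := Finset.filter_subset _ _
  have he : n * m / (2 * K) ≤ ∑ u ∈ U₀, deg u := by
    have h1 := Finset.sum_filter_add_sum_filter_not U (fun u => m / (2 * K) ≤ deg u) deg
    have h2 : ∑ u ∈ U.filter (fun u => ¬ m / (2 * K) ≤ deg u), deg u ≤ n * (m / (2 * K)) := by
      calc _ ≤ ∑ u ∈ U.filter (fun u => ¬ m / (2 * K) ≤ deg u), m / (2 * K) :=
            Finset.sum_le_sum fun u hu => (not_le.1 (Finset.mem_filter.1 hu).2).le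
        _ = (U.filter (fun u => ¬ m / (2 * K) ≤ deg u)).card * (m / (2 * K)) := by simp
        _ ≤ _ := by
            rw [hn']
            gcongr
            exact Finset.filter_subset _ _
    have h3 : n * m / K ≤ Γ.card := by rw [div_le_iff₀ hK0]; linarith
    have h4 : n * m / K = n * m / (2 * K) + n * (m / (2 * K)) := by field_simp; ring
    rw [hU₀]
    linarith
  set cod : α → α → ℝ := fun u u' => ∑ v ∈ V, g u v * g u' v with hcod
  set τ : ℝ := 1 / (128 * K ^ 3) with hτ
  have hτ0 : 0 < τ := by positivity
  set bad : Finset (α × α) := (U₀ ×ˢ U₀).filter fun p => cod p.1 p.2 < τ * m with hbad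
  set s : β → ℝ := fun v => ∑ u ∈ U₀, g u v with hs
  set bd : β → ℝ := fun v => ∑ p ∈ bad, g p.1 v * g p.2 v with hbd
  have hs1 : ∑ v ∈ V, s v = ∑ u ∈ U₀, deg u := Finset.sum_comm
  have hs2 : (∑ v ∈ V, s v) ^ 2 ≤ m * ∑ v ∈ V, s v ^ 2 := sq_sum_le_card_mul_sum_sq
  have hb1 : ∑ v ∈ V, bd v ≤ n ^ 2 * (τ * m) := by
    calc ∑ v ∈ V, bd v = ∑ p ∈ bad, cod p.1 p.2 := Finset.sum_comm
      _ ≤ ∑ p ∈ bad, τ * m := Finset.sum_le_sum fun p hp => (Finset.mem_filter.1 hp).2.le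
      _ = bad.card * (τ * m) := by simp
      _ ≤ n ^ 2 * (τ * m) := by
          gcongr
          have : bad.card ≤ U.card * U.card := by
            calc bad.card ≤ (U₀ ×ˢ U₀).card := Finset.card_filter_le _ _
              _ = U₀.card * U₀.card := Finset.card_product _ _
              _ ≤ _ := by gcongr
          rw [sq, hn']; exact_mod_cast this
  obtain ⟨v₀, -, hv₀⟩ : ∃ v ∈ V, n ^ 2 / (8 * K ^ 2) ≤ s v ^ 2 - 16 * K * bd v := by
    refine Finset.exists_le_of_sum_le ⟨y₀, hxy'.2⟩ ?_
    rw [Finset.sum_sub_distrib, ← Finset.mul_sum, Finset.sum_const, nsmul_eq_mul, ← hm']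
    have h1 : n ^ 2 * m / (4 * K ^ 2) ≤ ∑ v ∈ V, s v ^ 2 := by
      have h2 : (n * m / (2 * K)) ^ 2 ≤ m * ∑ v ∈ V, s v ^ 2 := by
        rw [hs1] at hs2
        exact le_trans (by gcongr) hs2
      have h3 : (n * m / (2 * K)) ^ 2 = m * (n ^ 2 * m / (4 * K ^ 2)) := by field_simp; ring
      rw [h3] at h2
      exact le_of_mul_le_mul_left h2 hm
    have h4 : 16 * K * ∑ v ∈ V, bd v ≤ n ^ 2 * m / (8 * K ^ 2) := by
      calc _ ≤ 16 * K * (n ^ 2 * (τ * m)) := by gcongr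
        _ = _ := by rw [hτ]; field_simp; ring
    have h5 : n ^ 2 * m / (4 * K ^ 2) - n ^ 2 * m / (8 * K ^ 2) = m * (n ^ 2 / (8 * K ^ 2)) := by
      field_simp; ring
    linarith
  set U₁ := U₀.filter fun u => (u, v₀) ∈ Γ with hU₁
  have hU₁U : U₁ ⊆ U := (Finset.filter_subset _ _).trans hU₀U
  have hU₁c : s v₀ = U₁.card := by simp only [hs, hg, hU₁]; exact Finset.sum_boole _ _
  set N₁ : ℝ := (U₁.card : ℝ) with hN₁
  set bc : α → ℝ := fun u => (U₁.filter fun u' => cod u u' < τ * m).card with hbc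
  have hbdc : bd v₀ = ∑ u ∈ U₁, bc u := by
    have h1 : ∀ u ∈ U₁, bc u = ∑ u' ∈ U₁, if cod u u' < τ * m then (1 : ℝ) else 0 := fun u _ => by
      rw [Finset.sum_boole]
    rw [Finset.sum_congr rfl h1, ← Finset.sum_product'
      U₁ U₁ (fun u u' => if cod u u' < τ * m then (1 : ℝ) else 0), Finset.sum_boole]
    have h2 : bd v₀ = ∑ p ∈ bad, if (p.1, v₀) ∈ Γ ∧ (p.2, v₀) ∈ Γ then (1 : ℝ) else 0 := by
      refine Finset.sum_congr rfl fun p _ => ?_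
      simp only [hg]
      by_cases h1 : (p.1, v₀) ∈ Γ <;> by_cases h2 : (p.2, v₀) ∈ Γ <;> simp [h1, h2]
    rw [h2, Finset.sum_boole]
    congr 2
    ext p
    simp only [hbad, hU₁, Finset.mem_filter, Finset.mem_product]
    tauto
  have hbd0 : 0 ≤ bd v₀ := by rw [hbdc]; exact Finset.sum_nonneg fun u _ => by simp [hbc]
  rw [hU₁c] at hv₀
  have hN₁n : n ≤ 3 * K * N₁ := by
    have h1 : n ^ 2 / (8 * K ^ 2) ≤ N₁ ^ 2 := by nlinarith
    rw [div_le_iff₀ (by positivity)] at h1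
    refine (sq_le_sq₀ hn.le (by positivity)).1 (h1.trans ?_)
    nlinarith [sq_nonneg (K * N₁)]
  have hN₁0 : 0 < N₁ := by
    by_contra! hc
    have : 3 * K * N₁ ≤ 0 := mul_nonpos_of_nonneg_of_nonpos (by positivity) hc
    linarith
  have hbdN : 16 * K * bd v₀ ≤ N₁ ^ 2 := by
    have : 0 ≤ n ^ 2 / (8 * K ^ 2) := by positivity
    linarith
  set U₂ := U₁.filter fun u => 8 * K * bc u ≤ N₁ with hU₂
  have hU₂c : N₁ ≤ 2 * U₂.card := by
    have h1 : (U₁.filter fun u => ¬ 8 * K * bc u ≤ N₁).card * N₁ ≤ 8 * K * bd v₀ := by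
      rw [hbdc, Finset.mul_sum]
      calc _ = ∑ u ∈ U₁.filter (fun u => ¬ 8 * K * bc u ≤ N₁), N₁ := by simp
        _ ≤ ∑ u ∈ U₁.filter (fun u => ¬ 8 * K * bc u ≤ N₁), 8 * K * bc u :=
            Finset.sum_le_sum fun u hu => (not_le.1 (Finset.mem_filter.1 hu).2).le
        _ ≤ _ := Finset.sum_le_sum_of_subset_of_nonneg (Finset.filter_subset _ _)
            fun u _ _ => by positivity
    have h2 : (U₂.card : ℝ) + (U₁.filter fun u => ¬ 8 * K * bc u ≤ N₁).card = N₁ := by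
      rw [hU₂, hN₁]; exact_mod_cast Finset.card_filter_add_card_filter_not _
    have h3 : (U₁.filter fun u => ¬ 8 * K * bc u ≤ N₁).card * N₁ ≤ N₁ / 2 * N₁ := by linarith
    linarith [le_of_mul_le_mul_right h3 hN₁0]
  set s₁ : β → ℝ := fun v => ∑ u ∈ U₁, g u v with hs₁
  set V' := V.filter fun v => N₁ / (4 * K) ≤ s₁ v with hV'
  have hV'c : m ≤ 4 * K * V'.card := by
    have h1 : ∑ v ∈ V, s₁ v = ∑ u ∈ U₁, deg u := Finset.sum_comm
    have h2 : N₁ * (m / (2 * K)) ≤ ∑ u ∈ U₁, deg u := by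
      rw [hN₁, ← nsmul_eq_mul]
      exact Finset.card_nsmul_le_sum _ _ _ fun u hu =>
        (Finset.mem_filter.1 (Finset.mem_filter.1 hu).1).2
    have h3 := sum_le_popular V s₁ (M := N₁) (τ := N₁ / (4 * K)) (fun v _ => by
      calc s₁ v ≤ ∑ u ∈ U₁, (1 : ℝ) := Finset.sum_le_sum fun u _ => hg1 u v
        _ = N₁ := by simp [hN₁]) (by positivity)
    rw [← hV', h1, ← hm'] at h3
    have h4 : N₁ * (m / (2 * K)) - N₁ / (4 * K) * m = N₁ * (m / (4 * K)) := by field_simp; ring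
    have h5 : N₁ * (m / (4 * K)) ≤ N₁ * V'.card := by linarith
    have h6 := le_of_mul_le_mul_left h5 hN₁0
    rw [div_le_iff₀ (by positivity)] at h6
    linarith
  have hK3 : (2 : ℝ) ^ 3 ≤ K ^ 3 := pow_le_pow_left₀ (by norm_num) hK 3
  refine ⟨U₂, (Finset.filter_subset _ _).trans hU₁U, V', Finset.filter_subset _ _, ?_, ?_, ?_⟩
  · calc n ≤ 3 * K * (2 * U₂.card) := hN₁n.trans (by gcongr)
      _ = 6 * K * U₂.card := by ring
      _ ≤ K ^ 3 * K * U₂.card := by gcongr; linarith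
      _ = _ := by ring
  · calc m ≤ 4 * K * V'.card := hV'c
      _ ≤ K ^ 3 * K * V'.card := by gcongr; linarith
      _ = _ := by ring
  · intro u hu v hv
    set G := U₁.filter fun u' => (u', v) ∈ Γ ∧ τ * m ≤ cod u u' with hG
    have hGc : N₁ / (8 * K) ≤ G.card := by
      have h1 : N₁ / (4 * K) ≤ (U₁.filter fun u' => (u', v) ∈ Γ).card := by
        have := (Finset.mem_filter.1 hv).2
        simp only [hs₁, hg] at this
        rwa [Finset.sum_boole] at this
      have h2 : bc u ≤ N₁ / (8 * K) := by
        rw [le_div_iff₀ (by positivity)]; linarith [(Finset.mem_filter.1 hu).2]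
      have h3 : ((U₁.filter fun u' => (u', v) ∈ Γ).card : ℝ) ≤ G.card + bc u := by
        have : (U₁.filter fun u' => (u', v) ∈ Γ) ⊆ G ∪ U₁.filter fun u' => cod u u' < τ * m := by
          intro w hw
          simp only [hG, Finset.mem_union, Finset.mem_filter] at hw ⊢
          rcases le_or_gt (τ * m) (cod u w) with h | h
          · exact Or.inl ⟨hw.1, hw.2, h⟩
          · exact Or.inr ⟨hw.1, h⟩
        simp only [hbc]
        exact_mod_cast (Finset.card_le_card this).trans (Finset.card_union_le _ _)
      have h4 : N₁ / (4 * K) = N₁ / (8 * K) + N₁ / (8 * K) := by field_simp; ring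
      linarith
    have hpaths : (((U ×ˢ V).filter fun q => (u, q.2) ∈ Γ ∧ (q.1, q.2) ∈ Γ ∧ (q.1, v) ∈ Γ).card
        : ℝ) = ∑ u' ∈ U, if (u', v) ∈ Γ then cod u u' else 0 := by
      rw [← Finset.sum_boole, Finset.sum_product]
      refine Finset.sum_congr rfl fun u' _ => ?_
      simp only [hcod, hg]
      split_ifs with h
      · refine Finset.sum_congr rfl fun v' _ => ?_
        by_cases h1 : (u, v') ∈ Γ <;> by_cases h2 : (u', v') ∈ Γ <;> simp [h, h1, h2]
      · simp [h]
    have hcod0 : ∀ u', 0 ≤ cod u u' := fun u' =>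
      Finset.sum_nonneg fun v _ => mul_nonneg (hg0 _ _) (hg0 _ _)
    have hlow : G.card * (τ * m) ≤ ∑ u' ∈ U, if (u', v) ∈ Γ then cod u u' else 0 := by
      calc G.card * (τ * m) = ∑ u' ∈ G, τ * m := by simp
        _ ≤ ∑ u' ∈ G, if (u', v) ∈ Γ then cod u u' else 0 :=
            Finset.sum_le_sum fun u' hu' => by
              have := (Finset.mem_filter.1 hu').2
              rw [if_pos this.1]; exact this.2
        _ ≤ _ := Finset.sum_le_sum_of_subset_of_nonneg
            ((Finset.filter_subset _ _).trans hU₁U) fun u' _ _ => by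
              split_ifs; exacts [hcod0 _, le_rfl]
    rw [hpaths]
    have hK12 : (2 : ℝ) ^ 12 ≤ K ^ 12 := pow_le_pow_left₀ (by norm_num) hK 12
    rw [div_le_iff₀ (by positivity)] at hGc
    calc n * m ≤ 3 * K * N₁ * m := by gcongr
      _ ≤ 3 * K * (G.card * (8 * K)) * m := by gcongr
      _ = 3072 * K ^ 5 * (G.card * (τ * m)) := by rw [hτ]; field_simp; ring
      _ ≤ K ^ 12 * K ^ 5 * (G.card * (τ * m)) := by gcongr; linarith
      _ = K ^ 17 * (G.card * (τ * m)) := by ring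
      _ ≤ _ := by gcongr

/-- Among large subsets `S p` of a finite set `T`, some `S p₀` meets many others in a large set. -/
lemma exists_popular_inter {ι α : Type*} [DecidableEq α] {P : Finset ι} (hP : P.Nonempty)
    {T : Finset α} (S : ι → Finset α) (hS : ∀ p ∈ P, S p ⊆ T) {K : ℝ} (hK : 1 ≤ K)
    (hT : T.Nonempty) (hc : ∀ p ∈ P, (T.card : ℝ) ≤ K * (S p).card) :
    ∃ p₀ ∈ P, (P.card : ℝ) ≤ 2 * K ^ 2 *
      (P.filter fun p => (T.card : ℝ) ≤ 2 * K ^ 2 * (S p ∩ S p₀).card).card := by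
  classical
  have hT0 : (0 : ℝ) < T.card := by exact_mod_cast Finset.card_pos.2 hT
  have hP0 : (0 : ℝ) < P.card := by exact_mod_cast Finset.card_pos.2 hP
  set g : ι → α → ℝ := fun p t => if t ∈ S p then 1 else 0 with hg
  have h1 : ∀ p ∈ P, ((S p).card : ℝ) = ∑ t ∈ T, g p t := fun p hp => by
    simp only [hg]
    rw [Finset.sum_boole, Finset.filter_mem_eq_inter, Finset.inter_eq_right.2 (hS p hp)]
  have h2 : ∀ p ∈ P, ∀ p' ∈ P, ((S p ∩ S p').card : ℝ) = ∑ t ∈ T, g p t * g p' t := by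
    intro p hp p' hp'
    simp only [hg, mul_ite, mul_one, mul_zero, ← ite_and]
    rw [Finset.sum_boole]
    congr 2
    ext t
    simp only [Finset.mem_inter, Finset.mem_filter]
    have := @hS p hp t
    tauto
  have h3 : (P.card * (T.card / K)) ^ 2 ≤ T.card * ∑ p' ∈ P, ∑ p ∈ P, ((S p ∩ S p').card : ℝ) := by
    calc (P.card * (T.card / K)) ^ 2 ≤ (∑ p ∈ P, ∑ t ∈ T, g p t) ^ 2 := by
          gcongr
          rw [← nsmul_eq_mul]
          refine Finset.card_nsmul_le_sum _ _ _ fun p hp => ?_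
          rw [← h1 p hp, div_le_iff₀ (by linarith)]
          linarith [hc p hp]
      _ = (∑ t ∈ T, ∑ p ∈ P, g p t) ^ 2 := by rw [Finset.sum_comm]
      _ ≤ T.card * ∑ t ∈ T, (∑ p ∈ P, g p t) ^ 2 := sq_sum_le_card_mul_sum_sq
      _ = T.card * ∑ t ∈ T, ∑ p' ∈ P, ∑ p ∈ P, g p t * g p' t := by
          congr 1
          refine Finset.sum_congr rfl fun t _ => ?_
          rw [sq, Finset.sum_mul_sum, Finset.sum_comm]
      _ = T.card * ∑ p' ∈ P, ∑ p ∈ P, ∑ t ∈ T, g p t * g p' t := by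
          rw [Finset.sum_comm]
          congr 1
          exact Finset.sum_congr rfl fun p' _ => Finset.sum_comm
      _ = _ := by
          congr 1
          refine Finset.sum_congr rfl fun p' hp' => Finset.sum_congr rfl fun p hp => ?_
          rw [h2 p hp p' hp']
  obtain ⟨p₀, hp₀, h4⟩ : ∃ p₀ ∈ P, P.card * (T.card / K ^ 2) ≤
      ∑ p ∈ P, ((S p ∩ S p₀).card : ℝ) := by
    refine Finset.exists_le_of_sum_le hP ?_
    rw [Finset.sum_const, nsmul_eq_mul]
    refine le_of_mul_le_mul_left (le_trans (le_of_eq ?_) h3) hT0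
    field_simp
  refine ⟨p₀, hp₀, ?_⟩
  have h5 := sum_le_popular P (fun p => ((S p ∩ S p₀).card : ℝ)) (M := T.card)
    (τ := T.card / (2 * K ^ 2)) (fun p hp => by
      exact_mod_cast Finset.card_le_card (Finset.inter_subset_left.trans (hS p hp)))
    (by positivity)
  have h6 : (P.filter fun p => T.card / (2 * K ^ 2) ≤ ((S p ∩ S p₀).card : ℝ)) =
      P.filter fun p => (T.card : ℝ) ≤ 2 * K ^ 2 * (S p ∩ S p₀).card := by
    refine Finset.filter_congr fun p _ => ?_
    rw [div_le_iff₀ (by positivity), mul_comm]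
  rw [h6] at h5
  have h7 : P.card * (T.card / K ^ 2) - T.card / (2 * K ^ 2) * P.card =
    T.card * (P.card / (2 * K ^ 2)) := by field_simp; ring
  have h8 := le_of_mul_le_mul_left (h7 ▸ (by linarith) : (T.card : ℝ) * (P.card / (2 * K ^ 2)) ≤
    T.card * (P.filter fun p => (T.card : ℝ) ≤ 2 * K ^ 2 * (S p ∩ S p₀).card).card) hT0
  rw [div_le_iff₀ (by positivity)] at h8
  linarith

section Pointwise

open scoped Pointwise

lemma card_int_window {S : Finset ℤ} {a h : ℝ} (hh : 0 ≤ h) (hS : ∀ x ∈ S, |(x : ℝ) - a| ≤ h) :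
    (S.card : ℝ) ≤ 2 * h + 1 := by
  have h1 : S ⊆ Finset.Icc ⌈a - h⌉ ⌊a + h⌋ := by
    intro x hx
    have := abs_le.1 (hS x hx)
    rw [Finset.mem_Icc, Int.ceil_le, Int.le_floor]
    constructor <;> linarith [this.1, this.2]
  have h2 := Finset.card_le_card h1
  rw [Int.card_Icc] at h2
  have h3 : ((⌊a + h⌋ + 1 - ⌈a - h⌉).toNat : ℝ) ≤ 2 * h + 1 := by
    rcases le_or_gt 0 (⌊a + h⌋ + 1 - ⌈a - h⌉) with h4 | h4
    · have h5 : (((⌊a + h⌋ + 1 - ⌈a - h⌉).toNat : ℤ) : ℝ) = ((⌊a + h⌋ + 1 - ⌈a - h⌉ : ℤ) : ℝ) := by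
        rw [Int.toNat_of_nonneg h4]
      rw [Int.cast_natCast] at h5
      rw [h5]; push_cast
      linarith [Int.floor_le (a + h), Int.le_ceil (a - h)]
    · rw [Int.toNat_of_nonpos h4.le]; push_cast; linarith
  calc (S.card : ℝ) ≤ _ := by exact_mod_cast h2
    _ ≤ _ := h3

lemma card_le_mul_card_image_real {α β : Type*} [DecidableEq β] {f : α → β} (s : Finset α)
    {m : ℝ} (h : ∀ b ∈ s.image f, ((s.filter fun a => f a = b).card : ℝ) ≤ m) :
    (s.card : ℝ) ≤ m * (s.image f).card := by
  have h1 : s.card = ∑ b ∈ s.image f, (s.filter fun i => f i = b).card :=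
    Finset.card_eq_sum_card_fiberwise fun x hx => Finset.mem_image_of_mem f hx
  rw [h1]; push_cast
  calc _ ≤ ∑ b ∈ s.image f, m := Finset.sum_le_sum fun b hb => h b hb
    _ = _ := by simp [mul_comm]

/-- A set of integer triples whose coordinates are successively determined up to windows. -/
lemma card_triple_le {T : Finset (ℤ × ℤ × ℤ)} {m : ℝ} (hm : 0 ≤ m)
    (h1 : ∃ a : ℝ, ∀ t ∈ T, |(t.1 : ℝ) - a| ≤ m)
    (h2 : ∀ x, ∃ a : ℝ, ∀ t ∈ T, t.1 = x → |(t.2.1 : ℝ) - a| ≤ m)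
    (h3 : ∀ x y, ∃ a : ℝ, ∀ t ∈ T, t.1 = x → t.2.1 = y → |(t.2.2 : ℝ) - a| ≤ m) :
    (T.card : ℝ) ≤ (2 * m + 1) ^ 3 := by
  classical
  have hm' : 0 ≤ 2 * m + 1 := by linarith
  have e1 : ((T.image Prod.fst).card : ℝ) ≤ 2 * m + 1 := by
    obtain ⟨a, ha⟩ := h1
    exact card_int_window hm fun x hx => by
      obtain ⟨t, ht, rfl⟩ := Finset.mem_image.1 hx
      exact ha t ht
  have e2 : (T.card : ℝ) ≤ (2 * m + 1) ^ 2 * (T.image Prod.fst).card := by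
    refine card_le_mul_card_image_real T fun x _ => ?_
    set T' := T.filter fun t => t.1 = x with hT'
    have e3 : (T'.card : ℝ) ≤ (2 * m + 1) * (T'.image fun t => t.2.1).card := by
      refine card_le_mul_card_image_real T' fun y _ => ?_
      obtain ⟨a, ha⟩ := h3 x y
      have e4 : ((T'.filter fun t => t.2.1 = y).image fun t => t.2.2).card =
          (T'.filter fun t => t.2.1 = y).card := by
        refine Finset.card_image_of_injOn fun t ht t' ht' h => ?_
        simp only [hT', Finset.coe_filter, Finset.mem_filter, Set.mem_ofPred_eq] at ht ht'
        exact Prod.ext (ht.1.2.trans ht'.1.2.symm) (Prod.ext (ht.2.trans ht'.2.symm) h)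
      rw [← e4]
      refine card_int_window hm (a := a) fun z hz => ?_
      obtain ⟨t, ht, rfl⟩ := Finset.mem_image.1 hz
      simp only [hT', Finset.mem_filter] at ht
      exact ha t ht.1.1 ht.1.2 ht.2
    have e5 : ((T'.image fun t => t.2.1).card : ℝ) ≤ 2 * m + 1 := by
      obtain ⟨a, ha⟩ := h2 x
      refine card_int_window hm (a := a) fun z hz => ?_
      obtain ⟨t, ht, rfl⟩ := Finset.mem_image.1 hz
      simp only [hT', Finset.mem_filter] at ht
      exact ha t ht.1 ht.2
    calc (T'.card : ℝ) ≤ _ := e3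
      _ ≤ (2 * m + 1) * (2 * m + 1) := by gcongr
      _ = _ := by ring
  calc (T.card : ℝ) ≤ _ := e2
    _ ≤ (2 * m + 1) ^ 2 * (2 * m + 1) := by gcongr
    _ = _ := by ring

/-- The integer parts of `a u + b v`. -/
def cells (U V : Finset ℤ) (a b : ℝ) : Finset ℤ :=
  (U ×ˢ V).image fun p => ⌊a * p.1 + b * p.2⌋

lemma cells_mono {U V U' V' : Finset ℤ} {a b : ℝ} (hU : U ⊆ U') (hV : V ⊆ V') :
    cells U V a b ⊆ cells U' V' a b :=
  Finset.image_subset_image (Finset.product_subset_product hU hV)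

lemma abs_sub_le_of_abs_mul_le {L b x y h : ℝ} (hL : 0 < L) (hb : 1 / L ≤ |b|)
    (h1 : |b * x - y| ≤ h) : |x - y / b| ≤ L * h := by
  have hb0 : 0 < |b| := lt_of_lt_of_le (by positivity) hb
  have hb1 : b ≠ 0 := abs_pos.1 hb0
  have h2 : b * x - y = b * (x - y / b) := by field_simp
  rw [h2, abs_mul] at h1
  rw [div_le_iff₀ hL] at hb
  have h3 := abs_nonneg (x - y / b)
  nlinarith

/-- Ruzsa's covering lemma for dilates of sets of integers, up to bounded errors. -/
lemma exists_cover_of_cells {U V : Finset ℤ} {a b L : ℝ} (hL : 0 < L) (hb : 1 / L ≤ |b|)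
    (hV : V.Nonempty) : ∃ X ⊆ U, (X.card : ℝ) * V.card ≤ (2 * L + 1) * (cells U V a b).card ∧
      ∀ u ∈ U, ∃ x ∈ X, ∃ v ∈ V, ∃ v' ∈ V, |a * u - a * x - b * (v - v')| ≤ 1 := by
  classical
  set F : ℤ → Finset ℤ := fun x => V.image fun v : ℤ => ⌊a * x + b * v⌋ with hF
  obtain ⟨X, hX, hmax⟩ := Finset.exists_max_image
    (U.powerset.filter fun X : Finset ℤ => (X : Set ℤ).PairwiseDisjoint F) Finset.card ⟨∅, by simp⟩
  simp only [Finset.mem_filter, Finset.mem_powerset] at hX hmax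
  refine ⟨X, hX.1, ?_, fun u hu => ?_⟩
  · have h1 : ∀ x ∈ X, (V.card : ℝ) ≤ (2 * L + 1) * (F x).card := fun x _ => by
      refine card_le_mul_card_image_real V fun c _ => ?_
      have := card_int_window (S := V.filter fun v : ℤ => ⌊a * x + b * v⌋ = c)
        (a := (c - a * x) / b) (h := L * 1) (by linarith) fun v hv => by
          have h2 := (Finset.mem_filter.1 hv).2
          refine abs_sub_le_of_abs_mul_le hL hb ?_
          rw [abs_le]
          have h3 := Int.floor_le (a * x + b * v)
          have h4 := Int.lt_floor_add_one (a * x + b * v)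
          rw [h2] at h3 h4
          constructor <;> linarith
      simpa using this
    have h2 : X.biUnion F ⊆ cells U V a b := by
      intro c hc
      obtain ⟨x, hx, hc⟩ := Finset.mem_biUnion.1 hc
      obtain ⟨v, hv, rfl⟩ := Finset.mem_image.1 hc
      exact Finset.mem_image.2 ⟨(x, v), Finset.mem_product.2 ⟨hX.1 hx, hv⟩, rfl⟩
    have h3 : ∑ x ∈ X, ((F x).card : ℝ) ≤ (cells U V a b).card := by
      have := Finset.card_le_card h2
      rw [Finset.card_biUnion hX.2] at this
      exact_mod_cast this
    calc (X.card : ℝ) * V.card = ∑ x ∈ X, (V.card : ℝ) := by simp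
      _ ≤ ∑ x ∈ X, (2 * L + 1) * (F x).card := Finset.sum_le_sum h1
      _ = (2 * L + 1) * ∑ x ∈ X, ((F x).card : ℝ) := by rw [Finset.mul_sum]
      _ ≤ _ := by gcongr
  · by_cases huX : u ∈ X
    · obtain ⟨v, hv⟩ := hV
      exact ⟨u, huX, v, hv, v, hv, by simp⟩
    have h1 : ¬ ((insert u X : Finset ℤ) : Set ℤ).PairwiseDisjoint F := fun h => by
      have := hmax (insert u X) ⟨Finset.insert_subset hu hX.1, h⟩
      rw [Finset.card_insert_of_notMem huX] at this
      omega
    rw [Finset.coe_insert, Set.pairwiseDisjoint_insert] at h1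
    have h2 : ∃ x ∈ X, ¬ Disjoint (F u) (F x) := by
      by_contra! hcon
      exact h1 ⟨hX.2, fun x hx _ => hcon x hx⟩
    obtain ⟨x, hx, h3⟩ := h2
    obtain ⟨c, hc1, hc2⟩ := Finset.not_disjoint_iff.1 h3
    obtain ⟨v, hv, e1⟩ := Finset.mem_image.1 hc1
    obtain ⟨v', hv', e2⟩ := Finset.mem_image.1 hc2
    refine ⟨x, hx, v', hv', v, hv, ?_⟩
    have h4 := Int.abs_sub_lt_one_of_floor_eq_floor (e1.trans e2.symm)
    have e5 : a * u - a * x - b * (v' - v) = a * u + b * v - (a * x + b * v') := by ring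
    rw [e5]; exact h4.le

/-- A dense graph along which `α u + β v` is close to a small set contains a large rectangle
on which `α u + β v` takes few values. -/
lemma exists_rectangle_few_cells {𝒟 : Finset ℤ} {N L α₁ α₂ β : ℝ} (hN : 0 < N) (hL : 2 ≤ L)
    (h𝒟 : (𝒟.card : ℝ) ≤ L * N) (hα₁ : 1 / L ≤ |α₁|) (hα₂ : 1 / L ≤ |α₂|)
    {Γ : Finset (ℤ × ℤ)} (hΓ : Γ ⊆ 𝒟 ×ˢ 𝒟) (hΓc : N ^ 2 ≤ L * Γ.card)
    (h : ∀ x ∈ Γ, ∃ k ∈ 𝒟, |α₁ * x.1 + α₂ * x.2 + β - k| ≤ L) :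
    ∃ U ⊆ 𝒟, ∃ V ⊆ 𝒟, (𝒟.card : ℝ) ≤ L ^ 12 * U.card ∧ (𝒟.card : ℝ) ≤ L ^ 12 * V.card ∧
      ((cells U V α₁ α₂).card : ℝ) ≤ L ^ 80 * N := by
  classical
  have hL0 : 0 < L := by linarith
  have hne : Γ.Nonempty := by
    rw [← Finset.card_pos]
    by_contra! hc
    have : Γ.card = 0 := by omega
    rw [this] at hΓc
    simp at hΓc
    have : 0 < N ^ 2 := by positivity
    linarith
  have hL3 : (2 : ℝ) ≤ L ^ 3 := hL.trans
    (by simpa using pow_le_pow_right₀ (by linarith) (by norm_num : 1 ≤ 3))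
  obtain ⟨U, hU, V, hV, hUc, hVc, hp⟩ := exists_many_paths hΓ hL3 hne (by
    calc (𝒟.card : ℝ) * 𝒟.card ≤ (L * N) * (L * N) := by gcongr
      _ = L ^ 2 * N ^ 2 := by ring
      _ ≤ L ^ 2 * (L * Γ.card) := by gcongr
      _ = _ := by ring)
  rw [← pow_mul] at hUc hVc
  refine ⟨U, hU, V, hV, hUc, hVc, ?_⟩
  choose! k hk hkL using h
  have hrep : ∀ c ∈ cells U V α₁ α₂, ∃ q : ℤ × ℤ, q.1 ∈ U ∧ q.2 ∈ V ∧
      ⌊α₁ * q.1 + α₂ * q.2⌋ = c := fun c hc => by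
    obtain ⟨q, hq, rfl⟩ := Finset.mem_image.1 hc
    exact ⟨q, (Finset.mem_product.1 hq).1, (Finset.mem_product.1 hq).2, rfl⟩
  choose! r hr1 hr2 hr3 using hrep
  set Pth : ℤ → Finset (ℤ × ℤ) := fun c => (𝒟 ×ˢ 𝒟).filter fun q =>
    ((r c).1, q.2) ∈ Γ ∧ (q.1, q.2) ∈ Γ ∧ (q.1, (r c).2) ∈ Γ with hPth
  set T : Finset (ℤ × ℤ × ℤ) := ((cells U V α₁ α₂) ×ˢ (𝒟 ×ˢ 𝒟)).filter fun t =>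
    t.2 ∈ Pth t.1 with hT
  have hTc : (T.card : ℝ) = ∑ c ∈ cells U V α₁ α₂, ((Pth c).card : ℝ) := by
    rw [hT, ← Finset.sum_boole, Finset.sum_product]
    refine Finset.sum_congr rfl fun c _ => ?_
    rw [Finset.sum_boole]
    congr 2
    ext q
    simp only [hPth, Finset.mem_filter]
    tauto
  have hTlow : (cells U V α₁ α₂).card * ((𝒟.card : ℝ) * 𝒟.card) ≤ L ^ 51 * T.card := by
    rw [hTc, Finset.mul_sum, ← nsmul_eq_mul]
    refine Finset.card_nsmul_le_sum _ _ _ fun c hc => ?_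
    refine (hp _ (hr1 c hc) _ (hr2 c hc)).trans (le_of_eq ?_)
    rw [← pow_mul]
  set f : ℤ × ℤ × ℤ → ℤ × ℤ × ℤ := fun t =>
    (k ((r t.1).1, t.2.2), k (t.2.1, t.2.2), k (t.2.1, (r t.1).2)) with hf
  have hTm : ∀ t ∈ T, ((r t.1).1, t.2.2) ∈ Γ ∧ (t.2.1, t.2.2) ∈ Γ ∧ (t.2.1, (r t.1).2) ∈ Γ ∧
      t.1 ∈ cells U V α₁ α₂ := fun t ht => by
    simp only [hT, hPth, Finset.mem_filter, Finset.mem_product] at ht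
    exact ⟨ht.2.2.1, ht.2.2.2.1, ht.2.2.2.2, ht.1.1⟩
  have himg : (T.image f).card ≤ 𝒟.card * (𝒟.card * 𝒟.card) := by
    rw [← Finset.card_product, ← Finset.card_product]
    refine Finset.card_le_card fun x hx => ?_
    obtain ⟨t, ht, rfl⟩ := Finset.mem_image.1 hx
    obtain ⟨h1, h2, h3, -⟩ := hTm t ht
    exact Finset.mem_product.2 ⟨hk _ h1, Finset.mem_product.2 ⟨hk _ h2, hk _ h3⟩⟩
  have hfib : (T.card : ℝ) ≤ (2 * (L * (4 * L)) + 1) ^ 3 * (T.image f).card := by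
    refine card_le_mul_card_image_real T fun y _ => ?_
    obtain ⟨y₁, y₂, y₃⟩ := y
    have key : ∀ t ∈ T.filter (fun t => f t = (y₁, y₂, y₃)),
        |α₁ * (r t.1).1 + α₂ * t.2.2 + β - y₁| ≤ L ∧ |α₁ * t.2.1 + α₂ * t.2.2 + β - y₂| ≤ L ∧
        |α₁ * t.2.1 + α₂ * (r t.1).2 + β - y₃| ≤ L ∧
        |α₁ * (r t.1).1 + α₂ * (r t.1).2 - t.1| ≤ 1 := by
      intro t ht
      rw [Finset.mem_filter] at ht
      obtain ⟨h1, h2, h3, h4⟩ := hTm t ht.1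
      have h5 := ht.2
      simp only [hf, Prod.mk.injEq] at h5
      refine ⟨?_, ?_, ?_, ?_⟩
      · have := hkL _ h1; rwa [h5.1] at this
      · have := hkL _ h2; rwa [h5.2.1] at this
      · have := hkL _ h3; rwa [h5.2.2] at this
      · have h6 := Int.floor_le (α₁ * (r t.1).1 + α₂ * (r t.1).2)
        have h7 := Int.lt_floor_add_one (α₁ * (r t.1).1 + α₂ * (r t.1).2)
        rw [hr3 _ h4] at h6 h7
        rw [abs_le]; constructor <;> linarith
    refine card_triple_le (by positivity) ?_ (fun x => ?_) (fun x y => ?_)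
    · refine ⟨y₁ - y₂ + y₃ - β, fun t ht => ?_⟩
      obtain ⟨h1, h2, h3, h4⟩ := key t ht
      rw [abs_le] at h1 h2 h3 h4 ⊢
      constructor <;> nlinarith [h1.1, h1.2, h2.1, h2.2, h3.1, h3.2, h4.1, h4.2]
    · refine ⟨(y₃ - β - α₂ * (r x).2) / α₁, fun t ht hx => ?_⟩
      obtain ⟨h1, h2, h3, h4⟩ := key t ht
      subst hx
      refine (abs_sub_le_of_abs_mul_le hL0 hα₁ (h := L) ?_).trans (by nlinarith)
      convert h3 using 2
      ring
    · refine ⟨(y₁ - β - α₁ * (r x).1) / α₂, fun t ht hx _ => ?_⟩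
      obtain ⟨h1, h2, h3, h4⟩ := key t ht
      subst hx
      refine (abs_sub_le_of_abs_mul_le hL0 hα₂ (h := L) ?_).trans (by nlinarith)
      convert h1 using 2
      ring
  have h𝒟0 : (0 : ℝ) < (𝒟.card : ℝ) * 𝒟.card := by
    obtain ⟨x, hx⟩ := hne
    have := Finset.card_pos.2 ⟨_, (Finset.mem_product.1 (hΓ hx)).1⟩
    positivity
  have h8 : (2 * (L * (4 * L)) + 1) ^ 3 ≤ (L ^ 6) ^ 3 := by
    gcongr
    have : (2 : ℝ) ^ 4 ≤ L ^ 4 := pow_le_pow_left₀ (by norm_num) hL 4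
    nlinarith [sq_nonneg L]
  refine le_of_mul_le_mul_right (a := (𝒟.card : ℝ) * 𝒟.card) ?_ h𝒟0
  calc (cells U V α₁ α₂).card * ((𝒟.card : ℝ) * 𝒟.card) ≤ L ^ 51 * T.card := hTlow
    _ ≤ L ^ 51 * ((L ^ 6) ^ 3 * (T.image f).card) := by
        gcongr
        exact hfib.trans (by gcongr)
    _ ≤ L ^ 51 * ((L ^ 6) ^ 3 * (𝒟.card * (𝒟.card * 𝒟.card))) := by
        gcongr; exact_mod_cast himg
    _ ≤ L ^ 51 * ((L ^ 6) ^ 3 * ((L * N) * (𝒟.card * 𝒟.card))) := by gcongr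
    _ = L ^ 70 * N * (𝒟.card * 𝒟.card) := by ring
    _ ≤ _ := by
        gcongr ?_ * _ * _
        exact pow_le_pow_right₀ (by linarith) (by norm_num)

lemma cells_swap (U V : Finset ℤ) (a b : ℝ) : cells V U b a = cells U V a b := by
  ext c
  simp only [cells, Finset.mem_image, Finset.mem_product, Prod.exists]
  constructor <;> rintro ⟨x, y, ⟨hx, hy⟩, rfl⟩ <;> exact ⟨y, x, ⟨hy, hx⟩, by rw [add_comm]⟩

/-- The integer parts of `a u`, for `u ∈ U`. -/
def floorDilate (U : Finset ℤ) (a : ℝ) : Finset ℤ := U.image fun u : ℤ => ⌊a * u⌋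

lemma card_le_floorDilate {U : Finset ℤ} {a L : ℝ} (hL : 0 < L) (ha : 1 / L ≤ |a|) :
    (U.card : ℝ) ≤ (2 * L + 1) * (floorDilate U a).card := by
  refine card_le_mul_card_image_real U fun c _ => ?_
  have := card_int_window (S := U.filter fun u : ℤ => ⌊a * u⌋ = c) (a := c / a) (h := L * 1)
    (by linarith) fun v hv => by
      refine abs_sub_le_of_abs_mul_le hL ha ?_
      rw [← (Finset.mem_filter.1 hv).2, abs_le]
      constructor <;> linarith [Int.floor_le (a * v), Int.lt_floor_add_one (a * v)]
  simpa using this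

lemma card_floorDilate_add_le (U V : Finset ℤ) (a b : ℝ) :
    (floorDilate U a + floorDilate V b).card ≤ 2 * (cells U V a b).card := by
  classical
  have h1 : floorDilate U a + floorDilate V b ⊆
      cells U V a b ∪ (cells U V a b).image fun c => c - 1 := by
    intro x hx
    obtain ⟨y, hy, z, hz, rfl⟩ := Finset.mem_add.1 hx
    obtain ⟨u, hu, rfl⟩ := Finset.mem_image.1 hy
    obtain ⟨v, hv, rfl⟩ := Finset.mem_image.1 hz
    have hc : ⌊a * u + b * v⌋ ∈ cells U V a b :=
      Finset.mem_image.2 ⟨(u, v), Finset.mem_product.2 ⟨hu, hv⟩, rfl⟩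
    have h1 := Int.le_floor_add (a * u) (b * v)
    have h2 := Int.le_floor_add_floor (a * u) (b * v)
    rw [Finset.mem_union, Finset.mem_image]
    by_cases h : ⌊a * u⌋ + ⌊b * v⌋ = ⌊a * u + b * v⌋
    · left; rw [h]; exact hc
    · right; exact ⟨_, hc, by omega⟩
  have h2 : ((cells U V a b).image fun c => c - 1).card ≤ (cells U V a b).card :=
    Finset.card_image_le
  have h3 := (Finset.card_le_card h1).trans (Finset.card_union_le _ _)
  omega

lemma card_cells_self_le (U V : Finset ℤ) (a : ℝ) :
    (cells U V a a).card ≤ 2 * (floorDilate U a + floorDilate V a).card := by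
  classical
  set S := floorDilate U a + floorDilate V a with hS
  have h1 : cells U V a a ⊆ S ∪ S.image fun c => c + 1 := by
    intro x hx
    obtain ⟨⟨u, v⟩, huv, rfl⟩ := Finset.mem_image.1 hx
    rw [Finset.mem_product] at huv
    have hc : ⌊a * u⌋ + ⌊a * v⌋ ∈ S :=
      Finset.add_mem_add (Finset.mem_image_of_mem _ huv.1) (Finset.mem_image_of_mem _ huv.2)
    have h1 := Int.le_floor_add (a * u) (a * v)
    have h2 := Int.le_floor_add_floor (a * u) (a * v)
    rw [Finset.mem_union, Finset.mem_image]
    by_cases h : ⌊a * u⌋ + ⌊a * v⌋ = ⌊a * u + a * v⌋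
    · left; rw [← h]; exact hc
    · right; exact ⟨_, hc, by simp only; omega⟩
  have h2 : (S.image fun c => c + 1).card ≤ S.card := Finset.card_image_le
  have h3 := (Finset.card_le_card h1).trans (Finset.card_union_le _ _)
  omega

/-- The dilate of an integer set as a set of reals. -/
def scaleSet (s : ℝ) (A : Finset ℤ) : Finset ℝ := A.image fun a : ℤ => s * a

lemma diffSet_scaleSet_subset (s : ℝ) (A : Finset ℤ) (k : ℕ) :
    diffSet (scaleSet s A) k ⊆ scaleSet s (k • A - k • A) := by
  induction k with
  | zero => simp [diffSet, scaleSet]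
  | succ k ih =>
    intro x hx
    obtain ⟨y, hy, a, ha, a', ha', rfl⟩ := mem_diffSet_succ.1 hx
    obtain ⟨n, hn, rfl⟩ := Finset.mem_image.1 (ih hy)
    obtain ⟨m, hm, rfl⟩ := Finset.mem_image.1 ha
    obtain ⟨m', hm', rfl⟩ := Finset.mem_image.1 ha'
    obtain ⟨p, hp, q, hq, rfl⟩ := Finset.mem_sub.1 hn
    refine Finset.mem_image.2 ⟨(p + m) - (q + m'), Finset.sub_mem_sub ?_ ?_, by push_cast; ring⟩
    · rw [succ_nsmul]; exact Finset.add_mem_add hp hm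
    · rw [succ_nsmul]; exact Finset.add_mem_add hq hm'

lemma card_diffSet_scaleSet_le (s : ℝ) (A : Finset ℤ) (k : ℕ) :
    (diffSet (scaleSet s A) k).card ≤ (k • A - k • A).card :=
  (Finset.card_le_card (diffSet_scaleSet_subset s A k)).trans Finset.card_image_le

lemma abs_mul_floor_error {x y L : ℝ} (hx : |x| ≤ L) (hy : |y| ≤ 1) : |x * y| ≤ L := by
  rw [abs_mul]
  calc |x| * |y| ≤ |x| * 1 := by gcongr
    _ ≤ L := by linarith

/-- Two rectangles with few cells, sharing a large rectangle, give an approximate multiplier. -/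
lemma multLvl_of_cells {U V U' V' : Finset ℤ} {N L a b a' b' s : ℝ} (hN : 0 < N) (hL : 2 ≤ L)
    (hs : 0 < s) (hb0 : 1 / L ≤ |b|) (hb : |b| ≤ L) (ha0 : 1 / L ≤ |a|)
    (ha' : |a'| ≤ L) (hb0' : 1 / L ≤ |b'|)
    (hU' : U' ⊆ U) (hV' : V' ⊆ V) (hU'c : N ≤ L * U'.card) (hV'c : N ≤ L * V'.card)
    (hc : ((cells U V a b).card : ℝ) ≤ L * N) (hc' : ((cells U' V' a' b').card : ℝ) ≤ L * N)
    (hsum : ((floorDilate U a + floorDilate U a).card : ℝ) ≤ L * N) :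
    MultLvl (scaleSet s (floorDilate U a)) s (L ^ 7) 0 ((a' / b') * (b / a)) := by
  classical
  have hL0 : 0 < L := by linarith
  have hL1 : 1 ≤ L := by linarith
  have hne : ∀ {S : Finset ℤ}, N ≤ L * S.card → S.Nonempty := fun {S} h => by
    rw [← Finset.card_pos]
    by_contra! hc
    have : S.card = 0 := by omega
    rw [this] at h
    simp at h; linarith
  have hinv : ∀ {x : ℝ}, 1 / L ≤ |x| → x ≠ 0 ∧ |x⁻¹| ≤ L := fun {x} h => by
    have hx : 0 < |x| := lt_of_lt_of_le (by positivity) h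
    refine ⟨abs_pos.1 hx, ?_⟩
    rw [abs_inv, inv_le_comm₀ hx hL0, ← one_div]; exact h
  obtain ⟨ha1, hai⟩ := hinv ha0
  obtain ⟨hb1, -⟩ := hinv hb0
  obtain ⟨hb1', hbi'⟩ := hinv hb0'
  have hcardX : ∀ {X S : Finset ℤ} {M : ℝ}, N ≤ L * S.card → M ≤ 4 * L * N →
      (X.card : ℝ) * S.card ≤ (2 * L + 1) * M → (X.card : ℝ) ≤ L ^ 7 := by
    intro X S M hS hM h
    refine le_of_mul_le_mul_right (a := N) ?_ hN
    have h4 : (2 : ℝ) ^ 4 ≤ L ^ 4 := pow_le_pow_left₀ (by norm_num) hL 4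
    calc X.card * N ≤ X.card * (L * S.card) := by gcongr
      _ = L * (X.card * S.card) := by ring
      _ ≤ L * ((2 * L + 1) * M) := by gcongr
      _ ≤ L * ((2 * L + 1) * (4 * L * N)) := by gcongr
      _ ≤ L * ((3 * L) * (4 * L * N)) := by gcongr; linarith
      _ ≤ L ^ 3 * 2 ^ 4 * N := by nlinarith [pow_pos hL0 3, mul_pos (pow_pos hL0 3) hN]
      _ ≤ L ^ 3 * L ^ 4 * N := by gcongr
      _ = _ := by ring
  have hLN : 0 < L * N := by positivity
  obtain ⟨X₁, hX₁, hc₁, hcov₁⟩ := exists_cover_of_cells (U := U) (V := U') (a := a) (b := a) hL0 ha0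
    (hne hU'c)
  have hX₁c := hcardX hU'c (by
    have h1 := Finset.card_le_card (cells_mono (a := a) (b := a) (Finset.Subset.refl U) hU')
    have h2 := card_cells_self_le U U a
    have h3 : ((cells U U' a a).card : ℝ) ≤ 2 * (floorDilate U a + floorDilate U a).card := by
      exact_mod_cast h1.trans h2
    linarith) hc₁
  obtain ⟨X₂, hX₂, hc₂, hcov₂⟩ := exists_cover_of_cells (U := U') (V := V') (a := a') (b := b') hL0
    hb0' (hne hV'c)
  have hX₂c := hcardX hV'c (by linarith) hc₂
  have hUc : N ≤ L * U.card := hU'c.trans (by gcongr)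
  obtain ⟨X₃, hX₃, hc₃, hcov₃⟩ := exists_cover_of_cells (U := V') (V := U) (a := b) (b := a) hL0
    ha0 (hne hUc)
  have hX₃c := hcardX hUc (by
    rw [cells_swap]
    have := Finset.card_le_card (cells_mono (a := a) (b := b) (Finset.Subset.refl U) hV')
    have h3 : ((cells U V' a b).card : ℝ) ≤ (cells U V a b).card := by exact_mod_cast this
    linarith) hc₃
  set l := (a' / b') * (b / a) with hl
  have hbb : |b / b'| ≤ L ^ 2 := by
    rw [div_eq_mul_inv, abs_mul, sq]; gcongr
  have hla : |l| ≤ L ^ 4 := by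
    have : l = a' * b'⁻¹ * (b * a⁻¹) := by rw [hl]; ring
    rw [this, abs_mul, abs_mul, abs_mul]
    calc _ ≤ L * L * (L * L) := by gcongr
      _ = _ := by ring
  have h48 : multIdx 0 = 8 := rfl
  refine ⟨?_, ?_⟩
  · rw [h48, ← pow_mul]
    exact hla.trans (pow_le_pow_right₀ hL1 (by norm_num))
  set Ψ : ℤ × (ℤ × ℤ) × ((ℤ × ℤ) × (ℤ × ℤ)) → ℝ := fun x => s * (l * (a * x.1) +
    b / b' * (a' * x.2.1.1 - a' * x.2.1.2) +
    (b * x.2.2.1.1 - b * x.2.2.1.2 - (b * x.2.2.2.1 - b * x.2.2.2.2))) with hΨ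
  refine ⟨(X₁ ×ˢ ((X₂ ×ˢ X₂) ×ˢ ((X₃ ×ˢ X₃) ×ˢ (X₃ ×ˢ X₃)))).image Ψ, ?_, ?_⟩
  · rw [h48]
    calc _ ≤ ((X₁ ×ˢ ((X₂ ×ˢ X₂) ×ˢ ((X₃ ×ˢ X₃) ×ˢ (X₃ ×ˢ X₃)))).card : ℝ) := by
          exact_mod_cast Finset.card_image_le
      _ = (X₁.card : ℝ) * ((X₂.card * X₂.card) * ((X₃.card * X₃.card) * (X₃.card * X₃.card))) := by
          simp only [Finset.card_product]; push_cast; ring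
      _ ≤ L ^ 7 * ((L ^ 7 * L ^ 7) * ((L ^ 7 * L ^ 7) * (L ^ 7 * L ^ 7))) := by gcongr
      _ = L ^ 49 := by ring
      _ ≤ _ := by rw [← pow_mul]; exact pow_le_pow_right₀ hL1 (by norm_num)
  · intro α hα
    obtain ⟨y, hy, rfl⟩ := Finset.mem_image.1 hα
    obtain ⟨u, hu, rfl⟩ := Finset.mem_image.1 hy
    obtain ⟨x₁, hx₁, u₁, hu₁, u₂, hu₂, e₁⟩ := hcov₁ u hu
    obtain ⟨x₂, hx₂, v₁, hv₁, v₂, hv₂, e₂⟩ := hcov₂ u₁ hu₁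
    obtain ⟨x₂', hx₂', v₃, hv₃, v₄, hv₄, e₂'⟩ := hcov₂ u₂ hu₂
    obtain ⟨z₁, hz₁, w₁, hw₁, w₁', hw₁', f₁⟩ := hcov₃ v₁ hv₁
    obtain ⟨z₂, hz₂, w₂, hw₂, w₂', hw₂', f₂⟩ := hcov₃ v₂ hv₂
    obtain ⟨z₃, hz₃, w₃, hw₃, w₃', hw₃', f₃⟩ := hcov₃ v₃ hv₃
    obtain ⟨z₄, hz₄, w₄, hw₄, w₄', hw₄', f₄⟩ := hcov₃ v₄ hv₄
    refine ⟨Ψ (x₁, (x₂, x₂'), ((z₁, z₂), (z₃, z₄))), Finset.mem_image_of_mem _ (by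
      simp only [Finset.mem_product]; tauto), s * ((⌊a * w₁⌋ - ⌊a * w₁'⌋) - (⌊a * w₂⌋ - ⌊a * w₂'⌋) -
      (⌊a * w₃⌋ - ⌊a * w₃'⌋) + (⌊a * w₄⌋ - ⌊a * w₄'⌋)), ?_, ?_⟩
    · have hm : ∀ {w : ℤ}, w ∈ U → s * (⌊a * w⌋ : ℝ) ∈ scaleSet s (floorDilate U a) := fun h =>
        Finset.mem_image_of_mem _ (Finset.mem_image_of_mem _ h)
      refine diffSet_mono ⟨_, hα⟩ (by rw [h48]; norm_num : 4 ≤ multIdx 0) ?_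
      refine mem_diffSet_succ.2 ⟨_, mem_diffSet_succ.2 ⟨_, mem_diffSet_succ.2 ⟨_,
        mem_diffSet_succ.2 ⟨0, by simp [diffSet], _, hm hw₁, _, hm hw₁', rfl⟩,
        _, hm hw₂', _, hm hw₂, rfl⟩, _, hm hw₃', _, hm hw₃, rfl⟩, _, hm hw₄, _, hm hw₄', ?_⟩
      ring
    · have hfl : ∀ w : ℤ, |a * w - ⌊a * w⌋| ≤ 1 := fun w => by
        rw [abs_le]
        constructor <;> linarith [Int.floor_le (a * w), Int.lt_floor_add_one (a * w)]
      have key : l * (s * (⌊a * u⌋ : ℝ)) - Ψ (x₁, (x₂, x₂'), ((z₁, z₂), (z₃, z₄))) -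
          s * ((⌊a * w₁⌋ - ⌊a * w₁'⌋) - (⌊a * w₂⌋ - ⌊a * w₂'⌋) -
          (⌊a * w₃⌋ - ⌊a * w₃'⌋) + (⌊a * w₄⌋ - ⌊a * w₄'⌋)) =
          s * (l * (a * u - a * x₁ - a * (u₁ - u₂)) - l * (a * u - ⌊a * u⌋) +
          b / b' * (a' * u₁ - a' * x₂ - b' * (v₁ - v₂)) -
          b / b' * (a' * u₂ - a' * x₂' - b' * (v₃ - v₄)) +
          ((b * v₁ - b * z₁ - a * (w₁ - w₁')) - (b * v₂ - b * z₂ - a * (w₂ - w₂')) -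
            (b * v₃ - b * z₃ - a * (w₃ - w₃')) + (b * v₄ - b * z₄ - a * (w₄ - w₄'))) +
          (((a * w₁ - ⌊a * w₁⌋) - (a * w₁' - ⌊a * w₁'⌋)) -
           ((a * w₂ - ⌊a * w₂⌋) - (a * w₂' - ⌊a * w₂'⌋)) -
           ((a * w₃ - ⌊a * w₃⌋) - (a * w₃' - ⌊a * w₃'⌋)) +
           ((a * w₄ - ⌊a * w₄⌋) - (a * w₄' - ⌊a * w₄'⌋)))) := by
        have hla' : l * a = b / b' * a' := by rw [hl]; field_simp
        have hbb' : b / b' * b' = b := by field_simp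
        simp only [hΨ]
        linear_combination s * (u₁ - u₂) * hla' + s * (v₁ - v₂ - v₃ + v₄) * hbb'
      rw [key, abs_mul, abs_of_pos hs, mul_comm]
      gcongr
      have g1 := abs_le.1 (abs_mul_floor_error hla e₁)
      have g2 := abs_le.1 (abs_mul_floor_error hla (hfl u))
      have g3 := abs_le.1 (abs_mul_floor_error hbb e₂)
      have g4 := abs_le.1 (abs_mul_floor_error hbb e₂')
      rw [abs_le] at f₁ f₂ f₃ f₄
      have k1 := abs_le.1 (hfl w₁)
      have k2 := abs_le.1 (hfl w₂)
      have k3 := abs_le.1 (hfl w₃)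
      have k4 := abs_le.1 (hfl w₄)
      have k1' := abs_le.1 (hfl w₁')
      have k2' := abs_le.1 (hfl w₂')
      have k3' := abs_le.1 (hfl w₃')
      have k4' := abs_le.1 (hfl w₄')
      have hfin : 2 * L ^ 4 + 2 * L ^ 2 + 12 ≤ (L ^ 7) ^ multIdx 0 := by
        rw [h48, ← pow_mul]
        have q1 : L ^ 2 ≤ L ^ 4 := pow_le_pow_right₀ hL1 (by norm_num)
        have q2 : 1 ≤ L ^ 4 := one_le_pow₀ hL1
        have q3 : (2 : ℝ) ^ 4 ≤ L ^ 4 := pow_le_pow_left₀ (by norm_num) hL 4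
        calc 2 * L ^ 4 + 2 * L ^ 2 + 12 ≤ L ^ 4 * 2 ^ 4 := by linarith
          _ ≤ L ^ 4 * L ^ 4 := by gcongr
          _ = L ^ 8 := by ring
          _ ≤ _ := pow_le_pow_right₀ hL1 (by norm_num)
      refine le_trans ?_ hfin
      rw [abs_le]
      constructor <;> linarith [g1.1, g1.2, g2.1, g2.2, g3.1, g3.2, g4.1, g4.2, f₁.1, f₁.2,
        f₂.1, f₂.2, f₃.1, f₃.2, f₄.1, f₄.2, k1.1, k1.2, k2.1, k2.2, k3.1, k3.2, k4.1, k4.2,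
        k1'.1, k1'.2, k2'.1, k2'.2, k3'.1, k3'.2, k4'.1, k4'.2]

lemma card_scaleSet {s : ℝ} (hs : 0 < s) (A : Finset ℤ) : (scaleSet s A).card = A.card :=
  Finset.card_image_of_injective _ fun a b h => by
    have := mul_left_cancel₀ hs.ne' h
    exact_mod_cast this

/-- Plünnecke–Ruzsa in real form. -/
lemma card_nsmul_sub_nsmul_le {A B : Finset ℤ} {R M : ℝ} (hA : A.Nonempty)
    (h : ((A + B).card : ℝ) ≤ R * A.card) (hM : (A.card : ℝ) ≤ M) (m n : ℕ) :
    ((m • B - n • B).card : ℝ) ≤ R ^ (m + n) * M := by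
  have hA0 : (0 : ℝ) < A.card := by exact_mod_cast Finset.card_pos.2 hA
  have h1 := Finset.pluennecke_ruzsa_inequality_nsmul_sub_nsmul_add hA B m n
  have h2 : ((m • B - n • B).card : ℝ) ≤ ((A + B).card / A.card : ℝ) ^ (m + n) * A.card := by
    have := (NNRat.cast_le (K := ℝ)).2 h1
    push_cast at this
    exact this
  have h3 : ((A + B).card / A.card : ℝ) ≤ R := by rwa [div_le_iff₀ hA0]
  calc _ ≤ _ := h2
    _ ≤ R ^ (m + n) * M := by
        have : (0 : ℝ) ≤ R := le_trans (by positivity) h3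
        gcongr

/-- A family of large approximate linear relations inside `𝒟` with indices `p ∈ P` produces
a set with slow growth and many approximate multipliers of it. -/
theorem exists_multipliers {ι : Type*} {P : Finset ι} (hP : P.Nonempty) {s L N : ℝ} (hs : 0 < s)
    (hL : 2 ≤ L) (hN : 0 < N) {α₁ α₂ β : ι → ℝ} {𝒟 : Finset ℤ} (h𝒟 : (𝒟.card : ℝ) ≤ L * N)
    (hα₁ : ∀ p ∈ P, 1 / L ≤ |α₁ p|) (hα₁' : ∀ p ∈ P, |α₁ p| ≤ L)
    (hα₂ : ∀ p ∈ P, 1 / L ≤ |α₂ p|) (hα₂' : ∀ p ∈ P, |α₂ p| ≤ L)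
    {Γ : ι → Finset (ℤ × ℤ)} (hΓ : ∀ p ∈ P, Γ p ⊆ 𝒟 ×ˢ 𝒟)
    (hΓc : ∀ p ∈ P, N ^ 2 ≤ L * (Γ p).card)
    (h : ∀ p ∈ P, ∀ x ∈ Γ p, ∃ k ∈ 𝒟, |α₁ p * x.1 + α₂ p * x.2 + β p - k| ≤ L) :
    ∃ p₀ ∈ P, ∃ P' ⊆ P, (P.card : ℝ) ≤ L ^ 49 * P'.card ∧ ∃ U ⊆ 𝒟,
      N ≤ L ^ 16 * (scaleSet s (floorDilate U (α₁ p₀))).card ∧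
      (∀ k, ((diffSet (scaleSet s (floorDilate U (α₁ p₀))) k).card : ℝ) ≤
        (L ^ 195) ^ (k + 1) * N) ∧
      ∀ p ∈ P', MultLvl (scaleSet s (floorDilate U (α₁ p₀))) s (L ^ 1365) 0
        ((α₁ p / α₂ p) * (α₂ p₀ / α₁ p₀)) := by
  classical
  have hL0 : 0 < L := by linarith
  have hL1 : 1 ≤ L := by linarith
  have h𝒟N : N ≤ L * 𝒟.card := by
    obtain ⟨p, hp⟩ := hP
    have h1 : ((Γ p).card : ℝ) ≤ (𝒟.card : ℝ) ^ 2 := by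
      have := Finset.card_le_card (hΓ p hp)
      rw [Finset.card_product] at this
      rw [sq]; exact_mod_cast this
    have h2 : N ^ 2 ≤ (L * 𝒟.card) ^ 2 := by
      calc N ^ 2 ≤ L * (Γ p).card := hΓc p hp
        _ ≤ L * (L * (𝒟.card : ℝ) ^ 2) := by
            gcongr; nlinarith [sq_nonneg (𝒟.card : ℝ)]
        _ = _ := by ring
    exact (pow_le_pow_iff_left₀ hN.le (by positivity) two_ne_zero).1 h2
  have h𝒟0 : 0 < (𝒟.card : ℝ) := by
    by_contra! hc
    nlinarith
  have h𝒟ne : 𝒟.Nonempty := by rw [← Finset.card_pos]; exact_mod_cast h𝒟0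
  have hrect : ∀ p, ∃ U V : Finset ℤ, p ∈ P → U ⊆ 𝒟 ∧ V ⊆ 𝒟 ∧ (𝒟.card : ℝ) ≤ L ^ 12 * U.card ∧
      (𝒟.card : ℝ) ≤ L ^ 12 * V.card ∧ ((cells U V (α₁ p) (α₂ p)).card : ℝ) ≤ L ^ 80 * N := by
    intro p
    by_cases hp : p ∈ P
    · obtain ⟨U, hU, V, hV, h1, h2, h3⟩ := exists_rectangle_few_cells hN hL h𝒟 (hα₁ p hp)
        (hα₂ p hp) (hΓ p hp) (hΓc p hp) (h p hp)
      exact ⟨U, V, fun _ => ⟨hU, hV, h1, h2, h3⟩⟩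
    · exact ⟨∅, ∅, fun h => absurd h hp⟩
  choose U V hUV using hrect
  obtain ⟨p₀, hp₀, hP'⟩ := exists_popular_inter hP (T := 𝒟 ×ˢ 𝒟) (fun p => U p ×ˢ V p)
    (fun p hp => Finset.product_subset_product (hUV p hp).1 (hUV p hp).2.1)
    (K := L ^ 24) (one_le_pow₀ hL1) (h𝒟ne.product h𝒟ne) (fun p hp => by
      obtain ⟨-, -, h1, h2, -⟩ := hUV p hp
      rw [Finset.card_product, Finset.card_product]
      push_cast
      calc (𝒟.card : ℝ) * 𝒟.card ≤ (L ^ 12 * (U p).card) * (L ^ 12 * (V p).card) := by gcongr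
        _ = _ := by ring)
  have hK : 2 * (L ^ 24) ^ 2 ≤ L ^ 49 := by
    calc 2 * (L ^ 24) ^ 2 ≤ L * (L ^ 24) ^ 2 := by gcongr
      _ = _ := by ring
  obtain ⟨hU0, hV0, hU0c, hV0c, hcell0⟩ := hUV p₀ hp₀
  refine ⟨p₀, hp₀, _, Finset.filter_subset _ _, hP'.trans (by gcongr), U p₀, hU0, ?_⟩
  have hcU := card_le_floorDilate (U := U p₀) hL0 (hα₁ p₀ hp₀)
  have hcV := card_le_floorDilate (U := V p₀) hL0 (hα₂ p₀ hp₀)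
  have hL3 : 2 * L + 1 ≤ L ^ 3 := by
    have : (2 : ℝ) ^ 2 ≤ L ^ 2 := pow_le_pow_left₀ (by norm_num) hL 2
    calc 2 * L + 1 ≤ L * 2 ^ 2 := by linarith
      _ ≤ L * L ^ 2 := by gcongr
      _ = _ := by ring
  have hbig : ∀ {W : Finset ℤ} {a : ℝ}, (𝒟.card : ℝ) ≤ L ^ 12 * W.card →
      (W.card : ℝ) ≤ (2 * L + 1) * (floorDilate W a).card →
      N ≤ L ^ 16 * (floorDilate W a).card := fun {W a} h1 h2 => by
    calc N ≤ L * (L ^ 12 * (L ^ 3 * (floorDilate W a).card)) := by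
          refine h𝒟N.trans ?_
          gcongr
          refine h1.trans ?_
          gcongr
          exact h2.trans (by gcongr)
      _ = _ := by ring
  set A := floorDilate (V p₀) (α₂ p₀) with hA
  set B := floorDilate (U p₀) (α₁ p₀) with hB
  have hAN := hbig hV0c hcV
  have hBN := hbig hU0c hcU
  rw [← hA] at hAN
  rw [← hB] at hBN
  have hAne : A.Nonempty := by
    rw [← Finset.card_pos]
    by_contra! hc
    have : A.card = 0 := by omega
    rw [this] at hAN
    simp at hAN; linarith
  have hAM : (A.card : ℝ) ≤ L * N := by
    refine le_trans ?_ h𝒟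
    exact_mod_cast Finset.card_image_le.trans (Finset.card_le_card hV0)
  have hAB : ((A + B).card : ℝ) ≤ L ^ 97 * A.card := by
    have h1 := card_floorDilate_add_le (U p₀) (V p₀) (α₁ p₀) (α₂ p₀)
    rw [← hA, ← hB, add_comm B A] at h1
    have h2 : ((A + B).card : ℝ) ≤ 2 * (cells (U p₀) (V p₀) (α₁ p₀) (α₂ p₀)).card := by
      exact_mod_cast h1
    calc _ ≤ _ := h2
      _ ≤ L * (L ^ 80 * (L ^ 16 * A.card)) := by
          gcongr; exact hcell0.trans (by gcongr)
      _ = _ := by ring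
  have hPl := fun m n => card_nsmul_sub_nsmul_le hAne hAB hAM m n
  refine ⟨by rw [card_scaleSet hs]; exact hBN, fun k => ?_, fun p hp => ?_⟩
  · have h1 : ((diffSet (scaleSet s B) k).card : ℝ) ≤ ((k • B - k • B).card : ℝ) := by
      exact_mod_cast card_diffSet_scaleSet_le s B k
    calc _ ≤ _ := h1.trans (hPl k k)
      _ = L ^ (97 * (k + k) + 1) * N := by ring
      _ ≤ L ^ (195 * (k + 1)) * N := by
          gcongr
          omega
      _ = _ := by rw [pow_mul]
  · rw [Finset.mem_filter] at hp
    obtain ⟨hpP, hp⟩ := hp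
    obtain ⟨hUp, hVp, -, -, hcellp⟩ := hUV p hpP
    rw [Finset.product_inter_product, Finset.card_product, Finset.card_product] at hp
    push_cast at hp
    have hU'le : ((U p ∩ U p₀).card : ℝ) ≤ 𝒟.card := by
      exact_mod_cast Finset.card_le_card (Finset.inter_subset_left.trans hUp)
    have hV'le : ((V p ∩ V p₀).card : ℝ) ≤ 𝒟.card := by
      exact_mod_cast Finset.card_le_card (Finset.inter_subset_left.trans hVp)
    have hlow : ∀ {x y : ℝ}, 0 ≤ x → 0 ≤ y → y ≤ 𝒟.card →
        (𝒟.card : ℝ) * 𝒟.card ≤ 2 * (L ^ 24) ^ 2 * (x * y) → N ≤ L ^ 195 * x := by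
      intro x y hx hy0 hy hxy
      have h1 : (𝒟.card : ℝ) ≤ L ^ 49 * x := by
        refine le_of_mul_le_mul_right ?_ h𝒟0
        calc _ ≤ _ := hxy
          _ ≤ L ^ 49 * (x * 𝒟.card) := by gcongr
          _ = _ := by ring
      calc N ≤ L * (L ^ 49 * x) := h𝒟N.trans (by gcongr)
        _ = L ^ 50 * x := by ring
        _ ≤ L ^ 195 * x := by
            gcongr
            norm_num
    have hpow : ∀ {x : ℝ}, x ≤ L → x ≤ L ^ 195 := fun hx =>
      hx.trans (le_self_pow₀ hL1 (by norm_num))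
    have hinv : ∀ {x : ℝ}, 1 / L ≤ x → 1 / L ^ 195 ≤ x := fun hx =>
      le_trans (one_div_le_one_div_of_le hL0 (le_self_pow₀ hL1 (by norm_num))) hx
    have h80 : L ^ 80 * N ≤ L ^ 195 * N := by
      gcongr
      norm_num
    have hsum : ((B + B).card : ℝ) ≤ L ^ 195 * N := by
      have := hPl 2 0
      rw [zero_nsmul, sub_zero, two_nsmul] at this
      calc _ ≤ _ := this
        _ = _ := by ring
    have hcells : ((cells (U p ∩ U p₀) (V p ∩ V p₀) (α₁ p) (α₂ p)).card : ℝ) ≤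
        (cells (U p) (V p) (α₁ p) (α₂ p)).card := by
      exact_mod_cast Finset.card_le_card
        (cells_mono Finset.inter_subset_left Finset.inter_subset_left)
    have := multLvl_of_cells (s := s) hN (hpow hL) hs (hinv (hα₂ p₀ hp₀)) (hpow (hα₂' p₀ hp₀))
      (hinv (hα₁ p₀ hp₀)) (hpow (hα₁' p hpP)) (hinv (hα₂ p hpP))
      (Finset.inter_subset_right (s₁ := U p) (s₂ := U p₀))
      (Finset.inter_subset_right (s₁ := V p) (s₂ := V p₀))
      (hlow (by positivity) (by positivity) hV'le hp)
      (hlow (by positivity) (by positivity) hU'le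
          (by rw [mul_comm ((V p ∩ V p₀).card : ℝ)]; exact hp))
      (hcell0.trans h80)
      (hcells.trans (hcellp.trans h80)) hsum
    rw [← pow_mul] at this
    exact this

end Pointwise

section RealInnerProductSpace

open scoped RealInnerProductSpace

section Frame

variable {V : Type*} [NormedAddCommGroup V] [InnerProductSpace ℝ V] {e : ℕ}

/-- Three convex sets and `e` points such that all choices of points span affinely, in a
quantitatively uniform way. -/
structure Frame (K : ℝ) (B₀ B₁ B₂ : Set V) (z : Fin e → V) : Prop where
  large : (e : ℝ) + 2 ≤ K
  conv₀ : Convex ℝ B₀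
  conv₁ : Convex ℝ B₁
  conv₂ : Convex ℝ B₂
  bdd : ∀ y ∈ B₀ ∪ B₁ ∪ B₂ ∪ range z, ∀ y' ∈ B₀ ∪ B₁ ∪ B₂ ∪ range z, ‖y - y'‖ ≤ K
  spread : ∀ p ∈ B₀, ∀ x ∈ B₁, ∀ w ∈ B₂, ∀ (a b c : ℝ) (μ : Fin e → ℝ), a + b + c + ∑ j, μ j = 0 →
    |a| ≤ K * ‖a • p + b • x + c • w + ∑ j, μ j • z j‖ ∧
    |b| ≤ K * ‖a • p + b • x + c • w + ∑ j, μ j • z j‖ ∧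
    |c| ≤ K * ‖a • p + b • x + c • w + ∑ j, μ j • z j‖ ∧
    ∀ j, |μ j| ≤ K * ‖a • p + b • x + c • w + ∑ j, μ j • z j‖
  span : ∀ p ∈ B₀, ∀ x ∈ B₁, ∀ w ∈ B₂, ∀ g : V, ∃ (a b c : ℝ) (μ : Fin e → ℝ),
    a + b + c + ∑ j, μ j = 0 ∧ g = a • p + b • x + c • w + ∑ j, μ j • z j

variable {K : ℝ} {B₀ B₁ B₂ : Set V} {z : Fin e → V}

lemma Frame.swap₀₁ (F : Frame K B₀ B₁ B₂ z) : Frame K B₁ B₀ B₂ z where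
  large := F.large
  conv₀ := F.conv₁
  conv₁ := F.conv₀
  conv₂ := F.conv₂
  bdd := by rw [union_comm B₁ B₀]; exact F.bdd
  spread p hp x hx w hw a b c μ h := by
    rw [add_comm a b] at h
    obtain ⟨h1, h2, h3, h4⟩ := F.spread x hx p hp w hw b a c μ h
    rw [add_comm (b • x)] at h1 h2 h3 h4
    exact ⟨h2, h1, h3, h4⟩
  span p hp x hx w hw g := by
    obtain ⟨a, b, c, μ, h, h'⟩ := F.span x hx p hp w hw g
    exact ⟨b, a, c, μ, by rw [add_comm b a]; exact h, by rw [add_comm (b • p)]; exact h'⟩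

lemma Frame.swap₁₂ (F : Frame K B₀ B₁ B₂ z) : Frame K B₀ B₂ B₁ z where
  large := F.large
  conv₀ := F.conv₀
  conv₁ := F.conv₂
  conv₂ := F.conv₁
  bdd := by rw [union_right_comm B₀ B₂ B₁]; exact F.bdd
  spread p hp x hx w hw a b c μ h := by
    rw [add_right_comm a b] at h
    obtain ⟨h1, h2, h3, h4⟩ := F.spread p hp w hw x hx a c b μ h
    rw [add_right_comm (a • p)] at h1 h2 h3 h4
    exact ⟨h1, h3, h2, h4⟩
  span p hp x hx w hw g := by
    obtain ⟨a, b, c, μ, h, h'⟩ := F.span p hp w hw x hx g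
    exact ⟨a, c, b, μ, by rw [add_right_comm a c]; exact h,
      by rw [add_right_comm (a • p)]; exact h'⟩

lemma Frame.two_le (F : Frame K B₀ B₁ B₂ z) : 2 ≤ K := by
  have := F.large
  have : (0 : ℝ) ≤ e := by positivity
  linarith

/-- A frame stays a frame with a larger constant. -/
lemma Frame.mono (F : Frame K B₀ B₁ B₂ z) {L : ℝ} (h : K ≤ L) : Frame L B₀ B₁ B₂ z where
  large := F.large.trans h
  conv₀ := F.conv₀
  conv₁ := F.conv₁
  conv₂ := F.conv₂
  bdd y hy y' hy' := (F.bdd y hy y' hy').trans h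
  spread p hp x hx w hw a b c μ h0 := by
    obtain ⟨h1, h2, h3, h4⟩ := F.spread p hp x hx w hw a b c μ h0
    refine ⟨h1.trans (by gcongr), h2.trans (by gcongr), h3.trans (by gcongr),
      fun j => (h4 j).trans (by gcongr)⟩
  span := F.span

lemma Frame.expand (F : Frame K B₀ B₁ B₂ z) {p x w : V} (hp : p ∈ B₀) (hx : x ∈ B₁) (hw : w ∈ B₂)
    (g : V) : ∃ (b c : ℝ) (μ : Fin e → ℝ),
      g = b • (x - p) + c • (w - p) + ∑ j, μ j • (z j - p) ∧ |b| ≤ K * ‖g‖ ∧ |c| ≤ K * ‖g‖ ∧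
      ∀ j, |μ j| ≤ K * ‖g‖ := by
  obtain ⟨a, b, c, μ, h, h'⟩ := F.span p hp x hx w hw g
  obtain ⟨-, h2, h3, h4⟩ := F.spread p hp x hx w hw a b c μ h
  rw [← h'] at h2 h3 h4
  refine ⟨b, c, μ, ?_, h2, h3, h4⟩
  have ha : a = -(b + c + ∑ j, μ j) := by linarith
  rw [h', ha]
  simp only [smul_sub, Finset.sum_sub_distrib, ← Finset.sum_smul]
  module

lemma Frame.mem₀ (F : Frame K B₀ B₁ B₂ z) {p p' : V} (hp : p ∈ B₀) (hp' : p' ∈ B₀) :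
    midpoint ℝ p p' ∈ B₀ := F.conv₀.midpoint_mem hp hp'

lemma dist_sq_sub (y y' v : V) :
    dist y v ^ 2 - dist y' v ^ 2 = 2 * ⟪y - y', midpoint ℝ y y' - v⟫ := by
  have h : ∀ a b : V, dist a b ^ 2 = ⟪a, a⟫ - 2 * ⟪a, b⟫ + ⟪b, b⟫ := fun a b => by
    rw [dist_eq_norm, @norm_sub_sq_real, real_inner_self_eq_norm_sq, real_inner_self_eq_norm_sq]
  rw [h, h, midpoint_eq_smul_add]
  simp only [inner_sub_left, inner_sub_right, inner_add_right, inner_smul_right, invOf_eq_inv]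
  rw [real_inner_comm y y']
  ring

lemma abs_inner_midpoint_le {y y' v : V} {σ : ℝ} (h : |dist y v ^ 2 - dist y' v ^ 2| ≤ σ) :
    |⟪y - y', midpoint ℝ y y' - v⟫| ≤ σ / 2 := by
  rw [dist_sq_sub, abs_mul, abs_of_pos (two_pos : (0 : ℝ) < 2)] at h
  linarith

/-- Pairing with a combination of vectors, most of which pair to something small. -/
lemma abs_inner_comb_sub_le (h u v : V) (t : Fin e → V) (b c : ℝ) (μ : Fin e → ℝ) {B σ : ℝ}
    (hμ : ∀ j, |μ j| ≤ B) (ht : ∀ j, |⟪h, t j⟫| ≤ σ) :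
    |⟪h, b • u + c • v + ∑ j, μ j • t j⟫ - b * ⟪h, u⟫ - c * ⟪h, v⟫| ≤ e * (B * σ) := by
  have : ⟪h, b • u + c • v + ∑ j, μ j • t j⟫ - b * ⟪h, u⟫ - c * ⟪h, v⟫ = ∑ j, μ j * ⟪h, t j⟫ := by
    simp only [inner_add_right, inner_sum, inner_smul_right]
    ring
  rw [this]
  calc _ ≤ ∑ j, |μ j * ⟪h, t j⟫| := Finset.abs_sum_le_sum_abs _ _
    _ ≤ ∑ _j : Fin e, B * σ := by
        refine Finset.sum_le_sum fun j _ => ?_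
        rw [abs_mul]
        exact mul_le_mul (hμ j) (ht j) (abs_nonneg _) ((abs_nonneg _).trans (hμ j))
    _ = _ := by simp

/-- A vector nearly orthogonal to a frame is small. -/
lemma Frame.norm_le_of_inner (F : Frame K B₀ B₁ B₂ z) {p x w g : V} (hp : p ∈ B₀) (hx : x ∈ B₁)
    (hw : w ∈ B₂) {σ : ℝ} (hσ : 0 ≤ σ) (h1 : |⟪g, x - p⟫| ≤ σ) (h2 : |⟪g, w - p⟫| ≤ σ)
    (h3 : ∀ j, |⟪g, z j - p⟫| ≤ σ) : ‖g‖ ≤ K ^ 2 * σ := by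
  obtain ⟨b, c, μ, hg, hb, hc, hμ⟩ := F.expand hp hx hw g
  have h4 := abs_inner_comb_sub_le g (x - p) (w - p) (fun j => z j - p) b c μ hμ h3
  rw [← hg, real_inner_self_eq_norm_sq] at h4
  have hK := F.two_le
  have hbx : |b * ⟪g, x - p⟫| ≤ K * ‖g‖ * σ := by
    rw [abs_mul]; exact mul_le_mul hb h1 (abs_nonneg _) (by positivity)
  have hcx : |c * ⟪g, w - p⟫| ≤ K * ‖g‖ * σ := by
    rw [abs_mul]; exact mul_le_mul hc h2 (abs_nonneg _) (by positivity)
  have h5 : ‖g‖ ^ 2 ≤ ‖g‖ * (K ^ 2 * σ) := by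
    have h6 : ((e : ℝ) + 2) * (K * ‖g‖ * σ) ≤ K * (K * ‖g‖ * σ) := by
      gcongr; exact F.large
    nlinarith [(abs_le.1 h4).2, (abs_le.1 hbx).2, (abs_le.1 hcx).2]
  rcases (norm_nonneg g).eq_or_lt with h | h
  · rw [← h]; positivity
  · rw [sq] at h5; exact le_of_mul_le_mul_left h5 h

/-- A point is determined by its distances to the other points of a frame. -/
lemma Frame.norm_sub_le (F : Frame K B₀ B₁ B₂ z) {p p' x w : V} (hp : p ∈ B₀) (hp' : p' ∈ B₀)
    (hx : x ∈ B₁) (hw : w ∈ B₂) {σ : ℝ} (hσ : 0 ≤ σ) (h1 : |dist p x ^ 2 - dist p' x ^ 2| ≤ σ)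
    (h2 : |dist p w ^ 2 - dist p' w ^ 2| ≤ σ)
    (h3 : ∀ j, |dist p (z j) ^ 2 - dist p' (z j) ^ 2| ≤ σ) : ‖p - p'‖ ≤ K ^ 2 * σ := by
  have h : ∀ {v : V}, |dist p v ^ 2 - dist p' v ^ 2| ≤ σ →
      |⟪p - p', v - midpoint ℝ p p'⟫| ≤ σ := fun {v} hv => by
    have := abs_inner_midpoint_le hv
    rw [← neg_sub (midpoint ℝ p p') v, inner_neg_right, abs_neg]
    linarith
  exact F.norm_le_of_inner (F.mem₀ hp hp') hx hw hσ (h h1) (h h2) fun j => h (h3 j)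

end Frame

section Frame

variable {V : Type*} [NormedAddCommGroup V] [InnerProductSpace ℝ V] {e : ℕ}
  {K : ℝ} {B₀ B₁ B₂ : Set V} {z : Fin e → V}

lemma Frame.norm_sub_le_const (F : Frame K B₀ B₁ B₂ z) {y y' : V}
    (hy : y ∈ B₀ ∪ B₁ ∪ B₂) (hy' : y' ∈ B₀ ∪ B₁ ∪ B₂) : ‖y - y'‖ ≤ K :=
  F.bdd y (Or.inl hy) y' (Or.inl hy')

lemma le_of_sq_le_mul {a b : ℝ} (ha : 0 ≤ a) (hb : 0 ≤ b) (h : a ^ 2 ≤ a * b) : a ≤ b := by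
  rcases ha.eq_or_lt with h0 | h0
  · rw [← h0]; exact hb
  · rw [sq] at h; exact le_of_mul_le_mul_left h h0

lemma Frame.transverse (F : Frame K B₀ B₁ B₂ z) {p x w f : V} (hp : p ∈ B₀) (hx : x ∈ B₁)
    (hw : w ∈ B₂) {σ : ℝ} (hσ : 0 ≤ σ) (h1 : |⟪f, x - p⟫| ≤ σ) (h3 : ∀ j, |⟪f, z j - p⟫| ≤ σ)
    (hf : 1 / K ≤ ‖f‖) (hσK : 2 * K ^ 3 * σ ≤ 1) :
    1 ≤ 2 * K ^ 2 * |⟪f, w - p⟫| ∧ ∃ (b c : ℝ) (μ : Fin e → ℝ),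
      f = b • (x - p) + c • (w - p) + ∑ j, μ j • (z j - p) ∧ |b| ≤ K * ‖f‖ ∧
      (∀ j, |μ j| ≤ K * ‖f‖) ∧ 1 ≤ 2 * K ^ 2 * |c| := by
  obtain ⟨b, c, μ, hg, hb, hc, hμ⟩ := F.expand hp hx hw f
  have h4 := abs_inner_comb_sub_le f (x - p) (w - p) (fun j => z j - p) b c μ hμ h3
  rw [← hg, real_inner_self_eq_norm_sq] at h4
  have hK := F.two_le
  have hK0 : 0 < K := by linarith
  have hbx : |b * ⟪f, x - p⟫| ≤ K * ‖f‖ * σ := by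
    rw [abs_mul]; exact mul_le_mul hb h1 (abs_nonneg _) (by positivity)
  have h5 : ‖f‖ ^ 2 ≤ |c| * |⟪f, w - p⟫| + K ^ 2 * ‖f‖ * σ := by
    have h6 : ((e : ℝ) + 1) * (K * ‖f‖ * σ) ≤ K * (K * ‖f‖ * σ) := by
      gcongr; linarith [F.large]
    have h7 := le_abs_self (c * ⟪f, w - p⟫)
    rw [abs_mul] at h7
    nlinarith [(abs_le.1 h4).2, (abs_le.1 hbx).2]
  have hfK : 1 ≤ K * ‖f‖ := by
    rw [div_le_iff₀ hK0] at hf; linarith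
  have hwp : ‖w - p‖ ≤ K := F.norm_sub_le_const (Or.inr hw) (Or.inl (Or.inl hp))
  have hin : |⟪f, w - p⟫| ≤ ‖f‖ * K := (abs_real_inner_le_norm _ _).trans (by gcongr)
  have key : ∀ {t : ℝ}, 0 ≤ t → ‖f‖ ^ 2 ≤ ‖f‖ * (K * t + K ^ 2 * σ) → 1 ≤ 2 * K ^ 2 * t := by
    intro t ht h
    have h8 := le_of_sq_le_mul (norm_nonneg f) (by positivity) h
    have h9 : K * ‖f‖ ≤ K * (K * t + K ^ 2 * σ) := by gcongr
    nlinarith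
  refine ⟨key (abs_nonneg _) ?_, b, c, μ, hg, hb, hμ, key (abs_nonneg _) ?_⟩
  · have : |c| * |⟪f, w - p⟫| ≤ K * ‖f‖ * |⟪f, w - p⟫| := by gcongr
    nlinarith
  · have : |c| * |⟪f, w - p⟫| ≤ |c| * (‖f‖ * K) := by gcongr
    nlinarith

/-- Distances to two points at separated positions of `B₁` and to the `z j` nearly determine a
point of the bisector in `B₀`. -/
lemma Frame.norm_sub_le_of_bisector (F : Frame K B₀ B₁ B₂ z) {p p' x x' w : V} (hp : p ∈ B₀)
    (hp' : p' ∈ B₀) (hx : x ∈ B₁) (hx' : x' ∈ B₁) (hw : w ∈ B₂) {σ : ℝ} (hσ : 0 ≤ σ)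
    (hσK : 2 * K ^ 3 * σ ≤ 1) (hf : 1 / K ≤ ‖x - x'‖)
    (hxz : ∀ j, |dist x (z j) ^ 2 - dist x' (z j) ^ 2| ≤ σ)
    (hpz : ∀ j, |dist p (z j) ^ 2 - dist p' (z j) ^ 2| ≤ σ)
    (h1 : |dist p x ^ 2 - dist p x' ^ 2| ≤ σ) (h2 : |dist p' x ^ 2 - dist p' x' ^ 2| ≤ σ)
    (h3 : |dist p x ^ 2 - dist p' x ^ 2| ≤ σ) : ‖p - p'‖ ≤ K ^ 9 * σ := by
  have hK := F.two_le
  have hK0 : 0 < K := by linarith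
  set f := x - x' with hfdef
  set g := p - p' with hgdef
  set M := midpoint ℝ p p' with hM
  set m := midpoint ℝ x x' with hm
  have hMB : M ∈ B₀ := F.conv₀.midpoint_mem hp hp'
  have hmB : m ∈ B₁ := F.conv₁.midpoint_mem hx hx'
  have e1 := abs_le.1 (abs_inner_midpoint_le (y := x) (y' := x') (v := p)
      (σ := σ) (by rwa [dist_comm x, dist_comm x']))
  have e2 := abs_le.1 (abs_inner_midpoint_le (y := x) (y' := x') (v := p')
      (σ := σ) (by rwa [dist_comm x, dist_comm x']))
  have e3 := fun j => abs_le.1 (abs_inner_midpoint_le (hxz j))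
  have e4 := fun j => abs_le.1 (abs_inner_midpoint_le (hpz j))
  have e5 := abs_le.1 (abs_inner_midpoint_le h3)
  have e6 := abs_le.1 (abs_inner_midpoint_le (y := p) (y' := p') (v := x') (σ := 3 * σ) (by
    rw [abs_le] at *; constructor <;> linarith [h1.1, h1.2, h2.1, h2.2, h3.1, h3.2]))
  rw [← hfdef, ← hm] at e1 e2 e3
  rw [← hgdef, ← hM] at e4 e5 e6
  have hMe : ∀ h : V, ⟪h, M⟫ = (⟪h, p⟫ + ⟪h, p'⟫) / 2 := fun h => by
    rw [hM, midpoint_eq_smul_add, inner_smul_right, inner_add_right, invOf_eq_inv]; ring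
  have hme : ∀ h : V, ⟪h, m⟫ = (⟪h, x⟫ + ⟪h, x'⟫) / 2 := fun h => by
    rw [hm, midpoint_eq_smul_add, inner_smul_right, inner_add_right, invOf_eq_inv]; ring
  simp only [inner_sub_right] at e1 e2 e3 e4 e5 e6
  have a1 : |⟪f, m - M⟫| ≤ σ := by
    rw [abs_le, inner_sub_right, hMe]; constructor <;> linarith
  have a2 : ∀ j, |⟪f, z j - M⟫| ≤ σ := fun j => by
    rw [abs_le, inner_sub_right, hMe]; constructor <;> linarith [(e3 j).1, (e3 j).2]
  obtain ⟨-, b, c, μ, hfe, hb, hμ, hc⟩ := F.transverse hMB hmB hw hσ a1 a2 hf hσK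
  have a3 : |⟪g, m - M⟫| ≤ 2 * σ := by
    rw [abs_le, inner_sub_right, hme]; constructor <;> linarith
  have a4 : ∀ j, |⟪g, z j - M⟫| ≤ σ := fun j => by
    rw [abs_le, inner_sub_right]; constructor <;> linarith [(e4 j).1, (e4 j).2]
  have a5 : |⟪g, f⟫| ≤ 2 * σ := by
    rw [abs_le, hfdef, inner_sub_right]; constructor <;> linarith
  have hfK : ‖f‖ ≤ K := F.norm_sub_le_const (Or.inl (Or.inr hx)) (Or.inl (Or.inr hx'))
  have hKf : K * ‖f‖ ≤ K ^ 2 := by rw [sq]; gcongr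
  have a6 := abs_inner_comb_sub_le g (m - M) (w - M) (fun j => z j - M) b c μ
    (fun j => (hμ j).trans hKf) a4
  rw [← hfe] at a6
  have a7 : |b * ⟪g, m - M⟫| ≤ K ^ 2 * (2 * σ) := by
    rw [abs_mul]; exact mul_le_mul (hb.trans hKf) a3 (abs_nonneg _) (by positivity)
  have k2 : 4 ≤ K ^ 2 := by nlinarith
  have a8 : |c| * |⟪g, w - M⟫| ≤ 2 * K ^ 3 * σ := by
    have h6 : ((e : ℝ) + 2) * (K ^ 2 * σ) ≤ K * (K ^ 2 * σ) := by
      gcongr; exact F.large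
    have h7 : 2 * σ ≤ K ^ 3 * σ := by gcongr; nlinarith
    rw [← abs_mul, abs_le]
    rw [abs_le] at a5 a6 a7
    constructor <;> linarith [a5.1, a5.2, a6.1, a6.2, a7.1, a7.2]
  have a9 : |⟪g, w - M⟫| ≤ 4 * K ^ 5 * σ := by
    calc |⟪g, w - M⟫| ≤ (2 * K ^ 2 * |c|) * |⟪g, w - M⟫| := le_mul_of_one_le_left (abs_nonneg _) hc
      _ = 2 * K ^ 2 * (|c| * |⟪g, w - M⟫|) := by ring
      _ ≤ 2 * K ^ 2 * (2 * K ^ 3 * σ) := by gcongr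
      _ = _ := by ring
  have k5 : 1 ≤ K ^ 5 := one_le_pow₀ (by linarith)
  have hb1 : σ ≤ 4 * K ^ 5 * σ := by nlinarith
  have hb2 : 2 * σ ≤ 4 * K ^ 5 * σ := by nlinarith
  refine (F.norm_le_of_inner hMB hmB hw (by positivity) (a3.trans hb2) a9
    fun j => (a4 j).trans hb1).trans ?_
  calc K ^ 2 * (4 * K ^ 5 * σ) ≤ K ^ 2 * (K ^ 2 * K ^ 5 * σ) := by gcongr
    _ = _ := by ring

/-- `p` is nearly equidistant from `x` and `x'`. -/
def NearBisector (σ : ℝ) (x x' p : V) : Prop := |dist p x ^ 2 - dist p x' ^ 2| ≤ σ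

lemma inner_midpoint_right (h p p' : V) : ⟪h, midpoint ℝ p p'⟫ = (⟪h, p⟫ + ⟪h, p'⟫) / 2 := by
  rw [midpoint_eq_smul_add, inner_smul_right, inner_add_right, invOf_eq_inv]; ring

/-- Points of a bisector are nearly orthogonal to its normal. -/
lemma NearBisector.inner_bounds {σ : ℝ} {x x' p₁ p₂ p₃ : V}
    (hxz : ∀ j, |dist x (z j) ^ 2 - dist x' (z j) ^ 2| ≤ σ)
    (h₁ : NearBisector σ x x' p₁) (h₂ : NearBisector σ x x' p₂) (h₃ : NearBisector σ x x' p₃) :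
    |⟪x - x', midpoint ℝ x x' - midpoint ℝ p₁ p₂⟫| ≤ σ ∧
    (∀ j, |⟪x - x', z j - midpoint ℝ p₁ p₂⟫| ≤ σ) ∧
    |⟪x - x', p₃ - midpoint ℝ p₁ p₂⟫| ≤ σ ∧ |⟪x - x', p₂ - p₁⟫| ≤ σ := by
  have H : ∀ {p : V}, NearBisector σ x x' p →
      |⟪x - x', midpoint ℝ x x' - p⟫| ≤ σ / 2 := fun {p} hp =>
    abs_inner_midpoint_le (by rw [dist_comm x, dist_comm x']; exact hp)
  have e1 := abs_le.1 (H h₁)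
  have e2 := abs_le.1 (H h₂)
  have e3 := abs_le.1 (H h₃)
  have e4 := fun j => abs_le.1 (abs_inner_midpoint_le (hxz j))
  simp only [inner_sub_right _ (midpoint ℝ x x')] at e1 e2 e3 e4
  refine ⟨?_, fun j => ?_, ?_, ?_⟩
  · rw [abs_le, inner_sub_right, inner_midpoint_right _ p₁]; constructor <;> linarith
  · rw [abs_le, inner_sub_right, inner_midpoint_right _ p₁]
    constructor <;> linarith [(e4 j).1, (e4 j).2]
  · rw [abs_le, inner_sub_right, inner_midpoint_right _ p₁]; constructor <;> linarith
  · rw [abs_le, inner_sub_right]; constructor <;> linarith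

/-- The component transverse to the bisector of a vector along the bisector is small. -/
lemma Frame.abs_coeff_le (F : Frame K B₀ B₁ B₂ z) {M m w f v : V} {σ : ℝ} (hσ : 0 ≤ σ)
    (hT : 1 ≤ 2 * K ^ 2 * |⟪f, w - M⟫|) (h1 : |⟪f, m - M⟫| ≤ σ) (h3 : ∀ j, |⟪f, z j - M⟫| ≤ σ)
    (hv : |⟪f, v⟫| ≤ σ) (hvK : ‖v‖ ≤ K) {b c : ℝ} {μ : Fin e → ℝ}
    (hve : v = b • (m - M) + c • (w - M) + ∑ j, μ j • (z j - M)) (hb : |b| ≤ K * ‖v‖)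
    (hμ : ∀ j, |μ j| ≤ K * ‖v‖) : |c| ≤ K ^ 7 * σ := by
  have hK := F.two_le
  have hK0 : 0 < K := by linarith
  have hKv : K * ‖v‖ ≤ K ^ 2 := by rw [sq]; gcongr
  have a6 := abs_inner_comb_sub_le f (m - M) (w - M) (fun j => z j - M) b c μ
    (fun j => (hμ j).trans hKv) h3
  rw [← hve] at a6
  have a7 : |b * ⟪f, m - M⟫| ≤ K ^ 2 * σ := by
    rw [abs_mul]; exact mul_le_mul (hb.trans hKv) h1 (abs_nonneg _) (by positivity)
  have k2 : 4 ≤ K ^ 2 := by nlinarith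
  have a8 : |c| * |⟪f, w - M⟫| ≤ K ^ 3 * σ := by
    have h6 : ((e : ℝ) + 2) * (K ^ 2 * σ) ≤ K * (K ^ 2 * σ) := by
      gcongr; exact F.large
    have h7 : σ ≤ K ^ 2 * σ := by nlinarith
    rw [← abs_mul, abs_le]
    rw [abs_le] at a6 a7 hv
    constructor <;> linarith [hv.1, hv.2, a6.1, a6.2, a7.1, a7.2]
  calc |c| ≤ (2 * K ^ 2 * |⟪f, w - M⟫|) * |c| := le_mul_of_one_le_left (abs_nonneg _) hT
    _ = 2 * K ^ 2 * (|c| * |⟪f, w - M⟫|) := by ring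
    _ ≤ K ^ 2 * K ^ 2 * (K ^ 3 * σ) := by gcongr; linarith
    _ = _ := by ring

lemma Frame.exists_direction (F : Frame K B₀ B₁ B₂ z) {p₁ p₂ x x' w : V} (hp₁ : p₁ ∈ B₀)
    (hp₂ : p₂ ∈ B₀) (hx : x ∈ B₁) (hx' : x' ∈ B₁) (hw : w ∈ B₂) {σ : ℝ} (hσ : 0 ≤ σ)
    (hσK : 2 * K ^ 10 * σ ≤ 1) (hf : 1 / K ≤ ‖x - x'‖) (he : 1 / K ≤ ‖p₂ - p₁‖)
    (hxz : ∀ j, |dist x (z j) ^ 2 - dist x' (z j) ^ 2| ≤ σ)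
    (hpz : ∀ j, |dist p₁ (z j) ^ 2 - dist p₂ (z j) ^ 2| ≤ σ)
    (h₁ : NearBisector σ x x' p₁) (h₂ : NearBisector σ x x' p₂) :
    1 ≤ 2 * K ^ 2 * |⟪x - x', w - midpoint ℝ p₁ p₂⟫| ∧ ∃ (b c : ℝ) (μ : Fin e → ℝ),
      p₂ - p₁ = b • (midpoint ℝ x x' - midpoint ℝ p₁ p₂) + c • (w - midpoint ℝ p₁ p₂) +
        ∑ j, μ j • (z j - midpoint ℝ p₁ p₂) ∧ |c| ≤ K ^ 7 * σ ∧ (∀ j, |μ j| ≤ K ^ 2) ∧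
      1 ≤ 2 * K ^ 2 * |b| := by
  have hK := F.two_le
  have hK0 : 0 < K := by linarith
  obtain ⟨a1, a2, -, a4⟩ := NearBisector.inner_bounds hxz h₁ h₂ h₁
  set M := midpoint ℝ p₁ p₂ with hM
  set m := midpoint ℝ x x' with hm
  have hMB : M ∈ B₀ := F.conv₀.midpoint_mem hp₁ hp₂
  have hmB : m ∈ B₁ := F.conv₁.midpoint_mem hx hx'
  have k37 : K ^ 10 = K ^ 3 * K ^ 7 := by ring
  have k7 : 1 ≤ K ^ 7 := one_le_pow₀ (by linarith)
  have k3 : 1 ≤ K ^ 3 := one_le_pow₀ (by linarith)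
  obtain ⟨hT, -⟩ := F.transverse hMB hmB hw hσ a1 a2 hf (by
    refine le_trans ?_ hσK
    gcongr
    · linarith
    · norm_num)
  refine ⟨hT, ?_⟩
  obtain ⟨b, c, μ, hve, hb, -, hμ⟩ := F.expand hMB hmB hw (p₂ - p₁)
  have hvK : ‖p₂ - p₁‖ ≤ K := F.norm_sub_le_const (Or.inl (Or.inl hp₂)) (Or.inl (Or.inl hp₁))
  have hc := F.abs_coeff_le hσ hT a1 a2 a4 hvK hve hb hμ
  refine ⟨b, c, μ, hve, hc, fun j => (hμ j).trans (by rw [sq]; gcongr), ?_⟩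
  set v := p₂ - p₁ with hv
  have e4 : ∀ j, |⟪v, z j - M⟫| ≤ σ := fun j => by
    have := abs_inner_midpoint_le (hpz j)
    rw [← hM, ← neg_sub p₂ p₁, inner_neg_left, abs_neg, ← neg_sub (z j) M, inner_neg_right,
      abs_neg] at this
    linarith
  have a6 := abs_inner_comb_sub_le v (m - M) (w - M) (fun j => z j - M) b c μ hμ e4
  rw [← hve, real_inner_self_eq_norm_sq] at a6
  have hmM : ‖m - M‖ ≤ K := F.norm_sub_le_const (Or.inl (Or.inr hmB)) (Or.inl (Or.inl hMB))
  have hwM : ‖w - M‖ ≤ K := F.norm_sub_le_const (Or.inr hw) (Or.inl (Or.inl hMB))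
  have b1 : |b * ⟪v, m - M⟫| ≤ |b| * (‖v‖ * K) := by
    rw [abs_mul]; gcongr
    exact (abs_real_inner_le_norm _ _).trans (by gcongr)
  have b2 : |c * ⟪v, w - M⟫| ≤ K ^ 7 * σ * (‖v‖ * K) := by
    rw [abs_mul]; gcongr
    exact (abs_real_inner_le_norm _ _).trans (by gcongr)
  have h6 : (e : ℝ) * (K * ‖v‖ * σ) ≤ K * (K * ‖v‖ * σ) := by
    gcongr; linarith [F.large]
  have h7 : ‖v‖ ^ 2 ≤ ‖v‖ * (K * |b| + (K ^ 8 * σ + K ^ 2 * σ)) := by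
    nlinarith [(abs_le.1 a6).2, (abs_le.1 b1).2, (abs_le.1 b2).2]
  have h8 := le_of_sq_le_mul (norm_nonneg v) (by positivity) h7
  have h9 : 1 ≤ K * ‖v‖ := by
    rw [div_le_iff₀ hK0] at he; linarith
  have h10 : K * ‖v‖ ≤ K * (K * |b| + (K ^ 8 * σ + K ^ 2 * σ)) := by gcongr
  have h11 : 2 * (K * (K ^ 8 * σ + K ^ 2 * σ)) ≤ 2 * K ^ 10 * σ := by
    have h12 : K ^ 3 * σ ≤ K ^ 9 * σ := by
      gcongr
      · linarith
      · norm_num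
    have h13 : 2 * (K ^ 9 * σ) ≤ K * (K ^ 9 * σ) := by gcongr
    nlinarith
  nlinarith

/-- Distances to `p₁`, `p₂` and the `z j` nearly determine a point of `B₂`. -/
lemma Frame.norm_sub_le_of_pencil (F : Frame K B₀ B₁ B₂ z) {p₁ p₂ x x' w w' : V} (hp₁ : p₁ ∈ B₀)
    (hp₂ : p₂ ∈ B₀) (hx : x ∈ B₁) (hx' : x' ∈ B₁) (hw : w ∈ B₂) (hw' : w' ∈ B₂) {σ : ℝ}
    (hσ : 0 ≤ σ) (hσK : 2 * K ^ 10 * σ ≤ 1) (hf : 1 / K ≤ ‖x - x'‖) (he : 1 / K ≤ ‖p₂ - p₁‖)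
    (hxz : ∀ j, |dist x (z j) ^ 2 - dist x' (z j) ^ 2| ≤ σ)
    (hpz : ∀ j, |dist p₁ (z j) ^ 2 - dist p₂ (z j) ^ 2| ≤ σ)
    (h₁ : NearBisector σ x x' p₁) (h₂ : NearBisector σ x x' p₂)
    (hwz : ∀ j, |dist w (z j) ^ 2 - dist w' (z j) ^ 2| ≤ σ)
    (hw₁ : |dist w p₁ ^ 2 - dist w' p₁ ^ 2| ≤ σ) (hw₂ : |dist w p₂ ^ 2 - dist w' p₂ ^ 2| ≤ σ) :
    ‖w - w'‖ ≤ K ^ 14 * σ := by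
  have hK := F.two_le
  have hK0 : 0 < K := by linarith
  have hWB : midpoint ℝ w w' ∈ B₂ := F.conv₂.midpoint_mem hw hw'
  obtain ⟨-, b, c, μ, hve, hc, hμ, hb⟩ := F.exists_direction hp₁ hp₂ hx hx' hWB hσ hσK hf he hxz
    hpz h₁ h₂
  set M := midpoint ℝ p₁ p₂ with hM
  set m := midpoint ℝ x x' with hm
  set W := midpoint ℝ w w' with hW
  have hMB : M ∈ B₀ := F.conv₀.midpoint_mem hp₁ hp₂
  have hmB : m ∈ B₁ := F.conv₁.midpoint_mem hx hx'
  set u := w - w' with hu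
  have e1 := abs_le.1 (abs_inner_midpoint_le hw₁)
  have e2 := abs_le.1 (abs_inner_midpoint_le hw₂)
  have e3 := fun j => abs_le.1 (abs_inner_midpoint_le (hwz j))
  rw [← hu, ← hW] at e1 e2 e3
  simp only [inner_sub_right _ W] at e1 e2 e3
  have f1 : |⟪u, p₂ - p₁⟫| ≤ σ := by
    rw [abs_le, inner_sub_right]; constructor <;> linarith
  have f2 : |⟪u, W - M⟫| ≤ σ := by
    rw [abs_le, inner_sub_right, hM, inner_midpoint_right _ p₁]; constructor <;> linarith
  have f3 : ∀ j, |⟪u, z j - M⟫| ≤ σ := fun j => by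
    rw [abs_le, inner_sub_right, hM, inner_midpoint_right _ p₁]
    constructor <;> linarith [(e3 j).1, (e3 j).2]
  have f4 : ∀ j, |⟪u, z j - W⟫| ≤ σ := fun j => by
    rw [abs_le, inner_sub_right]
    constructor <;> linarith [(e3 j).1, (e3 j).2]
  have a6 := abs_inner_comb_sub_le u (m - M) (W - M) (fun j => z j - M) b c μ hμ f3
  rw [← hve] at a6
  have k37 : 2 * K ^ 10 * σ = 2 * K ^ 3 * (K ^ 7 * σ) := by ring
  have k3 : 1 ≤ K ^ 3 := one_le_pow₀ (by linarith)
  have hc1 : |c| ≤ 1 := hc.trans (by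
    have : 0 ≤ K ^ 7 * σ := by positivity
    nlinarith)
  have a7 : |c * ⟪u, W - M⟫| ≤ σ := by
    rw [abs_mul]
    calc |c| * |⟪u, W - M⟫| ≤ 1 * σ := by gcongr
      _ = σ := one_mul _
  have k2 : 4 ≤ K ^ 2 := by nlinarith
  have a8 : |b| * |⟪u, m - M⟫| ≤ K ^ 3 * σ := by
    have h6 : ((e : ℝ) + 2) * (K ^ 2 * σ) ≤ K * (K ^ 2 * σ) := by
      gcongr; exact F.large
    have h7 : σ ≤ K ^ 2 * σ := by nlinarith
    rw [← abs_mul, abs_le]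
    rw [abs_le] at a6 a7 f1
    constructor <;> linarith [f1.1, f1.2, a6.1, a6.2, a7.1, a7.2]
  have a9 : |⟪u, m - M⟫| ≤ 2 * K ^ 5 * σ := by
    calc _ ≤ (2 * K ^ 2 * |b|) * |⟪u, m - M⟫| := le_mul_of_one_le_left (abs_nonneg _) hb
      _ = 2 * K ^ 2 * (|b| * |⟪u, m - M⟫|) := by ring
      _ ≤ 2 * K ^ 2 * (K ^ 3 * σ) := by gcongr
      _ = _ := by ring
  have k5 : 1 ≤ K ^ 5 := one_le_pow₀ (by linarith)
  have hb1 : σ ≤ K ^ 5 * σ := by nlinarith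
  have a10 : |⟪u, m - W⟫| ≤ 4 * K ^ 5 * σ := by
    have : ⟪u, m - W⟫ = ⟪u, m - M⟫ - ⟪u, W - M⟫ := by rw [← inner_sub_right]; congr 1; abel
    rw [this, abs_le]
    rw [abs_le] at a9 f2
    constructor <;> linarith [a9.1, a9.2, f2.1, f2.2]
  have f2' : |⟪u, M - W⟫| ≤ 4 * K ^ 5 * σ := by
    rw [← neg_sub, inner_neg_right, abs_neg]; linarith
  refine (F.swap₀₁.swap₁₂.swap₀₁.norm_le_of_inner hWB hmB hMB (by positivity) a10 f2'
    fun j => (f4 j).trans (by linarith)).trans ?_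
  calc K ^ 2 * (4 * K ^ 5 * σ) ≤ K ^ 2 * (K ^ 2 * K ^ 5 * σ) := by gcongr
    _ = K ^ 9 * σ := by ring
    _ ≤ _ := by
      gcongr
      · linarith
      · norm_num

end Frame

section Frame

variable {V : Type*} [NormedAddCommGroup V] [InnerProductSpace ℝ V] {e : ℕ}
  {K : ℝ} {B₀ B₁ B₂ : Set V} {z : Fin e → V}

/-- Points of a bisector lie close to the affine span of two of them and the `z j`. -/
lemma Frame.exists_affine_comb (F : Frame K B₀ B₁ B₂ z) {p₁ p₂ p₃ x x' w : V} (hp₁ : p₁ ∈ B₀)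
    (hp₂ : p₂ ∈ B₀) (hp₃ : p₃ ∈ B₀) (hx : x ∈ B₁) (hx' : x' ∈ B₁) (hw : w ∈ B₂) {σ : ℝ}
    (hσ : 0 ≤ σ) (hσK : 2 * K ^ 10 * σ ≤ 1) (hf : 1 / K ≤ ‖x - x'‖) (he : 1 / K ≤ ‖p₂ - p₁‖)
    (hxz : ∀ j, |dist x (z j) ^ 2 - dist x' (z j) ^ 2| ≤ σ)
    (hpz : ∀ j, |dist p₁ (z j) ^ 2 - dist p₂ (z j) ^ 2| ≤ σ)
    (h₁ : NearBisector σ x x' p₁) (h₂ : NearBisector σ x x' p₂) (h₃ : NearBisector σ x x' p₃) :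
    ∃ (α₁ α₂ : ℝ) (μ : Fin e → ℝ), α₁ + α₂ + ∑ j, μ j = 1 ∧ |α₁| ≤ K ^ 10 ∧ |α₂| ≤ K ^ 10 ∧
      (∀ j, |μ j| ≤ K ^ 8) ∧ ‖p₃ - (α₁ • p₁ + α₂ • p₂ + ∑ j, μ j • z j)‖ ≤ K ^ 14 * σ := by
  have hK := F.two_le
  have hK0 : 0 < K := by linarith
  have hK1 : 1 ≤ K := by linarith
  have k2 : 4 ≤ K ^ 2 := by nlinarith
  obtain ⟨hT, b, c, μ, hve, hc, hμ, hb⟩ := F.exists_direction hp₁ hp₂ hx hx' hw hσ hσK hf he hxz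
    hpz h₁ h₂
  obtain ⟨a1, a2, a3, -⟩ := NearBisector.inner_bounds hxz h₁ h₂ h₃
  set M := midpoint ℝ p₁ p₂ with hM
  set m := midpoint ℝ x x' with hm
  have hMB : M ∈ B₀ := F.conv₀.midpoint_mem hp₁ hp₂
  have hmB : m ∈ B₁ := F.conv₁.midpoint_mem hx hx'
  obtain ⟨b', c', μ', hv', hb', -, hμ'⟩ := F.expand hMB hmB hw (p₃ - M)
  have hvK : ‖p₃ - M‖ ≤ K := F.norm_sub_le_const (Or.inl (Or.inl hp₃)) (Or.inl (Or.inl hMB))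
  have hc' := F.abs_coeff_le hσ hT a1 a2 a3 hvK hv' hb' hμ'
  have hvK2 : K * ‖p₃ - M‖ ≤ K ^ 2 := by rw [sq]; gcongr
  have hb0 : b ≠ 0 := by
    rintro rfl; simp at hb; linarith
  have hwM : ‖w - M‖ ≤ K := F.norm_sub_le_const (Or.inr hw) (Or.inl (Or.inl hMB))
  set κ := b' / b with hκ
  have hκb : κ * b = b' := by rw [hκ]; field_simp
  have hκK : |κ| ≤ 2 * K ^ 4 := by
    rw [hκ, abs_div, div_le_iff₀ (abs_pos.2 hb0)]
    calc |b'| ≤ K ^ 2 * 1 := by linarith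
      _ ≤ K ^ 2 * (2 * K ^ 2 * |b|) := by gcongr
      _ = _ := by ring
  have k4 : 1 ≤ K ^ 4 := one_le_pow₀ hK1
  set ν : Fin e → ℝ := fun j => μ' j - κ * μ j with hν
  have hνK : ∀ j, |ν j| ≤ K ^ 8 := fun j => by
    have h1 : |κ * μ j| ≤ 2 * K ^ 4 * K ^ 2 := by
      rw [abs_mul]; exact mul_le_mul hκK (hμ j) (abs_nonneg _) (by positivity)
    have h2 := abs_sub (μ' j) (κ * μ j)
    have h3 := (hμ' j).trans hvK2
    have h4 : K ^ 2 ≤ K ^ 6 := pow_le_pow_right₀ hK1 (by norm_num)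
    have h5 : K ^ 8 = K ^ 2 * K ^ 6 := by ring
    have h6 : 2 * K ^ 4 * K ^ 2 = 2 * K ^ 6 := by ring
    have h7 : 4 * K ^ 6 ≤ K ^ 2 * K ^ 6 := by gcongr
    calc |ν j| ≤ |μ' j| + |κ * μ j| := h2
      _ ≤ K ^ 8 := by linarith [pow_pos hK0 6]
  set S := ∑ j, ν j with hS
  have hSK : |S| ≤ K ^ 9 := by
    calc |S| ≤ ∑ j, |ν j| := Finset.abs_sum_le_sum_abs _ _
      _ ≤ ∑ _j : Fin e, K ^ 8 := Finset.sum_le_sum fun j _ => hνK j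
      _ = e * K ^ 8 := by simp
      _ ≤ K * K ^ 8 := by gcongr; linarith [F.large]
      _ = _ := by ring
  have k9 : K ^ 4 ≤ K ^ 9 := pow_le_pow_right₀ hK1 (by norm_num)
  have k10 : 2 * K ^ 9 ≤ K * K ^ 9 := by gcongr
  have k59 : 2 * K ^ 4 ≤ K ^ 9 / 2 := by
    have h5 : (2 : ℝ) ^ 2 * K ^ 4 ≤ K ^ 5 * K ^ 4 := by
      gcongr
      calc (2 : ℝ) ^ 2 ≤ K ^ 2 := by gcongr
        _ ≤ K ^ 5 := pow_le_pow_right₀ hK1 (by norm_num)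
    have h6 : K ^ 9 = K ^ 5 * K ^ 4 := by ring
    linarith
  have hk10 : K ^ 10 = K * K ^ 9 := by ring
  rw [abs_le] at hSK hκK
  refine ⟨(1 - S) / 2 - κ, (1 - S) / 2 + κ, ν, by ring, ?_, ?_, hνK, ?_⟩
  · rw [abs_le]; constructor <;> linarith [hSK.1, hSK.2, hκK.1, hκK.2]
  · rw [abs_le]; constructor <;> linarith [hSK.1, hSK.2, hκK.1, hκK.2]
  · have hMp : M = (1 / 2 : ℝ) • (p₁ + p₂) := by rw [hM, midpoint_eq_smul_add]; norm_num
    have e1 : p₃ - (((1 - S) / 2 - κ) • p₁ + ((1 - S) / 2 + κ) • p₂ + ∑ j, ν j • z j) =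
        (c' - κ * c) • (w - M) := by
      have e2 : ∑ j, ν j • z j = ∑ j, μ' j • (z j - M) - κ • ∑ j, μ j • (z j - M) + S • M := by
        rw [Finset.smul_sum, ← Finset.sum_sub_distrib, hS, Finset.sum_smul,
          ← Finset.sum_add_distrib]
        refine Finset.sum_congr rfl fun j _ => ?_
        simp only [hν]
        module
      have e3 : ((1 - S) / 2 - κ) • p₁ + ((1 - S) / 2 + κ) • p₂ =
          (1 - S) • M + κ • (p₂ - p₁) := by rw [hMp]; module
      rw [e3, e2, hve]
      have e4 : p₃ = M + (b' • (m - M) + c' • (w - M) + ∑ j, μ' j • (z j - M)) := by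
        rw [← hv']; abel
      nth_rewrite 1 [e4]
      rw [← hκb]
      module
    rw [e1, norm_smul, Real.norm_eq_abs]
    have h7 : 0 ≤ K ^ 7 * σ := by positivity
    have h8 : |c' - κ * c| ≤ K ^ 13 * σ := by
      have h1 : |κ * c| ≤ 2 * K ^ 4 * (K ^ 7 * σ) := by
        rw [abs_mul]; exact mul_le_mul (abs_le.2 hκK) hc (abs_nonneg _) (by positivity)
      have h9 : K ^ 7 * σ ≤ K ^ 11 * σ := by
        gcongr
        norm_num
      have h10 : 4 * (K ^ 11 * σ) ≤ K ^ 2 * (K ^ 11 * σ) := by gcongr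
      have h11 : 0 ≤ K ^ 11 * σ := by positivity
      calc |c' - κ * c| ≤ |c'| + |κ * c| := abs_sub _ _
        _ ≤ K ^ 13 * σ := by nlinarith
    calc |c' - κ * c| * ‖w - M‖ ≤ (K ^ 13 * σ) * K := by gcongr
      _ = _ := by ring

/-- Two points with nearly the same distances to the `z j` that are nearly collinear with them
are close. -/
lemma Frame.norm_sub_le_of_comb (F : Frame K B₀ B₁ B₂ z) {p p' x w : V} (hp : p ∈ B₀)
    (hp' : p' ∈ B₀) (hx : x ∈ B₁) (hw : w ∈ B₂) {σ ρ : ℝ} (hσ : 0 ≤ σ)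
    (hpz : ∀ j, |dist p (z j) ^ 2 - dist p' (z j) ^ 2| ≤ σ) {κ : ℝ} {μ : Fin e → ℝ}
    (h1 : κ + ∑ j, μ j = 1) (h : ‖p - (κ • p' + ∑ j, μ j • z j)‖ ≤ ρ) :
    ‖p - p'‖ ≤ K ^ 3 * (ρ + σ) := by
  have hK := F.two_le
  have hK0 : 0 < K := by linarith
  have hρ : 0 ≤ ρ := (norm_nonneg _).trans h
  have k2 : 4 ≤ K ^ 2 := by nlinarith
  have k23 : 2 * K ^ 2 ≤ K * K ^ 2 := by gcongr
  rcases lt_or_ge κ 0 with hκ | hκ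
  · have hP : (1 / (1 - κ)) • p + (-κ / (1 - κ)) • p' ∈ B₀ :=
      F.conv₀ hp hp' (by apply div_nonneg <;> linarith) (by apply div_nonneg <;> linarith)
        (by rw [← add_div]; exact div_self (by linarith))
    have h2 := (F.spread _ hP x hx w hw (1 - κ) 0 0 (fun j => -μ j) (by
      rw [Finset.sum_neg_distrib]; linarith)).1
    have e1 : (1 - κ) • ((1 / (1 - κ)) • p + (-κ / (1 - κ)) • p') + (0 : ℝ) • x + (0 : ℝ) • w +
        ∑ j, (-μ j) • z j = p - (κ • p' + ∑ j, μ j • z j) := by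
      have : 1 - κ ≠ 0 := by linarith
      simp only [neg_smul, Finset.sum_neg_distrib, smul_add, smul_smul]
      rw [mul_div_cancel₀ _ this, mul_div_cancel₀ _ this]
      module
    rw [e1, abs_of_pos (by linarith)] at h2
    have h3 : 1 ≤ K * ρ := by
      have : K * ‖p - (κ • p' + ∑ j, μ j • z j)‖ ≤ K * ρ := by gcongr
      linarith
    have h4 : ‖p - p'‖ ≤ K := F.norm_sub_le_const (Or.inl (Or.inl hp)) (Or.inl (Or.inl hp'))
    calc ‖p - p'‖ ≤ K * 1 := by linarith
      _ ≤ K * (K * ρ) := by gcongr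
      _ ≤ K ^ 3 * (ρ + σ) := by nlinarith [mul_nonneg (pow_nonneg hK0.le 2) hρ, pow_pos hK0 3]
  · set P := midpoint ℝ p p' with hPdef
    have hP : P ∈ B₀ := F.conv₀.midpoint_mem hp hp'
    set g := p - p' with hg
    set t := (1 + κ) / 2 with ht
    have hPe : P = (1 / 2 : ℝ) • (p + p') := by rw [hPdef, midpoint_eq_smul_add]; norm_num
    have hsum : ∑ j, μ j = 1 - κ := by linarith
    have e1 : p - (κ • p' + ∑ j, μ j • z j) = t • g - ∑ j, μ j • (z j - P) := by
      simp only [smul_sub, Finset.sum_sub_distrib, ← Finset.sum_smul]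
      rw [hsum, hPe, hg, ht]
      module
    set R := p - (κ • p' + ∑ j, μ j • z j) with hR
    have ht0 : 1 / 2 ≤ t := by rw [ht]; linarith
    have hμ : ∀ j, |μ j| ≤ K * (ρ + t * ‖g‖) := fun j => by
      have h2 := (F.spread _ hP x hx w hw (-∑ j, μ j) 0 0 μ (by ring)).2.2.2 j
      have e2 : (-∑ j, μ j) • P + (0 : ℝ) • x + (0 : ℝ) • w + ∑ j, μ j • z j = t • g - R := by
        rw [e1]
        simp only [smul_sub, Finset.sum_sub_distrib, ← Finset.sum_smul]
        module
      rw [e2] at h2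
      refine h2.trans ?_
      gcongr
      calc ‖t • g - R‖ ≤ ‖t • g‖ + ‖R‖ := _root_.norm_sub_le _ _
        _ = t * ‖g‖ + ‖R‖ := by rw [norm_smul, Real.norm_eq_abs, abs_of_pos (by linarith)]
        _ ≤ _ := by linarith
    have hz : ∀ j, |⟪g, z j - P⟫| ≤ σ / 2 := fun j => by
      rw [← neg_sub, inner_neg_right, abs_neg]
      exact abs_inner_midpoint_le (hpz j)
    have h3 := abs_inner_comb_sub_le g (0 : V) (0 : V) (fun j => z j - P) 0 0 μ hμ hz
    have e3 : ⟪g, ∑ j, μ j • (z j - P)⟫ = t * ‖g‖ ^ 2 - ⟪g, R⟫ := by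
      have : ∑ j, μ j • (z j - P) = t • g - R := by rw [e1]; abel
      rw [this, inner_sub_right, inner_smul_right, real_inner_self_eq_norm_sq]
    simp only [smul_zero, zero_add, inner_zero_right, mul_zero, sub_zero, e3] at h3
    have h4 : ⟪g, R⟫ ≤ ‖g‖ * ρ := (real_inner_le_norm _ _).trans (by gcongr)
    have hg0 := norm_nonneg g
    set G := ‖g‖ with hG
    have h5 : t * G ^ 2 ≤ G * ρ + (K ^ 2 * σ / 2) * (ρ + t * G) := by
      have h6 : (e : ℝ) * (K * (ρ + t * G) * (σ / 2)) ≤ K * (K * (ρ + t * G) * (σ / 2)) := by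
        gcongr; linarith [F.large]
      have h7 := (abs_le.1 h3).2
      linarith
    clear_value G
    set τ := K ^ 2 * σ / 2 with hτ
    have hτ0 : 0 ≤ τ := by positivity
    have hfin : G ≤ 4 * ρ + 4 * τ := by
      by_contra! hc
      have hGτ : τ ≤ G / 4 := by linarith
      have h6 : τ * (ρ + t * G) ≤ G / 4 * (ρ + t * G) := by gcongr
      have h7 : 0 < G := by linarith
      have h8 : G * (3 / 4 * t * G) ≤ G * (5 / 4 * ρ) := by nlinarith
      have h9 := le_of_mul_le_mul_left h8 h7
      have h10 : 1 / 2 * G ≤ t * G := by gcongr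
      linarith
    calc G ≤ 4 * ρ + 4 * τ := hfin
      _ = 4 * ρ + 2 * K ^ 2 * σ := by rw [hτ]; ring
      _ ≤ K * K ^ 2 * ρ + K * K ^ 2 * σ := by
          have : 4 ≤ K * K ^ 2 := by nlinarith
          gcongr
      _ = _ := by ring

/-- A small coefficient forces closeness. -/
lemma Frame.norm_sub_le_of_small_coeff (F : Frame K B₀ B₁ B₂ z) {p₁ p₂ p₃ x w : V} (hp₁ : p₁ ∈ B₀)
    (hp₂ : p₂ ∈ B₀) (hp₃ : p₃ ∈ B₀) (hx : x ∈ B₁) (hw : w ∈ B₂) {σ ρ : ℝ} (hσ : 0 ≤ σ)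
    (hpz : ∀ j, |dist p₃ (z j) ^ 2 - dist p₁ (z j) ^ 2| ≤ σ) {α₁ α₂ : ℝ} {μ : Fin e → ℝ}
    (h1 : α₁ + α₂ + ∑ j, μ j = 1) (h : ‖p₃ - (α₁ • p₁ + α₂ • p₂ + ∑ j, μ j • z j)‖ ≤ ρ) :
    ‖p₃ - p₁‖ ≤ K ^ 3 * (ρ + |α₂| * K + σ) := by
  refine F.norm_sub_le_of_comb hp₃ hp₁ hx hw hσ hpz (κ := α₁ + α₂) h1 ?_
  have : p₃ - ((α₁ + α₂) • p₁ + ∑ j, μ j • z j) =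
      (p₃ - (α₁ • p₁ + α₂ • p₂ + ∑ j, μ j • z j)) + α₂ • (p₂ - p₁) := by module
  rw [this]
  refine (norm_add_le _ _).trans (add_le_add h ?_)
  rw [norm_smul, Real.norm_eq_abs]
  gcongr
  exact F.norm_sub_le_const (Or.inl (Or.inl hp₂)) (Or.inl (Or.inl hp₁))

/-- The ratio of the coefficients determines the point. -/
lemma Frame.norm_sub_le_of_ratio (F : Frame K B₀ B₁ B₂ z) {p₁ p₂ p p' x w : V} (hp₁ : p₁ ∈ B₀)
    (hp : p ∈ B₀) (hp' : p' ∈ B₀) (hx : x ∈ B₁) (hw : w ∈ B₂) {σ ρ y : ℝ} (hσ : 0 ≤ σ)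
    (hpz : ∀ j, |dist p (z j) ^ 2 - dist p' (z j) ^ 2| ≤ σ) {α₁ α₂ α₁' α₂' : ℝ}
    {μ μ' : Fin e → ℝ} (h1 : α₁ + α₂ + ∑ j, μ j = 1) (h1' : α₁' + α₂' + ∑ j, μ' j = 1)
    (h : ‖p - (α₁ • p₁ + α₂ • p₂ + ∑ j, μ j • z j)‖ ≤ ρ)
    (h' : ‖p' - (α₁' • p₁ + α₂' • p₂ + ∑ j, μ' j • z j)‖ ≤ ρ)
    (hα₂ : |α₂| ≤ K) (hα₂0 : α₂ ≠ 0) (hα₂' : 1 / K ≤ |α₂'|) (hy : |α₁ / α₂ - α₁' / α₂'| ≤ y) :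
    ‖p - p'‖ ≤ K ^ 6 * (ρ + y + σ) := by
  have hK := F.two_le
  have hK0 : 0 < K := by linarith
  have hρ : 0 ≤ ρ := (norm_nonneg _).trans h
  have hy0 : 0 ≤ y := (abs_nonneg _).trans hy
  have hα₂'0 : 0 < |α₂'| := lt_of_lt_of_le (by positivity) hα₂'
  have hα₂'1 : α₂' ≠ 0 := abs_pos.1 hα₂'0
  set κ := α₂ / α₂' with hκ
  have hκK : |κ| ≤ K ^ 2 := by
    rw [hκ, abs_div, div_le_iff₀ hα₂'0]
    rw [div_le_iff₀ hK0] at hα₂'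
    nlinarith
  set l := α₁ / α₂ - α₁' / α₂' with hl
  have e1 : κ * α₂' = α₂ := by rw [hκ]; field_simp
  have e2 : α₂ * l = α₁ - κ * α₁' := by rw [hl, hκ]; field_simp
  have key := F.norm_sub_le_of_comb hp hp' hx hw hσ hpz (κ := κ + α₂ * l)
    (μ := fun j => μ j - κ * μ' j) (ρ := ρ + K ^ 2 * ρ + K ^ 2 * y) (by
      rw [Finset.sum_sub_distrib, ← Finset.mul_sum, e2]
      linear_combination h1 - κ * h1' + e1) (by
      have : p - ((κ + α₂ * l) • p' + ∑ j, (μ j - κ * μ' j) • z j) =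
          (p - (α₁ • p₁ + α₂ • p₂ + ∑ j, μ j • z j)) -
          κ • (p' - (α₁' • p₁ + α₂' • p₂ + ∑ j, μ' j • z j)) + (α₂ * l) • (p₁ - p') := by
        have e3 : ∑ j, (μ j - κ * μ' j) • z j = ∑ j, μ j • z j - κ • ∑ j, μ' j • z j := by
          rw [Finset.smul_sum, ← Finset.sum_sub_distrib]
          exact Finset.sum_congr rfl fun j _ => by module
        rw [e3, e2]
        have e4 : α₂ • p₂ = (κ * α₂') • p₂ := by rw [e1]
        rw [e4]
        module
      rw [this]
      have hpp : ‖p₁ - p'‖ ≤ K := F.norm_sub_le_const (Or.inl (Or.inl hp₁)) (Or.inl (Or.inl hp'))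
      refine (norm_add_le _ _).trans (add_le_add ((_root_.norm_sub_le _ _).trans
          (add_le_add h ?_)) ?_)
      · rw [norm_smul, Real.norm_eq_abs]; gcongr
      · rw [norm_smul, Real.norm_eq_abs, abs_mul]
        calc |α₂| * |l| * ‖p₁ - p'‖ ≤ K * y * K := by gcongr
          _ = _ := by ring)
  refine key.trans ?_
  have k2 : 4 ≤ K ^ 2 := by nlinarith
  have k23 : 2 * K ^ 2 ≤ K * K ^ 2 := by gcongr
  have k3 : 1 ≤ K ^ 3 := one_le_pow₀ (by linarith)
  calc K ^ 3 * (ρ + K ^ 2 * ρ + K ^ 2 * y + σ) ≤ K ^ 3 * (K ^ 3 * ρ + K ^ 3 * y + K ^ 3 * σ) := by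
        gcongr ?_ * ?_
        have a1 : ρ + K ^ 2 * ρ ≤ K ^ 3 * ρ := by nlinarith
        have a2 : K ^ 2 * y ≤ K ^ 3 * y := by nlinarith [mul_nonneg (pow_nonneg hK0.le 2) hy0]
        have a3 : σ ≤ K ^ 3 * σ := by nlinarith
        linarith
    _ = _ := by ring

/-- Squared distances to an affine combination. -/
lemma dist_sq_comb (w p₁ p₂ : V) (z : Fin e → V) {α₁ α₂ : ℝ} {μ : Fin e → ℝ}
    (h : α₁ + α₂ + ∑ j, μ j = 1) :
    dist w (α₁ • p₁ + α₂ • p₂ + ∑ j, μ j • z j) ^ 2 =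
      α₁ * dist w p₁ ^ 2 + α₂ * dist w p₂ ^ 2 + ∑ j, μ j * dist w (z j) ^ 2 +
      (‖α₁ • p₁ + α₂ • p₂ + ∑ j, μ j • z j‖ ^ 2 - α₁ * ‖p₁‖ ^ 2 - α₂ * ‖p₂‖ ^ 2 -
        ∑ j, μ j * ‖z j‖ ^ 2) := by
  simp only [dist_eq_norm, @norm_sub_sq_real]
  have h1 : ⟪w, α₁ • p₁ + α₂ • p₂ + ∑ j, μ j • z j⟫ =
      α₁ * ⟪w, p₁⟫ + α₂ * ⟪w, p₂⟫ + ∑ j, μ j * ⟪w, z j⟫ := by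
    simp only [inner_add_right, inner_sum, inner_smul_right]
  have h2 : ∑ j, μ j * (‖w‖ ^ 2 - 2 * ⟪w, z j⟫ + ‖z j‖ ^ 2) =
      (∑ j, μ j) * ‖w‖ ^ 2 - 2 * ∑ j, μ j * ⟪w, z j⟫ + ∑ j, μ j * ‖z j‖ ^ 2 := by
    rw [Finset.sum_mul, Finset.mul_sum, ← Finset.sum_sub_distrib, ← Finset.sum_add_distrib]
    exact Finset.sum_congr rfl fun j _ => by ring
  rw [h1, h2]
  linear_combination -‖w‖ ^ 2 * h

end Frame

end RealInnerProductSpace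

section Incidences

variable {α β γ ι κ : Type*}

lemma card_sq_le_card_pairs [DecidableEq κ] (T : Finset ι) (f : ι → κ) (S : Finset κ)
    (h : ∀ t ∈ T, f t ∈ S) :
    (T.card : ℝ) ^ 2 ≤ S.card * ((T ×ˢ T).filter fun u => f u.1 = f u.2).card := by
  have h1 : (T.card : ℝ) = ∑ k ∈ S, ((T.filter fun t => f t = k).card : ℝ) := by
    exact_mod_cast Finset.card_eq_sum_card_fiberwise h
  have h2 : (((T ×ˢ T).filter fun u => f u.1 = f u.2).card : ℝ) =
      ∑ k ∈ S, ((T.filter fun t => f t = k).card : ℝ) ^ 2 := by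
    rw [Finset.card_eq_sum_card_fiberwise (f := fun u : ι × ι => f u.1) (t := S)
      (fun u hu => h _ (Finset.mem_product.1 (Finset.mem_filter.1 hu).1).1)]
    push_cast
    refine Finset.sum_congr rfl fun k _ => ?_
    rw [sq, ← Nat.cast_mul, ← Finset.card_product]
    congr 2
    ext u
    simp only [Finset.mem_filter, Finset.mem_product]
    grind
  rw [h1, h2]
  exact sq_sum_le_card_mul_sum_sq

open Classical in
/-- Two separated points `x, x'` that are equidistant from many `p` along many triples. -/
lemma exists_equidistant_pair {F₁ : Finset α} {F₂ : Finset β} {F₃ : Finset γ}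
    {T : Finset (α × β × γ)} (hT : T ⊆ F₁ ×ˢ F₂ ×ˢ F₃) {ℓ : α → β → ℤ} {𝒟 : Finset ℤ}
    (hℓ : ∀ t ∈ T, ℓ t.1 t.2.1 ∈ 𝒟) {L N : ℝ} (hL : 0 < L) (hN : 0 < N)
    (h₁ : (F₁.card : ℝ) ≤ L * N ^ 2) (h₂ : (F₂.card : ℝ) ≤ L * N ^ 2)
    (h₃ : (F₃.card : ℝ) ≤ L * N ^ 2) (h𝒟 : (𝒟.card : ℝ) ≤ L * N)
    (hTc : N ^ 6 ≤ L * T.card) {near : β → β → Prop}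
    (hnear : ∀ t ∈ T, 2 * L ^ 8 * ((T.filter fun t' => (t.1 = t'.1 ∧ t.2.2 = t'.2.2 ∧
      ℓ t.1 t.2.1 = ℓ t'.1 t'.2.1) ∧ near t.2.1 t'.2.1).card : ℝ) ≤ N) :
    ∃ x ∈ F₂, ∃ x' ∈ F₂, ¬ near x x' ∧ N ^ 3 ≤ 2 * L ^ 7 *
      ((F₁ ×ˢ F₃).filter fun r => (r.1, x, r.2) ∈ T ∧ (r.1, x', r.2) ∈ T ∧
        ℓ r.1 x = ℓ r.1 x').card := by
  set key : α × β × γ → (α × γ) × ℤ := fun t => ((t.1, t.2.2), ℓ t.1 t.2.1) with hkey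
  set Q := (T ×ˢ T).filter fun u => key u.1 = key u.2 with hQ
  have hQc := card_sq_le_card_pairs T key ((F₁ ×ˢ F₃) ×ˢ 𝒟) (fun t ht => by
    have := hT ht
    simp only [Finset.mem_product] at this ⊢
    exact ⟨⟨this.1, this.2.2⟩, hℓ t ht⟩)
  rw [Finset.card_product, Finset.card_product] at hQc
  push_cast at hQc
  rw [← hQ] at hQc
  set bad := Q.filter fun u => near u.1.2.1 u.2.2.1 with hbad
  set good := Q.filter fun u => ¬ near u.1.2.1 u.2.2.1 with hgood
  have hsum : (bad.card : ℝ) + good.card = Q.card := by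
    exact_mod_cast Finset.card_filter_add_card_filter_not _
  have hTle : (T.card : ℝ) ≤ L ^ 3 * N ^ 6 := by
    have h5 : (T.card : ℝ) ≤ F₁.card * (F₂.card * F₃.card) := by
      have := Finset.card_le_card hT
      rw [Finset.card_product, Finset.card_product] at this
      exact_mod_cast this
    calc (T.card : ℝ) ≤ _ := h5
      _ ≤ (L * N ^ 2) * ((L * N ^ 2) * (L * N ^ 2)) := by gcongr
      _ = _ := by ring
  have hbadc : 2 * L ^ 5 * (bad.card : ℝ) ≤ N ^ 7 := by
    have h5 : (bad.card : ℝ) ≤ N / (2 * L ^ 8) * (bad.image Prod.fst).card := by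
      refine card_le_mul_card_image_real bad fun t ht => ?_
      obtain ⟨u, hu, rfl⟩ := Finset.mem_image.1 ht
      have huT := (Finset.mem_product.1 (Finset.mem_filter.1 (Finset.mem_filter.1 hu).1).1).1
      rw [le_div_iff₀ (by positivity)]
      refine le_trans ?_ (hnear u.1 huT)
      rw [mul_comm]
      gcongr
      refine Finset.card_le_card_of_injOn Prod.snd (fun v hv => ?_) (fun v hv v' hv' hvv => ?_)
      · simp only [hbad, hQ, hkey, Finset.coe_filter, Finset.mem_filter, Finset.mem_product,
          Set.mem_ofPred_eq, Prod.mk.injEq] at hv ⊢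
        obtain ⟨⟨⟨⟨_, h2⟩, ⟨h3, h4⟩, h5⟩, h6⟩, h7⟩ := hv
        rw [← h7]
        exact ⟨h2, ⟨h3, h4, h5⟩, h6⟩
      · have e1 := (Finset.mem_filter.1 hv).2
        have e2 := (Finset.mem_filter.1 hv').2
        exact Prod.ext (e1.trans e2.symm) hvv
    have h6 : ((bad.image Prod.fst).card : ℝ) ≤ T.card := by
      exact_mod_cast Finset.card_le_card (Finset.image_subset_iff.2 fun u hu =>
        (Finset.mem_product.1 (Finset.mem_filter.1 (Finset.mem_filter.1 hu).1).1).1)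
    calc 2 * L ^ 5 * (bad.card : ℝ) ≤ 2 * L ^ 5 * (N / (2 * L ^ 8) * (L ^ 3 * N ^ 6)) := by
          gcongr
          exact h5.trans (by gcongr; exact h6.trans hTle)
      _ = N ^ 7 := by field_simp
  have hQlow : N ^ 7 ≤ L ^ 5 * Q.card := by
    have h5 : (N ^ 6) ^ 2 ≤ (L * T.card) ^ 2 := by gcongr
    have h6 : (N ^ 6) ^ 2 ≤ L ^ 2 * ((L * N ^ 2) * (L * N ^ 2) * (L * N) * Q.card) := by
      rw [mul_pow] at h5
      refine h5.trans ?_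
      gcongr
      exact hQc.trans (by gcongr)
    have h7 : N ^ 5 * N ^ 7 ≤ N ^ 5 * (L ^ 5 * Q.card) := by
      calc N ^ 5 * N ^ 7 = (N ^ 6) ^ 2 := by ring
        _ ≤ _ := h6
        _ = _ := by ring
    exact le_of_mul_le_mul_left h7 (by positivity)
  have hgoodc : N ^ 7 ≤ 2 * L ^ 5 * good.card := by
    rw [← hsum] at hQlow
    linarith
  by_contra! hcon
  have hgle : (good.card : ℝ) ≤
      N ^ 3 / (2 * L ^ 7) * (good.image fun u => (u.1.2.1, u.2.2.1)).card ∧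
      ((good.image fun u => (u.1.2.1, u.2.2.1)).Nonempty →
        (good.card : ℝ) < N ^ 3 / (2 * L ^ 7) * (good.image fun u => (u.1.2.1, u.2.2.1)).card) := by
    have hfib : ∀ b ∈ good.image (fun u => (u.1.2.1, u.2.2.1)),
        ((good.filter fun u => (u.1.2.1, u.2.2.1) = b).card : ℝ) < N ^ 3 / (2 * L ^ 7) := by
      intro b hb
      obtain ⟨u, hu, rfl⟩ := Finset.mem_image.1 hb
      rw [lt_div_iff₀ (by positivity), mul_comm]
      have hu' := Finset.mem_filter.1 hu
      have huT := Finset.mem_product.1 (Finset.mem_filter.1 hu'.1).1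
      have hx := (Finset.mem_product.1 (Finset.mem_product.1 (hT huT.1)).2).1
      have hx' := (Finset.mem_product.1 (Finset.mem_product.1 (hT huT.2)).2).1
      refine lt_of_le_of_lt ?_ (hcon _ hx _ hx' hu'.2)
      gcongr
      refine Finset.card_le_card_of_injOn (fun v => (v.1.1, v.1.2.2)) (fun v hv => ?_)
        (fun v hv v' hv' hvv => ?_)
      · simp only [hgood, hQ, hkey, Finset.coe_filter, Finset.mem_filter, Finset.mem_product,
          Set.mem_ofPred_eq, Prod.mk.injEq] at hv ⊢
        obtain ⟨⟨⟨⟨h1, h2⟩, ⟨h3, h4⟩, h5⟩, h6⟩, h7, h8⟩ := hv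
        have hv1 := Finset.mem_product.1 (hT h1)
        rw [← h7, ← h8]
        refine ⟨⟨hv1.1, (Finset.mem_product.1 hv1.2).2⟩, h1, ?_, ?_⟩
        · rw [h3, h4]; exact h2
        · rw [h5, h3]
      · simp only [hgood, hQ, hkey, Finset.coe_filter, Finset.mem_filter, Finset.mem_product,
          Set.mem_ofPred_eq, Prod.mk.injEq] at hv hv' hvv
        obtain ⟨⟨⟨_, ⟨h3, h4⟩, h5⟩, h6⟩, h7, h8⟩ := hv
        obtain ⟨⟨⟨_, ⟨h3', h4'⟩, h5'⟩, h6'⟩, h7', h8'⟩ := hv'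
        refine Prod.ext (Prod.ext hvv.1 (Prod.ext (h7.trans h7'.symm) hvv.2))
          (Prod.ext ?_ (Prod.ext (h8.trans h8'.symm) ?_))
        · rw [← h3, ← h3', hvv.1]
        · rw [← h4, ← h4', hvv.2]
    refine ⟨card_le_mul_card_image_real good fun b hb => (hfib b hb).le, fun hne => ?_⟩
    have e : (good.card : ℝ) = ∑ b ∈ good.image (fun u => (u.1.2.1, u.2.2.1)),
        ((good.filter fun u => (u.1.2.1, u.2.2.1) = b).card : ℝ) := by
      exact_mod_cast Finset.card_eq_sum_card_image _ _
    rw [e]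
    refine (Finset.sum_lt_sum_of_nonempty hne hfib).trans_eq ?_
    rw [Finset.sum_const, nsmul_eq_mul, mul_comm]
  have hg0 : 0 < (good.card : ℝ) := by
    by_contra! h0
    have : 0 < N ^ 7 := by positivity
    nlinarith [mul_nonneg_of_nonpos_of_nonpos h0 (neg_nonpos.2 (show 0 ≤ 2 * L ^ 5 by positivity))]
  have hne : good.Nonempty := Finset.card_pos.1 (by exact_mod_cast hg0)
  have h5 := hgle.2 (hne.image _)
  have h6 : ((good.image fun u => (u.1.2.1, u.2.2.1)).card : ℝ) ≤ (L * N ^ 2) * (L * N ^ 2) := by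
    have h7 : (good.image fun u => (u.1.2.1, u.2.2.1)) ⊆ F₂ ×ˢ F₂ := by
      refine Finset.image_subset_iff.2 fun u hu => ?_
      have huT := Finset.mem_product.1 (Finset.mem_filter.1 (Finset.mem_filter.1 hu).1).1
      exact Finset.mem_product.2 ⟨(Finset.mem_product.1 (Finset.mem_product.1 (hT huT.1)).2).1,
        (Finset.mem_product.1 (Finset.mem_product.1 (hT huT.2)).2).1⟩
    have h8 := Finset.card_le_card h7
    rw [Finset.card_product] at h8
    calc _ ≤ ((F₂.card * F₂.card : ℕ) : ℝ) := by exact_mod_cast h8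
      _ ≤ _ := by push_cast; gcongr
  have h9 : (good.card : ℝ) < N ^ 3 / (2 * L ^ 7) * ((L * N ^ 2) * (L * N ^ 2)) :=
    h5.trans_le (by gcongr)
  have h10 : 2 * L ^ 5 * (N ^ 3 / (2 * L ^ 7) * ((L * N ^ 2) * (L * N ^ 2))) = N ^ 7 := by
    field_simp
  have h11 : 2 * L ^ 5 * (good.card : ℝ) <
    2 * L ^ 5 * (N ^ 3 / (2 * L ^ 7) * ((L * N ^ 2) * (L * N ^ 2))) := by gcongr
  linarith

open Classical in
lemma card_cube_le {S : Finset α} {F : Finset γ} {R : Finset (α × γ)} (hR : R ⊆ S ×ˢ F) :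
    (R.card : ℝ) ^ 3 ≤ (F.card : ℝ) ^ 2 * ∑ p₁ ∈ S, ∑ p₂ ∈ S, ∑ p ∈ S,
      ((F.filter fun w => (p₁, w) ∈ R ∧ (p₂, w) ∈ R ∧ (p, w) ∈ R).card : ℝ) := by
  set g : α → α → α → ℝ := fun p₁ p₂ p =>
    ((F.filter fun w => (p₁, w) ∈ R ∧ (p₂, w) ∈ R ∧ (p, w) ∈ R).card : ℝ) with hg
  set r : γ → ℝ := fun w => ((S.filter fun p => (p, w) ∈ R).card : ℝ) with hr
  have hrsum : ∑ w ∈ F, r w = R.card := by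
    rw [Finset.card_eq_sum_card_fiberwise (f := Prod.snd) (t := F)
      (fun u hu => (Finset.mem_product.1 (hR hu)).2)]
    push_cast
    refine Finset.sum_congr rfl fun w _ => ?_
    rw [hr]
    refine congrArg Nat.cast ?_
    refine Finset.card_bij' (fun p _ => (p, w)) (fun u _ => u.1) ?_ ?_ ?_ ?_
    · intro p hp; simpa using (Finset.mem_filter.1 hp).2
    · intro u hu
      obtain ⟨h1, rfl⟩ := Finset.mem_filter.1 hu
      exact Finset.mem_filter.2 ⟨(Finset.mem_product.1 (hR h1)).1, h1⟩
    · intro p _; rfl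
    · intro u hu
      obtain ⟨h1, rfl⟩ := Finset.mem_filter.1 hu
      rfl
  have hgsum : ∑ p₁ ∈ S, ∑ p₂ ∈ S, ∑ p ∈ S, g p₁ p₂ p = ∑ w ∈ F, r w ^ 3 := by
    have e1 : ∀ p₁ p₂ p, g p₁ p₂ p = ∑ w ∈ F, (if (p₁, w) ∈ R then (1 : ℝ) else 0) *
        ((if (p₂, w) ∈ R then 1 else 0) * (if (p, w) ∈ R then 1 else 0)) := fun p₁ p₂ p => by
      rw [hg]
      simp only [Finset.card_filter]
      push_cast
      refine Finset.sum_congr rfl fun w _ => ?_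
      split_ifs <;> simp_all
    have e2 : ∀ w, r w = ∑ p ∈ S, if (p, w) ∈ R then (1 : ℝ) else 0 := fun w => by
      rw [hr]
      simp only [Finset.card_filter]
      push_cast
      rfl
    simp only [e1]
    calc _ = ∑ p₁ ∈ S, ∑ p₂ ∈ S, ∑ w ∈ F, (if (p₁, w) ∈ R then (1 : ℝ) else 0) *
        ((if (p₂, w) ∈ R then 1 else 0) * r w) := by
          refine Finset.sum_congr rfl fun p₁ _ => Finset.sum_congr rfl fun p₂ _ => ?_
          rw [Finset.sum_comm]
          refine Finset.sum_congr rfl fun w _ => ?_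
          rw [e2, Finset.mul_sum, Finset.mul_sum]
      _ = ∑ p₁ ∈ S, ∑ w ∈ F, (if (p₁, w) ∈ R then (1 : ℝ) else 0) * (r w * r w) := by
          refine Finset.sum_congr rfl fun p₁ _ => ?_
          rw [Finset.sum_comm]
          refine Finset.sum_congr rfl fun w _ => ?_
          rw [← Finset.mul_sum, ← Finset.sum_mul, ← e2]
      _ = ∑ w ∈ F, r w ^ 3 := by
          rw [Finset.sum_comm]
          refine Finset.sum_congr rfl fun w _ => ?_
          rw [← Finset.sum_mul, ← e2]
          ring
  rw [hgsum, ← hrsum]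
  rcases F.eq_empty_or_nonempty with rfl | hF
  · simp
  have hF0 : 0 < (F.card : ℝ) := by exact_mod_cast Finset.card_pos.2 hF
  have h1 := pow_sum_div_card_le_sum_pow (s := F) (f := r) (fun _ _ => by positivity) 2
  rw [div_le_iff₀ (by positivity)] at h1
  norm_num at h1
  linarith

open Classical in
/-- Many triples of points of `S`, pairwise not near, sharing many `w`. -/
lemma exists_popular_triples {S : Finset α} {F : Finset γ} {R : Finset (α × γ)}
    (hR : R ⊆ S ×ˢ F) {L N : ℝ} (hL : 0 < L) (hN : 0 < N) (hS : (S.card : ℝ) ≤ L * N)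
    (hF : (F.card : ℝ) ≤ L * N ^ 2) (hRc : N ^ 3 ≤ L * R.card) {near : α → α → Prop}
    (hnear : ∀ p ∈ S, 12 * L ^ 8 * ((S.filter fun p' => near p p').card : ℝ) ≤ N) :
    ∃ p₁ ∈ S, ∃ p₂ ∈ S, ¬ near p₁ p₂ ∧ ∃ G ⊆ S, N ≤ 4 * L ^ 8 * G.card ∧ ∀ p ∈ G,
      ¬ near p₁ p ∧ ¬ near p₂ p ∧ N ^ 2 ≤ 4 * L ^ 8 *
        (F.filter fun w => (p₁, w) ∈ R ∧ (p₂, w) ∈ R ∧ (p, w) ∈ R).card := by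
  have hcube := card_cube_le hR
  set g : α → α → α → ℝ := fun p₁ p₂ p =>
    ((F.filter fun w => (p₁, w) ∈ R ∧ (p₂, w) ∈ R ∧ (p, w) ∈ R).card : ℝ) with hg
  have hgF : ∀ p₁ p₂ p, g p₁ p₂ p ≤ L * N ^ 2 := fun p₁ p₂ p =>
    (Nat.cast_le.2 (Finset.card_filter_le _ _)).trans hF
  have hg0 : ∀ p₁ p₂ p, 0 ≤ g p₁ p₂ p := fun _ _ _ => Nat.cast_nonneg _
  have hlow : N ^ 5 ≤ L ^ 5 * ∑ p₁ ∈ S, ∑ p₂ ∈ S, ∑ p ∈ S, g p₁ p₂ p := by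
    change (R.card : ℝ) ^ 3 ≤ (F.card : ℝ) ^ 2 * ∑ p₁ ∈ S, ∑ p₂ ∈ S, ∑ p ∈ S, g p₁ p₂ p at hcube
    have hs0 : 0 ≤ ∑ p₁ ∈ S, ∑ p₂ ∈ S, ∑ p ∈ S, g p₁ p₂ p :=
      Finset.sum_nonneg fun _ _ => Finset.sum_nonneg fun _ _ => Finset.sum_nonneg fun _ _ =>
        hg0 _ _ _
    generalize ∑ p₁ ∈ S, ∑ p₂ ∈ S, ∑ p ∈ S, g p₁ p₂ p = Z at hcube hs0 ⊢
    have h3 : N ^ 4 * N ^ 5 ≤ N ^ 4 * (L ^ 5 * Z) := by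
      calc N ^ 4 * N ^ 5 = (N ^ 3) ^ 3 := by ring
        _ ≤ (L * R.card) ^ 3 := by gcongr
        _ = L ^ 3 * (R.card : ℝ) ^ 3 := by ring
        _ ≤ L ^ 3 * ((L * N ^ 2) ^ 2 * Z) := by
            gcongr
            exact hcube.trans (by gcongr)
        _ = _ := by ring
    exact le_of_mul_le_mul_left h3 (by positivity)
  clear hcube
  by_contra! hcon
  set m := N / (12 * L ^ 8) with hm
  have hm0 : 0 < m := by positivity
  have hnear' : ∀ p ∈ S, ((S.filter fun p' => near p p').card : ℝ) ≤ m := fun p hp => by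
    rw [hm, le_div_iff₀ (by positivity)]
    linarith [hnear p hp]
  have hnsum : ∀ p ∈ S, ∀ p₁ p₂, ∑ q ∈ S.filter (fun q => near p q), g p₁ p₂ q ≤
      m * (L * N ^ 2) := fun p hp p₁ p₂ => by
    refine (Finset.sum_le_card_nsmul _ _ _ fun q _ => hgF p₁ p₂ q).trans ?_
    rw [nsmul_eq_mul]
    exact mul_le_mul_of_nonneg_right (hnear' p hp) (by positivity)
  have hfar : ∀ p₁ ∈ S, ∀ p₂ ∈ S, ¬ near p₁ p₂ →
      ∑ p ∈ S, g p₁ p₂ p ≤ 2 * (m * (L * N ^ 2)) + N ^ 3 / (2 * L ^ 7) := by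
    intro p₁ hp₁ p₂ hp₂ h12
    set S' := S.filter (fun p => ¬ near p₁ p ∧ ¬ near p₂ p) with hS'
    set τ := N ^ 2 / (4 * L ^ 8) with hτ
    have h1 := sum_le_popular S' (fun p => g p₁ p₂ p) (fun p _ => hgF p₁ p₂ p)
      (τ := τ) (by positivity)
    have h2 : ((S'.filter fun p => τ ≤ g p₁ p₂ p).card : ℝ) ≤ N / (4 * L ^ 8) := by
      by_contra! h3
      rw [div_lt_iff₀ (by positivity)] at h3
      obtain ⟨p, hp, h4⟩ := hcon p₁ hp₁ p₂ hp₂ h12 (S'.filter fun p => τ ≤ g p₁ p₂ p)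
        ((Finset.filter_subset _ _).trans (Finset.filter_subset _ _)) (by linarith)
      obtain ⟨hp, hpτ⟩ := Finset.mem_filter.1 hp
      obtain ⟨-, hp1, hp2⟩ := Finset.mem_filter.1 hp
      have h5 := h4 hp1 hp2
      rw [hτ, div_le_iff₀ (by positivity)] at hpτ
      change 4 * L ^ 8 * g p₁ p₂ p < N ^ 2 at h5
      linarith
    have h3 : (S'.card : ℝ) ≤ L * N := (Nat.cast_le.2 (Finset.card_filter_le _ _)).trans hS
    have h4 : ∑ p ∈ S', g p₁ p₂ p ≤ N ^ 3 / (2 * L ^ 7) := by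
      calc _ ≤ _ := h1
        _ ≤ L * N ^ 2 * (N / (4 * L ^ 8)) + τ * (L * N) := by gcongr
        _ = _ := by rw [hτ]; field_simp; norm_num
    have h5 : ∑ p ∈ S, g p₁ p₂ p ≤ ∑ q ∈ S.filter (fun q => near p₁ q), g p₁ p₂ q +
        ∑ q ∈ S.filter (fun q => near p₂ q), g p₁ p₂ q + ∑ p ∈ S', g p₁ p₂ p := by
      rw [hS', Finset.sum_filter, Finset.sum_filter, Finset.sum_filter, ← Finset.sum_add_distrib,
        ← Finset.sum_add_distrib]
      refine Finset.sum_le_sum fun p _ => ?_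
      have := hg0 p₁ p₂ p
      split_ifs <;> first | linarith | tauto
    linarith [hnsum p₁ hp₁ p₁ p₂, hnsum p₂ hp₂ p₁ p₂]
  have hany : ∀ p₁ p₂, ∑ p ∈ S, g p₁ p₂ p ≤ L * N * (L * N ^ 2) := fun p₁ p₂ => by
    refine (Finset.sum_le_card_nsmul _ _ _ fun q _ => hgF p₁ p₂ q).trans ?_
    rw [nsmul_eq_mul]
    gcongr
  set B := 2 * (m * (L * N ^ 2)) + N ^ 3 / (2 * L ^ 7) with hB
  have hB0 : 0 ≤ B := by positivity
  have h2 : ∀ p₁ ∈ S, ∑ p₂ ∈ S, ∑ p ∈ S, g p₁ p₂ p ≤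
      m * (L * N * (L * N ^ 2)) + L * N * B := fun p₁ hp₁ => by
    rw [← Finset.sum_filter_add_sum_filter_not S fun p₂ => near p₁ p₂]
    refine add_le_add ?_ ?_
    · refine (Finset.sum_le_card_nsmul _ _ _ fun q _ => hany p₁ q).trans ?_
      rw [nsmul_eq_mul]
      exact mul_le_mul_of_nonneg_right (hnear' p₁ hp₁) (by positivity)
    · refine (Finset.sum_le_card_nsmul _ _ B fun q hq => hfar p₁ hp₁ q
        (Finset.mem_filter.1 hq).1 (Finset.mem_filter.1 hq).2).trans ?_
      rw [nsmul_eq_mul]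
      exact mul_le_mul_of_nonneg_right
        ((Nat.cast_le.2 (Finset.card_filter_le _ _)).trans hS) hB0
  have h3 : ∑ p₁ ∈ S, ∑ p₂ ∈ S, ∑ p ∈ S, g p₁ p₂ p ≤
      L * N * (m * (L * N * (L * N ^ 2)) + L * N * B) := by
    refine (Finset.sum_le_card_nsmul _ _ _ h2).trans ?_
    rw [nsmul_eq_mul]
    gcongr
  have h4 : L ^ 5 * (L * N * (m * (L * N * (L * N ^ 2)) + L * N * B)) = 3 / 4 * N ^ 5 := by
    rw [hB, hm]; field_simp; norm_num
  have h5 : L ^ 5 * ∑ p₁ ∈ S, ∑ p₂ ∈ S, ∑ p ∈ S, g p₁ p₂ p ≤ 3 / 4 * N ^ 5 := by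
    rw [← h4]; gcongr
  have : 0 < N ^ 5 := by positivity
  linarith

end Incidences

/-- A finite set with boundedly many points in each ball of radius comparable to `s`. -/
def Sparse {V : Type*} [NormedAddCommGroup V] (D : ℕ) (L s : ℝ) (F : Finset V) : Prop :=
  ∀ M, 1 ≤ M → ∀ c, ((F.filter fun p => ‖p - c‖ ≤ M * s).card : ℝ) ≤ L * M ^ D

/-- The integer label of the squared distance at scale `s`. -/
def lab {V : Type*} [NormedAddCommGroup V] (s : ℝ) (x y : V) : ℤ := ⌊dist x y ^ 2 / s⌋

/-- A finite set of integer labels at scale `s` satisfying a square root non-concentration. -/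
structure LabelSet (θ s L : ℝ) (𝒟 : Finset ℤ) : Prop where
  card : (𝒟.card : ℝ) ≤ L * (θ ^ 1000 / s)
  window : ∀ y, θ ^ 1000 ≤ y → ∀ c,
    ((𝒟.filter fun n : ℤ => |s * n - c| ≤ y).card : ℝ) ≤ L * √y * (θ ^ 1000 / s)
  bdd : ∀ n ∈ 𝒟, |s * (n : ℝ)| ≤ L

section Labels

variable {V : Type*} [NormedAddCommGroup V] {D : ℕ} {s L θ : ℝ} {F F' : Finset V} {𝒟 : Finset ℤ}

lemma Sparse.subset (h : Sparse D L s F) (hF : F' ⊆ F) : Sparse D L s F' := fun M hM c =>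
  (Nat.cast_le.2 (Finset.card_le_card (Finset.filter_subset_filter _ hF))).trans (h M hM c)

lemma Sparse.mono {L' : ℝ} (h : Sparse D L s F) (hL : L ≤ L') : Sparse D L' s F :=
  fun M hM c => (h M hM c).trans (by gcongr)

/-- A subset of `F` of diameter at most `M * s` is small. -/
lemma Sparse.card_le (h : Sparse D L s F) {M : ℝ} (hM : 1 ≤ M) {G : Finset V} (hG : G ⊆ F)
    (hd : ∀ p ∈ G, ∀ p' ∈ G, ‖p - p'‖ ≤ M * s) (hL : 0 ≤ L) : (G.card : ℝ) ≤ L * M ^ D := by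
  rcases G.eq_empty_or_nonempty with rfl | ⟨c, hc⟩
  · simp only [Finset.card_empty, Nat.cast_zero]; positivity
  · refine le_trans ?_ (h M hM c)
    exact Nat.cast_le.2 (Finset.card_le_card fun p hp =>
      Finset.mem_filter.2 ⟨hG hp, hd p hp c hc⟩)

lemma LabelSet.mono {L' : ℝ} (h : LabelSet θ s L 𝒟) (hθ : 0 < θ) (hs : 0 < s) (hL : L ≤ L') :
    LabelSet θ s L' 𝒟 where
  card := h.card.trans (by gcongr)
  window y hy c := (h.window y hy c).trans (by gcongr)
  bdd n hn := (h.bdd n hn).trans hL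

lemma lab_comm (s : ℝ) (x y : V) : lab s x y = lab s y x := by rw [lab, lab, dist_comm]

lemma lab_mul_le (hs : 0 < s) (x y : V) : s * (lab s x y : ℝ) ≤ dist x y ^ 2 := by
  have := Int.floor_le (dist x y ^ 2 / s)
  rw [le_div_iff₀ hs] at this
  rw [lab]; linarith

lemma lt_lab_mul (hs : 0 < s) (x y : V) : dist x y ^ 2 < s * (lab s x y : ℝ) + s := by
  have := Int.lt_floor_add_one (dist x y ^ 2 / s)
  rw [div_lt_iff₀ hs] at this
  rw [lab]; linarith

lemma abs_sub_le_of_lab_eq (hs : 0 < s) {x y x' y' : V} (h : lab s x y = lab s x' y') :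
    |dist x y ^ 2 - dist x' y' ^ 2| ≤ s := by
  have h1 := lab_mul_le hs x y
  have h2 := lt_lab_mul hs x y
  have h3 := lab_mul_le hs x' y'
  have h4 := lt_lab_mul hs x' y'
  rw [h] at h1 h2
  rw [abs_le]
  constructor <;> linarith

lemma abs_dist_sq_sub_le {K : ℝ} {x y x' : V} (h : ‖x - y‖ ≤ K) (h' : ‖x' - y‖ ≤ K) :
    |dist x y ^ 2 - dist x' y ^ 2| ≤ 2 * K * ‖x - x'‖ := by
  have h1 : |dist x y - dist x' y| ≤ ‖x - x'‖ := by
    rw [← dist_eq_norm]; exact abs_dist_sub_le _ _ _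
  rw [← dist_eq_norm] at h h'
  have e : dist x y ^ 2 - dist x' y ^ 2 = (dist x y + dist x' y) * (dist x y - dist x' y) := by
    ring
  have hK : 0 ≤ K := dist_nonneg.trans h
  rw [e, abs_mul, abs_of_nonneg (by positivity)]
  gcongr
  linarith

lemma sqrt_mul_le {a y : ℝ} (ha : 1 ≤ a) : √(a * y) ≤ a * √y := by
  rw [Real.sqrt_mul (by linarith)]
  gcongr
  rw [Real.sqrt_le_left (by linarith)]
  nlinarith

/-- The number of labels of points in a set whose labels lie in a window. -/
lemma LabelSet.card_le_of_window (h𝒟 : LabelSet θ s L 𝒟)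
    {ι : Type*} {G : Finset ι} {f : ι → ℤ} (hf : ∀ p ∈ G, f p ∈ 𝒟) {m y : ℝ} (hm : 0 ≤ m)
    (hfib : ∀ k, ((G.filter fun p => f p = k).card : ℝ) ≤ m) (hy : θ ^ 1000 ≤ y) {c : ℝ}
    (hw : ∀ p ∈ G, |s * (f p : ℝ) - c| ≤ y) :
    (G.card : ℝ) ≤ m * (L * √y * (θ ^ 1000 / s)) := by
  refine (card_le_mul_card_image_real (f := f) G fun b _ => hfib b).trans ?_
  gcongr
  refine le_trans (Nat.cast_le.2 (Finset.card_le_card fun n hn => ?_)) (h𝒟.window y hy c)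
  obtain ⟨p, hp, rfl⟩ := Finset.mem_image.1 hn
  exact Finset.mem_filter.2 ⟨hf p hp, hw p hp⟩

lemma nonConc_scaleSet (h𝒟 : LabelSet θ s L 𝒟) (hs : 0 < s) (hθ : 0 < θ) (hsθ : s ≤ θ ^ 1000)
    (hs1 : s ≤ 1) (hL : 2 ≤ L) {U : Finset ℤ} (hU : U ⊆ 𝒟) {a : ℝ} (ha : 1 / L ≤ |a|)
    (ha' : |a| ≤ L) {k : ℕ} (hk : 3 ≤ k)
    (hc : θ ^ 1000 / s ≤ L ^ k * (scaleSet s (floorDilate U a)).card) :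
    NonConc θ s (L ^ k) (scaleSet s (floorDilate U a)) := by
  have hL0 : 0 < L := by linarith
  have hL1 : 1 ≤ L := by linarith
  have ha0 : 0 < |a| := lt_of_lt_of_le (by positivity) ha
  have hane : a ≠ 0 := abs_pos.1 ha0
  have h3 : L ^ 3 ≤ L ^ k := pow_le_pow_right₀ hL1 hk
  have hmem : ∀ t ∈ scaleSet s (floorDilate U a), ∃ u ∈ U, t = s * (⌊a * (u : ℝ)⌋ : ℝ) := by
    intro t ht
    obtain ⟨n, hn, rfl⟩ := Finset.mem_image.1 ht
    obtain ⟨u, hu, rfl⟩ := Finset.mem_image.1 hn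
    exact ⟨u, hu, rfl⟩
  have hfl : ∀ u : ℤ, |s * (⌊a * (u : ℝ)⌋ : ℝ) - a * (s * u)| ≤ s := fun u => by
    have h1 := Int.floor_le (a * (u : ℝ))
    have h2 := Int.lt_floor_add_one (a * (u : ℝ))
    have e : s * (⌊a * (u : ℝ)⌋ : ℝ) - a * (s * u) = s * ((⌊a * (u : ℝ)⌋ : ℝ) - a * u) := by ring
    rw [e, abs_mul, abs_of_pos hs]
    have : |(⌊a * (u : ℝ)⌋ : ℝ) - a * u| ≤ 1 := by rw [abs_le]; constructor <;> linarith
    nlinarith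
  refine ⟨hc, ?_, ?_, ?_⟩
  · intro t ht
    obtain ⟨u, hu, rfl⟩ := hmem t ht
    have h1 := abs_sub_abs_le_abs_sub (s * (⌊a * (u : ℝ)⌋ : ℝ)) (a * (s * u))
    have h2 := hfl u
    have h4 : |a * (s * u)| ≤ L * L := by
      rw [abs_mul]
      exact mul_le_mul ha' (h𝒟.bdd u (hU hu)) (abs_nonneg _) hL0.le
    have : L * L + 1 ≤ L ^ 3 := by nlinarith
    linarith
  · intro y hy hy1 c
    have hy0 : 0 ≤ y := le_trans (by positivity) hy
    set W := 𝒟.filter fun n : ℤ => |s * n - c / a| ≤ 2 * L * y with hW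
    have hWc := h𝒟.window (2 * L * y) (by nlinarith) (c / a)
    have hsub : ((scaleSet s (floorDilate U a)).filter fun t => |t - c| ≤ y) ⊆
        W.image fun u : ℤ => s * (⌊a * (u : ℝ)⌋ : ℝ) := by
      intro t ht
      obtain ⟨ht, htc⟩ := Finset.mem_filter.1 ht
      obtain ⟨u, hu, rfl⟩ := hmem t ht
      refine Finset.mem_image.2 ⟨u, Finset.mem_filter.2 ⟨hU hu, ?_⟩, rfl⟩
      have h1 : |a| * |s * u - c / a| ≤ 2 * y := by
        rw [← abs_mul]
        have e : a * (s * u - c / a) = (s * (⌊a * (u : ℝ)⌋ : ℝ) - c) -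
            (s * (⌊a * (u : ℝ)⌋ : ℝ) - a * (s * u)) := by field_simp; ring
        rw [e]
        exact (abs_sub _ _).trans (by linarith [hfl u])
      have h2 : 1 / L * |s * u - c / a| ≤ 2 * y := le_trans (by gcongr) h1
      rw [div_mul_eq_mul_div, div_le_iff₀ hL0] at h2
      linarith
    have h5 : (((scaleSet s (floorDilate U a)).filter fun t => |t - c| ≤ y).card : ℝ) ≤ W.card :=
      Nat.cast_le.2 ((Finset.card_le_card hsub).trans Finset.card_image_le)
    refine (h5.trans hWc).trans (mul_le_mul_of_nonneg_right ?_ (by positivity))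
    calc L * √(2 * L * y) ≤ L * (2 * L * √y) := by
          gcongr
          exact sqrt_mul_le (by linarith)
      _ = 2 * L ^ 2 * √y := by ring
      _ ≤ L ^ k * √y := by
          gcongr
          refine le_trans ?_ h3
          nlinarith [sq_nonneg L]
  · intro c
    have h1 : (((scaleSet s (floorDilate U a)).filter fun t => |t - c| ≤ s).card : ℝ) ≤
        ((floorDilate U a).filter fun n : ℤ => |(n : ℝ) - c / s| ≤ 1).card := by
      refine Nat.cast_le.2 (le_trans (Finset.card_le_card fun t ht => ?_)
        (Finset.card_image_le (f := fun n : ℤ => s * (n : ℝ))))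
      obtain ⟨ht, htc⟩ := Finset.mem_filter.1 ht
      obtain ⟨n, hn, rfl⟩ := Finset.mem_image.1 ht
      refine Finset.mem_image.2 ⟨n, Finset.mem_filter.2 ⟨hn, ?_⟩, rfl⟩
      have e : s * (n : ℝ) - c = s * (n - c / s) := by field_simp
      rw [e, abs_mul, abs_of_pos hs] at htc
      nlinarith
    have h2 := card_int_window (S := (floorDilate U a).filter fun n : ℤ => |(n : ℝ) - c / s| ≤ 1)
      zero_le_one fun n hn => (Finset.mem_filter.1 hn).2
    have : 2 * 2 * 2 ≤ L * L * L := by gcongr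
    nlinarith

end Labels

open Classical in
/-- Non-concentration of the image of a set of points under an expanding parameter. -/
lemma nonConc_image {V : Type*} [NormedAddCommGroup V] {s θ K L : ℝ} {P : Finset V} {l : V → ℝ}
    (hs : 0 < s) (hθ : 0 < θ) (hsθ : s ≤ θ ^ 1000) (hK1 : 1 ≤ K) (hKL : K ≤ L) (hL : 2 ≤ L)
    (hP : θ ^ 1000 / s ≤ L * P.card) (hl : ∀ p ∈ P, |l p| ≤ L)
    (hinj : ∀ p ∈ P, ∀ p' ∈ P, ‖p - p'‖ ≤ K * (s + |l p - l p'|))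
    (hball : ∀ y, θ ^ 1000 ≤ y → ∀ c,
      ((P.filter fun p => ‖p - c‖ ≤ y).card : ℝ) ≤ L * √y * (θ ^ 1000 / s))
    (hfine : ∀ c, ((P.filter fun p => ‖p - c‖ ≤ 3 * K * s).card : ℝ) ≤ L) :
    NonConc θ s (L ^ 4) (P.image l) := by
  have hL0 : 0 < L := by linarith
  have hL1 : 1 ≤ L := by linarith
  have hK0 : 0 < K := by linarith
  have k3 : 2 * 2 * 2 ≤ L * L * L := by gcongr
  have k4 : L ≤ L ^ 4 := le_self_pow₀ hL1 (by norm_num)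
  have hwin : ∀ y c, ∃ c', ((P.image l).filter fun t => |t - c| ≤ y) ⊆
      (P.filter fun p => ‖p - c'‖ ≤ K * (s + 2 * y)).image l := by
    intro y c
    rcases ((P.image l).filter fun t => |t - c| ≤ y).eq_empty_or_nonempty with h | ⟨t, ht⟩
    · exact ⟨0, h ▸ Finset.empty_subset _⟩
    · obtain ⟨ht, htc⟩ := Finset.mem_filter.1 ht
      obtain ⟨p₀, hp₀, rfl⟩ := Finset.mem_image.1 ht
      refine ⟨p₀, fun t ht => ?_⟩
      obtain ⟨ht, htc'⟩ := Finset.mem_filter.1 ht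
      obtain ⟨p, hp, rfl⟩ := Finset.mem_image.1 ht
      refine Finset.mem_image.2 ⟨p, Finset.mem_filter.2 ⟨hp, ?_⟩, rfl⟩
      refine (hinj p hp p₀ hp₀).trans ?_
      gcongr
      have : l p - l p₀ = (l p - c) - (l p₀ - c) := by ring
      rw [this]
      exact (abs_sub _ _).trans (by linarith)
  refine ⟨?_, ?_, ?_, ?_⟩
  · have h1 : (P.card : ℝ) ≤ L * (P.image l).card := by
      refine card_le_mul_card_image_real P fun b hb => ?_
      obtain ⟨p₀, hp₀, rfl⟩ := Finset.mem_image.1 hb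
      refine le_trans (Nat.cast_le.2 (Finset.card_le_card fun p hp => ?_)) (hfine p₀)
      obtain ⟨hp, hpl⟩ := Finset.mem_filter.1 hp
      refine Finset.mem_filter.2 ⟨hp, (hinj p hp p₀ hp₀).trans ?_⟩
      rw [hpl, sub_self, abs_zero]
      nlinarith [mul_pos hK0 hs]
    calc θ ^ 1000 / s ≤ L * P.card := hP
      _ ≤ L * (L * (P.image l).card) := by gcongr
      _ = L ^ 2 * (P.image l).card := by ring
      _ ≤ L ^ 4 * (P.image l).card := by gcongr; norm_num
  · intro t ht
    obtain ⟨p, hp, rfl⟩ := Finset.mem_image.1 ht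
    exact (hl p hp).trans k4
  · intro y hy hy1 c
    obtain ⟨c', hc'⟩ := hwin y c
    have hy0 : 0 ≤ y := le_trans (by positivity) hy
    have h1 : K * (s + 2 * y) ≤ 3 * K * y := by nlinarith
    have h2 := hball (3 * K * y) (by nlinarith) c'
    calc (((P.image l).filter fun t => |t - c| ≤ y).card : ℝ)
        ≤ (P.filter fun p => ‖p - c'‖ ≤ K * (s + 2 * y)).card :=
          Nat.cast_le.2 ((Finset.card_le_card hc').trans Finset.card_image_le)
      _ ≤ (P.filter fun p => ‖p - c'‖ ≤ 3 * K * y).card :=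
          Nat.cast_le.2 (Finset.card_le_card
            (Finset.monotone_filter_right _ fun p _ hp => le_trans hp h1))
      _ ≤ L * √(3 * K * y) * (θ ^ 1000 / s) := h2
      _ ≤ L * (3 * L * √y) * (θ ^ 1000 / s) := by
          gcongr
          exact (sqrt_mul_le (by linarith)).trans (by gcongr)
      _ = (3 * L ^ 2) * √y * (θ ^ 1000 / s) := by ring
      _ ≤ L ^ 4 * √y * (θ ^ 1000 / s) := by
          gcongr
          nlinarith [sq_nonneg L]
  · intro c
    obtain ⟨c', hc'⟩ := hwin s c
    refine le_trans ?_ ((hfine c').trans k4)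
    refine Nat.cast_le.2 ((Finset.card_le_card hc').trans (Finset.card_image_le.trans
      (Finset.card_le_card (Finset.monotone_filter_right _ fun p _ hp => le_trans hp ?_))))
    linarith

section RealInnerProductSpace

open scoped RealInnerProductSpace

section Frame

variable {V : Type*} [NormedAddCommGroup V] [InnerProductSpace ℝ V] {e : ℕ} {K : ℝ}
  {B₀ B₁ B₂ : Set V} {z : Fin e → V}

/-- The labels of a third point of the pencil are an affine function of the labels of the
first two. -/
lemma Frame.exists_label_relation (F : Frame K B₀ B₁ B₂ z) {p₁ p₂ p x x' w₀ : V} {s : ℝ}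
    (hs : 0 < s) (hsK : 2 * K ^ 30 * s ≤ 1) (hp₁ : p₁ ∈ B₀) (hp₂ : p₂ ∈ B₀) (hp : p ∈ B₀)
    (hx : x ∈ B₁) (hx' : x' ∈ B₁) (hw₀ : w₀ ∈ B₂) (hf : 1 / K ≤ ‖x - x'‖)
    (he : 1 / K ≤ ‖p₂ - p₁‖) (h1p : 1 / K ≤ ‖p - p₁‖) (h2p : 1 / K ≤ ‖p - p₂‖)
    (hxz : ∀ j, |dist x (z j) ^ 2 - dist x' (z j) ^ 2| ≤ s)
    (h12z : ∀ j, |dist p₁ (z j) ^ 2 - dist p₂ (z j) ^ 2| ≤ s)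
    (hp1z : ∀ j, |dist p (z j) ^ 2 - dist p₁ (z j) ^ 2| ≤ s)
    (hp2z : ∀ j, |dist p (z j) ^ 2 - dist p₂ (z j) ^ 2| ≤ s)
    (h₁ : lab s p₁ x = lab s p₁ x') (h₂ : lab s p₂ x = lab s p₂ x')
    (h₃ : lab s p x = lab s p x') :
    ∃ (α₁ α₂ β : ℝ) (μ : Fin e → ℝ), α₁ + α₂ + ∑ j, μ j = 1 ∧
      1 / K ^ 6 ≤ |α₁| ∧ |α₁| ≤ K ^ 10 ∧ 1 / K ^ 6 ≤ |α₂| ∧ |α₂| ≤ K ^ 10 ∧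
      ‖p - (α₁ • p₁ + α₂ • p₂ + ∑ j, μ j • z j)‖ ≤ K ^ 14 * s ∧
      ∀ w ∈ B₂, (∀ j, |dist w (z j) ^ 2 - dist w₀ (z j) ^ 2| ≤ s) →
        |α₁ * lab s p₁ w + α₂ * lab s p₂ w + β - lab s p w| ≤ K ^ 19 := by
  have hK := F.two_le
  have hK0 : 0 < K := by linarith
  have hK1 : 1 ≤ K := by linarith
  have hpow : ∀ {a b : ℕ}, a ≤ b → K ^ a ≤ K ^ b := fun h => pow_le_pow_right₀ hK1 h
  have hs10 : 2 * K ^ 10 * s ≤ 1 := by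
    refine le_trans ?_ hsK
    have := hpow (show 10 ≤ 30 by norm_num)
    gcongr
  obtain ⟨α₁, α₂, μ, hsum, hα₁, hα₂, hμ, hcomb⟩ := F.exists_affine_comb hp₁ hp₂ hp hx hx' hw₀
    hs.le hs10 hf he hxz h12z (abs_sub_le_of_lab_eq hs h₁) (abs_sub_le_of_lab_eq hs h₂)
    (abs_sub_le_of_lab_eq hs h₃)
  have hcomb' : ‖p - (α₂ • p₂ + α₁ • p₁ + ∑ j, μ j • z j)‖ ≤ K ^ 14 * s := by
    rwa [add_comm (α₂ • p₂)]
  have hlow : ∀ a : ℝ, 1 / K ≤ K ^ 3 * (K ^ 14 * s + |a| * K + s) → 1 / K ^ 6 ≤ |a| := by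
    intro a ha
    rw [div_le_iff₀ hK0] at ha
    rw [div_le_iff₀ (by positivity)]
    have e1 : K ^ 3 * (K ^ 14 * s + |a| * K + s) * K = K ^ 18 * s + K ^ 4 * s + |a| * K ^ 5 := by
      ring
    have h1 : K ^ 18 * s ≤ 1 / 4 := by
      have : 4 * K ^ 18 * s ≤ K ^ 12 * K ^ 18 * s := by
        have : (4 : ℝ) ≤ K ^ 12 := by
          calc (4 : ℝ) ≤ 2 ^ 12 := by norm_num
            _ ≤ K ^ 12 := by gcongr
        gcongr
      have h2 : K ^ 12 * K ^ 18 * s = K ^ 30 * s := by ring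
      have h3 : 0 ≤ K ^ 30 * s := by positivity
      linarith
    have h2 : K ^ 4 * s ≤ K ^ 18 * s := by gcongr; norm_num
    have h3 : 1 / 2 ≤ |a| * K ^ 5 := by linarith
    have h4 : 2 * (|a| * K ^ 5) ≤ K * (|a| * K ^ 5) := by gcongr
    calc 1 ≤ 2 * (|a| * K ^ 5) := by linarith
      _ ≤ _ := h4
      _ = _ := by ring
  refine ⟨α₁, α₂, (∑ j, μ j * dist w₀ (z j) ^ 2 +
    (‖α₁ • p₁ + α₂ • p₂ + ∑ j, μ j • z j‖ ^ 2 - α₁ * ‖p₁‖ ^ 2 - α₂ * ‖p₂‖ ^ 2 -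
        ∑ j, μ j * ‖z j‖ ^ 2)) / s, μ, hsum, hlow _ ?_, hα₁, hlow _ ?_, hα₂, hcomb, ?_⟩
  · exact h2p.trans (F.norm_sub_le_of_small_coeff hp₂ hp₁ hp hx hw₀ hs.le hp2z
      (by linarith) hcomb')
  · exact h1p.trans (F.norm_sub_le_of_small_coeff hp₁ hp₂ hp hx hw₀ hs.le hp1z hsum hcomb)
  intro w hw hwz
  set P := α₁ • p₁ + α₂ • p₂ + ∑ j, μ j • z j with hP
  set ct := ‖P‖ ^ 2 - α₁ * ‖p₁‖ ^ 2 - α₂ * ‖p₂‖ ^ 2 - ∑ j, μ j * ‖z j‖ ^ 2 with hct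
  have hdc := dist_sq_comb w p₁ p₂ z hsum
  rw [← hP, ← hct] at hdc
  set Z := ∑ j, μ j * dist w (z j) ^ 2 with hZ
  set Z₀ := ∑ j, μ j * dist w₀ (z j) ^ 2 with hZ₀
  have hZZ : |Z - Z₀| ≤ K ^ 9 * s := by
    rw [hZ, hZ₀, ← Finset.sum_sub_distrib]
    refine (Finset.abs_sum_le_sum_abs _ _).trans ?_
    have : ∀ j ∈ Finset.univ, |μ j * dist w (z j) ^ 2 - μ j * dist w₀ (z j) ^ 2| ≤ K ^ 8 * s :=
      fun j _ => by
        rw [← mul_sub, abs_mul]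
        exact mul_le_mul (hμ j) (hwz j) (abs_nonneg _) (by positivity)
    refine (Finset.sum_le_card_nsmul _ _ _ this).trans ?_
    rw [nsmul_eq_mul, Finset.card_univ, Fintype.card_fin]
    calc (e : ℝ) * (K ^ 8 * s) ≤ K * (K ^ 8 * s) := by gcongr; linarith [F.large]
      _ = _ := by ring
  have hpw : ‖p - w‖ ≤ K := F.norm_sub_le_const (Or.inl (Or.inl hp)) (Or.inr hw)
  have hK14 : K ^ 14 * s ≤ K := by
    have : K ^ 14 * s ≤ K ^ 30 * s := by gcongr; norm_num
    linarith
  have hPw : ‖P - w‖ ≤ 2 * K := by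
    have : P - w = (p - w) - (p - P) := by abel
    rw [this]
    exact (_root_.norm_sub_le _ _).trans (by linarith)
  have hPp : |dist p w ^ 2 - dist P w ^ 2| ≤ 2 * (2 * K) * (K ^ 14 * s) :=
    (abs_dist_sq_sub_le (by linarith) hPw).trans (by gcongr)
  have a1 := lab_mul_le hs p₁ w
  have a1' := lt_lab_mul hs p₁ w
  have a2 := lab_mul_le hs p₂ w
  have a2' := lt_lab_mul hs p₂ w
  have a3 := lab_mul_le hs p w
  have a3' := lt_lab_mul hs p w
  rw [dist_comm P w, hdc, dist_comm w p₁, dist_comm w p₂] at hPp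
  set q₁ := dist p₁ w ^ 2
  set q₂ := dist p₂ w ^ 2
  set q := dist p w ^ 2
  have b1 : |α₁ * (q₁ - s * (lab s p₁ w : ℝ))| ≤ K ^ 10 * s := by
    rw [abs_mul]
    refine mul_le_mul hα₁ ?_ (abs_nonneg _) (by positivity)
    rw [abs_le]; constructor <;> linarith
  have b2 : |α₂ * (q₂ - s * (lab s p₂ w : ℝ))| ≤ K ^ 10 * s := by
    rw [abs_mul]
    refine mul_le_mul hα₂ ?_ (abs_nonneg _) (by positivity)
    rw [abs_le]; constructor <;> linarith
  have e1 : α₁ * lab s p₁ w + α₂ * lab s p₂ w + (Z₀ + ct) / s - lab s p w =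
      (α₁ * (s * lab s p₁ w) + α₂ * (s * lab s p₂ w) + (Z₀ + ct) - s * lab s p w) / s := by
    field_simp
  rw [e1, abs_div, abs_of_pos hs, div_le_iff₀ hs]
  have c1 := abs_le.1 b1
  have c2 := abs_le.1 b2
  have c3 := abs_le.1 hZZ
  have c4 := abs_le.1 hPp
  have d1 : K ^ 9 * s ≤ K ^ 15 * s := by gcongr; norm_num
  have d2 : K ^ 10 * s ≤ K ^ 15 * s := by gcongr; norm_num
  have d3 : s ≤ K ^ 15 * s := le_mul_of_one_le_left hs.le (one_le_pow₀ hK1)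
  have d4 : 2 * (2 * K) * (K ^ 14 * s) = 4 * (K ^ 15 * s) := by ring
  have d5 : 16 * (K ^ 15 * s) ≤ K ^ 4 * (K ^ 15 * s) := by
    have : (16 : ℝ) ≤ K ^ 4 := by
      calc (16 : ℝ) = 2 ^ 4 := by norm_num
        _ ≤ K ^ 4 := by gcongr
    gcongr
  have d6 : K ^ 4 * (K ^ 15 * s) = K ^ 19 * s := by ring
  have d7 : 0 ≤ K ^ 15 * s := by positivity
  rw [d4] at c4
  rw [abs_le]
  constructor <;> linarith [c1.1, c1.2, c2.1, c2.2, c3.1, c3.2, c4.1, c4.2]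

end Frame

lemma NonConc.mono {θ η L L' : ℝ} {S : Finset ℝ} (h : NonConc θ η L S) (hθ : 0 < θ) (hη : 0 < η)
    (hL : L ≤ L') : NonConc θ η L' S where
  lower := h.lower.trans (by gcongr)
  bdd t ht := (h.bdd t ht).trans hL
  count y hy hy1 c := (h.count y hy hy1 c).trans (by gcongr)
  fine c := (h.fine c).trans hL

lemma Mult.mono_right {A : Finset ℝ} {η L L' l : ℝ} {j : ℕ} (h : Mult A η L j l) (hη : 0 < η)
    (hL0 : 0 ≤ L) (hL : L ≤ L') : Mult A η L' j l := by
  have hp : L ^ j ≤ L' ^ j := by gcongr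
  obtain ⟨h1, X, hX, h⟩ := h
  refine ⟨h1.trans hp, X, hX.trans hp, fun a ha => ?_⟩
  obtain ⟨x, hx, t, ht, hd⟩ := h a ha
  exact ⟨x, hx, t, ht, hd.trans (by gcongr)⟩

section Frame

variable {V : Type*} [NormedAddCommGroup V] [InnerProductSpace ℝ V] {e D : ℕ} {L s θ : ℝ}
  {B₀ B₁ B₂ : Set V} {z : Fin e → V}

/-- The points of `Π` are equidistant from `x` and `x'` at scale `s`, with labels in `𝒟`, and
have nearly constant distances to the points `z j`. -/
structure Equidistant (s : ℝ) (𝒟 : Finset ℤ) (B₀ : Set V) (z : Fin e → V) (x x' : V)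
    (S : Finset V) : Prop where
  mem : ∀ p ∈ S, p ∈ B₀
  lab_eq : ∀ p ∈ S, lab s p x = lab s p x'
  lab_mem : ∀ p ∈ S, lab s p x ∈ 𝒟
  const : ∀ p ∈ S, ∀ p' ∈ S, ∀ j, |dist p (z j) ^ 2 - dist p' (z j) ^ 2| ≤ s

lemma Frame.card_fiber_le (F : Frame L B₀ B₁ B₂ z) {x x' w₀ : V} {𝒟 : Finset ℤ} {S : Finset V}
    (hE : Equidistant s 𝒟 B₀ z x x' S) (hS : Sparse D L s S) (hs : 0 < s)
    (hsL : 2 * L ^ 3 * s ≤ 1) (hx : x ∈ B₁) (hx' : x' ∈ B₁) (hw₀ : w₀ ∈ B₂)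
    (hf : 1 / L ≤ ‖x - x'‖) (hxz : ∀ j, |dist x (z j) ^ 2 - dist x' (z j) ^ 2| ≤ s) (k : ℤ) :
    ((S.filter fun p => lab s p x = k).card : ℝ) ≤ L ^ (1 + 9 * D) := by
  have hL := F.two_le
  have := hS.card_le (M := L ^ 9) (one_le_pow₀ (by linarith)) (Finset.filter_subset
    (fun p => lab s p x = k) S) (fun p hp p' hp' => by
      obtain ⟨hp, hpk⟩ := Finset.mem_filter.1 hp
      obtain ⟨hp', hpk'⟩ := Finset.mem_filter.1 hp'
      exact F.norm_sub_le_of_bisector (hE.mem p hp) (hE.mem p' hp') hx hx' hw₀ hs.le hsL hf hxz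
        (hE.const p hp p' hp') (abs_sub_le_of_lab_eq hs (hE.lab_eq p hp))
        (abs_sub_le_of_lab_eq hs (hE.lab_eq p' hp'))
        (abs_sub_le_of_lab_eq hs (hpk.trans hpk'.symm))) (by linarith)
  refine this.trans_eq ?_
  rw [← pow_mul, pow_add, pow_one]

lemma Frame.card_equidistant_le (F : Frame L B₀ B₁ B₂ z) {x x' w₀ : V} {𝒟 : Finset ℤ}
    {S : Finset V} (h𝒟 : LabelSet θ s L 𝒟) (hE : Equidistant s 𝒟 B₀ z x x' S)
    (hS : Sparse D L s S) (hs : 0 < s) (hsL : 2 * L ^ 3 * s ≤ 1) (hx : x ∈ B₁) (hx' : x' ∈ B₁)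
    (hw₀ : w₀ ∈ B₂) (hf : 1 / L ≤ ‖x - x'‖)
    (hxz : ∀ j, |dist x (z j) ^ 2 - dist x' (z j) ^ 2| ≤ s) :
    (S.card : ℝ) ≤ L ^ (2 + 9 * D) * (θ ^ 1000 / s) := by
  have hL := F.two_le
  have h1 := card_le_mul_card_image_real (f := fun p => lab s p x) S fun k _ =>
    F.card_fiber_le hE hS hs hsL hx hx' hw₀ hf hxz k
  have h2 : ((S.image fun p => lab s p x).card : ℝ) ≤ 𝒟.card :=
    Nat.cast_le.2 (Finset.card_le_card (Finset.image_subset_iff.2 hE.lab_mem))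
  calc (S.card : ℝ) ≤ _ := h1
    _ ≤ L ^ (1 + 9 * D) * (L * (θ ^ 1000 / s)) := by gcongr; exact h2.trans h𝒟.card
    _ = _ := by ring

lemma Frame.card_equidistant_ball_le (F : Frame L B₀ B₁ B₂ z) {x x' w₀ : V} {𝒟 : Finset ℤ}
    {S : Finset V} (h𝒟 : LabelSet θ s L 𝒟) (hE : Equidistant s 𝒟 B₀ z x x' S)
    (hS : Sparse D L s S) (hs : 0 < s) (hθ : 0 < θ) (hsθ : s ≤ θ ^ 1000) (hsL : 2 * L ^ 3 * s ≤ 1)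
    (hx : x ∈ B₁) (hx' : x' ∈ B₁) (hw₀ : w₀ ∈ B₂) (hf : 1 / L ≤ ‖x - x'‖)
    (hxz : ∀ j, |dist x (z j) ^ 2 - dist x' (z j) ^ 2| ≤ s) {y : ℝ} (hy : θ ^ 1000 ≤ y) (c : V) :
    ((S.filter fun p => ‖p - c‖ ≤ y).card : ℝ) ≤ L ^ (6 + 9 * D) * √y * (θ ^ 1000 / s) := by
  have hL := F.two_le
  have hL1 : 1 ≤ L := by linarith
  have hy0 : 0 ≤ y := le_trans (by positivity) hy
  rcases (S.filter fun p => ‖p - c‖ ≤ y).eq_empty_or_nonempty with h | ⟨p₀, hp₀⟩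
  · rw [h, Finset.card_empty, Nat.cast_zero]; positivity
  obtain ⟨hp₀, hp₀c⟩ := Finset.mem_filter.1 hp₀
  have hnorm : ∀ p ∈ S, ‖p - x‖ ≤ L := fun p hp =>
    F.norm_sub_le_const (Or.inl (Or.inl (hE.mem p hp))) (Or.inl (Or.inr hx))
  have key := h𝒟.card_le_of_window (G := S.filter fun p => ‖p - c‖ ≤ y)
    (f := fun p => lab s p x) (fun p hp => hE.lab_mem p (Finset.mem_filter.1 hp).1)
    (m := L ^ (1 + 9 * D)) (by positivity) (fun k => le_trans (Nat.cast_le.2 (Finset.card_le_card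
      (Finset.filter_subset_filter _ (Finset.filter_subset _ _))))
      (F.card_fiber_le hE hS hs hsL hx hx' hw₀ hf hxz k)) (y := 5 * L * y) (by nlinarith)
    (c := dist p₀ x ^ 2) (fun p hp => by
      obtain ⟨hp, hpc⟩ := Finset.mem_filter.1 hp
      have h1 := abs_dist_sq_sub_le (hnorm p hp) (hnorm p₀ hp₀)
      have h2 : ‖p - p₀‖ ≤ 2 * y := by
        have : p - p₀ = (p - c) - (p₀ - c) := by abel
        rw [this]
        exact (_root_.norm_sub_le _ _).trans (by linarith)
      have h3 : 2 * L * ‖p - p₀‖ ≤ 2 * L * (2 * y) := by gcongr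
      have h4 := lab_mul_le hs p x
      have h5 := lt_lab_mul hs p x
      have h6 := abs_le.1 (h1.trans h3)
      have h7 : y ≤ L * y := le_mul_of_one_le_left hy0 hL1
      rw [abs_le]
      constructor <;> linarith)
  refine key.trans ?_
  have h8 : √(5 * L * y) ≤ 5 * L * √y := sqrt_mul_le (by linarith)
  have h9 : 5 * L ≤ L ^ 4 := by
    have : 2 * 2 * 2 ≤ L * L * L := by gcongr
    nlinarith
  calc L ^ (1 + 9 * D) * (L * √(5 * L * y) * (θ ^ 1000 / s))
      ≤ L ^ (1 + 9 * D) * (L * (L ^ 4 * √y) * (θ ^ 1000 / s)) := by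
        gcongr
        exact h8.trans (by gcongr)
    _ = _ := by ring

set_option maxHeartbeats 1000000 in
open Classical in
/-- A rich pencil contradicts the discretized ring theorem. -/
theorem pencil_contra (D : ℕ) : ∃ n₁ : ℕ, ∀ {V : Type*} [NormedAddCommGroup V]
    [InnerProductSpace ℝ V] {e : ℕ} {L s θ : ℝ} {B₀ B₁ B₂ : Set V} {z : Fin e → V}
    (_ : Frame L B₀ B₁ B₂ z) (_ : 0 < s) (_ : 0 < θ) (_ : θ ≤ 1) (_ : s ≤ θ ^ 1000)
    (_ : L ^ n₁ * θ ≤ 1) {𝒟 : Finset ℤ} (_ : LabelSet θ s L 𝒟) {x x' : V} (_ : x ∈ B₁)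
    (_ : x' ∈ B₁) (_ : 1 / L ≤ ‖x - x'‖)
    (_ : ∀ j, |dist x (z j) ^ 2 - dist x' (z j) ^ 2| ≤ s) {S F₃ G : Finset V}
    (_ : Equidistant s 𝒟 B₀ z x x' S) (_ : Sparse D L s S) (_ : ∀ w ∈ F₃, w ∈ B₂)
    (_ : Sparse D L s F₃) (_ : F₃.Nonempty)
    (_ : ∀ w ∈ F₃, ∀ w' ∈ F₃, ∀ j, |dist w (z j) ^ 2 - dist w' (z j) ^ 2| ≤ s)
    {p₁ p₂ : V} (_ : p₁ ∈ S) (_ : p₂ ∈ S) (_ : 1 / L ≤ ‖p₂ - p₁‖) (_ : G ⊆ S)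
    (_ : θ ^ 1000 / s ≤ L * G.card) (_ : ∀ p ∈ G, 1 / L ≤ ‖p - p₁‖ ∧ 1 / L ≤ ‖p - p₂‖ ∧
      (θ ^ 1000 / s) ^ 2 ≤ L * (F₃.filter fun w => lab s p₁ w ∈ 𝒟 ∧ lab s p₂ w ∈ 𝒟 ∧
        lab s p w ∈ 𝒟).card), False := by
  obtain ⟨n₀, hring⟩ := ring_contra
  set k := 20 + 14 * D with hk
  set M := 1365 + (51 + 11 * D) * 4 with hM
  refine ⟨k * M * n₀ + 31, ?_⟩
  intro V _ _ e L s θ B₀ B₁ B₂ z F hs hθ hθ1 hsθ hLθ 𝒟 h𝒟 x x' hx hx' hf hxz S F₃ G hE hS hF₃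
    hF₃S hF₃ne hF₃z p₁ p₂ hp₁ hp₂ h12 hGS hG hGp
  have hL := F.two_le
  have hL0 : 0 < L := by linarith
  have hL1 : 1 ≤ L := by linarith
  have hpow : ∀ {a b : ℕ}, a ≤ b → L ^ a ≤ L ^ b := fun h => pow_le_pow_right₀ hL1 h
  have hs1 : s ≤ θ := hsθ.trans (pow_le_of_le_one hθ.le hθ1 (by norm_num))
  have hsL : 2 * L ^ 30 * s ≤ 1 := by
    calc 2 * L ^ 30 * s ≤ L * L ^ 30 * θ := by gcongr
      _ = L ^ 31 * θ := by ring
      _ ≤ L ^ (k * M * n₀ + 31) * θ := by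
          have := hpow (show 31 ≤ k * M * n₀ + 31 by omega)
          gcongr
      _ ≤ 1 := hLθ
  have hsL' : ∀ {a : ℕ}, a ≤ 30 → 2 * L ^ a * s ≤ 1 := fun h => by
    refine le_trans ?_ hsL
    have := hpow h
    gcongr
  obtain ⟨w₀, hw₀⟩ := hF₃ne
  set N := θ ^ 1000 / s with hN
  have hN0 : 0 < N := by positivity
  set L₁ := L ^ k with hL₁
  have hLk : ∀ {a : ℕ}, a ≤ k → L ^ a ≤ L₁ := fun h => hpow h
  have hLL₁ : L ≤ L₁ := le_self_pow₀ hL1 (by omega)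
  have hL₁2 : 2 ≤ L₁ := hL.trans hLL₁
  have hL₁1 : 1 ≤ L₁ := by linarith
  have hL₁0 : 0 < L₁ := by linarith
  have hrel : ∀ p ∈ G, ∃ (α₁ α₂ β : ℝ) (μ : Fin e → ℝ), α₁ + α₂ + ∑ j, μ j = 1 ∧
      1 / L ^ 6 ≤ |α₁| ∧ |α₁| ≤ L ^ 10 ∧ 1 / L ^ 6 ≤ |α₂| ∧ |α₂| ≤ L ^ 10 ∧
      ‖p - (α₁ • p₁ + α₂ • p₂ + ∑ j, μ j • z j)‖ ≤ L ^ 14 * s ∧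
      ∀ w ∈ B₂, (∀ j, |dist w (z j) ^ 2 - dist w₀ (z j) ^ 2| ≤ s) →
        |α₁ * lab s p₁ w + α₂ * lab s p₂ w + β - lab s p w| ≤ L ^ 19 := fun p hp =>
    F.exists_label_relation hs hsL (hE.mem _ hp₁) (hE.mem _ hp₂) (hE.mem _ (hGS hp)) hx hx'
      (hF₃ _ hw₀) hf h12 (hGp p hp).1 (hGp p hp).2.1 hxz (hE.const _ hp₁ _ hp₂)
      (hE.const _ (hGS hp) _ hp₁) (hE.const _ (hGS hp) _ hp₂) (hE.lab_eq _ hp₁)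
      (hE.lab_eq _ hp₂) (hE.lab_eq _ (hGS hp))
  choose! α₁ α₂ β μ hsum hα₁ hα₁' hα₂ hα₂' hcomb hlab using hrel
  have hinv : 1 / L₁ ≤ 1 / L ^ 6 := one_div_le_one_div_of_le (by positivity) (hLk (by omega))
  set Wp : V → Finset V := fun p => F₃.filter fun w => lab s p₁ w ∈ 𝒟 ∧ lab s p₂ w ∈ 𝒟 ∧
        lab s p w ∈ 𝒟 with hWp
  set Γ : V → Finset (ℤ × ℤ) := fun p => (Wp p).image fun w => (lab s p₁ w, lab s p₂ w) with hΓ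
  have hGne : G.Nonempty := by
    rw [← Finset.card_pos]
    by_contra! h0
    have h1 : G.card = 0 := by omega
    rw [h1, Nat.cast_zero, mul_zero] at hG
    linarith
  have hΓc : ∀ p ∈ G, N ^ 2 ≤ L₁ * (Γ p).card := fun p hp => by
    have h1 : ((Wp p).card : ℝ) ≤ (L * (L ^ 14) ^ D) * (Γ p).card := by
      refine card_le_mul_card_image_real _ fun b _ => ?_
      refine hF₃S.card_le (one_le_pow₀ hL1)
        ((Finset.filter_subset _ _).trans (Finset.filter_subset _ _)) (fun w hw w' hw' => ?_) hL0.le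
      obtain ⟨hw, rfl⟩ := Finset.mem_filter.1 hw
      obtain ⟨hw', hww⟩ := Finset.mem_filter.1 hw'
      have hwF := (Finset.mem_filter.1 (Finset.mem_filter.1 hw).1).1
      have hwF' := (Finset.mem_filter.1 hw').1
      obtain ⟨h1, h2⟩ := Prod.mk.inj hww
      refine F.norm_sub_le_of_pencil (hE.mem _ hp₁) (hE.mem _ hp₂) hx hx' (hF₃ _ hwF) (hF₃ _ hwF')
        hs.le (hsL' (by norm_num)) hf h12 hxz (hE.const _ hp₁ _ hp₂)
        (abs_sub_le_of_lab_eq hs (hE.lab_eq _ hp₁)) (abs_sub_le_of_lab_eq hs (hE.lab_eq _ hp₂))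
        (hF₃z _ hwF _ hwF') ?_ ?_
      · rw [dist_comm w, dist_comm w']; exact abs_sub_le_of_lab_eq hs h1.symm
      · rw [dist_comm w, dist_comm w']; exact abs_sub_le_of_lab_eq hs h2.symm
    calc N ^ 2 ≤ L * (Wp p).card := (hGp p hp).2.2
      _ ≤ L * ((L * (L ^ 14) ^ D) * (Γ p).card) := by gcongr
      _ = L ^ (2 + 14 * D) * (Γ p).card := by ring
      _ ≤ L₁ * (Γ p).card := by gcongr; exact hLk (by omega)
  obtain ⟨p₀, hp₀, P', hP'G, hP'c, U, hU, hUc, hgrow, hmult⟩ :=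
    exists_multipliers (P := G) hGne hs hL₁2 hN0 (α₁ := α₁) (α₂ := α₂) (β := β) (𝒟 := 𝒟)
    (h𝒟.card.trans (by gcongr)) (fun p hp => hinv.trans (hα₁ p hp))
    (fun p hp => (hα₁' p hp).trans (hLk (by omega))) (fun p hp => hinv.trans (hα₂ p hp))
    (fun p hp => (hα₂' p hp).trans (hLk (by omega))) (Γ := Γ)
    (fun p hp => Finset.image_subset_iff.2 fun w hw => Finset.mem_product.2
      ⟨(Finset.mem_filter.1 hw).2.1, (Finset.mem_filter.1 hw).2.2.1⟩) hΓc
    (fun p hp a ha => by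
      obtain ⟨w, hw, rfl⟩ := Finset.mem_image.1 ha
      obtain ⟨hwF, -, -, hw3⟩ := Finset.mem_filter.1 hw
      exact ⟨_, hw3, (hlab p hp w (hF₃ _ hwF) (hF₃z _ hwF _ hw₀)).trans (hLk (by omega))⟩)
  set A := scaleSet s (floorDilate U (α₁ p₀)) with hA
  set lam : V → ℝ := fun p => α₁ p / α₂ p * (α₂ p₀ / α₁ p₀) with hlam
  have hα0 : ∀ p ∈ G, α₁ p ≠ 0 ∧ α₂ p ≠ 0 := fun p hp =>
    ⟨abs_pos.1 (lt_of_lt_of_le (by positivity) (hα₁ p hp)),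
      abs_pos.1 (lt_of_lt_of_le (by positivity) (hα₂ p hp))⟩
  have hquot : ∀ {a b : ℝ}, |a| ≤ L ^ 10 → 1 / L ^ 6 ≤ |b| → |a / b| ≤ L₁ := fun {a b} ha hb => by
    have hb0 : 0 < |b| := lt_of_lt_of_le (by positivity) hb
    rw [abs_div, div_le_iff₀ hb0]
    rw [div_le_iff₀ (by positivity)] at hb
    calc |a| ≤ L ^ 10 * 1 := by linarith
      _ ≤ L ^ 10 * (|b| * L ^ 6) := by gcongr
      _ = L ^ 16 * |b| := by ring
      _ ≤ _ := by gcongr; exact hLk (by omega)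
  set L₂ := L₁ ^ (51 + 11 * D) with hL₂
  have hpow₁ : ∀ {a b : ℕ}, a ≤ b → L₁ ^ a ≤ L₁ ^ b := fun h => pow_le_pow_right₀ hL₁1 h
  have hΛ : NonConc θ s (L₂ ^ 4) (P'.image lam) := by
    refine nonConc_image (K := L₁ ^ 9) (L := L₂) hs hθ hsθ (one_le_pow₀ hL₁1) (hpow₁ (by omega))
      (hL₁2.trans (le_self_pow₀ hL₁1 (by omega))) ?_ ?_ ?_ ?_ ?_
    · calc N ≤ L * G.card := hG
        _ ≤ L₁ * (L₁ ^ 49 * P'.card) := by gcongr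
        _ = L₁ ^ 50 * P'.card := by ring
        _ ≤ L₂ * P'.card := by gcongr; exact hpow₁ (by omega)
    · intro p hp
      have hpG := hP'G hp
      rw [hlam]
      simp only
      rw [abs_mul]
      calc _ ≤ L₁ * L₁ := mul_le_mul (hquot (hα₁' p hpG) (hα₂ p hpG))
            (hquot (hα₂' p₀ hp₀) (hα₁ p₀ hp₀)) (abs_nonneg _) hL₁0.le
        _ = L₁ ^ 2 := by ring
        _ ≤ L₂ := hpow₁ (by omega)
    · intro p hp p' hp'
      have hpG := hP'G hp
      have hpG' := hP'G hp'
      have e1 : α₁ p / α₂ p - α₁ p' / α₂ p' = (lam p - lam p') * (α₁ p₀ / α₂ p₀) := by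
        have := hα0 p₀ hp₀
        have h1 := this.1
        have h2 := this.2
        rw [hlam]
        simp only
        have : α₂ p₀ / α₁ p₀ * (α₁ p₀ / α₂ p₀) = 1 := by field_simp
        linear_combination (-(α₁ p / α₂ p) + α₁ p' / α₂ p') * this
      have h1 : |α₁ p / α₂ p - α₁ p' / α₂ p'| ≤ L₁ * |lam p - lam p'| := by
        rw [e1, abs_mul, mul_comm]
        gcongr
        exact hquot (hα₁' p₀ hp₀) (hα₂ p₀ hp₀)
      have h2 := (F.mono hLL₁).norm_sub_le_of_ratio (hE.mem _ hp₁) (hE.mem _ (hGS hpG))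
        (hE.mem _ (hGS hpG')) hx (hF₃ _ hw₀) hs.le (hE.const _ (hGS hpG) _ (hGS hpG'))
        (hsum p hpG) (hsum p' hpG') (hcomb p hpG) (hcomb p' hpG')
        ((hα₂' p hpG).trans (hLk (by omega))) (hα0 p hpG).2 (hinv.trans (hα₂ p' hpG')) h1
      refine h2.trans ?_
      have h3 : L ^ 14 * s ≤ L₁ * s := by gcongr; exact hLk (by omega)
      have h4 : s ≤ L₁ * s := le_mul_of_one_le_left hs.le hL₁1
      have h5 : 0 ≤ |lam p - lam p'| := abs_nonneg _
      calc L₁ ^ 6 * (L ^ 14 * s + L₁ * |lam p - lam p'| + s)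
          ≤ L₁ ^ 6 * (L₁ * s + L₁ * |lam p - lam p'| + L₁ * s) := by gcongr
        _ ≤ L₁ ^ 6 * (2 * (L₁ * (s + |lam p - lam p'|))) := by
            gcongr
            have : 0 ≤ L₁ * |lam p - lam p'| := by positivity
            linarith
        _ ≤ L₁ ^ 6 * (L₁ ^ 2 * (L₁ * (s + |lam p - lam p'|))) := by
            gcongr
            nlinarith
        _ = _ := by ring
    · intro y hy c
      refine le_trans (Nat.cast_le.2 (Finset.card_le_card
        (Finset.filter_subset_filter _ (hP'G.trans hGS)))) ((F.card_equidistant_ball_le h𝒟 hE hS hs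
          hθ hsθ (hsL' (by norm_num)) hx hx' (hF₃ _ hw₀) hf hxz hy c).trans ?_)
      gcongr
      calc L ^ (6 + 9 * D) ≤ L₁ := hLk (by omega)
        _ ≤ L₂ := le_self_pow₀ hL₁1 (by omega)
    · intro c
      have h1 : 3 * L₁ ^ 9 ≤ L₁ ^ 11 := by
        calc 3 * L₁ ^ 9 ≤ L₁ ^ 2 * L₁ ^ 9 := by gcongr; nlinarith
          _ = _ := by ring
      have h2 := hS (3 * L₁ ^ 9) (by linarith [one_le_pow₀ hL₁1 (n := 9)]) c
      refine le_trans (Nat.cast_le.2 (Finset.card_le_card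
        (Finset.filter_subset_filter _ (hP'G.trans hGS)))) (h2.trans ?_)
      calc L * (3 * L₁ ^ 9) ^ D ≤ L₁ * (L₁ ^ 11) ^ D := by gcongr
        _ = L₁ ^ (1 + 11 * D) := by ring
        _ ≤ L₂ := hpow₁ (by omega)
  have hANC : NonConc θ s (L₁ ^ 16) A :=
    nonConc_scaleSet (h𝒟.mono hθ hs hLL₁) hs hθ hsθ (hs1.trans hθ1) hL₁2 hU
      (hinv.trans (hα₁ p₀ hp₀)) ((hα₁' p₀ hp₀).trans (hLk (by omega))) (by norm_num) hUc
  have hML : ∀ {a : ℕ}, a ≤ M → L₁ ^ a ≤ L₁ ^ M := fun h => hpow₁ h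
  refine hring θ s (L₁ ^ M) A (P'.image lam) hθ hθ1 hs (hs1.trans hθ1)
    (hL₁2.trans (le_self_pow₀ hL₁1 (by omega))) ?_ (hANC.mono hθ hs (hML (by omega)))
    (hΛ.mono hθ hs ?_) ?_ ?_ ?_
  · refine le_trans ?_ hLθ
    rw [hL₁, ← pow_mul, ← pow_mul]
    gcongr
    rw [← mul_assoc]; omega
  · rw [hL₂, ← pow_mul]
    exact hML (by omega)
  · intro i
    refine (hgrow i).trans ?_
    gcongr ?_ * _
    exact pow_le_pow_left₀ (by positivity) (hML (by omega)) _
  · have h1 : ((P'.image lam).card : ℝ) ≤ S.card :=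
      Nat.cast_le.2 (Finset.card_image_le.trans (Finset.card_le_card (hP'G.trans hGS)))
    refine (h1.trans (F.card_equidistant_le h𝒟 hE hS hs (hsL' (by norm_num)) hx hx' (hF₃ _ hw₀)
      hf hxz)).trans ?_
    gcongr
    calc L ^ (2 + 9 * D) ≤ L₁ := hLk (by omega)
      _ ≤ L₁ ^ M := le_self_pow₀ hL₁1 (by omega)
      _ ≤ (L₁ ^ M) ^ 3 := le_self_pow₀ (one_le_pow₀ hL₁1) (by norm_num)
  · intro l hl
    obtain ⟨p, hp, rfl⟩ := Finset.mem_image.1 hl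
    exact Mult.mono_right (hmult p hp) hs (by positivity) (hML (by omega))

end Frame

section Frame

variable {V : Type*} [NormedAddCommGroup V] [InnerProductSpace ℝ V] {e D : ℕ} {L s θ : ℝ}
  {B₀ B₁ B₂ : Set V} {z : Fin e → V}

/-- The points near `x₀` with a given label to `p` and a label in `𝒟` to `w` are few. -/
lemma Frame.card_slice_le (F : Frame L B₀ B₁ B₂ z) {𝒟 : Finset ℤ} (h𝒟 : LabelSet θ s L 𝒟)
    (hs : 0 < s) (hθ : 0 < θ) (hsθ : s ≤ θ ^ 1000) {p w x₀ : V} (hp : p ∈ B₀) (hw : w ∈ B₂)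
    (hx₀ : x₀ ∈ B₁) {F₂ : Finset V} (hF₂ : ∀ x ∈ F₂, x ∈ B₁) (hS : Sparse D L s F₂)
    (hz : ∀ x ∈ F₂, ∀ x' ∈ F₂, ∀ j, |dist x (z j) ^ 2 - dist x' (z j) ^ 2| ≤ s) {k : ℤ}
    (hk : ∀ x ∈ F₂, lab s p x = k) (hl : ∀ x ∈ F₂, lab s x w ∈ 𝒟) {y : ℝ} (hy : θ ^ 1000 ≤ y)
    (hxy : ∀ x ∈ F₂, ‖x₀ - x‖ ≤ y) :
    (F₂.card : ℝ) ≤ L ^ (5 + 2 * D) * √y * (θ ^ 1000 / s) := by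
  have hL := F.two_le
  have hL1 : 1 ≤ L := by linarith
  have hy0 : 0 ≤ y := le_trans (by positivity) hy
  have hfib : ∀ l, ((F₂.filter fun x => lab s x w = l).card : ℝ) ≤ L ^ (1 + 2 * D) := fun l => by
    have := hS.card_le (M := L ^ 2) (one_le_pow₀ hL1) (Finset.filter_subset
      (fun x => lab s x w = l) F₂) (fun x hx x' hx' => by
        obtain ⟨hx, hxl⟩ := Finset.mem_filter.1 hx
        obtain ⟨hx', hxl'⟩ := Finset.mem_filter.1 hx'
        refine F.swap₀₁.norm_sub_le (hF₂ _ hx) (hF₂ _ hx') hp hw hs.le ?_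
          (abs_sub_le_of_lab_eq hs (hxl.trans hxl'.symm)) (hz x hx x' hx')
        rw [dist_comm x, dist_comm x']
        exact abs_sub_le_of_lab_eq hs ((hk x hx).trans (hk x' hx').symm)) (by linarith)
    refine this.trans_eq ?_
    rw [← pow_mul, pow_add, pow_one]
  have key := h𝒟.card_le_of_window (G := F₂) (f := fun x => lab s x w) hl (by positivity) hfib
    (y := 3 * L * y) (by nlinarith) (c := dist x₀ w ^ 2) (fun x hx => by
      have h1 := abs_dist_sq_sub_le (F.norm_sub_le_const (Or.inl (Or.inr hx₀)) (Or.inr hw))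
        (F.norm_sub_le_const (Or.inl (Or.inr (hF₂ x hx))) (Or.inr hw))
      have h3 : 2 * L * ‖x₀ - x‖ ≤ 2 * L * y := by gcongr; exact hxy x hx
      have h4 := lab_mul_le hs x w
      have h5 := lt_lab_mul hs x w
      have h6 := abs_le.1 (h1.trans h3)
      have h7 : y ≤ L * y := le_mul_of_one_le_left hy0 hL1
      rw [abs_le]
      constructor <;> linarith)
  refine key.trans ?_
  have h8 : √(3 * L * y) ≤ 3 * L * √y := sqrt_mul_le (by linarith)
  have h9 : 3 * L ≤ L ^ 3 := by
    have : 2 * 2 ≤ L * L := by gcongr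
    nlinarith
  calc L ^ (1 + 2 * D) * (L * √(3 * L * y) * (θ ^ 1000 / s))
      ≤ L ^ (1 + 2 * D) * (L * (L ^ 3 * √y) * (θ ^ 1000 / s)) := by
        gcongr
        exact h8.trans (by gcongr)
    _ = _ := by ring

end Frame

lemma sqrt_one_div_pow {L : ℝ} (hL : 0 < L) (m : ℕ) : √(1 / L ^ (2 * m)) = 1 / L ^ m := by
  rw [mul_comm, pow_mul, Real.sqrt_div zero_le_one, Real.sqrt_one, Real.sqrt_sq (by positivity)]

set_option maxHeartbeats 2000000 in
open Classical in
/-- Three families of points with prescribed distances to `z j` do not span too many triangles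
with labels in `𝒟`. -/
theorem counting_contra (D : ℕ) : ∃ n₂ : ℕ, ∀ {V : Type*} [NormedAddCommGroup V]
    [InnerProductSpace ℝ V] {e : ℕ} {L s θ : ℝ} {B₀ B₁ B₂ : Set V} {z : Fin e → V}
    (_ : Frame L B₀ B₁ B₂ z) (_ : 0 < s) (_ : 0 < θ) (_ : θ ≤ 1) (_ : s ≤ θ ^ 1000)
    (_ : L ^ n₂ * θ ≤ 1) {𝒟 : Finset ℤ} (_ : LabelSet θ s L 𝒟) {F₁ F₂ F₃ : Finset V}
    (_ : ∀ p ∈ F₁, p ∈ B₀) (_ : ∀ p ∈ F₂, p ∈ B₁) (_ : ∀ p ∈ F₃, p ∈ B₂)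
    (_ : Sparse D L s F₁) (_ : Sparse D L s F₂) (_ : Sparse D L s F₃)
    (_ : ∀ w ∈ F₁, ∀ w' ∈ F₁, ∀ j, |dist w (z j) ^ 2 - dist w' (z j) ^ 2| ≤ s)
    (_ : ∀ w ∈ F₂, ∀ w' ∈ F₂, ∀ j, |dist w (z j) ^ 2 - dist w' (z j) ^ 2| ≤ s)
    (_ : ∀ w ∈ F₃, ∀ w' ∈ F₃, ∀ j, |dist w (z j) ^ 2 - dist w' (z j) ^ 2| ≤ s)
    (_ : (F₁.card : ℝ) ≤ L * (θ ^ 1000 / s) ^ 2) (_ : (F₂.card : ℝ) ≤ L * (θ ^ 1000 / s) ^ 2)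
    (_ : (F₃.card : ℝ) ≤ L * (θ ^ 1000 / s) ^ 2) {T : Finset (V × V × V)}
    (_ : T ⊆ F₁ ×ˢ F₂ ×ˢ F₃) (_ : ∀ t ∈ T, lab s t.1 t.2.1 ∈ 𝒟 ∧ lab s t.1 t.2.2 ∈ 𝒟 ∧
      lab s t.2.1 t.2.2 ∈ 𝒟) (_ : (θ ^ 1000 / s) ^ 6 ≤ L * T.card), False := by
  obtain ⟨n₁, hpencil⟩ := pencil_contra D
  set m := 14 + 2 * D with hm
  set m₂ := 26 + 81 * D with hm₂
  refine ⟨2 * m * (2 * m₂) * n₁ + 2 * m * (2 * m₂) + 6 * m + 1, ?_⟩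
  intro V _ _ e L s θ B₀ B₁ B₂ z F hs hθ hθ1 hsθ hLθ 𝒟 h𝒟 F₁ F₂ F₃ hF₁ hF₂ hF₃ hS₁ hS₂ hS₃ hz₁ hz₂
    hz₃ hc₁ hc₂ hc₃ T hT hTl hTc
  have hL := F.two_le
  have hL0 : 0 < L := by linarith
  have hL1 : 1 ≤ L := by linarith
  have hpow : ∀ {a b : ℕ}, a ≤ b → L ^ a ≤ L ^ b := fun h => pow_le_pow_right₀ hL1 h
  have hθp : ∀ {a : ℕ}, a ≤ 2 * m * (2 * m₂) * n₁ + 2 * m * (2 * m₂) + 6 * m + 1 →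
      L ^ a * θ ≤ 1 := fun h => by
    refine le_trans ?_ hLθ
    gcongr
  have hs1 : s ≤ θ := hsθ.trans (pow_le_of_le_one hθ.le hθ1 (by norm_num))
  have hθy : θ ^ 1000 ≤ θ := pow_le_of_le_one hθ.le hθ1 (by norm_num)
  set N := θ ^ 1000 / s with hN
  have hN0 : 0 < N := by positivity
  set y₁ := 1 / L ^ (2 * m) with hy₁
  have hy₁θ : θ ^ 1000 ≤ y₁ := by
    rw [hy₁, le_div_iff₀ (by positivity), mul_comm]
    exact le_trans (by gcongr) (hθp (a := 2 * m) (by omega))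
  obtain ⟨x, hx, x', hx', hxx, hR⟩ := exists_equidistant_pair hT (ℓ := lab s)
    (fun t ht => (hTl t ht).1) hL0 hN0 hc₁ hc₂ hc₃ h𝒟.card hTc (near := fun x x' => ‖x - x'‖ ≤ y₁)
    (fun t ht => by
      set Tt := T.filter fun t' => (t.1 = t'.1 ∧ t.2.2 = t'.2.2 ∧
        lab s t.1 t.2.1 = lab s t'.1 t'.2.1) ∧ ‖t.2.1 - t'.2.1‖ ≤ y₁ with hTt
      have hmem : ∀ t' ∈ Tt, t' ∈ T ∧ (t.1 = t'.1 ∧ t.2.2 = t'.2.2 ∧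
        lab s t.1 t.2.1 = lab s t'.1 t'.2.1) ∧ ‖t.2.1 - t'.2.1‖ ≤ y₁ := fun t' ht' =>
        Finset.mem_filter.1 ht'
      have hprod : ∀ t' ∈ T, t'.1 ∈ F₁ ∧ t'.2.1 ∈ F₂ ∧ t'.2.2 ∈ F₃ := fun t' ht' => by
        have := hT ht'
        simpa only [Finset.mem_product] using this
      have hcard : Tt.card = (Tt.image fun t' => t'.2.1).card := by
        refine (Finset.card_image_of_injOn fun a ha b hb hab => ?_).symm
        have h1 := (hmem a ha).2.1
        have h2 := (hmem b hb).2.1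
        exact Prod.ext (h1.1.symm.trans h2.1) (Prod.ext hab (h1.2.1.symm.trans h2.2.1))
      have hsub : (Tt.image fun t' => t'.2.1) ⊆ F₂ := fun u hu => by
        obtain ⟨t', ht', rfl⟩ := Finset.mem_image.1 hu
        exact (hprod t' (hmem t' ht').1).2.1
      have hp := hprod t ht
      have := F.card_slice_le h𝒟 hs hθ hsθ (hF₁ _ hp.1) (hF₃ _ hp.2.2) (hF₂ _ hp.2.1)
        (F₂ := Tt.image fun t' => t'.2.1) (fun u hu => hF₂ u (hsub hu)) (hS₂.subset hsub)
        (fun u hu v hv => hz₂ u (hsub hu) v (hsub hv)) (k := lab s t.1 t.2.1) (fun u hu => by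
          obtain ⟨t', ht', rfl⟩ := Finset.mem_image.1 hu
          have h1 := (hmem t' ht').2.1
          rw [h1.2.2, h1.1]) (fun u hu => by
          obtain ⟨t', ht', rfl⟩ := Finset.mem_image.1 hu
          obtain ⟨h1, h2, -⟩ := hmem t' ht'
          rw [h2.2.1]
          exact (hTl t' h1).2.2) hy₁θ (fun u hu => by
          obtain ⟨t', ht', rfl⟩ := Finset.mem_image.1 hu
          exact (hmem t' ht').2.2)
      rw [hcard]
      calc 2 * L ^ 8 * ((Tt.image fun t' => t'.2.1).card : ℝ)
          ≤ L * L ^ 8 * (L ^ (5 + 2 * D) * √y₁ * N) := by gcongr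
        _ = L ^ m * √y₁ * N := by
          have h1 : L * L ^ 8 * L ^ (5 + 2 * D) = L ^ m := by
            rw [← pow_succ', ← pow_add, hm]; congr 1; omega
          rw [← mul_assoc, ← mul_assoc, h1]
        _ = N := by
          rw [hy₁, sqrt_one_div_pow hL0, mul_one_div_cancel (by positivity), one_mul])
  set L₁ := L ^ (2 * m) with hL₁
  have hLL₁ : L ≤ L₁ := le_self_pow₀ hL1 (by omega)
  have hL₁2 : 2 ≤ L₁ := hL.trans hLL₁
  have hL₁1 : 1 ≤ L₁ := by linarith
  have hL₁0 : 0 < L₁ := by linarith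
  have hpow₁ : ∀ {a b : ℕ}, a ≤ b → L₁ ^ a ≤ L₁ ^ b := fun h => pow_le_pow_right₀ hL₁1 h
  have FL₁ := F.mono hLL₁
  have h𝒟₁ := h𝒟.mono hθ hs hLL₁
  have hf : 1 / L₁ ≤ ‖x - x'‖ := (not_le.1 hxx).le
  have hxz := hz₂ x hx x' hx'
  have hTne : T.Nonempty := by
    by_contra h
    rw [Finset.not_nonempty_iff_eq_empty.1 h, Finset.card_empty, Nat.cast_zero, mul_zero] at hTc
    exact absurd hTc (not_le.2 (by positivity))
  have hF₃ne : F₃.Nonempty := by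
    obtain ⟨t, ht⟩ := hTne
    have := hT ht
    simp only [Finset.mem_product] at this
    exact ⟨_, this.2.2⟩
  obtain ⟨w₀, hw₀⟩ := id hF₃ne
  have hsL₁ : 2 * L₁ ^ 3 * s ≤ 1 := by
    calc 2 * L₁ ^ 3 * s ≤ L * L₁ ^ 3 * θ := by gcongr
      _ = L ^ (6 * m + 1) * θ := by rw [hL₁]; ring
      _ ≤ 1 := hθp (by omega)
  set S := F₁.filter fun p => lab s p x = lab s p x' ∧ lab s p x ∈ 𝒟 with hSdef
  have hSF : S ⊆ F₁ := Finset.filter_subset _ _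
  have hE : Equidistant s 𝒟 B₀ z x x' S :=
    ⟨fun p hp => hF₁ p (hSF hp), fun p hp => (Finset.mem_filter.1 hp).2.1,
      fun p hp => (Finset.mem_filter.1 hp).2.2, fun p hp p' hp' => hz₁ p (hSF hp) p' (hSF hp')⟩
  have hSS : Sparse D L₁ s S := (hS₁.subset hSF).mono hLL₁
  set R := (F₁ ×ˢ F₃).filter fun r => (r.1, x, r.2) ∈ T ∧ (r.1, x', r.2) ∈ T ∧
    lab s r.1 x = lab s r.1 x' with hRdef
  have hRmem : ∀ r ∈ R, r.1 ∈ S ∧ r.2 ∈ F₃ ∧ lab s r.1 r.2 ∈ 𝒟 := fun r hr => by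
    obtain ⟨h1, h2, -, h4⟩ := Finset.mem_filter.1 hr
    obtain ⟨h5, h6⟩ := Finset.mem_product.1 h1
    exact ⟨Finset.mem_filter.2 ⟨h5, h4, (hTl _ h2).1⟩, h6, (hTl _ h2).2.1⟩
  set L₂ := L₁ ^ (2 + 9 * D) with hL₂
  have hL₁₂ : L₁ ≤ L₂ := le_self_pow₀ hL₁1 (by omega)
  have hL₂0 : 0 < L₂ := by positivity
  set y₂ := 1 / L₁ ^ (2 * m₂) with hy₂
  have hy₂θ : θ ^ 1000 ≤ y₂ := by
    rw [hy₂, le_div_iff₀ (by positivity), mul_comm, hL₁, ← pow_mul]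
    exact le_trans (by gcongr) (hθp (a := 2 * m * (2 * m₂)) (by omega))
  obtain ⟨p₁, hp₁, p₂, hp₂, hp12, G, hGS, hG, hGp⟩ := exists_popular_triples (S := S) (F := F₃)
    (R := R) (fun r hr => Finset.mem_product.2 ⟨(hRmem r hr).1, (hRmem r hr).2.1⟩) hL₂0 hN0
    (FL₁.card_equidistant_le h𝒟₁ hE hSS hs hsL₁ (hF₂ x hx) (hF₂ x' hx') (hF₃ _ hw₀) hf hxz)
    (hc₃.trans (by gcongr; exact hLL₁.trans hL₁₂)) (hR.trans (by
      gcongr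
      calc 2 * L ^ 7 ≤ L * L ^ 7 := by gcongr
        _ = L ^ 8 := by ring
        _ ≤ L₁ := hpow (by omega)
        _ ≤ L₂ := hL₁₂)) (near := fun p p' => ‖p' - p‖ ≤ y₂) (fun p _ => by
      calc 12 * L₂ ^ 8 * ((S.filter fun p' => ‖p' - p‖ ≤ y₂).card : ℝ)
          ≤ L₁ ^ 4 * L₂ ^ 8 * (L₁ ^ (6 + 9 * D) * √y₂ * N) := by
            gcongr
            · have : (2 : ℝ) ^ 4 ≤ L₁ ^ 4 := by gcongr
              linarith
            · exact FL₁.card_equidistant_ball_le h𝒟₁ hE hSS hs hθ hsθ hsL₁ (hF₂ x hx) (hF₂ x' hx')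
                (hF₃ _ hw₀) hf hxz hy₂θ p
        _ = L₁ ^ m₂ * √y₂ * N := by
          have h1 : L₁ ^ 4 * L₂ ^ 8 * L₁ ^ (6 + 9 * D) = L₁ ^ m₂ := by
            rw [hL₂, ← pow_mul L₁ (2 + 9 * D) 8, ← pow_add, ← pow_add, hm₂]; congr 1; omega
          rw [← mul_assoc, ← mul_assoc, h1]
        _ = N := by
          rw [hy₂, sqrt_one_div_pow hL₁0, mul_one_div_cancel (by positivity), one_mul])
  set L₃ := L₁ ^ (2 * m₂) with hL₃
  have hL₁₃ : L₁ ≤ L₃ := le_self_pow₀ hL₁1 (by omega)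
  have hL₂₃ : 4 * L₂ ^ 8 ≤ L₃ := by
    calc 4 * L₂ ^ 8 ≤ L₁ ^ 2 * L₂ ^ 8 := by
          gcongr
          nlinarith
      _ = L₁ ^ (18 + 72 * D) := by rw [hL₂]; ring
      _ ≤ L₃ := hpow₁ (by omega)
  have hLL₃ := hLL₁.trans hL₁₃
  refine hpencil (F.mono hLL₃) hs hθ hθ1 hsθ ?_ (h𝒟.mono hθ hs hLL₃) (hF₂ x hx) (hF₂ x' hx')
    (le_trans (by gcongr) hf) hxz hE (hSS.mono hL₁₃) hF₃ (hS₃.mono hLL₃) hF₃ne hz₃ hp₁ hp₂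
    (not_le.1 hp12).le hGS (hG.trans (by gcongr)) fun p hp => ?_
  · rw [hL₃, hL₁, ← pow_mul, ← pow_mul]
    exact hθp (by nlinarith)
  · obtain ⟨h1, h2, h3⟩ := hGp p hp
    refine ⟨(not_le.1 h1).le, (not_le.1 h2).le, h3.trans ?_⟩
    refine mul_le_mul hL₂₃ (Nat.cast_le.2 (Finset.card_le_card
      (Finset.monotone_filter_right F₃ fun w _ h => ?_))) (by positivity) (by positivity)
    exact ⟨(hRmem _ h.1).2.2, (hRmem _ h.2.1).2.2, (hRmem _ h.2.2).2.2⟩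

end RealInnerProductSpace

lemma abs_le_of_det {n : ℕ} {c K : ℝ} (hc : 0 < c) (hK : 1 ≤ K) {A : Matrix (Fin n) (Fin n) ℝ}
    (hA : c ≤ |A.det|) (hAK : ∀ i j, |A i j| ≤ K) {l : Fin n → ℝ} {r : ℝ}
    (hl : ∀ i, |(A.mulVec l) i| ≤ r) (i : Fin n) : |l i| ≤ n.factorial * K ^ n / c * r := by
  have hr : 0 ≤ r := (abs_nonneg _).trans (hl i)
  have h1 : A.cramer (A.mulVec l) = A.det • l := by
    rw [Matrix.cramer_eq_adjugate_mulVec, Matrix.mulVec_mulVec, Matrix.adjugate_mul,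
      Matrix.smul_mulVec, Matrix.one_mulVec]
  have h2 : A.det * l i = (A.updateCol i (A.mulVec l)).det := by
    rw [← Matrix.cramer_apply, h1]; rfl
  have h3 : ∀ t, 0 < t → r ≤ t → |(A.updateCol i (A.mulVec l)).det| ≤ n.factorial * K ^ n * t := by
    intro t ht hrt
    have e : A.updateCol i (A.mulVec l) = A.updateCol i (t • (t⁻¹ • A.mulVec l)) := by
      rw [smul_smul, mul_inv_cancel₀ ht.ne', one_smul]
    rw [e, Matrix.det_updateCol_smul, abs_mul, abs_of_pos ht, mul_comm]
    gcongr
    have := Matrix.det_le (A := A.updateCol i (t⁻¹ • A.mulVec l)) (abv := AbsoluteValue.abs)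
      (x := K) (fun k j => by
        change |_| ≤ K
        rw [Matrix.updateCol_apply]
        split_ifs with h
        · rw [Pi.smul_apply, smul_eq_mul, abs_mul, abs_inv, abs_of_pos ht]
          refine le_trans ?_ hK
          rw [inv_mul_le_iff₀ ht, mul_one]
          exact (hl k).trans hrt
        · exact hAK k j)
    rw [Fintype.card_fin, nsmul_eq_mul] at this
    exact this
  have h4 : |(A.updateCol i (A.mulVec l)).det| ≤ n.factorial * K ^ n * r := by
    refine le_of_forall_pos_le_add fun ε hε => ?_
    have hF : 0 < (n.factorial : ℝ) * K ^ n := by positivity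
    refine (h3 (r + ε / (n.factorial * K ^ n)) (by positivity)
      (le_add_of_nonneg_right (by positivity))).trans_eq ?_
    field_simp
  rw [← h2, abs_mul] at h4
  rw [div_mul_eq_mul_div, le_div_iff₀ hc]
  calc |l i| * c ≤ |l i| * |A.det| := by gcongr
    _ ≤ _ := by rw [mul_comm]; exact h4

lemma mulVec_sub_apply {e : ℕ} (p x w : Euc (e + 2)) (z : Fin e → Euc (e + 2)) (b c : ℝ)
    (μ : Fin e → ℝ) (i : Fin (e + 2)) :
    ((Matrix.of fun i j : Fin (e + 2) => ((Fin.cons p (Fin.cons x (Fin.cons w z)) :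
      Fin (e + 3) → Euc (e + 2)) j.succ - (Fin.cons p (Fin.cons x (Fin.cons w z)) :
      Fin (e + 3) → Euc (e + 2)) 0) i).mulVec (Fin.cons b (Fin.cons c μ) : Fin (e + 2) → ℝ)) i =
      (-(b + c + ∑ j, μ j) • p + b • x + c • w + ∑ j, μ j • z j) i := by
  simp only [Matrix.mulVec, dotProduct, Matrix.of_apply, Fin.sum_univ_succ (n := e + 1),
    Fin.sum_univ_succ (n := e), Fin.cons_succ, Fin.cons_zero, PiLp.sub_apply, PiLp.add_apply,
    PiLp.smul_apply, smul_eq_mul]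
  have h : ∀ (f : Fin e → Euc (e + 2)), (∑ j, f j) i = ∑ j, f j i := fun f => by
    simp
  rw [h]
  simp only [PiLp.smul_apply, smul_eq_mul, sub_mul, Finset.sum_sub_distrib, mul_comm (μ _)]
  rw [← Finset.mul_sum]
  ring

/-- Balls with all determinants bounded below form a frame. -/
lemma frame_of_det {e : ℕ} {c K L : ℝ} (hc : 0 < c) {b : Fin (e + 3) → Euc (e + 2)}
    (hdet : ∀ x : Fin (e + 3) → Euc (e + 2), (∀ j, x j ∈ closedBall (b j) 1) →
      c ≤ |Matrix.det (Matrix.of fun i j : Fin (e + 2) => (x j.succ - x 0) i)|)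
    (hK : (e : ℝ) + 2 ≤ K)
    (hb : ∀ i j, ∀ y ∈ closedBall (b i) 1, ∀ y' ∈ closedBall (b j) 1, ‖y - y'‖ ≤ K)
    (hKL : K ≤ L) (hL : ((e : ℝ) + 2) * ((e + 2).factorial * K ^ (e + 2) / c) ≤ L)
    {z : Fin e → Euc (e + 2)} (hz : ∀ j, z j ∈ closedBall (b j.succ.succ.succ) 1) :
    Frame L (closedBall (b 0) 1) (closedBall (b 1) 1) (closedBall (b 2) 1) z := by
  have he : (0 : ℝ) ≤ e := Nat.cast_nonneg e
  have hK1 : 1 ≤ K := by linarith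
  set k := ((e + 2).factorial : ℝ) * K ^ (e + 2) / c with hk
  have hk0 : 0 ≤ k := by positivity
  have hkL : k ≤ L := le_trans (le_mul_of_one_le_left hk0 (by linarith)) hL
  have hcons : ∀ p ∈ closedBall (b 0) 1, ∀ x ∈ closedBall (b 1) 1, ∀ w ∈ closedBall (b 2) 1,
      ∀ j, (Fin.cons p (Fin.cons x (Fin.cons w z)) : Fin (e + 3) → Euc (e + 2)) j ∈
        closedBall (b j) 1 := fun p hp x hx w hw j => by
    refine Fin.cases hp (fun j => ?_) j
    refine Fin.cases hx (fun j => ?_) j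
    exact Fin.cases hw (fun j => hz j) j
  refine ⟨hK.trans hKL, convex_closedBall _ _, convex_closedBall _ _, convex_closedBall _ _, ?_, ?_,
    ?_⟩
  · have h : ∀ y ∈ closedBall (b 0) 1 ∪ closedBall (b 1) 1 ∪ closedBall (b 2) 1 ∪ range z,
        ∃ j, y ∈ closedBall (b j) 1 := by
      rintro y (((hy | hy) | hy) | ⟨j, rfl⟩)
      exacts [⟨_, hy⟩, ⟨_, hy⟩, ⟨_, hy⟩, ⟨_, hz j⟩]
    intro y hy y' hy'
    obtain ⟨j, hj⟩ := h y hy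
    obtain ⟨j', hj'⟩ := h y' hy'
    exact (hb _ _ _ hj _ hj').trans hKL
  · intro p hp x hx w hw a b' c' μ hsum
    have hX := hcons p hp x hx w hw
    have ha : a = -(b' + c' + ∑ j, μ j) := by linarith
    rw [ha]
    set v := -(b' + c' + ∑ j, μ j) • p + b' • x + c' • w + ∑ j, μ j • z j with hv
    have key := abs_le_of_det hc hK1 (hdet _ hX) (fun i j => by
      rw [Matrix.of_apply, ← Real.norm_eq_abs]
      exact (PiLp.norm_apply_le _ _).trans (hb _ _ _ (hX _) _ (hX _)))
      (l := (Fin.cons b' (Fin.cons c' μ) : Fin (e + 2) → ℝ)) (r := ‖v‖) (fun i => by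
        rw [mulVec_sub_apply, ← Real.norm_eq_abs]
        exact PiLp.norm_apply_le _ _)
    rw [← hk] at key
    have h1 : |b'| ≤ k * ‖v‖ := key 0
    have h2 : |c'| ≤ k * ‖v‖ := key (Fin.succ 0)
    have h3 : ∀ j, |μ j| ≤ k * ‖v‖ := fun j => key j.succ.succ
    have hkL' : k * ‖v‖ ≤ L * ‖v‖ := by gcongr
    refine ⟨?_, h1.trans hkL', h2.trans hkL', fun j => (h3 j).trans hkL'⟩
    rw [abs_neg]
    have h4 : |∑ j, μ j| ≤ e * (k * ‖v‖) := by
      refine (Finset.abs_sum_le_sum_abs _ _).trans ((Finset.sum_le_sum fun j _ => h3 j).trans ?_)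
      rw [Finset.sum_const, Finset.card_univ, Fintype.card_fin, nsmul_eq_mul]
    calc |b' + c' + ∑ j, μ j| ≤ |b'| + |c'| + |∑ j, μ j| := abs_add_three _ _ _
      _ ≤ k * ‖v‖ + k * ‖v‖ + e * (k * ‖v‖) := by gcongr
      _ = (e + 2) * k * ‖v‖ := by ring
      _ ≤ L * ‖v‖ := by gcongr
  · intro p hp x hx w hw g
    have hX := hcons p hp x hx w hw
    set A := Matrix.of fun i j : Fin (e + 2) => ((Fin.cons p (Fin.cons x (Fin.cons w z)) :
      Fin (e + 3) → Euc (e + 2)) j.succ - (Fin.cons p (Fin.cons x (Fin.cons w z)) :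
      Fin (e + 3) → Euc (e + 2)) 0) i with hA
    have hAd : IsUnit A.det := by
      rw [isUnit_iff_ne_zero, ← abs_pos]
      exact hc.trans_le (hdet _ hX)
    set l := A⁻¹.mulVec g.ofLp with hl
    have hAl : A.mulVec l = g.ofLp := by
      rw [hl, Matrix.mulVec_mulVec, Matrix.mul_nonsing_inv _ hAd, Matrix.one_mulVec]
    have hcl : l = (Fin.cons (l 0) (Fin.cons (l 1) fun j => l j.succ.succ) : Fin (e + 2) → ℝ) := by
      ext j
      refine Fin.cases rfl (fun j => ?_) j
      exact Fin.cases rfl (fun j => rfl) j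
    refine ⟨-(l 0 + l 1 + ∑ j : Fin e, l j.succ.succ), l 0, l 1, fun j => l j.succ.succ,
        by ring, ?_⟩
    ext i
    rw [← mulVec_sub_apply, ← hcl, ← hA, hAl]

section RealInnerProductSpace

open scoped RealInnerProductSpace

section Frame

variable {V : Type*} [NormedAddCommGroup V] [InnerProductSpace ℝ V] {e D : ℕ} {L s θ : ℝ}
  {B₀ B₁ B₂ : Set V} {z : Fin e → V}

/-- The points with labels in `𝒟` to two given points are at most quadratically many. -/
lemma Frame.card_le_sq (F : Frame L B₀ B₁ B₂ z) {𝒟 : Finset ℤ} (h𝒟 : LabelSet θ s L 𝒟)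
    (hs : 0 < s) (hθ : 0 < θ) {x w : V} (hx : x ∈ B₁) (hw : w ∈ B₂) {G : Finset V}
    (hG : ∀ p ∈ G, p ∈ B₀) (hS : Sparse D L s G)
    (hz : ∀ p ∈ G, ∀ p' ∈ G, ∀ j, |dist p (z j) ^ 2 - dist p' (z j) ^ 2| ≤ s)
    (hk : ∀ p ∈ G, lab s p x ∈ 𝒟) (hl : ∀ p ∈ G, lab s p w ∈ 𝒟) :
    (G.card : ℝ) ≤ L ^ (3 + 2 * D) * (θ ^ 1000 / s) ^ 2 := by
  have hL := F.two_le
  have h1 := card_le_mul_card_image_real (f := fun p => (lab s p x, lab s p w))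
    (m := L ^ (1 + 2 * D)) G fun b _ => by
      have := hS.card_le (M := L ^ 2) (one_le_pow₀ (by linarith)) (Finset.filter_subset
        (fun p => (lab s p x, lab s p w) = b) G) (fun p hp p' hp' => by
          obtain ⟨hp, hpk⟩ := Finset.mem_filter.1 hp
          obtain ⟨hp', hpk'⟩ := Finset.mem_filter.1 hp'
          obtain ⟨e1, e2⟩ := Prod.mk.inj (hpk.trans hpk'.symm)
          exact F.norm_sub_le (hG _ hp) (hG _ hp') hx hw hs.le (abs_sub_le_of_lab_eq hs e1)
            (abs_sub_le_of_lab_eq hs e2) (hz p hp p' hp')) (by linarith)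
      refine this.trans_eq ?_
      rw [← pow_mul, pow_add, pow_one]
  have h2 : ((G.image fun p => (lab s p x, lab s p w)).card : ℝ) ≤ 𝒟.card * 𝒟.card := by
    rw [← Nat.cast_mul, ← Finset.card_product]
    exact Nat.cast_le.2 (Finset.card_le_card (Finset.image_subset_iff.2 fun p hp =>
      Finset.mem_product.2 ⟨hk p hp, hl p hp⟩))
  have h3 := h𝒟.card
  calc (G.card : ℝ) ≤ _ := h1
    _ ≤ L ^ (1 + 2 * D) * (L * (θ ^ 1000 / s) * (L * (θ ^ 1000 / s))) := by
      gcongr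
      exact h2.trans (by gcongr)
    _ = _ := by ring

lemma Frame.card_le_sq_of_injOn (F : Frame L B₀ B₁ B₂ z) {𝒟 : Finset ℤ}
    (h𝒟 : LabelSet θ s L 𝒟) (hs : 0 < s) (hθ : 0 < θ) {x w : V} (hx : x ∈ B₁) (hw : w ∈ B₂)
    {A : Finset V} (hA : ∀ p ∈ A, p ∈ B₀) (hS : Sparse D L s A)
    (hz : ∀ p ∈ A, ∀ p' ∈ A, ∀ j, |dist p (z j) ^ 2 - dist p' (z j) ^ 2| ≤ s) {ι : Type*}
    {Q : Finset ι} {g : ι → V} (hg : Set.InjOn g Q)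
    (hQ : ∀ t ∈ Q, g t ∈ A ∧ lab s (g t) x ∈ 𝒟 ∧ lab s (g t) w ∈ 𝒟) :
    (Q.card : ℝ) ≤ L ^ (3 + 2 * D) * (θ ^ 1000 / s) ^ 2 := by
  classical
  have hsub : Q.image g ⊆ A := Finset.image_subset_iff.2 fun t ht => (hQ t ht).1
  have := F.card_le_sq h𝒟 hs hθ hx hw (G := Q.image g) (fun p hp => hA p (hsub hp))
    (hS.subset hsub) (fun p hp p' hp' => hz p (hsub hp) p' (hsub hp'))
    (Finset.forall_mem_image.2 fun t ht => (hQ t ht).2.1)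
    (Finset.forall_mem_image.2 fun t ht => (hQ t ht).2.2)
  rwa [Finset.card_image_of_injOn hg] at this

end Frame

lemma sum_card_fiber_le {ι κ : Type*} [DecidableEq κ] (Y : Finset ι) (I : Finset κ) (f : ι → κ) :
    ∑ i ∈ I, ((Y.filter fun u => f u = i).card : ℝ) ≤ Y.card := by
  rw [← Nat.cast_sum, Finset.sum_card_fiberwise_eq_card_filter]
  exact Nat.cast_le.2 (Finset.card_filter_le _ _)

lemma le_of_prod_le {a b n R m t : ℝ} (ha : 0 < a) (hb : 0 < b) (hR : 0 ≤ R)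
    (h : a * b * n ≤ R * t) (ht : t ≤ m * (a * b)) : n ≤ R * m := by
  have h1 : a * b * n ≤ a * b * (R * m) := by
    calc a * b * n ≤ R * (m * (a * b)) := h.trans (by gcongr)
      _ = _ := by ring
  exact le_of_mul_le_mul_left h1 (by positivity)

set_option maxHeartbeats 2000000 in
open Classical in
/-- Too many simplices with all labels in `𝒟` are impossible. -/
theorem tuple_contra (D e : ℕ) : ∃ n₃ : ℕ, ∀ {V : Type*} [NormedAddCommGroup V]
    [InnerProductSpace ℝ V] {L s θ : ℝ} {B₀ B₁ B₂ : Set V} {Z : Finset (Fin e → V)}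
    (_ : 2 ≤ L) (_ : ∀ z ∈ Z, Frame L B₀ B₁ B₂ z) (_ : 0 < s) (_ : 0 < θ) (_ : θ ≤ 1)
    (_ : s ≤ θ ^ 1000) (_ : L ^ n₃ * θ ≤ 1) {𝒟 : Finset ℤ} (_ : LabelSet θ s L 𝒟)
    {P₁ P₂ P₃ : Finset V} (_ : ∀ p ∈ P₁, p ∈ B₀) (_ : ∀ p ∈ P₂, p ∈ B₁) (_ : ∀ p ∈ P₃, p ∈ B₂)
    (_ : Sparse D L s P₁) (_ : Sparse D L s P₂) (_ : Sparse D L s P₃)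
    (_ : (P₁.card : ℝ) ≤ L * (θ ^ 1000 / s) ^ (e + 2))
    (_ : (P₂.card : ℝ) ≤ L * (θ ^ 1000 / s) ^ (e + 2))
    (_ : (P₃.card : ℝ) ≤ L * (θ ^ 1000 / s) ^ (e + 2))
    (_ : (Z.card : ℝ) ≤ L * (θ ^ 1000 / s) ^ ((e + 2) * e))
    {X : Finset ((V × V × V) × (Fin e → V))} (_ : X ⊆ (P₁ ×ˢ P₂ ×ˢ P₃) ×ˢ Z)
    (_ : ∀ u ∈ X, (lab s u.1.1 u.1.2.1 ∈ 𝒟 ∧ lab s u.1.1 u.1.2.2 ∈ 𝒟 ∧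
      lab s u.1.2.1 u.1.2.2 ∈ 𝒟) ∧ ∀ j, lab s u.1.1 (u.2 j) ∈ 𝒟 ∧ lab s u.1.2.1 (u.2 j) ∈ 𝒟 ∧
      lab s u.1.2.2 (u.2 j) ∈ 𝒟)
    (_ : (θ ^ 1000 / s) ^ ((e + 2) * (e + 3)) ≤ L * X.card), False := by
  obtain ⟨n₂, hcount⟩ := counting_contra D
  refine ⟨(9 + 3 * e + 2 * D) * n₂, ?_⟩
  intro V _ _ L s θ B₀ B₁ B₂ Z hL hF hs hθ hθ1 hsθ hLθ 𝒟 h𝒟 P₁ P₂ P₃ hP₁ hP₂ hP₃ hS₁ hS₂ hS₃ hc₁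
    hc₂ hc₃ hZ X hX hXl hXc
  have hL0 : 0 < L := by linarith
  have hL1 : 1 ≤ L := by linarith
  have hpow : ∀ {a b : ℕ}, a ≤ b → L ^ a ≤ L ^ b := fun h => pow_le_pow_right₀ hL1 h
  have h𝒟c := h𝒟.card
  set N := θ ^ 1000 / s with hN
  have hN0 : 0 < N := by positivity
  set Y := (P₁ ×ˢ P₂ ×ˢ P₃) ×ˢ Z with hY
  set key : (V × V × V) × (Fin e → V) → (Fin e → V) × (Fin e → ℤ) × (Fin e → ℤ) × (Fin e → ℤ) :=
    fun u => (u.2, (fun j => lab s u.1.1 (u.2 j)), (fun j => lab s u.1.2.1 (u.2 j)),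
      fun j => lab s u.1.2.2 (u.2 j)) with hkey
  set E := Fintype.piFinset fun _ : Fin e => 𝒟 with hE
  set I := Z ×ˢ E ×ˢ E ×ˢ E with hI
  have hXI : ∀ u ∈ X, key u ∈ I := fun u hu => by
    have h1 := hX hu
    have h2 := (hXl u hu).2
    simp only [hY, hI, hE, hkey, Finset.mem_product, Fintype.mem_piFinset] at h1 ⊢
    exact ⟨h1.2, fun j => (h2 j).1, fun j => (h2 j).2.1, fun j => (h2 j).2.2⟩
  have hEc : (E.card : ℝ) ≤ (L * N) ^ e := by
    rw [hE, Fintype.card_piFinset_const, Nat.cast_pow]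
    gcongr
  have hIc : (I.card : ℝ) ≤ L ^ (1 + 3 * e) * N ^ ((e + 2) * e + 3 * e) := by
    rw [hI, Finset.card_product, Finset.card_product, Finset.card_product]
    push_cast
    calc (Z.card : ℝ) * (E.card * (E.card * E.card))
        ≤ L * N ^ ((e + 2) * e) * ((L * N) ^ e * ((L * N) ^ e * (L * N) ^ e)) := by gcongr
      _ = _ := by rw [mul_pow]; ring
  have hYc : (Y.card : ℝ) ≤ L ^ 4 * N ^ ((e + 2) * (e + 3)) := by
    rw [hY, Finset.card_product, Finset.card_product, Finset.card_product]
    push_cast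
    calc (P₁.card : ℝ) * (P₂.card * P₃.card) * Z.card
        ≤ L * N ^ (e + 2) * (L * N ^ (e + 2) * (L * N ^ (e + 2))) * (L * N ^ ((e + 2) * e)) := by
          gcongr
      _ = _ := by ring
  have hXsum : (X.card : ℝ) = ∑ i ∈ I, ((X.filter fun u => key u = i).card : ℝ) := by
    exact_mod_cast Finset.card_eq_sum_card_fiberwise hXI
  have hYsum : ∑ i ∈ I, ((Y.filter fun u => key u = i).card : ℝ) ≤ Y.card := by
    exact sum_card_fiber_le Y I key
  have hNpos : 0 < N ^ ((e + 2) * (e + 3)) := by positivity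
  have hXpos : 0 < (X.card : ℝ) := by
    by_contra h
    have : (X.card : ℝ) = 0 := le_antisymm (not_lt.1 h) (Nat.cast_nonneg _)
    rw [this, mul_zero] at hXc
    exact absurd hXc (not_le.2 hNpos)
  have hIne : I.Nonempty := by
    obtain ⟨u, hu⟩ := Finset.card_pos.1 (Nat.cast_pos.1 hXpos)
    exact ⟨_, hXI u hu⟩
  set L₁ := L ^ (6 + 3 * e) with hL₁
  have hL₁0 : 0 < L₁ := by positivity
  obtain ⟨i, hi, hile⟩ := Finset.exists_le_of_sum_le (s := I)
    (f := fun i => N ^ 6 + ((Y.filter fun u => key u = i).card : ℝ))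
    (g := fun i => L₁ * ((X.filter fun u => key u = i).card : ℝ)) hIne (by
      rw [← Finset.mul_sum, ← hXsum, Finset.sum_add_distrib, Finset.sum_const, nsmul_eq_mul]
      calc (I.card : ℝ) * N ^ 6 + ∑ i ∈ I, ((Y.filter fun u => key u = i).card : ℝ)
          ≤ L ^ (1 + 3 * e) * N ^ ((e + 2) * e + 3 * e) * N ^ 6 +
            L ^ 4 * N ^ ((e + 2) * (e + 3)) := by
            gcongr
            exact hYsum.trans hYc
        _ = (L ^ (1 + 3 * e) + L ^ 4) * N ^ ((e + 2) * (e + 3)) := by ring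
        _ ≤ (L ^ (4 + 3 * e) + L ^ (4 + 3 * e)) * N ^ ((e + 2) * (e + 3)) := by
            gcongr <;> first | exact hL1 | omega
        _ = 2 * L ^ (4 + 3 * e) * N ^ ((e + 2) * (e + 3)) := by ring
        _ ≤ L * L ^ (4 + 3 * e) * (L * X.card) := by gcongr
        _ = L₁ * X.card := by rw [hL₁]; ring)
  obtain ⟨z, τ₁, τ₂, τ₃⟩ := i
  have hzZ : z ∈ Z := (Finset.mem_product.1 hi).1
  have F := hF z hzZ
  set F₁ := P₁.filter fun p => (fun j => lab s p (z j)) = τ₁ with hF₁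
  set F₂ := P₂.filter fun p => (fun j => lab s p (z j)) = τ₂ with hF₂
  set F₃ := P₃.filter fun p => (fun j => lab s p (z j)) = τ₃ with hF₃
  set X' := X.filter fun u => key u = (z, τ₁, τ₂, τ₃) with hX'
  set T := X'.image fun u => u.1 with hT
  have hTmem : ∀ t ∈ T, (t, z) ∈ X ∧ key (t, z) = (z, τ₁, τ₂, τ₃) := fun t ht => by
    obtain ⟨⟨t, z'⟩, hu, rfl⟩ := Finset.mem_image.1 ht
    obtain ⟨h1, h2⟩ := Finset.mem_filter.1 hu
    have : z' = z := (Prod.mk.inj h2).1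
    subst this
    exact ⟨h1, h2⟩
  have hTc : T.card = X'.card := Finset.card_image_of_injOn fun u hu v hv huv => by
    have h1 := (Prod.mk.inj (Finset.mem_filter.1 hu).2).1
    have h2 := (Prod.mk.inj (Finset.mem_filter.1 hv).2).1
    exact Prod.ext huv (h1.trans h2.symm)
  have hTF : T ⊆ F₁ ×ˢ F₂ ×ˢ F₃ := fun t ht => by
    obtain ⟨h1, h2⟩ := hTmem t ht
    obtain ⟨-, h3⟩ := Prod.mk.inj h2
    obtain ⟨h3, h4⟩ := Prod.mk.inj h3
    obtain ⟨h4, h5⟩ := Prod.mk.inj h4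
    have h6 := (Finset.mem_product.1 (hX h1)).1
    simp only [Finset.mem_product] at h6 ⊢
    exact ⟨Finset.mem_filter.2 ⟨h6.1, h3⟩, Finset.mem_filter.2 ⟨h6.2.1, h4⟩,
      Finset.mem_filter.2 ⟨h6.2.2, h5⟩⟩
  have hFY : F₁.card * (F₂.card * F₃.card) ≤ (Y.filter fun u => key u = (z, τ₁, τ₂, τ₃)).card := by
    rw [← Finset.card_product, ← Finset.card_product]
    refine Finset.card_le_card_of_injOn (fun t => (t, z)) (fun t ht => ?_)
      fun t _ t' _ h => (Prod.mk.inj h).1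
    simp only [Finset.coe_product, Set.mem_prod, Finset.mem_coe] at ht
    obtain ⟨h1, h2, h3⟩ := ht
    obtain ⟨h1, h1'⟩ := Finset.mem_filter.1 h1
    obtain ⟨h2, h2'⟩ := Finset.mem_filter.1 h2
    obtain ⟨h3, h3'⟩ := Finset.mem_filter.1 h3
    refine Finset.mem_coe.2 (Finset.mem_filter.2 ⟨?_, ?_⟩)
    · simp only [hY, Finset.mem_product]
      exact ⟨⟨h1, h2, h3⟩, hzZ⟩
    · rw [← h1', ← h2', ← h3']
  have hFT : (F₁.card : ℝ) * (F₂.card * F₃.card) ≤ L₁ * T.card := by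
    rw [hTc]
    refine le_trans ?_ hile
    refine le_add_of_nonneg_of_le (by positivity) ?_
    exact_mod_cast hFY
  have hNT : N ^ 6 ≤ L₁ * T.card := by
    rw [hTc]
    exact (le_add_of_nonneg_right (Nat.cast_nonneg _)).trans hile
  have hTne : T.Nonempty := by
    by_contra h
    rw [Finset.not_nonempty_iff_eq_empty.1 h, Finset.card_empty, Nat.cast_zero, mul_zero] at hNT
    exact absurd hNT (not_le.2 (by positivity))
  have hTl : ∀ t ∈ T, lab s t.1 t.2.1 ∈ 𝒟 ∧ lab s t.1 t.2.2 ∈ 𝒟 ∧ lab s t.2.1 t.2.2 ∈ 𝒟 :=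
    fun t ht => (hXl _ (hTmem t ht).1).1
  have hTp : ∀ t ∈ T, t.1 ∈ F₁ ∧ t.2.1 ∈ F₂ ∧ t.2.2 ∈ F₃ := fun t ht => by
    have := hTF ht
    simpa only [Finset.mem_product] using this
  have hpos : 0 < (F₁.card : ℝ) ∧ 0 < (F₂.card : ℝ) ∧ 0 < (F₃.card : ℝ) := by
    obtain ⟨t, ht⟩ := hTne
    obtain ⟨h1, h2, h3⟩ := hTp t ht
    exact ⟨Nat.cast_pos.2 (Finset.card_pos.2 ⟨_, h1⟩), Nat.cast_pos.2 (Finset.card_pos.2 ⟨_, h2⟩),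
      Nat.cast_pos.2 (Finset.card_pos.2 ⟨_, h3⟩)⟩
  have hz : ∀ {P : Finset V} {τ : Fin e → ℤ}, ∀ w ∈
      P.filter (fun p => (fun j => lab s p (z j)) = τ),
      ∀ w' ∈ P.filter (fun p => (fun j => lab s p (z j)) = τ), ∀ j,
      |dist w (z j) ^ 2 - dist w' (z j) ^ 2| ≤ s := fun w hw w' hw' j =>
    abs_sub_le_of_lab_eq hs (congrFun ((Finset.mem_filter.1 hw).2.trans
      (Finset.mem_filter.1 hw').2.symm) j)
  have hB₁ : ∀ p ∈ F₁, p ∈ B₀ := fun p hp => hP₁ p (Finset.mem_filter.1 hp).1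
  have hB₂ : ∀ p ∈ F₂, p ∈ B₁ := fun p hp => hP₂ p (Finset.mem_filter.1 hp).1
  have hB₃ : ∀ p ∈ F₃, p ∈ B₂ := fun p hp => hP₃ p (Finset.mem_filter.1 hp).1
  have hS₁' : Sparse D L s F₁ := hS₁.subset (Finset.filter_subset _ _)
  have hS₂' : Sparse D L s F₂ := hS₂.subset (Finset.filter_subset _ _)
  have hS₃' : Sparse D L s F₃ := hS₃.subset (Finset.filter_subset _ _)
  have him : ∀ {A B : Finset V} {f : V × V × V → V × V}, (∀ t ∈ T, (f t).1 ∈ A ∧ (f t).2 ∈ B) →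
      ((T.image f).card : ℝ) ≤ A.card * B.card := fun h => by
    rw [← Nat.cast_mul, ← Finset.card_product]
    exact Nat.cast_le.2 (Finset.card_le_card (Finset.image_subset_iff.2 fun t ht =>
      Finset.mem_product.2 (h t ht)))
  set m := L ^ (3 + 2 * D) * N ^ 2 with hm
  have hm0 : 0 ≤ m := by positivity
  have hfin : L₁ * m = L ^ (9 + 3 * e + 2 * D) * N ^ 2 := by rw [hL₁, hm]; ring
  have hn₁ : (F₁.card : ℝ) ≤ L ^ (9 + 3 * e + 2 * D) * N ^ 2 := by
    rw [← hfin]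
    refine le_of_prod_le (t := T.card) hpos.2.1 hpos.2.2 hL₁0.le (by rw [mul_comm]; exact hFT) ?_
    refine (card_le_mul_card_image_real (f := fun t => (t.2.1, t.2.2)) (m := m) T
      fun b hb => ?_).trans (by gcongr; exact him fun t ht => (hTp t ht).2)
    obtain ⟨t, ht, rfl⟩ := Finset.mem_image.1 hb
    obtain ⟨-, h2, h3⟩ := hTp t ht
    refine F.card_le_sq_of_injOn h𝒟 hs hθ (hB₂ _ h2) (hB₃ _ h3) hB₁ hS₁' hz (g := fun t => t.1)
      (fun u hu v hv huv => ?_) fun u hu => ?_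
    · exact Prod.ext huv ((Finset.mem_filter.1 hu).2.trans (Finset.mem_filter.1 hv).2.symm)
    · obtain ⟨hu, hut⟩ := Finset.mem_filter.1 hu
      obtain ⟨e1, e2⟩ := Prod.mk.inj hut
      obtain ⟨l1, l2, -⟩ := hTl u hu
      rw [← e1, ← e2]
      exact ⟨(hTp u hu).1, l1, l2⟩
  have hn₂ : (F₂.card : ℝ) ≤ L ^ (9 + 3 * e + 2 * D) * N ^ 2 := by
    rw [← hfin]
    refine le_of_prod_le (t := T.card) hpos.1 hpos.2.2 hL₁0.le
      (le_of_eq_of_le (by ring) hFT) ?_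
    refine (card_le_mul_card_image_real (f := fun t => (t.1, t.2.2)) (m := m) T
      fun b hb => ?_).trans (by gcongr; exact him fun t ht => ⟨(hTp t ht).1, (hTp t ht).2.2⟩)
    obtain ⟨t, ht, rfl⟩ := Finset.mem_image.1 hb
    obtain ⟨h1, -, h3⟩ := hTp t ht
    refine F.swap₀₁.card_le_sq_of_injOn h𝒟 hs hθ (hB₁ _ h1) (hB₃ _ h3) hB₂ hS₂' hz
      (g := fun t => t.2.1) (fun u hu v hv huv => ?_) fun u hu => ?_
    · obtain ⟨e1, e2⟩ := Prod.mk.inj ((Finset.mem_filter.1 hu).2.trans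
        (Finset.mem_filter.1 hv).2.symm)
      exact Prod.ext e1 (Prod.ext huv e2)
    · obtain ⟨hu, hut⟩ := Finset.mem_filter.1 hu
      obtain ⟨e1, e2⟩ := Prod.mk.inj hut
      obtain ⟨l1, -, l2⟩ := hTl u hu
      rw [← e1, ← e2, lab_comm s u.2.1 u.1]
      exact ⟨(hTp u hu).2.1, l1, l2⟩
  have hn₃ : (F₃.card : ℝ) ≤ L ^ (9 + 3 * e + 2 * D) * N ^ 2 := by
    rw [← hfin]
    refine le_of_prod_le (t := T.card) hpos.1 hpos.2.1 hL₁0.le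
      (le_of_eq_of_le (by ring) hFT) ?_
    refine (card_le_mul_card_image_real (f := fun t => (t.1, t.2.1)) (m := m) T
      fun b hb => ?_).trans (by gcongr; exact him fun t ht => ⟨(hTp t ht).1, (hTp t ht).2.1⟩)
    obtain ⟨t, ht, rfl⟩ := Finset.mem_image.1 hb
    obtain ⟨h1, h2, -⟩ := hTp t ht
    refine F.swap₁₂.swap₀₁.card_le_sq_of_injOn h𝒟 hs hθ (hB₁ _ h1) (hB₂ _ h2) hB₃ hS₃' hz
      (g := fun t => t.2.2) (fun u hu v hv huv => ?_) fun u hu => ?_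
    · obtain ⟨e1, e2⟩ := Prod.mk.inj ((Finset.mem_filter.1 hu).2.trans
        (Finset.mem_filter.1 hv).2.symm)
      exact Prod.ext e1 (Prod.ext e2 huv)
    · obtain ⟨hu, hut⟩ := Finset.mem_filter.1 hu
      obtain ⟨e1, e2⟩ := Prod.mk.inj hut
      obtain ⟨-, l1, l2⟩ := hTl u hu
      rw [← e1, ← e2, lab_comm s u.2.2 u.1, lab_comm s u.2.2 u.2.1]
      exact ⟨(hTp u hu).2.2, l1, l2⟩
  have hLL : L ≤ L ^ (9 + 3 * e + 2 * D) := le_self_pow₀ hL1 (by omega)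
  refine hcount (F.mono hLL) hs hθ hθ1 hsθ (by rw [← pow_mul]; exact hLθ) (h𝒟.mono hθ hs hLL)
    hB₁ hB₂ hB₃ (hS₁'.mono hLL) (hS₂'.mono hLL) (hS₃'.mono hLL) hz hz hz hn₁ hn₂ hn₃ hTF hTl
    (hNT.trans (by gcongr; exact hpow (by omega)))

end RealInnerProductSpace

lemma exists_net {V : Type*} [MetricSpace V] {A : Set V} (hA : IsCompact A) {s : ℝ} (hs : 0 < s) :
    ∃ P : Finset V, (∀ p ∈ P, p ∈ A) ∧ (∀ p ∈ P, ∀ q ∈ P, p ≠ q → s < dist p q) ∧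
      ∀ x ∈ A, ∃ p ∈ P, dist x p ≤ s := by
  lift s to NNReal using hs.le
  have hs' : s / 2 ≠ 0 := by
    have : s ≠ 0 := by rintro rfl; simp at hs
    positivity
  have hpack : packingNumber s A ≠ ⊤ := by
    obtain ⟨N, -, hN, hc⟩ := exists_finite_isCover_of_isCompact hs' hA
    have h1 := packingNumber_two_mul_le_externalCoveringNumber (s / 2) A
    rw [mul_div_cancel₀ s (two_ne_zero)] at h1
    refine ((h1.trans (iInf₂_le N hc)).trans_lt ?_).ne
    exact encard_lt_top_iff.2 hN
  obtain ⟨N, hNA, hN, hsep, hcard⟩ := exists_set_encard_eq_packingNumber hpack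
  have hmax : Maximal (fun M => M ⊆ A ∧ IsSeparated s M) N := by
    refine ⟨⟨hNA, hsep⟩, fun M hM hNM => ?_⟩
    have h1 : M.encard ≤ N.encard := by
      rw [hcard]; exact le_iSup₂_of_le M hM.1 (le_iSup_of_le hM.2 le_rfl)
    exact (hN.eq_of_subset_of_encard_le hNM h1).symm.subset
  have hcov := IsCover.of_maximal_isSeparated hmax
  refine ⟨hN.toFinset, fun p hp => hNA (by simpa using hp), fun p hp q hq hpq => ?_, fun x hx => ?_⟩
  · have h : (s : ℝ≥0∞) < edist p q := hsep (by simpa using hp) (by simpa using hq) hpq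
    rw [edist_nndist] at h
    exact_mod_cast h
  · obtain ⟨p, hp, hxp⟩ := hcov hx
    refine ⟨p, by simpa using hp, ?_⟩
    have h : edist x p ≤ s := hxp
    rw [edist_nndist] at h
    exact_mod_cast h

/-- The volume of the unit ball. -/
def unitVol (d : ℕ) : ℝ := volume.real (ball (0 : Euc d) 1)

lemma unitVol_pos (d : ℕ) : 0 < unitVol d :=
  ENNReal.toReal_pos (measure_ball_pos _ _ one_pos).ne' measure_ball_lt_top.ne

lemma volume_real_closedBall {d : ℕ} (x : Euc d) {r : ℝ} (hr : 0 ≤ r) :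
    volume.real (closedBall x r) = r ^ d * unitVol d := by
  rw [Measure.addHaar_real_closedBall volume x hr]
  simp [unitVol]

/-- Balls of radius `s / 3` around the points of an `s`-separated set pack. -/
lemma card_mul_le_volume {d : ℕ} {P : Finset (Euc d)} {s : ℝ} (hs : 0 < s)
    (hP : ∀ p ∈ P, ∀ q ∈ P, p ≠ q → s < dist p q) {T : Set (Euc d)} (hT : volume T ≠ ⊤)
    (hPT : ∀ p ∈ P, closedBall p (s / 3) ⊆ T) :
      P.card * ((s / 3) ^ d * unitVol d) ≤ volume.real T := by
  have hdisj : (P : Set (Euc d)).PairwiseDisjoint fun p => closedBall p (s / 3) := by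
    intro p hp q hq hpq
    refine closedBall_disjoint_closedBall ?_
    have := hP p hp q hq hpq
    linarith
  have h1 := measureReal_biUnion_finset (μ := volume) hdisj
    (fun p _ => measurableSet_closedBall) fun p _ => measure_closedBall_lt_top.ne
  have h2 : volume.real (⋃ p ∈ P, closedBall p (s / 3)) ≤ volume.real T :=
    measureReal_mono (iUnion₂_subset hPT) hT
  rw [h1, Finset.sum_congr rfl fun p _ => volume_real_closedBall p (by positivity),
    Finset.sum_const, nsmul_eq_mul] at h2
  exact h2

lemma sparse_of_separated {d : ℕ} {P : Finset (Euc d)} {s : ℝ} (hs : 0 < s)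
    (hP : ∀ p ∈ P, ∀ q ∈ P, p ≠ q → s < dist p q) : Sparse d (4 ^ d) s P := by
  intro M hM c
  have h := card_mul_le_volume (P := P.filter fun p => ‖p - c‖ ≤ M * s) hs
    (fun p hp q hq => hP p (Finset.mem_filter.1 hp).1 q (Finset.mem_filter.1 hq).1)
    (T := closedBall c (M * s + s / 3)) measure_closedBall_lt_top.ne fun p hp => by
      refine closedBall_subset_closedBall' ?_
      have := (Finset.mem_filter.1 hp).2
      rw [dist_eq_norm]; linarith
  rw [volume_real_closedBall _ (by positivity), ← mul_assoc] at h
  have h1 := le_of_mul_le_mul_right h (unitVol_pos d)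
  have h2 : M * s + s / 3 ≤ 4 * M * (s / 3) := by nlinarith
  have h3 : (M * s + s / 3) ^ d ≤ (4 * M) ^ d * (s / 3) ^ d := by
    rw [← mul_pow]; exact pow_le_pow_left₀ (by positivity) h2 d
  have h4 := le_of_mul_le_mul_right (h1.trans h3) (by positivity)
  rwa [mul_pow] at h4

lemma IsDeltaRhoSet1.real_le {δ C : ℝ} {D : Set ℝ} (h : IsDeltaRhoSet1 δ (1 / 2) C D) (hδ : 0 ≤ δ)
    (hC : 0 ≤ C) {x r : ℝ} (hr : δ ≤ r) : volume.real (D ∩ closedBall x r) ≤ C * √δ * √r := by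
  have h1 := ENNReal.toReal_mono ENNReal.ofReal_ne_top (h x r hr)
  rw [ENNReal.toReal_ofReal (by have := hδ.trans hr; positivity)] at h1
  rw [Real.sqrt_eq_rpow, Real.sqrt_eq_rpow]
  rwa [show (1 : ℝ) - 1 / 2 = 1 / 2 by norm_num] at h1

/-- Integer labels close to squares of elements of a thin set are thin. -/
lemma card_labels_le {δ C K s ρ : ℝ} {D : Set ℝ} (hD : IsCompact D) (hDC : ∀ t ∈ D, t ≤ C)
    (h : IsDeltaRhoSet1 δ (1 / 2) C D) (hδ : 0 < δ) (hδ1 : δ ≤ 1) (hC : 0 ≤ C) (hK : 1 ≤ K)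
    (hCK : C ≤ K) (hs : 0 < s) (hsρ : (K + 1) * K * s ≤ ρ) (hs1 : (K + 1) * K ^ 2 * s ≤ 1)
    (hsδ : (K + 1) * s ≤ √δ)
    (hρ : volume.real (cthickening ρ D) ≤ volume.real D + δ) {𝒟 : Finset ℤ}
    (h𝒟 : ∀ n ∈ 𝒟, ∃ t ∈ D, 1 ≤ K * t ∧ |s * n - t ^ 2| ≤ K * s) {y c : ℝ} (hy : √δ ≤ y)
    (h𝒟y : ∀ n ∈ 𝒟, |s * (n : ℝ) - c| ≤ y) :
    (𝒟.card : ℝ) ≤ 12 * K ^ 3 * √y * (√δ / s) := by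
  rcases 𝒟.eq_empty_or_nonempty with rfl | ⟨n₀, hn₀⟩
  · simp only [Finset.card_empty, Nat.cast_zero]; positivity
  obtain ⟨t₀, ht₀, hKt₀, hnt₀⟩ := h𝒟 n₀ hn₀
  have hy0 : 0 < y := (Real.sqrt_pos.2 hδ).trans_le hy
  have hK0 : 0 < K := by linarith
  have hnn : ∀ n ∈ 𝒟, 0 ≤ s * (n : ℝ) ∧ s * n + s ≤ (2 * K) ^ 2 := fun n hn => by
    obtain ⟨t, ht, hKt, hnt⟩ := h𝒟 n hn
    have h1 := abs_le.1 hnt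
    have htC := (hDC t ht).trans hCK
    have ht0 : 0 < t := by by_contra! h0; nlinarith
    have h2 : 1 ≤ K ^ 2 * t ^ 2 := by rw [← mul_pow]; exact one_le_pow₀ hKt
    have h3 : t ^ 2 ≤ K ^ 2 := pow_le_pow_left₀ ht0.le htC 2
    have h4 : (K + 1) * s ≤ K ^ 2 * ((K + 1) * s) :=
      le_mul_of_one_le_left (by positivity) (one_le_pow₀ hK)
    constructor
    · by_contra! h0
      have h5 : K ^ 2 * t ^ 2 < K ^ 2 * (K * s) := by
        apply mul_lt_mul_of_pos_left _ (by positivity); linarith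
      nlinarith [mul_pos (pow_pos hK0 2) hs]
    · nlinarith [one_le_pow₀ hK (n := 2)]
  have hmem : ∀ n ∈ 𝒟, ∀ u ∈ Ico √(s * n) √(s * n + s), 0 ≤ u ∧ |u ^ 2 - s * n| ≤ s := by
    intro n hn u hu
    have hu0 : 0 ≤ u := (Real.sqrt_nonneg _).trans hu.1
    have h1 : s * n ≤ u ^ 2 := (Real.sqrt_le_left hu0).1 hu.1
    have h2 : u ^ 2 < s * n + s := (Real.lt_sqrt hu0).1 hu.2
    exact ⟨hu0, by rw [abs_le]; constructor <;> linarith⟩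
  have hsqrt : ∀ {u t a : ℝ}, 0 ≤ u → 1 ≤ K * t → |u ^ 2 - t ^ 2| ≤ a → |u - t| ≤ K * a := by
    intro u t a hu ht ha
    have ht0 : 0 < t := by by_contra! h0; nlinarith
    have h1 : u ^ 2 - t ^ 2 = (u - t) * (u + t) := by ring
    rw [h1, abs_mul, abs_of_nonneg (by linarith : 0 ≤ u + t)] at ha
    have h2 : |u - t| * 1 ≤ |u - t| * (K * (u + t)) := by
      apply mul_le_mul_of_nonneg_left _ (abs_nonneg _); nlinarith
    nlinarith
  set J : ℤ → Set ℝ := fun n => Ico √(s * n) √(s * n + s) with hJ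
  have hdisj : (𝒟 : Set ℤ).PairwiseDisjoint J := by
    have key : ∀ n ∈ 𝒟, ∀ m ∈ 𝒟, n < m → Disjoint (J n) (J m) := fun n hn m hm hnm => by
      rw [Set.disjoint_left]
      intro u hu hu'
      have h1 : (n : ℝ) + 1 ≤ m := by exact_mod_cast hnm
      have h2 : √(s * n + s) ≤ √(s * m) := Real.sqrt_le_sqrt (by nlinarith)
      exact absurd (hu.2.trans_le h2) (not_lt.2 hu'.1)
    intro n hn m hm hnm
    rcases lt_or_gt_of_ne hnm with h1 | h1
    · exact key n hn m hm h1
    · exact (key m hm n hn h1).symm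
  set B := closedBall t₀ (4 * K * y) with hB
  have hsub : ∀ n ∈ 𝒟, J n ⊆ cthickening ρ D ∩ B := by
    intro n hn u hu
    obtain ⟨hu0, hu2⟩ := hmem n hn u hu
    obtain ⟨t, ht, hKt, hnt⟩ := h𝒟 n hn
    constructor
    · refine mem_cthickening_of_dist_le u t ρ D ht ?_
      rw [Real.dist_eq]
      have h1 : |u ^ 2 - t ^ 2| ≤ (K + 1) * s := by
        have := abs_sub_le (u ^ 2) (s * n) (t ^ 2); linarith
      have := hsqrt hu0 hKt h1
      linarith
    · rw [hB, mem_closedBall, Real.dist_eq]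
      have h1 : |u ^ 2 - t₀ ^ 2| ≤ 4 * y := by
        have h2 := abs_sub_le (u ^ 2) (s * n) (t₀ ^ 2)
        have h3 := abs_sub_le (s * (n : ℝ)) (s * n₀) (t₀ ^ 2)
        have h4 := abs_sub_le (s * (n : ℝ)) c (s * n₀)
        have h5 := h𝒟y n hn
        have h6 := h𝒟y n₀ hn₀
        rw [abs_sub_comm] at h6
        linarith
      have := hsqrt hu0 hKt₀ h1
      linarith
  have hlen : ∀ n ∈ 𝒟, s / (4 * K) ≤ volume.real (J n) := by
    intro n hn
    obtain ⟨h0, h1⟩ := hnn n hn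
    have h2 : √(s * n) ≤ √(s * n + s) := Real.sqrt_le_sqrt (by linarith)
    have h3 : √(s * n + s) ≤ 2 * K := Real.sqrt_le_left (by positivity) |>.2 h1
    rw [hJ, Real.volume_real_Ico_of_le h2, div_le_iff₀ (by positivity)]
    have h4 := Real.sq_sqrt h0
    have h5 := Real.sq_sqrt (by linarith : 0 ≤ s * n + s)
    nlinarith [Real.sqrt_nonneg (s * n)]
  have hDfin : volume (cthickening ρ D) ≠ ⊤ := hD.cthickening.measure_lt_top.ne
  have hsum := measureReal_biUnion_finset (μ := volume) hdisj (fun n _ => measurableSet_Ico)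
    fun n _ => measure_Ico_lt_top.ne
  have hle : volume.real (⋃ n ∈ 𝒟, J n) ≤ volume.real (cthickening ρ D ∩ B) :=
    measureReal_mono (iUnion₂_subset hsub) (measure_ne_top_of_subset inter_subset_left hDfin)
  have hcard : 𝒟.card * (s / (4 * K)) ≤ ∑ n ∈ 𝒟, volume.real (J n) := by
    rw [← nsmul_eq_mul]; exact Finset.card_nsmul_le_sum _ _ _ hlen
  have hδy : √δ ≤ √y := by
    apply Real.sqrt_le_sqrt; refine le_trans ?_ hy
    exact Real.le_sqrt_of_sq_le (by nlinarith)
  have hδδ : δ = √δ * √δ := (Real.mul_self_sqrt hδ.le).symm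
  have hvol : volume.real (cthickening ρ D ∩ B) ≤ 3 * K ^ 2 * (√δ * √y) := by
    have h1 : cthickening ρ D ∩ B ⊆ (D ∩ B) ∪ (cthickening ρ D \ D) := fun u hu => by
      by_cases hu' : u ∈ D
      · exact Or.inl ⟨hu', hu.2⟩
      · exact Or.inr ⟨hu.1, hu'⟩
    have hfin : volume ((D ∩ B) ∪ (cthickening ρ D \ D)) ≠ ⊤ :=
      measure_ne_top_of_subset (union_subset
        (inter_subset_left.trans (self_subset_cthickening D)) sdiff_subset) hDfin
    have h2 := (measureReal_mono h1 hfin).trans (measureReal_union_le _ _)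
    have h3 : volume.real (cthickening ρ D \ D) ≤ δ := by
      rw [measureReal_sdiff (self_subset_cthickening D) hD.measurableSet hDfin]; linarith
    have h4 := h.real_le hδ.le hC (x := t₀) (r := 4 * K * y) (by
      have : √δ * √δ ≤ √δ := mul_le_of_le_one_left (Real.sqrt_nonneg _)
        (Real.sqrt_le_one.2 hδ1)
      nlinarith)
    have h5 : √(4 * K * y) ≤ 2 * K * √y := by
      refine Real.sqrt_le_left (by positivity) |>.2 ?_
      rw [mul_pow, Real.sq_sqrt hy0.le]
      nlinarith [mul_le_mul_of_nonneg_left hK (by positivity : 0 ≤ 4 * K * y)]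
    have h6 : C * √δ * √(4 * K * y) ≤ K * √δ * (2 * K * √y) := by gcongr
    have h7 : √δ * √δ ≤ K ^ 2 * (√δ * √y) := by
      refine le_trans ?_ (le_mul_of_one_le_left (by positivity) (one_le_pow₀ hK))
      gcongr
    nlinarith
  have hfinal : 𝒟.card * (s / (4 * K)) ≤ 3 * K ^ 2 * (√δ * √y) := by linarith
  have h8 : (𝒟.card : ℝ) = 𝒟.card * (s / (4 * K)) * (4 * K / s) := by
    generalize (𝒟.card : ℝ) = a
    field_simp
  rw [h8]
  refine (mul_le_mul_of_nonneg_right hfinal (by positivity)).trans (le_of_eq ?_)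
  field_simp
  ring

lemma labelSet_of_thin {δ C K s ρ θ L : ℝ} {D : Set ℝ} (hD : IsCompact D) (hDC : ∀ t ∈ D, t ≤ C)
    (h : IsDeltaRhoSet1 δ (1 / 2) C D) (hδ : 0 < δ) (hδ1 : δ ≤ 1) (hC : 0 ≤ C) (hK : 1 ≤ K)
    (hCK : C ≤ K) (hs : 0 < s) (hsρ : (K + 1) * K * s ≤ ρ) (hs1 : (K + 1) * K ^ 2 * s ≤ 1)
    (hsδ : (K + 1) * s ≤ √δ)
    (hρ : volume.real (cthickening ρ D) ≤ volume.real D + δ) {𝒟 : Finset ℤ}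
    (h𝒟 : ∀ n ∈ 𝒟, ∃ t ∈ D, 1 ≤ K * t ∧ |s * n - t ^ 2| ≤ K * s) (hθ : θ ^ 1000 = √δ)
    (hL : 24 * K ^ 4 ≤ L) : LabelSet θ s L 𝒟 := by
  have hK0 : 0 < K := by linarith
  have h34 : K ^ 3 ≤ K ^ 4 := pow_le_pow_right₀ hK (by norm_num)
  have h24 : K ^ 2 ≤ K ^ 4 := pow_le_pow_right₀ hK (by norm_num)
  have hbdd : ∀ n ∈ 𝒟, |s * (n : ℝ)| ≤ 2 * K ^ 2 := fun n hn => by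
    obtain ⟨t, ht, hKt, hnt⟩ := h𝒟 n hn
    have ht0 : 0 < t := by by_contra! h0; nlinarith
    have h3 : t ^ 2 ≤ K ^ 2 := pow_le_pow_left₀ ht0.le ((hDC t ht).trans hCK) 2
    have h4 := abs_add_le (s * n - t ^ 2) (t ^ 2)
    rw [sub_add_cancel, abs_of_nonneg (sq_nonneg t)] at h4
    have h5 : K * s ≤ 1 * 1 := by
      refine le_trans ?_ (hs1.trans (by norm_num))
      have : (1 : ℝ) ≤ K ^ 2 := one_le_pow₀ hK
      nlinarith [mul_pos hK0 hs]
    have : (1 : ℝ) ≤ K ^ 2 := one_le_pow₀ hK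
    linarith
  refine ⟨?_, fun y hy c => ?_, fun n hn => (hbdd n hn).trans (by nlinarith)⟩
  · have h1 := card_labels_le hD hDC h hδ hδ1 hC hK hCK hs hsρ hs1 hsδ hρ h𝒟
      (y := 2 * K ^ 2) (c := 0)
      (by have := Real.sqrt_le_one.2 hδ1; nlinarith) (by simpa using hbdd)
    have h2 : √(2 * K ^ 2) ≤ 2 * K := Real.sqrt_le_left (by positivity) |>.2 (by nlinarith)
    rw [hθ]
    refine h1.trans (mul_le_mul_of_nonneg_right ?_ (by positivity))
    calc 12 * K ^ 3 * √(2 * K ^ 2) ≤ 12 * K ^ 3 * (2 * K) := by gcongr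
      _ = 24 * K ^ 4 := by ring
      _ ≤ L := hL
  · rw [hθ] at hy ⊢
    have h1 := card_labels_le hD hDC h hδ hδ1 hC hK hCK hs hsρ hs1 hsδ hρ
      (𝒟 := 𝒟.filter fun n : ℤ => |s * n - c| ≤ y)
      (fun n hn => h𝒟 n (Finset.mem_filter.1 hn).1) hy fun n hn => (Finset.mem_filter.1 hn).2
    refine h1.trans ?_
    gcongr
    nlinarith [pow_pos hK0 3]

open Filter Topology in
lemma eventually_cthickening_le {α : Type*} [MetricSpace α] [ProperSpace α] [MeasureSpace α]
    [OpensMeasurableSpace α] [IsFiniteMeasureOnCompacts (volume : Measure α)] {A : Set α}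
    (hA : IsCompact A) {η : ℝ} (hη : 0 < η) :
    ∀ᶠ s in 𝓝[>] (0 : ℝ), volume.real (cthickening s A) ≤ volume.real A + η := by
  have h1 := (ENNReal.tendsto_toReal hA.measure_lt_top.ne).comp
    (tendsto_measure_cthickening_of_isCompact (μ := volume) hA)
  have h2 : ∀ᶠ s in 𝓝 (0 : ℝ), volume.real (cthickening s A) < volume.real A + η :=
    h1.eventually_lt_const (u := volume.real A + η) (by
      have : (volume A).toReal = volume.real A := rfl
      linarith)
  exact (h2.filter_mono nhdsWithin_le_nhds).mono fun s hs => hs.le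

open Filter Topology in
lemma eventually_mul_le (a : ℝ) {b : ℝ} (hb : 0 < b) : ∀ᶠ s in 𝓝[>] (0 : ℝ), a * s ≤ b := by
  have h1 : Tendsto (fun s : ℝ => a * s) (𝓝 0) (𝓝 (a * 0)) := tendsto_id.const_mul a
  rw [mul_zero] at h1
  exact ((h1.eventually_lt_const hb).filter_mono nhdsWithin_le_nhds).mono fun s hs => hs.le

lemma volume_real_le_card_mul {n d : ℕ} {𝒦 : Set (Fin n → Euc d)} {P : Finset (Fin n → Euc d)}
    {s : ℝ} (hs : 0 ≤ s) (h : ∀ x ∈ 𝒦, ∃ p ∈ P, ∀ j, dist (x j) (p j) ≤ s) :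
    volume.real 𝒦 ≤ P.card * (s ^ d * unitVol d) ^ n := by
  have hbox : ∀ p : Fin n → Euc d, volume.real (Set.pi univ fun j => closedBall (p j) s) =
      (s ^ d * unitVol d) ^ n := fun p => by
    rw [measureReal_def, volume_pi_pi, ENNReal.toReal_prod]
    have : ∀ j, (volume (closedBall (p j) s)).toReal = s ^ d * unitVol d :=
      fun j => volume_real_closedBall (p j) hs
    simp [this]
  have hfin : volume (⋃ p ∈ P, Set.pi univ fun j => closedBall (p j) s) ≠ ⊤ := by
    refine ((P.finite_toSet.isCompact_biUnion fun p _ => ?_).measure_lt_top).ne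
    exact isCompact_univ_pi fun j => isCompact_closedBall _ _
  have hsub : 𝒦 ⊆ ⋃ p ∈ P, Set.pi univ fun j => closedBall (p j) s := fun x hx => by
    obtain ⟨p, hp, hxp⟩ := h x hx
    exact mem_biUnion hp fun j _ => hxp j
  refine (measureReal_mono hsub hfin).trans ((measureReal_biUnion_finset_le _ _).trans ?_)
  rw [Finset.sum_congr rfl fun p _ => hbox p, Finset.sum_const, nsmul_eq_mul]

section Frame
variable {V : Type*} [NormedAddCommGroup V] [InnerProductSpace ℝ V] {e : ℕ} {K : ℝ}
  {B₀ B₁ B₂ : Set V} {z : Fin e → V}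

lemma Frame.one_le_mul_dist (F : Frame K B₀ B₁ B₂ z) {p x w : V} (hp : p ∈ B₀) (hx : x ∈ B₁)
    (hw : w ∈ B₂) : (1 ≤ K * dist p x ∧ 1 ≤ K * dist p w ∧ 1 ≤ K * dist x w) ∧
      ∀ j, 1 ≤ K * dist p (z j) ∧ 1 ≤ K * dist x (z j) ∧ 1 ≤ K * dist w (z j) := by
  have hs : ∀ j, ∑ i, (Pi.single j (-1) : Fin e → ℝ) i • z i = -z j := fun j => by
    rw [Finset.sum_eq_single j (fun i _ hi => by simp [hi]) (by simp)]; simp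
  refine ⟨⟨?_, ?_, ?_⟩, fun j => ⟨?_, ?_, ?_⟩⟩
  · have h := (F.spread p hp x hx w hw 1 (-1) 0 0 (by simp)).1
    simpa [dist_eq_norm, sub_eq_add_neg] using h
  · have h := (F.spread p hp x hx w hw 1 0 (-1) 0 (by simp)).1
    simpa [dist_eq_norm, sub_eq_add_neg] using h
  · have h := (F.spread p hp x hx w hw 0 1 (-1) 0 (by simp)).2.1
    simpa [dist_eq_norm, sub_eq_add_neg] using h
  · have h := (F.spread p hp x hx w hw 1 0 0 (Pi.single j (-1)) (by simp)).1
    rw [hs j] at h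
    simpa [dist_eq_norm, sub_eq_add_neg] using h
  · have h := (F.spread p hp x hx w hw 0 1 0 (Pi.single j (-1)) (by simp)).2.1
    rw [hs j] at h
    simpa [dist_eq_norm, sub_eq_add_neg] using h
  · have h := (F.spread p hp x hx w hw 0 0 1 (Pi.single j (-1)) (by simp)).2.2.1
    rw [hs j] at h
    simpa [dist_eq_norm, sub_eq_add_neg] using h

end Frame

/-- Moving two points by at most `s` moves `s` times the label by `O(s)`. -/
lemma abs_lab_mul_sub_le {V : Type*} [NormedAddCommGroup V] {s K : ℝ} {x y p q : V} (hs : 0 < s)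
    (hs1 : s ≤ 1) (hK : 1 ≤ K) (hxy : dist x y ≤ K) (hxp : dist x p ≤ s) (hyq : dist y q ≤ s) :
    |s * (lab s p q : ℝ) - dist x y ^ 2| ≤ 13 * K * s := by
  have h1 := lab_mul_le hs p q
  have h2 := lt_lab_mul hs p q
  have h3 := dist_triangle4 p x y q
  have h4 := dist_triangle4 x p q y
  rw [dist_comm p x] at h3
  rw [dist_comm q y] at h4
  have h5 : dist p q ≤ dist x y + 2 * s := by linarith
  have h6 : dist x y ≤ dist p q + 2 * s := by linarith
  have h7 : dist p q ≤ 3 * K := by linarith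
  have h0 := dist_nonneg (x := x) (y := y)
  have h0' := dist_nonneg (x := p) (y := q)
  have h8 : dist p q ^ 2 - dist x y ^ 2 ≤ 8 * K * s := by
    have : (dist p q - dist x y) * (dist p q + dist x y) ≤ 2 * s * (dist p q + dist x y) :=
      mul_le_mul_of_nonneg_right (by linarith) (by linarith)
    nlinarith
  have h9 : dist x y ^ 2 - dist p q ^ 2 ≤ 8 * K * s := by
    have : (dist x y - dist p q) * (dist p q + dist x y) ≤ 2 * s * (dist p q + dist x y) :=
      mul_le_mul_of_nonneg_right (by linarith) (by linarith)
    nlinarith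
  have hKs : s ≤ K * s := by nlinarith
  rw [abs_le]
  constructor <;> nlinarith

/-- A tuple split into its first three entries and the rest. -/
def splitTuple {V : Type*} {e : ℕ} (x : Fin (e + 3) → V) : (V × V × V) × (Fin e → V) :=
  ((x 0, x 1, x 2), fun j => x j.succ.succ.succ)

lemma splitTuple_injective {V : Type*} {e : ℕ} :
    Function.Injective (splitTuple : (Fin (e + 3) → V) → (V × V × V) × (Fin e → V)) := by
  intro x y h
  simp only [splitTuple, Prod.mk.injEq] at h
  obtain ⟨⟨h0, h1, h2⟩, h3⟩ := h
  funext i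
  refine Fin.cases h0 (fun i => ?_) i
  refine Fin.cases (by simpa using h1) (fun i => ?_) i
  refine Fin.cases (by simpa using h2) (fun i => ?_) i
  exact congrFun h3 i

open Filter Topology in
lemma exists_scale {ι : Type*} [Finite ι] {d : ℕ} {E : ι → Set (Euc d)} {D : Set ℝ}
    (hE : ∀ j, IsCompact (E j)) (hD : IsCompact D) {η δ κ K : ℝ} (hη : 0 < η) (hδ : 0 < δ)
    (hκ : 0 < κ) : ∃ ρ s : ℝ, 0 < s ∧ s ≤ 1 ∧ s ≤ κ ∧
      volume.real (cthickening ρ D) ≤ volume.real D + δ ∧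
      (∀ j, volume.real (cthickening s (E j)) ≤ volume.real (E j) + η) ∧
      (K + 1) * K * s ≤ ρ ∧ (K + 1) * K ^ 2 * s ≤ 1 ∧ (K + 1) * s ≤ κ := by
  obtain ⟨ρ, hρ, hρ0⟩ := ((eventually_cthickening_le hD hδ).and self_mem_nhdsWithin).exists
  have hρ0 : 0 < ρ := hρ0
  obtain ⟨s, ⟨⟨⟨⟨⟨⟨h1, h2⟩, h3⟩, h4⟩, h5⟩, h6⟩, h7⟩⟩ := (((((((eventually_all.2 fun j =>
    eventually_cthickening_le (hE j) hη).and (eventually_mul_le ((K + 1) * K) hρ0)).and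
    (eventually_mul_le ((K + 1) * K ^ 2) one_pos)).and (eventually_mul_le (K + 1) hκ)).and
    (eventually_mul_le 1 hκ)).and (eventually_mul_le 1 one_pos)).and self_mem_nhdsWithin).exists
  exact ⟨ρ, s, h7, by linarith, by linarith, hρ, h1, h2, h3, h4⟩

open Classical in
theorem compact_contra (e : ℕ) : ∃ n₃ : ℕ, ∀ {C K Q L L₁ δ θ : ℝ} {b : Fin (e + 3) → Euc (e + 2)}
    {E : Fin (e + 3) → Set (Euc (e + 2))} {D : Set ℝ} {𝒦 : Set (Fin (e + 3) → Euc (e + 2))}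
    (_ : ∀ z : Fin e → Euc (e + 2), (∀ j, z j ∈ closedBall (b j.succ.succ.succ) 1) →
      Frame K (closedBall (b 0) 1) (closedBall (b 1) 1) (closedBall (b 2) 1) z)
    (_ : 0 < C) (_ : C ≤ K) (_ : 0 < δ) (_ : δ ≤ 1) (_ : 0 < θ) (_ : θ ^ 1000 = √δ)
    (_ : ∀ j, IsCompact (E j)) (_ : ∀ j, E j ⊆ closedBall (b j) 1)
    (_ : ∀ j, volume.real (E j) ≤ C * (θ ^ 1000) ^ (e + 2))
    (_ : IsCompact D) (_ : ∀ t ∈ D, t ≤ C) (_ : IsDeltaRhoSet1 δ (1 / 2) C D)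
    (_ : ∀ x ∈ 𝒦, ∀ j, x j ∈ E j) (_ : ∀ x ∈ 𝒦, ∀ j k, j < k → dist (x k) (x j) ∈ D)
    (_ : (θ ^ 1000) ^ ((e + 2) * (e + 3)) ≤ L₁ * volume.real 𝒦)
    (_ : 2 * K * 3 ^ (e + 2) / unitVol (e + 2) ≤ Q)
    (_ : 2 ≤ L) (_ : K ≤ L) (_ : 24 * (13 * K) ^ 4 ≤ L) (_ : (4 : ℝ) ^ (e + 2) ≤ L) (_ : Q ≤ L)
    (_ : Q ^ e ≤ L) (_ : 0 ≤ L₁) (_ : L₁ * unitVol (e + 2) ^ (e + 3) ≤ L) (_ : L ^ n₃ * θ ≤ 1),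
    False := by
  obtain ⟨n₃, H⟩ := tuple_contra (e + 2) e
  refine ⟨n₃, ?_⟩
  intro C K Q L L₁ δ θ b E D 𝒦 hF hC hCK hδ hδ1 hθ hθδ hE hEb hEv hD hDC hDδ h𝒦E h𝒦D h𝒦v hQ hL2 hKL
    hL24 hL4 hQL hQeL hL₁ hL₁L hLθ
  have hω := unitVol_pos (e + 2)
  set ω := unitVol (e + 2) with hωdef
  have he : (0 : ℝ) ≤ e := Nat.cast_nonneg e
  have hK2 : (e : ℝ) + 2 ≤ K := (hF (fun j => b j.succ.succ.succ) fun j => by simp).large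
  have hK1 : 1 ≤ K := by linarith
  have hK0 : 0 < K := by linarith
  have hκ : 0 < √δ := Real.sqrt_pos.2 hδ
  have hθ1 : θ ≤ 1 := by
    by_contra! h1
    have := one_lt_pow₀ h1 (n := 1000) (by norm_num)
    rw [hθδ] at this
    exact absurd (Real.sqrt_le_one.2 hδ1) (not_le.2 this)
  obtain ⟨ρ, s, hs, hs1, hsκ, hρ, hsE, hsρ, hsK2, hsK⟩ := exists_scale (K := 13 * K) hE hD
    (η := C * √δ ^ (e + 2)) (by positivity) hδ hκ
  choose P hPE hPsep hPcov using fun j => exists_net (hE j) hs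
  set 𝒳 : Finset (Fin (e + 3) → Euc (e + 2)) :=
    (Fintype.piFinset P).filter fun p => ∃ x ∈ 𝒦, ∀ j, dist (x j) (p j) ≤ s with h𝒳
  have h𝒳P : ∀ p ∈ 𝒳, ∀ j, p j ∈ P j := fun p hp =>
    Fintype.mem_piFinset.1 (Finset.mem_filter.1 hp).1
  have hPb : ∀ j, ∀ p ∈ P j, p ∈ closedBall (b j) 1 := fun j p hp => hEb j (hPE j p hp)
  set N := θ ^ 1000 / s with hN
  have hN0 : 0 < N := by positivity
  have hPc : ∀ j, ((P j).card : ℝ) ≤ Q * N ^ (e + 2) := by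
    intro j
    have h1 := card_mul_le_volume hs (hPsep j) (T := cthickening s (E j))
      (hE j).cthickening.measure_lt_top.ne fun p hp =>
        (closedBall_subset_closedBall (by linarith)).trans
          (closedBall_subset_cthickening (hPE j p hp) s)
    have h2 : volume.real (cthickening s (E j)) ≤ 2 * K * (θ ^ 1000) ^ (e + 2) := by
      have h3 := hsE j
      have h4 := hEv j
      rw [← hθδ] at h3
      have h5 : C * (θ ^ 1000) ^ (e + 2) ≤ K * (θ ^ 1000) ^ (e + 2) := by gcongr
      linarith
    have h3 : ((P j).card : ℝ) ≤ 2 * K * (θ ^ 1000) ^ (e + 2) / ((s / 3) ^ (e + 2) * ω) := by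
      rw [le_div_iff₀ (by positivity)]; exact h1.trans h2
    refine h3.trans (le_trans (le_of_eq ?_) (mul_le_mul_of_nonneg_right hQ (by positivity)))
    rw [hN, div_pow, div_pow]
    generalize θ ^ 1000 = κ
    field_simp
  have hQ0 : 0 ≤ Q := le_trans (by positivity) hQ
  set 𝒟 : Finset ℤ := ((𝒳 ×ˢ (Finset.univ : Finset (Fin (e + 3))) ×ˢ
      (Finset.univ : Finset (Fin (e + 3)))).image fun w => lab s (w.1 w.2.1) (w.1 w.2.2)).filter
    fun n : ℤ => ∃ t ∈ D, 1 ≤ 13 * K * t ∧ |s * (n : ℝ) - t ^ 2| ≤ 13 * K * s with h𝒟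
  have hlab : ∀ p ∈ 𝒳, ∀ j k, j < k → (∀ x ∈ 𝒦, 1 ≤ K * dist (x j) (x k)) →
      lab s (p j) (p k) ∈ 𝒟 := by
    intro p hp j k hjk hdist
    refine Finset.mem_filter.2 ⟨Finset.mem_image.2 ⟨(p, j, k), by simpa using hp, rfl⟩, ?_⟩
    obtain ⟨x, hx, hxp⟩ := (Finset.mem_filter.1 hp).2
    have hxD := h𝒦D x hx j k hjk
    rw [dist_comm] at hxD
    refine ⟨_, hxD, ?_, ?_⟩
    · have := hdist x hx
      linarith
    · exact abs_lab_mul_sub_le hs hs1 hK1 ((hDC _ hxD).trans hCK) (hxp j) (hxp k)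
  have hLS : LabelSet θ s L 𝒟 := labelSet_of_thin hD hDC hDδ hδ hδ1 hC.le (K := 13 * K)
    (by linarith) (by linarith) hs hsρ hsK2 hsK hρ
    (fun n hn => (Finset.mem_filter.1 hn).2) hθδ hL24
  set Z : Finset (Fin e → Euc (e + 2)) := Fintype.piFinset fun j => P j.succ.succ.succ with hZ
  have hZb : ∀ z ∈ Z, ∀ j, z j ∈ closedBall (b j.succ.succ.succ) 1 := fun z hz j =>
    hPb _ _ (Fintype.mem_piFinset.1 hz j)
  have hdist : ∀ x ∈ 𝒦, (1 ≤ K * dist (x 0) (x 1) ∧ 1 ≤ K * dist (x 0) (x 2) ∧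
      1 ≤ K * dist (x 1) (x 2)) ∧ ∀ j : Fin e, 1 ≤ K * dist (x 0) (x j.succ.succ.succ) ∧
        1 ≤ K * dist (x 1) (x j.succ.succ.succ) ∧ 1 ≤ K * dist (x 2) (x j.succ.succ.succ) :=
    fun x hx => (hF (fun j => x j.succ.succ.succ) fun j => hEb _ (h𝒦E x hx _)).one_le_mul_dist
      (hEb _ (h𝒦E x hx 0)) (hEb _ (h𝒦E x hx 1)) (hEb _ (h𝒦E x hx 2))
  have hcard : (𝒳.image splitTuple).card = 𝒳.card :=
    Finset.card_image_of_injective _ splitTuple_injective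
  have hsp : ∀ j, Sparse (e + 2) L s (P j) := fun j =>
    (sparse_of_separated hs (hPsep j)).mono hL4
  have hc : ∀ j, ((P j).card : ℝ) ≤ L * N ^ (e + 2) := fun j =>
    (hPc j).trans (mul_le_mul_of_nonneg_right hQL (by positivity))
  have h2 : (2 : Fin (e + 3)) = (Fin.succ 0).succ := by simp
  have h1 : (1 : Fin (e + 3)) = Fin.succ 0 := by simp
  have h02 : (0 : Fin (e + 3)) < 2 := h2 ▸ Fin.succ_pos _
  have h01 : (0 : Fin (e + 3)) < 1 := h1 ▸ Fin.succ_pos _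
  have h12 : (1 : Fin (e + 3)) < 2 := by
    rw [h1, h2]; exact Fin.succ_lt_succ_iff.2 (Fin.succ_pos 0)
  have h2s : ∀ j : Fin e, (2 : Fin (e + 3)) < j.succ.succ.succ := fun j => by
    rw [h2]; exact Fin.succ_lt_succ_iff.2 (Fin.succ_lt_succ_iff.2 (Fin.succ_pos j))
  refine H hL2 (fun z hz => (hF z (hZb z hz)).mono hKL) hs hθ hθ1 (hsκ.trans hθδ.ge) hLθ hLS
    (hPb 0) (hPb 1) (hPb 2) (hsp 0) (hsp 1) (hsp 2) (hc 0) (hc 1) (hc 2) ?_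
    (X := 𝒳.image splitTuple) ?_ ?_ ?_ (Z := Z)
  · rw [hZ, Fintype.card_piFinset, Nat.cast_prod]
    calc ∏ j : Fin e, ((P j.succ.succ.succ).card : ℝ) ≤ ∏ j : Fin e, Q * N ^ (e + 2) :=
          Finset.prod_le_prod (fun _ _ => Nat.cast_nonneg _) fun j _ => hPc _
      _ = Q ^ e * N ^ ((e + 2) * e) := by
          rw [Finset.prod_const, Finset.card_univ, Fintype.card_fin, mul_pow, ← pow_mul]
      _ ≤ L * N ^ ((e + 2) * e) := by gcongr
  · intro u hu
    obtain ⟨p, hp, rfl⟩ := Finset.mem_image.1 hu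
    simp only [splitTuple, Finset.mem_product, hZ, Fintype.mem_piFinset]
    exact ⟨⟨h𝒳P p hp 0, h𝒳P p hp 1, h𝒳P p hp 2⟩, fun j => h𝒳P p hp _⟩
  · intro u hu
    obtain ⟨p, hp, rfl⟩ := Finset.mem_image.1 hu
    exact ⟨⟨hlab p hp 0 1 h01 fun x hx => (hdist x hx).1.1,
      hlab p hp 0 2 h02 fun x hx => (hdist x hx).1.2.1,
      hlab p hp 1 2 h12 fun x hx => (hdist x hx).1.2.2⟩, fun j =>
      ⟨hlab p hp 0 _ (h02.trans (h2s j)) fun x hx => ((hdist x hx).2 j).1,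
      hlab p hp 1 _ (h12.trans (h2s j)) fun x hx => ((hdist x hx).2 j).2.1,
      hlab p hp 2 _ (h2s j) fun x hx => ((hdist x hx).2 j).2.2⟩⟩
  · rw [hcard]
    have h1 : volume.real 𝒦 ≤ 𝒳.card * (s ^ (e + 2) * ω) ^ (e + 3) := by
      refine volume_real_le_card_mul hs.le fun x hx => ?_
      choose p hp hxp using fun j => hPcov j (x j) (h𝒦E x hx j)
      exact ⟨p, Finset.mem_filter.2 ⟨Fintype.mem_piFinset.2 hp, x, hx, hxp⟩, hxp⟩
    have h2 := h𝒦v.trans (mul_le_mul_of_nonneg_left h1 hL₁)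
    rw [mul_pow, ← pow_mul s] at h2
    rw [div_pow, div_le_iff₀ (by positivity)]
    calc _ ≤ _ := h2
      _ = L₁ * ω ^ (e + 3) * (𝒳.card * s ^ ((e + 2) * (e + 3))) := by ring
      _ ≤ L * (𝒳.card * s ^ ((e + 2) * (e + 3))) := by gcongr
      _ = L * 𝒳.card * s ^ ((e + 2) * (e + 3)) := (mul_assoc _ _ _).symm

lemma sqrt_pow_eq_rpow {δ : ℝ} (hδ : 0 ≤ δ) (n : ℕ) : √δ ^ n = δ ^ ((n : ℝ) / 2) := by
  rw [Real.sqrt_eq_rpow, ← Real.rpow_natCast, ← Real.rpow_mul hδ]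
  congr 1; ring

/-- The exponents can be chosen so that powers of `δ⁻ᵋ` and constants are absorbed by a power
of `δ`. -/
lemma pow_mul_rpow_le_one {n : ℕ} {M δ : ℝ} (hM : 1 ≤ M) (hδ : 0 < δ) (hδ1 : δ ≤ 1)
    (hδM : δ ≤ ((M ^ n)⁻¹) ^ 4000) :
    (M * δ ^ (-(1 / (4000 * ((n : ℝ) + 1))))) ^ n * δ ^ (1 / 2000 : ℝ) ≤ 1 := by
  have hn : (0 : ℝ) ≤ n := Nat.cast_nonneg n
  have hM0 : 0 < M ^ n := by positivity
  rw [mul_pow, ← Real.rpow_natCast (δ ^ _), ← Real.rpow_mul hδ.le, mul_assoc, ← Real.rpow_add hδ]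
  have h1 : δ ^ (-(1 / (4000 * ((n : ℝ) + 1))) * n + 1 / 2000) ≤ δ ^ (1 / 4000 : ℝ) := by
    apply Real.rpow_le_rpow_of_exponent_ge hδ hδ1
    have : 1 / (4000 * ((n : ℝ) + 1)) * n ≤ 1 / 4000 := by
      rw [div_mul_eq_mul_div, div_le_div_iff₀ (by positivity) (by norm_num)]; linarith
    linarith
  have h2 : δ ^ (1 / 4000 : ℝ) ≤ (M ^ n)⁻¹ := by
    have h3 := Real.rpow_le_rpow hδ.le hδM (by norm_num : (0 : ℝ) ≤ 1 / 4000)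
    rwa [← Real.rpow_natCast, ← Real.rpow_mul (by positivity),
      show ((4000 : ℕ) : ℝ) * (1 / 4000) = 1 by norm_num, Real.rpow_one] at h3
  calc _ ≤ M ^ n * (M ^ n)⁻¹ := by gcongr; exact h1.trans h2
    _ = 1 := mul_inv_cancel₀ hM0.ne'

set_option maxHeartbeats 1000000 in
theorem falconer_of_two_le (e : ℕ) {c C : ℝ} (hc : 0 < c) (hC : 1 ≤ C) :
    ∃ ε : ℝ, 0 < ε ∧ ∃ δ₀ : ℝ, 0 < δ₀ ∧ ∀ δ : ℝ, 0 < δ → δ < δ₀ →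
      ∀ (b : Fin (e + 3) → Euc (e + 2)) (E : Fin (e + 3) → Set (Euc (e + 2))) (D : Set ℝ),
        (∀ x : Fin (e + 3) → Euc (e + 2), (∀ j, x j ∈ closedBall (b j) 1) →
          c ≤ |Matrix.det (Matrix.of fun i j : Fin (e + 2) => (x j.succ - x 0) i)|) →
        (∀ j, E j ⊆ closedBall (b j) 1) →
        (∀ j, IsDeltaRhoSet (e + 2) δ (((e + 2 : ℕ) : ℝ) / 2) C (E j)) →
        D ⊆ Icc 0 C →
        IsDeltaRhoSet1 δ (1 / 2) C D →
        volume {x : Fin (e + 3) → Euc (e + 2) |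
            (∀ j, x j ∈ E j) ∧ ∀ j k : Fin (e + 3), j < k → dist (x k) (x j) ∈ D}
          ≤ ENNReal.ofReal (δ ^ ((((e + 2) * (e + 3) : ℕ) : ℝ) / 2 + ε)) := by
  obtain ⟨n₃, H⟩ := compact_contra e
  have he : (0 : ℝ) ≤ e := Nat.cast_nonneg e
  obtain ⟨K₀, hK₀⟩ : ∃ r : ℝ, r = C + e + 4 := ⟨_, rfl⟩
  have hK₀0 : 0 < K₀ := by rw [hK₀]; positivity
  obtain ⟨k, hk⟩ : ∃ r : ℝ, r = ((e : ℝ) + 2) * ((e + 2).factorial * K₀ ^ (e + 2) / c) := ⟨_, rfl⟩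
  have hk0 : 0 ≤ k := by rw [hk]; positivity
  obtain ⟨K, hK⟩ : ∃ r : ℝ, r = K₀ + k := ⟨_, rfl⟩
  have hω := unitVol_pos (e + 2)
  set ω := unitVol (e + 2) with hωdef
  obtain ⟨Q, hQ⟩ : ∃ r : ℝ, r = 2 * K * 3 ^ (e + 2) / ω := ⟨_, rfl⟩
  have hK0 : 0 < K := by rw [hK]; positivity
  have hQ0 : 0 < Q := by rw [hQ]; positivity
  obtain ⟨M, hM⟩ : ∃ r : ℝ, r = 2 + K + 24 * (13 * K) ^ 4 + 4 ^ (e + 2) + Q + Q ^ e + ω ^ (e + 3)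
      := ⟨_, rfl⟩
  have hp1 : 0 ≤ 24 * (13 * K) ^ 4 := by positivity
  have hp2 : (0 : ℝ) ≤ 4 ^ (e + 2) := by positivity
  have hp3 : 0 ≤ Q ^ e := by positivity
  have hp4 : 0 ≤ ω ^ (e + 3) := by positivity
  have hM2 : 2 ≤ M := by linarith
  have hMK : K ≤ M := by linarith
  have hMK4 : 24 * (13 * K) ^ 4 ≤ M := by linarith
  have hM4 : (4 : ℝ) ^ (e + 2) ≤ M := by linarith
  have hMQ : Q ≤ M := by linarith
  have hMQe : Q ^ e ≤ M := by linarith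
  have hMω : ω ^ (e + 3) ≤ M := by linarith
  have hM1 : 1 ≤ M := by linarith
  have hM0 : 0 ≤ M := by linarith
  have hCK : C ≤ K := by linarith
  have hC0 : 0 < C := by linarith
  have heK₀ : (e : ℝ) + 2 ≤ K₀ := by linarith
  have hK₀K : K₀ ≤ K := by linarith
  have hkK : k ≤ K := by linarith
  clear hM hp1 hp2 hp3 hp4
  refine ⟨1 / (4000 * ((n₃ : ℝ) + 1)), by positivity, min 1 (((M ^ n₃)⁻¹) ^ 4000),
    lt_min one_pos (by positivity), fun δ hδ hδ₀ b E D hdet hEb hEδ hDC hDδ => ?_⟩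
  have hδ1 : δ ≤ 1 := (hδ₀.trans_le (min_le_left _ _)).le
  have hδM := (hδ₀.trans_le (min_le_right _ _)).le
  have habs := pow_mul_rpow_le_one hM1 hδ hδ1 hδM
  clear hδM
  set ε : ℝ := 1 / (4000 * ((n₃ : ℝ) + 1)) with hε
  have hε0 : 0 < ε := by positivity
  set L₁ := δ ^ (-ε) with hL₁
  have hL₁1 : 1 ≤ L₁ := Real.one_le_rpow_of_pos_of_le_one_of_nonpos hδ hδ1 (neg_nonpos.2 hε0.le)
  by_contra! hX
  set X := {x : Fin (e + 3) → Euc (e + 2) |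
    (∀ j, x j ∈ E j) ∧ ∀ j k : Fin (e + 3), j < k → dist (x k) (x j) ∈ D} with hXdef
  set E₁ : Fin (e + 3) → Set (Euc (e + 2)) := fun j =>
    toMeasurable volume (E j) ∩ closedBall (b j) 1 with hE₁
  set D₁ : Set ℝ := toMeasurable volume D ∩ Icc 0 C with hD₁
  set X₁ : Set (Fin (e + 3) → Euc (e + 2)) := (⋂ j, (fun x => x j) ⁻¹' E₁ j) ∩
    ⋂ j, ⋂ k, ⋂ (_ : j < k), (fun x => dist (x k) (x j)) ⁻¹' D₁ with hX₁
  have hXX : X ⊆ X₁ := fun x hx => by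
    refine ⟨mem_iInter.2 fun j => ⟨subset_toMeasurable _ _ (hx.1 j), hEb j (hx.1 j)⟩, ?_⟩
    simp only [mem_iInter]
    exact fun j k hjk => ⟨subset_toMeasurable _ _ (hx.2 j k hjk), hDC (hx.2 j k hjk)⟩
  have hE₁m : ∀ j, MeasurableSet (E₁ j) := fun j =>
    (measurableSet_toMeasurable _ _).inter measurableSet_closedBall
  have hD₁m : MeasurableSet D₁ := (measurableSet_toMeasurable _ _).inter measurableSet_Icc
  have hX₁m : MeasurableSet X₁ := by
    refine (MeasurableSet.iInter fun j => measurable_pi_apply j (hE₁m j)).inter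
      (MeasurableSet.iInter fun j => MeasurableSet.iInter fun k => MeasurableSet.iInter fun _ => ?_)
    exact ((continuous_apply k).dist (continuous_apply j)).measurable hD₁m
  have hreg : (volume : Measure (Fin (e + 3) → Euc (e + 2))).InnerRegular :=
    Measure.InnerRegularCompactLTTop.instInnerRegularOfSigmaFinite
  obtain ⟨𝒦, h𝒦X, h𝒦, h𝒦v⟩ := hreg.innerRegular hX₁m _ (hX.trans_le (measure_mono hXX))
  have h𝒦E : ∀ x ∈ 𝒦, ∀ j, x j ∈ E₁ j := fun x hx j => mem_iInter.1 (h𝒦X hx).1 j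
  have h𝒦D : ∀ x ∈ 𝒦, ∀ j k, j < k → dist (x k) (x j) ∈ D₁ := fun x hx j k hjk => by
    have := (h𝒦X hx).2
    simp only [mem_iInter] at this
    exact this j k hjk
  obtain ⟨x₀, hx₀⟩ : 𝒦.Nonempty := by
    by_contra h0
    rw [not_nonempty_iff_eq_empty.1 h0, measure_empty] at h𝒦v
    exact absurd h𝒦v not_lt_zero
  have hxx : ∀ i j, dist (x₀ i) (x₀ j) ≤ C := fun i j => by
    rcases lt_trichotomy i j with h | rfl | h
    · rw [dist_comm]; exact (h𝒦D x₀ hx₀ i j h).2.2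
    · rw [dist_self]; linarith
    · exact (h𝒦D x₀ hx₀ j i h).2.2
  have hb : ∀ i j, ∀ y ∈ closedBall (b i) 1, ∀ y' ∈ closedBall (b j) 1, ‖y - y'‖ ≤ K₀ := by
    intro i j y hy y' hy'
    rw [← dist_eq_norm]
    have h1 := dist_triangle4 y (b i) (x₀ i) y'
    have h2 := dist_triangle4 (x₀ i) (x₀ j) (b j) y'
    have h3 := hxx i j
    have h4 := mem_closedBall.1 (h𝒦E x₀ hx₀ i).2
    have h5 := mem_closedBall.1 (h𝒦E x₀ hx₀ j).2
    rw [dist_comm] at h4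
    have h6 := mem_closedBall.1 hy
    have h7 := mem_closedBall.1 hy'
    rw [dist_comm] at h7
    linarith
  have hF : ∀ z : Fin e → Euc (e + 2), (∀ j, z j ∈ closedBall (b j.succ.succ.succ) 1) →
      Frame K (closedBall (b 0) 1) (closedBall (b 1) 1) (closedBall (b 2) 1) z := fun z hz =>
    frame_of_det hc hdet heK₀ hb hK₀K (hk ▸ hkK) hz
  set E₂ : Fin (e + 3) → Set (Euc (e + 2)) := fun j => (fun x => x j) '' 𝒦 with hE₂
  set D₂ : Set ℝ := ⋃ j, ⋃ k, ⋃ (_ : j < k), (fun x => dist (x k) (x j)) '' 𝒦 with hD₂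
  have hE₂E : ∀ j, E₂ j ⊆ E₁ j := by
    rintro j _ ⟨x, hx, rfl⟩; exact h𝒦E x hx j
  have hD₂D : D₂ ⊆ D₁ := by
    simp only [hD₂, iUnion_subset_iff]
    rintro j k hjk _ ⟨x, hx, rfl⟩; exact h𝒦D x hx j k hjk
  have hE₂c : ∀ j, IsCompact (E₂ j) := fun j => h𝒦.image (continuous_apply j)
  have hD₂c : IsCompact D₂ := isCompact_iUnion fun j => isCompact_iUnion fun k =>
    isCompact_iUnion fun _ => h𝒦.image ((continuous_apply k).dist (continuous_apply j))
  set θ := δ ^ (1 / 2000 : ℝ) with hθ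
  have hθδ : θ ^ 1000 = √δ := by
    rw [hθ, ← Real.rpow_natCast, ← Real.rpow_mul hδ.le, Real.sqrt_eq_rpow]
    norm_num
  have hE₂v : ∀ j, volume.real (E₂ j) ≤ C * (θ ^ 1000) ^ (e + 2) := by
    intro j
    have h1 : volume (E₂ j) ≤ volume (E j ∩ closedBall (b j) 1) := by
      rw [← Measure.measure_toMeasurable_inter_of_sFinite measurableSet_closedBall]
      exact measure_mono (hE₂E j)
    have h2 := ENNReal.toReal_mono ENNReal.ofReal_ne_top (h1.trans (hEδ j (b j) 1 hδ1))
    rw [ENNReal.toReal_ofReal (by positivity), Real.one_rpow, mul_one, sub_half] at h2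
    rw [hθδ, sqrt_pow_eq_rpow hδ.le]
    exact h2
  have hD₂δ : IsDeltaRhoSet1 δ (1 / 2) C D₂ := by
    intro x r hr
    refine le_trans ?_ (hDδ x r hr)
    refine le_trans (measure_mono (inter_subset_inter_left _ (hD₂D.trans inter_subset_left))) ?_
    exact (Measure.measure_toMeasurable_inter_of_sFinite measurableSet_closedBall _).le
  have hvol : (θ ^ 1000) ^ ((e + 2) * (e + 3)) ≤ L₁ * volume.real 𝒦 := by
    rw [ENNReal.ofReal_lt_iff_lt_toReal (by positivity) h𝒦.measure_lt_top.ne] at h𝒦v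
    rw [hθδ, sqrt_pow_eq_rpow hδ.le]
    refine le_trans (le_of_eq ?_) (mul_le_mul_of_nonneg_left h𝒦v.le (by positivity))
    rw [hL₁, ← Real.rpow_add hδ]
    congr 1; ring
  have hML : ∀ {a : ℝ}, a ≤ M → a ≤ M * L₁ := fun h =>
    h.trans (le_mul_of_one_le_right hM0 hL₁1)
  refine H (L := M * L₁) (Q := Q) hF hC0 hCK hδ hδ1 (by positivity) hθδ hE₂c
    (fun j => (hE₂E j).trans inter_subset_right) hE₂v hD₂c (fun t ht => (hD₂D ht).2.2) hD₂δ
    (fun x hx j => ⟨x, hx, rfl⟩) (fun x hx j k hjk => ?_) hvol hQ.ge (hML hM2) (hML hMK)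
    (hML hMK4) (hML hM4) (hML hMQ) (hML hMQe) (by positivity) ?_ habs
  · exact mem_iUnion.2 ⟨j, mem_iUnion.2 ⟨k, mem_iUnion.2 ⟨hjk, x, hx, rfl⟩⟩⟩
  · rw [mul_comm]
    exact mul_le_mul_of_nonneg_right hMω (by positivity)

/-- **Multilinear multidimensional Falconer conjecture (Theorem 1.1).** -/
theorem multilinear_falconer (d : ℕ) (hd : 2 ≤ d) (c C : ℝ) (hc : 0 < c) (hC : 1 ≤ C) :
    ∃ ε : ℝ, 0 < ε ∧ ∃ δ₀ : ℝ, 0 < δ₀ ∧ ∀ δ : ℝ, 0 < δ → δ < δ₀ →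
      ∀ (b : Fin (d + 1) → Euc d) (E : Fin (d + 1) → Set (Euc d)) (D : Set ℝ),
        (∀ x : Fin (d + 1) → Euc d, (∀ j, x j ∈ closedBall (b j) 1) →
          c ≤ |Matrix.det (Matrix.of fun i j : Fin d => (x j.succ - x 0) i)| ∧
          |Matrix.det (Matrix.of fun i j : Fin d => (x j.succ - x 0) i)| ≤ C) →
        (∀ j, E j ⊆ closedBall (b j) 1) →
        (∀ j, IsDeltaRhoSet d δ ((d : ℝ) / 2) C (E j)) →
        D ⊆ Icc 0 C →
        IsDeltaRhoSet1 δ (1 / 2) C D →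
        volume {x : Fin (d + 1) → Euc d |
            (∀ j, x j ∈ E j) ∧ ∀ j k : Fin (d + 1), j < k → dist (x k) (x j) ∈ D}
          ≤ ENNReal.ofReal (δ ^ ((d * (d + 1) : ℝ) / 2 + ε)) := by
  obtain ⟨e, rfl⟩ := Nat.exists_eq_add_of_le' hd
  obtain ⟨ε, hε, δ₀, hδ₀, H⟩ := falconer_of_two_le e hc hC
  refine ⟨ε, hε, δ₀, hδ₀, fun δ hδ hδδ₀ b E D hdet hEb hEδ hDC hDδ => ?_⟩
  have h := H δ hδ hδδ₀ b E D (fun x hx => (hdet x hx).1) hEb hEδ hDC hDδ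
  rw [Nat.cast_mul, show ((e + 3 : ℕ) : ℝ) = ((e + 2 : ℕ) : ℝ) + 1 by push_cast; ring] at h
  exact h

end
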